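/- Let A be a Stein manifold of dimension n, X ⊂ A a Kobayashi-hyperbolic domain, and U ⊂ X open and relatively compact in X. Then there exists a constant k < 1 such that F_X(a,v) ≤ k · F_U(a,v) for all a ∈ U and all tangent vectors v ∈ T_a U, where F denotes the infinitesimal Kobayashi metric. -/

import Mathlib

open scoped Manifold
open Metric Set Filter Topology intervalIntegral

/-- A complex manifold `A` modelled on `E` is Stein: it admits a proper (closed) holomorphic
embedding into some `ℂᴺ` which is an immersion. -/
def IsSteinManifold (E : Type*) [NormedAddCommGroup E] [NormedSpace ℂ E]
    (A : Type*) [TopologicalSpace A] [ChartedSpace E A] : Prop :=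
  ∃ (N : ℕ) (ι : A → (Fin N → ℂ)), MDifferentiable 𝓘(ℂ, E) 𝓘(ℂ, Fin N → ℂ) ι ∧
    IsClosedEmbedding ι ∧
    ∀ x : A, Function.Injective (mfderiv 𝓘(ℂ, E) 𝓘(ℂ, Fin N → ℂ) ι x)

/-- Infinitesimal Kobayashi (Royden–Kobayashi) metric of a subset `Ω` of a complex manifold. -/
noncomputable def kobMetricOn (E : Type*) [NormedAddCommGroup E] [NormedSpace ℂ E]
    {A : Type*} [TopologicalSpace A] [ChartedSpace E A]
    (Ω : Set A) (x : A) (v : TangentSpace 𝓘(ℂ, E) x) : ℝ :=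
  sInf {r : ℝ | ∃ φ : ℂ → A, MDifferentiableOn 𝓘(ℂ, ℂ) 𝓘(ℂ, E) φ (ball 0 1) ∧
    MapsTo φ (ball 0 1) Ω ∧ φ 0 = x ∧
    ∃ lam : ℂ, r = ‖lam‖ ∧
      lam • (show E from mfderivWithin 𝓘(ℂ, ℂ) 𝓘(ℂ, E) φ (ball 0 1) 0 (show ℂ from 1)) =
        (show E from v)}

/-- Kobayashi pseudodistance of a subset `Ω` of a complex manifold (integrated form). -/
noncomputable def kobDistOn (E : Type*) [NormedAddCommGroup E] [NormedSpace ℂ E]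
    {A : Type*} [TopologicalSpace A] [ChartedSpace E A]
    (Ω : Set A) (a b : A) : ℝ :=
  sInf {r : ℝ | ∃ γ : ℝ → A, ContMDiffOn 𝓘(ℝ, ℝ) 𝓘(ℝ, E) 1 γ (Icc 0 1) ∧
    (∀ t ∈ Icc (0:ℝ) 1, γ t ∈ Ω) ∧ γ 0 = a ∧ γ 1 = b ∧
    r = ∫ t in (0:ℝ)..1, kobMetricOn E Ω (γ t)
      (show E from mfderivWithin 𝓘(ℝ, ℝ) 𝓘(ℝ, E) γ (Icc 0 1) t (show ℝ from 1))}

namespace KobAux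

open MeasureTheory

section Degree
variable {E : Type*} [NormedAddCommGroup E] [InnerProductSpace ℝ E] [FiniteDimensional ℝ E]
  [MeasurableSpace E] [BorelSpace E]

/-- A perturbation of a large multiple of the identity by a compactly supported map preserves
the volume of a large ball. -/
theorem integral_det_smul_id_add {u : E → E} (hu : ContDiff ℝ 1 u)
    (hc : HasCompactSupport u) {R : ℝ} (hR : tsupport u ⊆ ball 0 R) :
    ∃ s₀ : ℝ, ∀ s, s₀ ≤ s → ∫ x in ball (0 : E) R, (s • ContinuousLinearMap.id ℝ E + fderiv ℝ u x).det
      = s ^ Module.finrank ℝ E * volume.real (ball (0 : E) R) := by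
  obtain ⟨K, hK⟩ := hu.lipschitzWith_of_hasCompactSupport hc one_ne_zero
  have hnh : ∀ᶠ A : E →L[ℝ] E in 𝓝 0, 0 < (ContinuousLinearMap.id ℝ E + A).det := by
    have : ContinuousAt (fun A : E →L[ℝ] E => (ContinuousLinearMap.id ℝ E + A).det) 0 :=
      (ContinuousLinearMap.continuous_det.comp (continuous_const.add continuous_id)).continuousAt
    apply this.eventually (lt_mem_nhds _)
    simp [ContinuousLinearMap.det]
  obtain ⟨δ, hδ, hδ'⟩ := Metric.eventually_nhds_iff.1 hnh
  refine ⟨1 + (K + 1) / δ + (K + 1), fun s hs => ?_⟩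
  have hs1 : 1 + (K : ℝ) < s + 1 := by
    have : 0 ≤ ((K : ℝ) + 1) / δ := by positivity
    linarith
  have hs0 : 0 < s := by
    have := K.2
    have : 0 ≤ ((K : ℝ) + 1) / δ := by positivity
    have : (0 : ℝ) ≤ K := K.2
    linarith
  have hKs : (K : ℝ) / s < 1 := by
    rw [div_lt_one hs0]
    have : 0 ≤ ((K : ℝ) + 1) / δ := by positivity
    linarith
  have hKδ : (K : ℝ) / s < δ := by
    rw [div_lt_iff₀ hs0]
    have h1 : ((K : ℝ) + 1) / δ ≤ s := by
      have : (0 : ℝ) ≤ K := K.2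
      linarith
    rw [div_le_iff₀ hδ] at h1
    linarith
  set Ψ : E → E := fun x => x + s⁻¹ • u x with hΨ
  have hap : ApproximatesLinearOn Ψ ((ContinuousLinearEquiv.refl ℝ E : E ≃L[ℝ] E) : E →L[ℝ] E) univ
      (K / s.toNNReal) := by
    refine LipschitzOnWith.approximatesLinearOn ?_
    refine LipschitzOnWith.of_dist_le_mul fun x _ y _ => ?_
    have h2 := hK.dist_le_mul x y
    have e : (Ψ - ⇑((ContinuousLinearEquiv.refl ℝ E : E ≃L[ℝ] E) : E →L[ℝ] E)) = fun x => s⁻¹ • u x := by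
      ext x; simp [hΨ]
    rw [e, dist_smul₀, NNReal.coe_div, Real.norm_eq_abs, abs_of_pos (inv_pos.2 hs0)]
    calc s⁻¹ * dist (u x) (u y) ≤ s⁻¹ * (K * dist x y) := by gcongr
      _ = _ := by rw [Real.coe_toNNReal _ hs0.le]; field_simp
  have hc' : Subsingleton E ∨ (K / s.toNNReal : NNReal) <
      ‖(((ContinuousLinearEquiv.refl ℝ E : E ≃L[ℝ] E).symm : E ≃L[ℝ] E) : E →L[ℝ] E)‖₊⁻¹ := by
    rcases subsingleton_or_nontrivial E with h | h
    · exact Or.inl h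
    · right
      have : ‖(((ContinuousLinearEquiv.refl ℝ E : E ≃L[ℝ] E).symm : E ≃L[ℝ] E) : E →L[ℝ] E)‖₊ = 1 := by
        have := ContinuousLinearMap.norm_id (𝕜 := ℝ) (E := E)
        ext
        exact this
      rw [this, inv_one, ← NNReal.coe_lt_coe]
      simpa [hs0.le] using hKs
  have hsurj : Function.Surjective Ψ := hap.surjective hc'
  have hinj : Function.Injective Ψ := injOn_univ.1 (hap.injOn hc')
  have hout : ∀ x, x ∉ ball (0 : E) R → Ψ x = x := fun x hx => by
    have : u x = 0 := image_eq_zero_of_notMem_tsupport fun h => hx (hR h)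
    simp [hΨ, this]
  have himg : Ψ '' ball 0 R = ball 0 R := by
    ext y
    constructor
    · rintro ⟨x, hx, rfl⟩
      by_contra h
      exact h (by rwa [hinj (hout _ h)])
    · intro hy
      obtain ⟨x, rfl⟩ := hsurj y
      refine ⟨x, ?_, rfl⟩
      by_contra h
      rw [hout x h] at hy
      exact h hy
  have hd : ∀ x, HasFDerivAt Ψ (ContinuousLinearMap.id ℝ E + s⁻¹ • fderiv ℝ u x) x := fun x =>
    (hasFDerivAt_id x).add (((hu.differentiable one_ne_zero) x).hasFDerivAt.const_smul s⁻¹)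
  have hcv := integral_image_eq_integral_abs_det_fderiv_smul volume (measurableSet_ball (x := (0 : E)) (ε := R))
    (fun x _ => (hd x).hasFDerivWithinAt) hinj.injOn (fun _ => (1 : ℝ))
  rw [himg] at hcv
  have hpos : ∀ x, 0 < (ContinuousLinearMap.id ℝ E + s⁻¹ • fderiv ℝ u x).det := fun x => by
    apply hδ'
    rw [dist_zero_right, norm_smul, Real.norm_eq_abs, abs_of_pos (inv_pos.2 hs0)]
    have := norm_fderiv_le_of_lipschitz ℝ hK (x₀ := x)
    calc s⁻¹ * ‖fderiv ℝ u x‖ ≤ s⁻¹ * K := by gcongr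
      _ = K / s := by field_simp
      _ < δ := hKδ
  have e : ∀ x, (s • ContinuousLinearMap.id ℝ E + fderiv ℝ u x).det =
      s ^ Module.finrank ℝ E * (|(ContinuousLinearMap.id ℝ E + s⁻¹ • fderiv ℝ u x).det| • (1 : ℝ)) := fun x => by
    rw [abs_of_pos (hpos x)]
    have : s • ContinuousLinearMap.id ℝ E + fderiv ℝ u x =
        s • (ContinuousLinearMap.id ℝ E + s⁻¹ • fderiv ℝ u x) := by
      rw [smul_add, smul_smul, mul_inv_cancel₀ hs0.ne', one_smul]
    rw [this]
    simp only [ContinuousLinearMap.det, ContinuousLinearMap.toLinearMap_smul, LinearMap.det_smul, smul_eq_mul, mul_one]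
  simp_rw [e]
  rw [MeasureTheory.integral_const_mul, ← hcv]
  simp [Measure.real]

theorem continuous_det_add_fderiv {u : E → E} (hu : ContDiff ℝ 1 u) (s : ℝ) :
    Continuous fun x => (s • ContinuousLinearMap.id ℝ E + fderiv ℝ u x).det :=
  ContinuousLinearMap.continuous_det.comp (continuous_const.add (hu.continuous_fderiv one_ne_zero))

theorem integral_det_fderiv_eq_zero [Nontrivial E] {u : E → E} (hu : ContDiff ℝ 1 u)
    (hc : HasCompactSupport u) : ∫ x, (fderiv ℝ u x).det = 0 := by
  obtain ⟨R, hR⟩ := hc.isCompact.isBounded.subset_ball (0 : E)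
  obtain ⟨s₀, hs₀⟩ := integral_det_smul_id_add hu hc hR
  set d := Module.finrank ℝ E with hd
  have hd0 : d ≠ 0 := Module.finrank_pos.ne'
  have h1 : ∫ x, (fderiv ℝ u x).det = ∫ x in ball (0 : E) R, (fderiv ℝ u x).det := by
    symm
    apply setIntegral_eq_integral_of_forall_compl_eq_zero
    intro x hx
    have : fderiv ℝ u x = 0 := by
      apply image_eq_zero_of_notMem_tsupport
      exact fun h => hx (hR (tsupport_fderiv_subset ℝ h))
    rw [this]
    simp only [ContinuousLinearMap.det, ContinuousLinearMap.toLinearMap_zero]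
    rw [LinearMap.det_zero, ← hd, zero_pow hd0]
  rw [h1]
  let v : ℕ → ℝ := fun i => s₀ + i
  have hv : Set.InjOn v (Finset.range (d + 1) : Finset ℕ) := fun i _ j _ h => by simpa [v] using h
  have key : ∀ p : Polynomial ℝ, p.degree < (Finset.range (d+1)).card → p.eval 0 =
      ∑ i ∈ Finset.range (d+1), p.eval (v i) * (Lagrange.basis (Finset.range (d+1)) v i).eval 0 := by
    intro p hp
    conv_lhs => rw [Lagrange.eq_interpolate hv hp]
    rw [Lagrange.interpolate_apply, Polynomial.eval_finsetSum]
    simp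
  have e : ∀ x, (fderiv ℝ u x).det = ∑ i ∈ Finset.range (d+1),
      (v i • ContinuousLinearMap.id ℝ E + fderiv ℝ u x).det *
        (Lagrange.basis (Finset.range (d+1)) v i).eval 0 := fun x => by
    have hev : ∀ t : ℝ, ((-(fderiv ℝ u x : E →ₗ[ℝ] E)).charpoly).eval t =
        (t • ContinuousLinearMap.id ℝ E + fderiv ℝ u x).det := fun t => by
      rw [LinearMap.eval_charpoly, ContinuousLinearMap.det]
      congr 1
      ext y; simp [Module.algebraMap_end_apply]
    have := key ((-(fderiv ℝ u x : E →ₗ[ℝ] E)).charpoly) (by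
      rw [Polynomial.degree_eq_natDegree (LinearMap.charpoly_monic _).ne_zero,
        LinearMap.charpoly_natDegree]
      simp only [Finset.card_range, hd]; exact_mod_cast Nat.lt_succ_self _)
    simp_rw [hev] at this
    simpa using this
  simp_rw [e]
  rw [integral_finset_sum _ fun i _ => ?_]
  · simp_rw [MeasureTheory.integral_mul_const]
    rw [Finset.sum_congr rfl fun i _ => by rw [hs₀ (v i) (by simp [v])]]
    have := key (Polynomial.X ^ d) (by
      simp only [Polynomial.degree_X_pow, Finset.card_range]; exact_mod_cast Nat.lt_succ_self _)
    simp only [Polynomial.eval_pow, Polynomial.eval_X, zero_pow hd0] at this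
    calc _ = volume.real (ball (0 : E) R) * ∑ i ∈ Finset.range (d+1), v i ^ d *
        (Lagrange.basis (Finset.range (d+1)) v i).eval 0 := by
          rw [Finset.mul_sum]; exact Finset.sum_congr rfl fun i _ => by ring
      _ = 0 := by rw [← this, mul_zero]
  · exact (((continuous_det_add_fderiv hu _).mul continuous_const).continuousOn.integrableOn_compact
      (isCompact_closedBall 0 R)).mono_set ball_subset_closedBall

end Degree

section Degree
variable {E : Type*} [NormedAddCommGroup E] [InnerProductSpace ℝ E] [FiniteDimensional ℝ E]

/-- Smooth cutoff functions. -/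
theorem exists_cutoff {K V : Set E} (hK : IsCompact K) (hV : IsOpen V) (hKV : K ⊆ V) :
    ∃ χ : E → ℝ, ContDiff ℝ 1 χ ∧ HasCompactSupport χ ∧ tsupport χ ⊆ V ∧
      (∀ᶠ x in 𝓝ˢ K, χ x = 1) ∧ ∀ x, χ x ∈ Icc (0 : ℝ) 1 := by
  obtain ⟨K', hK', h1, h2⟩ := exists_compact_between hK hV hKV
  obtain ⟨K'', hK'', h3, h4⟩ := exists_compact_between hK isOpen_interior h1
  obtain ⟨f, hf0, hf1, hf⟩ := exists_contMDiffMap_one_nhds_of_subset_interior (n := 1) 𝓘(ℝ, E)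
    hK.isClosed h1
  have hsupp : tsupport f ⊆ K' := closure_minimal (fun x hx => by
    by_contra h; exact hx (hf1 x h)) hK'.isClosed
  exact ⟨f, f.contMDiff.contDiff, hK'.of_isClosed_subset (isClosed_tsupport _) hsupp,
    hsupp.trans h2, hf0, hf⟩

theorem det_clm_zero [Nontrivial E] : (0 : E →L[ℝ] E).det = 0 := by
  simp only [ContinuousLinearMap.det, ContinuousLinearMap.toLinearMap_zero]
  rw [LinearMap.det_zero, zero_pow Module.finrank_pos.ne']

theorem contDiff_cutoff_smul {V : Set E} (hV : IsOpen V) {χ : E → ℝ} (hχ : ContDiff ℝ 1 χ)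
    (hs : tsupport χ ⊆ V) {F : E → E} (hF : ContDiffOn ℝ 1 F V) :
    ContDiff ℝ 1 (fun x => χ x • F x) := by
  rw [contDiff_iff_contDiffAt]
  intro x
  by_cases hx : x ∈ tsupport χ
  · exact hχ.contDiffAt.smul (hF.contDiffAt (hV.mem_nhds (hs hx)))
  · have : (fun x => χ x • F x) =ᶠ[𝓝 x] fun _ => 0 := by
      filter_upwards [(isClosed_tsupport χ).isOpen_compl.mem_nhds hx] with y hy
      rw [image_eq_zero_of_notMem_tsupport hy, zero_smul]
    exact contDiffAt_const.congr_of_eventuallyEq this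

variable [MeasurableSpace E] [BorelSpace E]

/-- The Jacobian determinant is a null Lagrangian. -/
theorem integral_det_sub_eq_zero [Nontrivial E] {V K : Set E} (hV : IsOpen V) (hK : IsCompact K)
    (hKV : K ⊆ V) {F G : E → E} (hF : ContDiffOn ℝ 1 F V) (hG : ContDiffOn ℝ 1 G V)
    (h : ∀ x ∈ V, x ∉ K → F x = G x) :
    ∫ x in V, ((fderiv ℝ F x).det - (fderiv ℝ G x).det) = 0 := by
  obtain ⟨χ, hχ, hχc, hχV, hχ1, -⟩ := exists_cutoff hK hV hKV
  have hF' := contDiff_cutoff_smul hV hχ hχV hF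
  have hG' := contDiff_cutoff_smul hV hχ hχV hG
  have hFc : HasCompactSupport fun x => χ x • F x := hχc.smul_right
  have hGc : HasCompactSupport fun x => χ x • G x := hχc.smul_right
  have e : ∀ x, V.indicator (fun x => (fderiv ℝ F x).det - (fderiv ℝ G x).det) x =
      (fderiv ℝ (fun x => χ x • F x) x).det - (fderiv ℝ (fun x => χ x • G x) x).det := by
    intro x
    by_cases hx : x ∈ K
    · rw [indicator_of_mem (hKV hx)]
      have h1 : ∀ᶠ y in 𝓝 x, χ y = 1 := hχ1.filter_mono (nhds_le_nhdsSet hx)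
      have h2 : (fun x => χ x • F x) =ᶠ[𝓝 x] F := by
        filter_upwards [h1] with y hy; rw [hy, one_smul]
      have h3 : (fun x => χ x • G x) =ᶠ[𝓝 x] G := by
        filter_upwards [h1] with y hy; rw [hy, one_smul]
      rw [h2.fderiv_eq, h3.fderiv_eq]
    · have hloc : (fun x => χ x • F x) =ᶠ[𝓝 x] (fun x => χ x • G x) := by
        filter_upwards [hK.isClosed.isOpen_compl.mem_nhds hx] with y hy
        by_cases hyV : y ∈ V
        · rw [h y hyV hy]
        · rw [image_eq_zero_of_notMem_tsupport fun hh => hyV (hχV hh), zero_smul, zero_smul]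
      rw [hloc.fderiv_eq, sub_self]
      by_cases hxV : x ∈ V
      · rw [indicator_of_mem hxV]
        have : F =ᶠ[𝓝 x] G := by
          filter_upwards [hK.isClosed.isOpen_compl.mem_nhds hx, hV.mem_nhds hxV] with y hy hy'
          exact h y hy' hy
        rw [this.fderiv_eq, sub_self]
      · rw [indicator_of_notMem hxV]
  rw [← MeasureTheory.integral_indicator hV.measurableSet, integral_congr_ae (Eventually.of_forall e),
    MeasureTheory.integral_sub, integral_det_fderiv_eq_zero hF' hFc, integral_det_fderiv_eq_zero hG' hGc, sub_zero]
  · apply Continuous.integrable_of_hasCompactSupport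
    · exact ContinuousLinearMap.continuous_det.comp (hF'.continuous_fderiv one_ne_zero)
    · exact (hFc.fderiv ℝ).comp_left (g := fun A : E →L[ℝ] E => A.det) det_clm_zero
  · apply Continuous.integrable_of_hasCompactSupport
    · exact ContinuousLinearMap.continuous_det.comp (hG'.continuous_fderiv one_ne_zero)
    · exact (hGc.fderiv ℝ).comp_left (g := fun A : E →L[ℝ] E => A.det) det_clm_zero

end Degree

section Radial
variable {E : Type*} [NormedAddCommGroup E] [InnerProductSpace ℝ E] [FiniteDimensional ℝ E]

/-- A smooth step function, zero for `s ≤ η²/2`, one for `s ≥ η²`. -/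
noncomputable def stepFn (η s : ℝ) : ℝ := Real.smoothTransition (2 * s / η ^ 2 - 1)

/-- The radial factor of the smoothed radial projection. -/
noncomputable def radFn (η s : ℝ) : ℝ := stepFn η s / √s

/-- A smooth version of `y ↦ y / ‖y‖`. -/
noncomputable def radProj (η : ℝ) (y : E) : E := radFn η (‖y‖ ^ 2) • y

/-- The Jacobian determinant of `radProj`. -/
noncomputable def radJac (η : ℝ) (y : E) : ℝ := (fderiv ℝ (radProj η) y).det

theorem contDiff_stepFn (η : ℝ) : ContDiff ℝ 1 (stepFn η) :=
  (Real.smoothTransition.contDiff (n := 1)).comp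
    (((contDiff_const.mul contDiff_id).div_const _).sub contDiff_const)

theorem stepFn_zero {η s : ℝ} (hη : 0 < η) (h : s ≤ η ^ 2 / 2) : stepFn η s = 0 := by
  apply Real.smoothTransition.zero_of_nonpos
  rw [sub_nonpos, div_le_one (by positivity)]; linarith

theorem stepFn_one {η s : ℝ} (hη : 0 < η) (h : η ^ 2 ≤ s) : stepFn η s = 1 := by
  apply Real.smoothTransition.one_of_one_le
  have : 2 ≤ 2 * s / η ^ 2 := by rw [le_div_iff₀ (by positivity)]; linarith
  linarith

theorem stepFn_nonneg (η s : ℝ) : 0 ≤ stepFn η s := Real.smoothTransition.nonneg _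

theorem stepFn_pos {η s : ℝ} (hη : 0 < η) (h : η ^ 2 / 2 < s) : 0 < stepFn η s := by
  apply Real.smoothTransition.pos_of_pos
  have : 1 < 2 * s / η ^ 2 := by rw [lt_div_iff₀ (by positivity)]; linarith
  linarith

theorem deriv_stepFn_nonneg (η s : ℝ) : 0 ≤ deriv (stepFn η) s := by
  apply Monotone.deriv_nonneg
  intro a b hab
  apply Real.smoothTransition.monotone
  gcongr

theorem deriv_stepFn_eq_zero {η s : ℝ} (hη : 0 < η) (h : η ^ 2 ≤ s) : deriv (stepFn η) s = 0 := by
  apply IsLocalMax.deriv_eq_zero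
  refine Eventually.of_forall fun t => ?_
  rw [stepFn_one hη h]
  exact Real.smoothTransition.le_one _

theorem contDiff_radFn {η : ℝ} (hη : 0 < η) : ContDiff ℝ 1 (radFn η) := by
  rw [contDiff_iff_contDiffAt]
  intro s
  by_cases hs : s < η ^ 2 / 2
  · have : radFn η =ᶠ[𝓝 s] fun _ => 0 := by
      filter_upwards [gt_mem_nhds hs] with t ht
      rw [radFn, stepFn_zero hη ht.le, zero_div]
    exact contDiffAt_const.congr_of_eventuallyEq this
  · have hs0 : 0 < s := lt_of_lt_of_le (by positivity) (not_lt.1 hs)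
    exact (contDiff_stepFn η).contDiffAt.div (Real.contDiffAt_sqrt hs0.ne') (Real.sqrt_pos.2 hs0).ne'

theorem contDiff_radProj {η : ℝ} (hη : 0 < η) : ContDiff ℝ 1 (radProj η : E → E) :=
  ((contDiff_radFn hη).comp (contDiff_norm_sq ℝ)).smul contDiff_id

theorem radProj_eq {η η' : ℝ} (hη : 0 < η) (hη' : 0 < η') {y : E} (h : η ≤ ‖y‖) (h' : η' ≤ ‖y‖) :
    radProj η y = radProj η' y := by
  unfold radProj radFn
  rw [stepFn_one hη (by gcongr), stepFn_one hη' (by gcongr)]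

theorem continuous_radJac {η : ℝ} (hη : 0 < η) : Continuous (radJac η : E → ℝ) :=
  ContinuousLinearMap.continuous_det.comp ((contDiff_radProj hη).continuous_fderiv one_ne_zero)

theorem det_smul_id_add_smulRight [Nontrivial E] (a : ℝ) (φ : E →L[ℝ] ℝ) (y : E) :
    (a • ContinuousLinearMap.id ℝ E + φ.smulRight y).det =
      a ^ (Module.finrank ℝ E - 1) * (a + φ y) := by
  have hne : ∀ b : ℝ, b ≠ 0 → (b • ContinuousLinearMap.id ℝ E + φ.smulRight y).det =
      b ^ (Module.finrank ℝ E - 1) * (b + φ y) := by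
    intro b hb
    have h1 : ((b • ContinuousLinearMap.id ℝ E + φ.smulRight y : E →L[ℝ] E) : E →ₗ[ℝ] E) =
        b • LinearMap.transvection (b⁻¹ • (φ : E →ₗ[ℝ] ℝ)) y := by
      ext x
      simp [LinearMap.transvection.apply, smul_smul, mul_inv_cancel_left₀ hb]
    rw [ContinuousLinearMap.det, h1, LinearMap.det_smul, LinearMap.transvection.det]
    obtain ⟨k, hk⟩ : ∃ k, Module.finrank ℝ E = k + 1 :=
      ⟨_, (Nat.succ_pred_eq_of_pos Module.finrank_pos).symm⟩
    rw [hk, Nat.add_sub_cancel, pow_succ]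
    simp only [LinearMap.smul_apply, ContinuousLinearMap.coe_coe, smul_eq_mul]
    field_simp
  have hc1 : Continuous fun b : ℝ => (b • ContinuousLinearMap.id ℝ E + φ.smulRight y).det :=
    ContinuousLinearMap.continuous_det.comp
      ((continuous_id.smul continuous_const).add continuous_const)
  have hc2 : Continuous fun b : ℝ => b ^ (Module.finrank ℝ E - 1) * (b + φ y) := by fun_prop
  exact congrFun (hc1.ext_on (dense_compl_singleton (0 : ℝ)) hc2 fun b hb => hne b hb) a

theorem radJac_eq [Nontrivial E] {η : ℝ} (hη : 0 < η) (y : E) :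
    radJac η y = radFn η (‖y‖ ^ 2) ^ (Module.finrank ℝ E - 1) * (2 * ‖y‖ * deriv (stepFn η) (‖y‖ ^ 2)) := by
  set d := Module.finrank ℝ E
  have hd0 : 1 ≤ d := Module.finrank_pos
  set a := radFn η (‖y‖ ^ 2) with ha
  set a' := deriv (radFn η) (‖y‖ ^ 2) with ha'
  have hda : HasDerivAt (radFn η) a' (‖y‖ ^ 2) :=
    ((contDiff_radFn hη).differentiable one_ne_zero _).hasDerivAt
  have hD : HasFDerivAt (radProj η : E → E) (a • ContinuousLinearMap.id ℝ E +
      ((a' • (2 • innerSL ℝ y))).smulRight y) y := by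
    have h1 : HasFDerivAt (fun y : E => radFn η (‖y‖ ^ 2)) (a' • (2 • innerSL ℝ y)) y :=
      hda.comp_hasFDerivAt (f := fun y : E => ‖y‖ ^ 2) y (hasStrictFDerivAt_norm_sq y).hasFDerivAt
    exact h1.smul (hasFDerivAt_id y)
  rw [radJac, hD.fderiv]
  rcases le_or_gt (‖y‖ ^ 2) (η ^ 2 / 4) with hs | hs
  · have hlt : ‖y‖ ^ 2 < η ^ 2 / 2 := by nlinarith
    have h0 : a = 0 := by rw [ha, radFn, stepFn_zero hη hlt.le, zero_div]
    have h0' : a' = 0 := by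
      have : radFn η =ᶠ[𝓝 (‖y‖ ^ 2)] fun _ => 0 := by
        filter_upwards [gt_mem_nhds hlt] with t ht
        rw [radFn, stepFn_zero hη ht.le, zero_div]
      rw [ha', this.deriv_eq]; simp
    have h1 : deriv (stepFn η) (‖y‖ ^ 2) = 0 := by
      have : stepFn η =ᶠ[𝓝 (‖y‖ ^ 2)] fun _ => 0 := by
        filter_upwards [gt_mem_nhds hlt] with t ht
        rw [stepFn_zero hη ht.le]
      rw [this.deriv_eq]; simp
    rw [h0, h0', h1]
    simp only [zero_smul, ContinuousLinearMap.zero_smulRight, add_zero, mul_zero]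
    exact det_clm_zero
  · have hy0 : 0 < ‖y‖ := by
      rcases (norm_nonneg y).eq_or_lt with h | h
      · rw [← h] at hs; nlinarith [sq_nonneg η]
      · exact h
    have hda2 : deriv (stepFn η) (‖y‖ ^ 2) = a / (2 * ‖y‖) + a' * ‖y‖ := by
      have h1 : stepFn η =ᶠ[𝓝 (‖y‖ ^ 2)] fun s => √s * radFn η s := by
        filter_upwards [lt_mem_nhds (show 0 < ‖y‖ ^ 2 by positivity)] with t ht
        rw [radFn, mul_div_cancel₀]
        exact (Real.sqrt_pos.2 ht).ne'
      rw [h1.deriv_eq]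
      have h2 := (Real.hasDerivAt_sqrt (show ‖y‖ ^ 2 ≠ 0 by positivity)).mul hda
      rw [Real.sqrt_sq hy0.le] at h2
      refine h2.deriv.trans ?_
      rw [← ha]; field_simp
    rw [hda2]
    have hn : inner ℝ y y = ‖y‖ ^ 2 := real_inner_self_eq_norm_sq y
    rw [det_smul_id_add_smulRight]
    obtain ⟨k, hk⟩ : ∃ k, d = k + 1 := ⟨d - 1, by omega⟩
    have : (a' • (2 • innerSL ℝ y) : E →L[ℝ] ℝ) y = 2 * a' * ‖y‖ ^ 2 := by
      simp; ring
    rw [this]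
    congr 1
    field_simp

end Radial

section Degree
variable {E : Type*} [NormedAddCommGroup E] [InnerProductSpace ℝ E] [FiniteDimensional ℝ E]

theorem radFn_nonneg (η s : ℝ) : 0 ≤ radFn η s := div_nonneg (stepFn_nonneg _ _) (Real.sqrt_nonneg _)

theorem radJac_nonneg [Nontrivial E] {η : ℝ} (hη : 0 < η) (y : E) : 0 ≤ radJac η y := by
  rw [radJac_eq hη]
  exact mul_nonneg (pow_nonneg (radFn_nonneg _ _) _)
    (mul_nonneg (by positivity) (deriv_stepFn_nonneg _ _))

theorem radJac_eq_zero [Nontrivial E] {η : ℝ} (hη : 0 < η) {y : E} (h : η ≤ ‖y‖) : radJac η y = 0 := by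
  rw [radJac_eq hη, deriv_stepFn_eq_zero hη (by gcongr), mul_zero, mul_zero]

/-- The degree integrand. -/
noncomputable def degDensity (η : ℝ) (F : E → E) (x : E) : ℝ :=
  radJac η (F x) * (fderiv ℝ F x).det

theorem det_fderiv_radProj_comp {η : ℝ} (hη : 0 < η) {F : E → E} {x : E}
    (hF : DifferentiableAt ℝ F x) :
    (fderiv ℝ (fun x => radProj η (F x)) x).det = degDensity η F x := by
  have h := ((contDiff_radProj hη).differentiable one_ne_zero (F x)).hasFDerivAt.comp x hF.hasFDerivAt
  have h2 : fderiv ℝ (fun x => radProj η (F x)) x = _ := h.fderiv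
  rw [h2, degDensity, radJac]
  simp only [ContinuousLinearMap.det, ContinuousLinearMap.toLinearMap_comp, LinearMap.det_comp]

variable [MeasurableSpace E] [BorelSpace E]

/-- The total mass of `radJac`. -/
noncomputable def radMass (E : Type*) [NormedAddCommGroup E] [InnerProductSpace ℝ E]
    [FiniteDimensional ℝ E] [MeasurableSpace E] [BorelSpace E] (η : ℝ) : ℝ :=
  ∫ y : E, radJac η y

theorem hasCompactSupport_radJac [Nontrivial E] {η : ℝ} (hη : 0 < η) :
    HasCompactSupport (radJac η : E → ℝ) :=
  HasCompactSupport.intro (isCompact_closedBall (0 : E) η) fun x hx =>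
    radJac_eq_zero hη (by
      rw [mem_closedBall_zero_iff, not_le] at hx
      exact hx.le)

theorem radMass_pos [Nontrivial E] {η : ℝ} (hη : 0 < η) : 0 < radMass E η := by
  obtain ⟨s, hs1, hs2⟩ : ∃ s, η ^ 2 / 2 < s ∧ deriv (stepFn η) s ≠ 0 := by
    by_contra! hcon
    have hη2 : 0 < η ^ 2 := by positivity
    obtain ⟨c, hc, hc'⟩ := exists_deriv_eq_slope (stepFn η) (show η ^ 2 / 2 < η ^ 2 by linarith)
      (contDiff_stepFn η).continuous.continuousOn
      ((contDiff_stepFn η).differentiable one_ne_zero).differentiableOn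
    rw [hcon c hc.1, stepFn_one hη le_rfl, stepFn_zero hη le_rfl] at hc'
    have : (1 - 0) / (η ^ 2 - η ^ 2 / 2) > 0 := by
      apply div_pos <;> linarith
    linarith
  have hs0 : 0 < s := lt_trans (by positivity) hs1
  obtain ⟨y, hy⟩ := exists_norm_eq E (Real.sqrt_nonneg s)
  have hy2 : ‖y‖ ^ 2 = s := by rw [hy, Real.sq_sqrt hs0.le]
  refine (continuous_radJac hη).integral_pos_of_hasCompactSupport_nonneg_nonzero
    (hasCompactSupport_radJac hη) (radJac_nonneg hη) (x := y) ?_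
  rw [radJac_eq hη, hy2]
  refine mul_ne_zero (pow_ne_zero _ ?_) (mul_ne_zero (mul_ne_zero two_ne_zero ?_) hs2)
  · exact (div_pos (stepFn_pos hη hs1) (Real.sqrt_pos.2 hs0)).ne'
  · rw [hy]; exact (Real.sqrt_pos.2 hs0).ne'

/-- The Brouwer degree at `0` of a `C¹` map. -/
noncomputable def smoothDeg (η : ℝ) (F : E → E) (V : Set E) : ℝ :=
  (∫ x in V, degDensity η F x) / radMass E η

theorem continuousOn_degDensity {η : ℝ} (hη : 0 < η) {F : E → E} {V : Set E} (hV : IsOpen V)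
    (hF : ContDiffOn ℝ 1 F V) : ContinuousOn (degDensity η F) V :=
  ((continuous_radJac hη).comp_continuousOn hF.continuousOn).mul
    (ContinuousLinearMap.continuous_det.comp_continuousOn
      (hF.continuousOn_fderiv_of_isOpen hV le_rfl))

theorem integrableOn_degDensity [Nontrivial E] {η : ℝ} (hη : 0 < η) {F : E → E} {V K : Set E}
    (hV : IsOpen V) (hF : ContDiffOn ℝ 1 F V) (hK : IsCompact K) (hKV : K ⊆ V)
    (h : ∀ x ∈ V, x ∉ K → η ≤ ‖F x‖) : IntegrableOn (degDensity η F) V := by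
  have h1 : IntegrableOn (degDensity η F) K :=
    ((continuousOn_degDensity hη hV hF).mono hKV).integrableOn_compact hK
  refine h1.of_forall_diff_eq_zero hV.measurableSet fun x hx => ?_
  rw [degDensity, radJac_eq_zero hη (h x hx.1 hx.2), zero_mul]

theorem integral_degDensity_sub [Nontrivial E] {η η' : ℝ} (hη : 0 < η) (hη' : 0 < η') {F G : E → E}
    {V K : Set E} (hV : IsOpen V) (hF : ContDiffOn ℝ 1 F V) (hG : ContDiffOn ℝ 1 G V)
    (hK : IsCompact K) (hKV : K ⊆ V)
    (h : ∀ x ∈ V, x ∉ K → radProj η (F x) = radProj η' (G x)) :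
    ∫ x in V, (degDensity η F x - degDensity η' G x) = 0 := by
  rw [← integral_det_sub_eq_zero hV hK hKV ((contDiff_radProj hη).comp_contDiffOn hF)
    ((contDiff_radProj hη').comp_contDiffOn hG) h]
  refine setIntegral_congr_fun hV.measurableSet fun x hx => ?_
  have h1 := det_fderiv_radProj_comp hη ((hF.differentiableOn one_ne_zero).differentiableAt (hV.mem_nhds hx))
  have h2 := det_fderiv_radProj_comp hη' ((hG.differentiableOn one_ne_zero).differentiableAt (hV.mem_nhds hx))
  simp only [← h1, ← h2]
  rfl

theorem radMass_eq [Nontrivial E] {η η' : ℝ} (hη : 0 < η) (hη' : 0 < η') :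
    radMass E η = radMass E η' := by
  have h := integral_degDensity_sub (E := E) hη hη' isOpen_univ contDiffOn_id contDiffOn_id
    (isCompact_closedBall 0 (max η η')) (subset_univ _) fun x _ hx => by
      rw [mem_closedBall_zero_iff, not_le, max_lt_iff] at hx
      exact radProj_eq hη hη' hx.1.le hx.2.le
  have e : ∀ η : ℝ, degDensity η (id : E → E) = radJac η := fun η => by
    ext x
    rw [degDensity, fderiv_id]
    simp [ContinuousLinearMap.det]
  rw [setIntegral_univ, e, e, MeasureTheory.integral_sub
    ((continuous_radJac hη).integrable_of_hasCompactSupport (hasCompactSupport_radJac hη))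
    ((continuous_radJac hη').integrable_of_hasCompactSupport (hasCompactSupport_radJac hη'))] at h
  unfold radMass
  linarith

theorem smoothDeg_eta [Nontrivial E] {η η' r : ℝ} (hη : 0 < η) (hη' : 0 < η') (hr : η ≤ r)
    (hr' : η' ≤ r) {F : E → E} {V K : Set E} (hV : IsOpen V) (hF : ContDiffOn ℝ 1 F V)
    (hK : IsCompact K) (hKV : K ⊆ V) (h : ∀ x ∈ V, x ∉ K → r ≤ ‖F x‖) :
    smoothDeg η F V = smoothDeg η' F V := by
  have h1 := integral_degDensity_sub hη hη' hV hF hF hK hKV fun x hx hxK =>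
    radProj_eq hη hη' (hr.trans (h x hx hxK)) (hr'.trans (h x hx hxK))
  rw [MeasureTheory.integral_sub
    (integrableOn_degDensity hη hV hF hK hKV fun x hx hxK => hr.trans (h x hx hxK))
    (integrableOn_degDensity hη' hV hF hK hKV fun x hx hxK => hr'.trans (h x hx hxK))] at h1
  rw [smoothDeg, smoothDeg, radMass_eq hη hη']
  congr 1
  linarith

theorem smoothDeg_homotopy [Nontrivial E] {η : ℝ} (hη : 0 < η) {F G : E → E} {V K : Set E}
    (hV : IsOpen V) (hF : ContDiffOn ℝ 1 F V) (hG : ContDiffOn ℝ 1 G V)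
    (hK : IsCompact K) (hKV : K ⊆ V)
    (h : ∀ x ∈ V, x ∉ K → ∀ t ∈ Icc (0 : ℝ) 1, η ≤ ‖F x + t • (G x - F x)‖) :
    smoothDeg η F V = smoothDeg η G V := by
  obtain ⟨χ, hχ, hχc, hχV, hχ1, hχI⟩ := exists_cutoff hK hV hKV
  set H : E → E := fun x => F x + (1 - χ x) • (G x - F x) with hH
  have hHd : ContDiffOn ℝ 1 H V :=
    hF.add ((contDiff_const.sub hχ).contDiffOn.smul (hG.sub hF))
  have hχ' : ∀ x, 1 - χ x ∈ Icc (0 : ℝ) 1 := fun x =>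
    ⟨sub_nonneg.2 (hχI x).2, by linarith [(hχI x).1]⟩
  have hHη : ∀ x ∈ V, x ∉ K → η ≤ ‖H x‖ := fun x hx hxK => h x hx hxK _ (hχ' x)
  have hGη : ∀ x ∈ V, x ∉ K → η ≤ ‖G x‖ := fun x hx hxK => by
    simpa using h x hx hxK 1 (by simp)
  have h1 : smoothDeg η H V = smoothDeg η G V := by
    have := integral_degDensity_sub hη hη hV hHd hG hχc.isCompact hχV fun x hx hxK => by
      simp [hH, image_eq_zero_of_notMem_tsupport hxK]
    rw [MeasureTheory.integral_sub (integrableOn_degDensity hη hV hHd hK hKV hHη)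
      (integrableOn_degDensity hη hV hG hK hKV hGη)] at this
    rw [smoothDeg, smoothDeg]
    congr 1
    linarith
  rw [← h1, smoothDeg, smoothDeg]
  congr 1
  refine setIntegral_congr_fun hV.measurableSet fun x hx => ?_
  by_cases hxK : x ∈ K
  · have : H =ᶠ[𝓝 x] F := by
      filter_upwards [hχ1.filter_mono (nhds_le_nhdsSet hxK)] with y hy
      simp [hH, hy]
    simp only [degDensity, this.fderiv_eq, this.eq_of_nhds]
  · have hFx : η ≤ ‖F x‖ := by simpa using h x hx hxK 0 (by simp)
    simp only [degDensity, radJac_eq_zero hη (hHη x hx hxK), radJac_eq_zero hη hFx, zero_mul]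

end Degree

section Degree
variable {E : Type*} [NormedAddCommGroup E] [InnerProductSpace ℝ E] [FiniteDimensional ℝ E]

theorem exists_contDiff_approx {F : E → E} (hF : Continuous F) {V : Set E}
    (hV : Bornology.IsBounded V) {ε : ℝ} (hε : 0 < ε) :
    ∃ G : E → E, ContDiff ℝ 1 G ∧ ∀ x ∈ V, ‖G x - F x‖ ≤ ε := by
  obtain ⟨R, hR⟩ := hV.subset_closedBall (0 : E)
  have hu : UniformContinuousOn F (closedBall 0 (R + 1)) :=
    (isCompact_closedBall _ _).uniformContinuousOn_of_continuous hF.continuousOn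
  obtain ⟨δ, hδ, hδ'⟩ := Metric.uniformContinuousOn_iff.1 hu ε hε
  obtain ⟨G, hG, hG'⟩ := hF.exists_contDiff_dist_le_of_forall_mem_ball_dist_le
    (show 0 < min δ 1 by positivity)
  refine ⟨G, hG.of_le (by exact_mod_cast le_top), fun x hx => ?_⟩
  rw [← dist_eq_norm]
  refine hG' x ε fun y hy => ?_
  have hx' : x ∈ closedBall (0 : E) R := hR hx
  rw [mem_ball, lt_min_iff] at hy
  refine (hδ' y ?_ x ?_ hy.1).le
  · rw [mem_closedBall] at hx' ⊢
    linarith [dist_triangle y x 0]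
  · exact closedBall_subset_closedBall (by linarith) hx'

variable [MeasurableSpace E] [BorelSpace E]

/-- `d` is the Brouwer degree of `F` on `V` at `0`. -/
def HasDeg (F : E → E) (V : Set E) (d : ℝ) : Prop :=
  ∃ K : Set E, ∃ η : ℝ, IsCompact K ∧ K ⊆ V ∧ 0 < η ∧ (∀ x ∈ V, x ∉ K → η ≤ ‖F x‖) ∧
    ∃ G : E → E, ContDiffOn ℝ 1 G V ∧ (∀ x ∈ V, ‖G x - F x‖ ≤ η / 4) ∧ smoothDeg (η / 4) G V = d

theorem norm_segment_sub_le {F : Type*} [NormedAddCommGroup F] [NormedSpace ℝ F] {a b c : F}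
    {ε t : ℝ} (ha : ‖a - c‖ ≤ ε) (hb : ‖b - c‖ ≤ ε)
    (ht : t ∈ Icc (0 : ℝ) 1) : ‖(a + t • (b - a)) - c‖ ≤ ε := by
  have h := (convex_closedBall c ε).add_smul_sub_mem (x := a) (y := b) (by simpa [dist_eq_norm] using ha)
    (by simpa [dist_eq_norm] using hb) ht
  simpa [dist_eq_norm] using h

theorem HasDeg.smoothDeg_eq [Nontrivial E] {F : E → E} {V : Set E} {d : ℝ} (h : HasDeg F V d)
    (hV : IsOpen V) :
    ∃ ε₀ > 0, ∀ G : E → E, ContDiffOn ℝ 1 G V → ∀ ε, 0 < ε → ε ≤ ε₀ →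
      (∀ x ∈ V, ‖G x - F x‖ ≤ ε) → smoothDeg ε G V = d := by
  obtain ⟨K, η, hK, hKV, hη, hKη, G, hG, hGF, rfl⟩ := h
  refine ⟨η / 4, by positivity, fun G' hG' ε hε hε' hG'F => ?_⟩
  have key : ∀ x ∈ V, x ∉ K → ∀ t ∈ Icc (0 : ℝ) 1, η / 4 ≤ ‖G x + t • (G' x - G x)‖ := by
    intro x hx hxK t ht
    have h1 := norm_segment_sub_le (hGF x hx) ((hG'F x hx).trans hε') ht
    have h2 := hKη x hx hxK
    have h3 := norm_sub_norm_le (F x) (G x + t • (G' x - G x))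
    rw [norm_sub_rev] at h3
    linarith
  rw [smoothDeg_homotopy (by positivity) hV hG hG' hK hKV key]
  refine smoothDeg_eta hε (by positivity) hε' le_rfl hV hG' hK hKV fun x hx hxK => ?_
  simpa using key x hx hxK 1 (by simp)

theorem exists_hasDeg {F : E → E} (hF : Continuous F) {V K : Set E} (hVb : Bornology.IsBounded V)
    (hK : IsCompact K) (hKV : K ⊆ V) {η : ℝ} (hη : 0 < η) (h : ∀ x ∈ V, x ∉ K → η ≤ ‖F x‖) :
    ∃ d, HasDeg F V d := by
  obtain ⟨G, hG, hGF⟩ := exists_contDiff_approx hF hVb (show 0 < η / 4 by positivity)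
  exact ⟨_, K, η, hK, hKV, hη, h, G, hG.contDiffOn, hGF, rfl⟩

theorem HasDeg.homotopy_eq [Nontrivial E] {F₁ F₂ : E → E} (hF₁ : Continuous F₁) (hF₂ : Continuous F₂)
    {V K : Set E} (hV : IsOpen V) (hVb : Bornology.IsBounded V) {d₁ d₂ : ℝ}
    (h₁ : HasDeg F₁ V d₁) (h₂ : HasDeg F₂ V d₂) (hK : IsCompact K) (hKV : K ⊆ V) {η : ℝ}
    (hη : 0 < η) (h : ∀ x ∈ V, x ∉ K → ∀ t ∈ Icc (0 : ℝ) 1, η ≤ ‖F₁ x + t • (F₂ x - F₁ x)‖) :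
    d₁ = d₂ := by
  obtain ⟨e₁, he₁, H₁⟩ := h₁.smoothDeg_eq hV
  obtain ⟨e₂, he₂, H₂⟩ := h₂.smoothDeg_eq hV
  set ε := min (min e₁ e₂) (η / 4) with hε
  have hε0 : 0 < ε := by positivity
  have hε1 : ε ≤ e₁ := (min_le_left _ _).trans (min_le_left _ _)
  have hε2 : ε ≤ e₂ := (min_le_left _ _).trans (min_le_right _ _)
  have hε3 : ε ≤ η / 4 := min_le_right _ _
  obtain ⟨G₁, hG₁, hG₁F⟩ := exists_contDiff_approx hF₁ hVb hε0
  obtain ⟨G₂, hG₂, hG₂F⟩ := exists_contDiff_approx hF₂ hVb hε0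
  rw [← H₁ G₁ hG₁.contDiffOn ε hε0 hε1 hG₁F, ← H₂ G₂ hG₂.contDiffOn ε hε0 hε2 hG₂F]
  refine smoothDeg_homotopy hε0 hV hG₁.contDiffOn hG₂.contDiffOn hK hKV fun x hx hxK t ht => ?_
  have h1 := h x hx hxK t ht
  have h2 : ‖(F₁ x + t • (F₂ x - F₁ x)) - (G₁ x + t • (G₂ x - G₁ x))‖ ≤ ε := by
    have : (F₁ x + t • (F₂ x - F₁ x)) - (G₁ x + t • (G₂ x - G₁ x)) =
        -((1 - t) • (G₁ x - F₁ x) + t • (G₂ x - F₂ x)) := by module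
    rw [this, norm_neg]
    refine (norm_add_le _ _).trans ?_
    rw [norm_smul, norm_smul, Real.norm_eq_abs, Real.norm_eq_abs, abs_of_nonneg ht.1,
      abs_of_nonneg (sub_nonneg.2 ht.2)]
    have a := hG₁F x hx
    have b := hG₂F x hx
    have := mul_le_mul_of_nonneg_left a (sub_nonneg.2 ht.2)
    have := mul_le_mul_of_nonneg_left b ht.1
    linarith
  have h3 := norm_sub_norm_le (F₁ x + t • (F₂ x - F₁ x)) (G₁ x + t • (G₂ x - G₁ x))
  linarith

theorem HasDeg.unique [Nontrivial E] {F : E → E} (hF : Continuous F) {V : Set E} (hV : IsOpen V)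
    (hVb : Bornology.IsBounded V) {d₁ d₂ : ℝ} (h₁ : HasDeg F V d₁) (h₂ : HasDeg F V d₂) : d₁ = d₂ := by
  obtain ⟨K, η, hK, hKV, hη, hKη, -⟩ := id h₁
  exact HasDeg.homotopy_eq hF hF hV hVb h₁ h₂ hK hKV hη fun x hx hxK t ht => by
    simpa using hKη x hx hxK

theorem HasDeg.homotopy [Nontrivial E] {F₁ F₂ : E → E} (hF₁ : Continuous F₁) (hF₂ : Continuous F₂)
    {V K : Set E} (hV : IsOpen V) (hVb : Bornology.IsBounded V) {d : ℝ}
    (h₁ : HasDeg F₁ V d) (hK : IsCompact K) (hKV : K ⊆ V) {η : ℝ}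
    (hη : 0 < η) (h : ∀ x ∈ V, x ∉ K → ∀ t ∈ Icc (0 : ℝ) 1, η ≤ ‖F₁ x + t • (F₂ x - F₁ x)‖) :
    HasDeg F₂ V d := by
  obtain ⟨d', hd'⟩ := exists_hasDeg hF₂ hVb hK hKV hη fun x hx hxK => by
    simpa using h x hx hxK 1 (by simp)
  rwa [h₁.homotopy_eq hF₁ hF₂ hV hVb hd' hK hKV hη h]

theorem hasDeg_sub_const [Nontrivial E] {V : Set E} (hV : IsOpen V) {a : E} (ha : a ∈ V) :
    HasDeg (fun x => x - a) V 1 := by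
  obtain ⟨r, hr, hrV⟩ := Metric.nhds_basis_closedBall.mem_iff.1 (hV.mem_nhds ha)
  refine ⟨closedBall a r, r, isCompact_closedBall _ _, hrV, hr, fun x _ hx => ?_, fun x => id x - a,
    (contDiff_id.sub contDiff_const).contDiffOn, fun x _ => by simp; positivity, ?_⟩
  · rw [mem_closedBall, not_le, dist_eq_norm] at hx
    exact hx.le
  · have hr4 : 0 < r / 4 := by positivity
    have e : ∀ x : E, degDensity (r / 4) (fun x => id x - a) x = radJac (r / 4) (x - a) := by
      intro x
      have : fderiv ℝ (fun x : E => id x - a) x = ContinuousLinearMap.id ℝ E :=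
        ((hasFDerivAt_id x).sub_const a).fderiv
      rw [degDensity, this]
      simp [ContinuousLinearMap.det]
    rw [smoothDeg, div_eq_one_iff_eq (radMass_pos hr4).ne', radMass]
    have h2 : ∫ x in V, degDensity (r / 4) (fun x => id x - a) x = ∫ x : E, radJac (r / 4) (x - a) := by
      simp_rw [e]
      apply setIntegral_eq_integral_of_forall_compl_eq_zero
      intro x hx
      apply radJac_eq_zero hr4
      by_contra hcon
      apply hx
      apply hrV
      rw [mem_closedBall, dist_eq_norm]
      linarith [not_le.1 hcon]
    exact h2.trans (integral_sub_right_eq_self _ a)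

theorem HasDeg.sum [Nontrivial E] {F : E → E} (hF : Continuous F) {V : Set E} (hV : IsOpen V)
    (hVb : Bornology.IsBounded V) {ι : Type*} (s : Finset ι) {W K : ι → Set E}
    (hW : ∀ i ∈ s, IsOpen (W i)) (hWV : ∀ i ∈ s, W i ⊆ V)
    (hd : (s : Set ι).PairwiseDisjoint W)
    (hK : ∀ i ∈ s, IsCompact (K i)) (hKW : ∀ i ∈ s, K i ⊆ W i) {η : ℝ} (hη : 0 < η)
    (h : ∀ x ∈ V, x ∉ ⋃ i ∈ s, K i → η ≤ ‖F x‖) {d : ι → ℝ}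
    (hdeg : ∀ i ∈ s, HasDeg F (W i) (d i)) : HasDeg F V (∑ i ∈ s, d i) := by
  have hKc : IsCompact (⋃ i ∈ s, K i) := s.isCompact_biUnion hK
  have hKV : (⋃ i ∈ s, K i) ⊆ V := iUnion₂_subset fun i hi => (hKW i hi).trans (hWV i hi)
  obtain ⟨D, hD⟩ := exists_hasDeg hF hVb hKc hKV hη h
  obtain ⟨e₀, he₀, H₀⟩ := hD.smoothDeg_eq hV
  have hex : ∀ i ∈ s, ∃ ε₀ > 0, ∀ G : E → E, ContDiffOn ℝ 1 G (W i) → ∀ ε, 0 < ε → ε ≤ ε₀ →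
      (∀ x ∈ W i, ‖G x - F x‖ ≤ ε) → smoothDeg ε G (W i) = d i := fun i hi =>
    (hdeg i hi).smoothDeg_eq (hW i hi)
  choose! e he H using hex
  obtain ⟨ε, hε0, hε1, hε2, hε3⟩ : ∃ ε, 0 < ε ∧ ε ≤ e₀ ∧ (∀ i ∈ s, ε ≤ e i) ∧ ε ≤ η / 4 := by
    have h1 : ∀ᶠ ε : ℝ in 𝓝[>] 0, (∀ i ∈ s, ε ≤ e i) := by
      rw [Filter.eventually_all_finset]
      intro i hi
      filter_upwards [Ioc_mem_nhdsGT (he i hi)] with x hx using hx.2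
    have h2 : ∀ᶠ ε : ℝ in 𝓝[>] 0, ε ∈ Ioc 0 e₀ := Ioc_mem_nhdsGT he₀
    have h3 : ∀ᶠ ε : ℝ in 𝓝[>] 0, ε ∈ Ioc 0 (η / 4) := Ioc_mem_nhdsGT (by positivity)
    obtain ⟨ε, a, b, c⟩ := (h1.and (h2.and h3)).exists
    exact ⟨ε, b.1, b.2, a, c.2⟩
  obtain ⟨G, hG, hGF⟩ := exists_contDiff_approx hF hVb hε0
  have hGK : ∀ x ∈ V, x ∉ ⋃ i ∈ s, K i → ε ≤ ‖G x‖ := fun x hx hxK => by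
    have h1 := h x hx hxK
    have h2 := hGF x hx
    have h3 := norm_sub_norm_le (F x) (G x)
    rw [norm_sub_rev] at h3
    linarith
  have hsum : smoothDeg ε G V = ∑ i ∈ s, smoothDeg ε G (W i) := by
    simp only [smoothDeg]
    rw [← Finset.sum_div, ← integral_biUnion_finset s (fun i hi => (hW i hi).measurableSet) hd]
    · congr 1
      apply setIntegral_eq_of_subset_of_forall_diff_eq_zero hV.measurableSet (iUnion₂_subset hWV)
      intro x hx
      rw [degDensity, radJac_eq_zero hε0 (hGK x hx.1 fun hh => hx.2 ?_), zero_mul]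
      obtain ⟨i, hi, hxi⟩ := mem_iUnion₂.1 hh
      exact mem_iUnion₂.2 ⟨i, hi, hKW i hi hxi⟩
    · intro i hi
      exact (integrableOn_degDensity hε0 hV hG.contDiffOn hKc hKV hGK).mono_set (hWV i hi)
  rw [H₀ G hG.contDiffOn ε hε0 hε1 hGF] at hsum
  rw [Finset.sum_congr rfl fun i hi => (H i hi G hG.contDiffOn ε hε0 (hε2 i hi)
    fun x hx => hGF x (hWV i hi hx))] at hsum
  rwa [← hsum]

end Degree

section Degree
variable {E : Type*} [NormedAddCommGroup E] [InnerProductSpace ℝ E] [FiniteDimensional ℝ E]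
  [MeasurableSpace E] [BorelSpace E]

theorem hasDeg_of_injOn [Nontrivial E] {G : E → E} (hG : ContDiff ℝ 1 G) {W : Set E} (hW : IsOpen W)
    {x : E} (hxW : x ∈ W) (hx : G x = 0) (hdet : (fderiv ℝ G x).det ≠ 0) (hinj : InjOn G W)
    {σ : ℝ} (hσ : ∀ y ∈ W, (fderiv ℝ G y).det = σ * |(fderiv ℝ G y).det|) :
    HasDeg G W σ := by
  obtain ⟨r, hr, hrW⟩ := Metric.nhds_basis_closedBall.mem_iff.1 (hW.mem_nhds hxW)
  have hopen : map G (𝓝 x) = 𝓝 (G x) := by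
    have h1 : HasStrictFDerivAt G (fderiv ℝ G x) x := hG.contDiffAt.hasStrictFDerivAt one_ne_zero
    have h2 := h1.map_nhds_eq_of_surj (by
      have := (LinearMap.equivOfDetNeZero (fderiv ℝ G x : E →ₗ[ℝ] E) hdet).surjective
      exact LinearMap.range_eq_top.2 this)
    exact h2
  have himg : G '' closedBall x r ∈ 𝓝 (0 : E) := by
    rw [← hx, ← hopen]
    exact image_mem_map (closedBall_mem_nhds x hr)
  obtain ⟨η, hη, hηG⟩ := Metric.mem_nhds_iff.1 himg
  refine ⟨closedBall x r, η, isCompact_closedBall _ _, hrW, hη, fun y hy hyK => ?_, G,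
    hG.contDiffOn, fun _ _ => by simp; positivity, ?_⟩
  · by_contra hcon
    rw [not_le] at hcon
    obtain ⟨z, hz, hzy⟩ := hηG (mem_ball_zero_iff.2 hcon)
    exact hyK (hinj (hrW hz) hy hzy ▸ hz)
  · have hη4 : 0 < η / 4 := by positivity
    rw [smoothDeg, div_eq_iff (radMass_pos hη4).ne', radMass]
    have hd : ∀ y ∈ W, HasFDerivWithinAt G (fderiv ℝ G y) W y := fun y _ =>
      ((hG.differentiable one_ne_zero) y).hasFDerivAt.hasFDerivWithinAt
    have h1 := integral_image_eq_integral_abs_det_fderiv_smul volume hW.measurableSet hd hinj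
      (radJac (η / 4))
    have h2 : ∫ y in G '' W, radJac (η / 4) y = ∫ y : E, radJac (η / 4) y := by
      apply setIntegral_eq_integral_of_forall_compl_eq_zero
      intro y hy
      refine radJac_eq_zero (E := E) hη4 ?_
      by_contra hcon
      rw [not_le] at hcon
      exact hy (image_mono hrW (hηG (mem_ball_zero_iff.2 (by linarith))))
    rw [← h2, h1, ← MeasureTheory.integral_const_mul]
    refine setIntegral_congr_fun hW.measurableSet fun y hy => ?_
    simp only [degDensity, smul_eq_mul]
    conv_lhs => rw [hσ y hy]
    ring

theorem HasDeg.int [Nontrivial E] {F : E → E} (hF : Continuous F) {V : Set E} (hV : IsOpen V)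
    (hVb : Bornology.IsBounded V) {d : ℝ} (h : HasDeg F V d) : ∃ m : ℤ, d = m := by
  obtain ⟨K, η, hK, hKV, hη, hKη, -⟩ := id h
  obtain ⟨G₀, hG₀, hG₀F⟩ := exists_contDiff_approx hF hVb (show 0 < η / 4 by positivity)
  obtain ⟨y, hy, hyreg⟩ : ∃ y ∈ ball (0 : E) (η / 4), y ∉ G₀ '' {x | (fderiv ℝ G₀ x).det = 0} := by
    by_contra! hcon
    have h0 : volume (G₀ '' {x | (fderiv ℝ G₀ x).det = 0}) = 0 :=
      addHaar_image_eq_zero_of_det_fderivWithin_eq_zero volume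
        (fun x _ => ((hG₀.differentiable one_ne_zero) x).hasFDerivAt.hasFDerivWithinAt) fun x hx => hx
    have h1 := measure_mono_null hcon h0
    exact (measure_ball_pos volume (0 : E) (show 0 < η / 4 by positivity)).ne' h1
  rw [mem_ball_zero_iff] at hy
  set G : E → E := fun x => G₀ x - y with hGdef
  have hG : ContDiff ℝ 1 G := hG₀.sub contDiff_const
  have hfd : ∀ x, fderiv ℝ G x = fderiv ℝ G₀ x := fun x => fderiv_sub_const y
  have hGF : ∀ x ∈ V, ‖G x - F x‖ ≤ η / 2 := fun x hx => by
    have : G x - F x = (G₀ x - F x) - y := by simp [hGdef]; abel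
    rw [this]
    linarith [norm_sub_le (G₀ x - F x) y, hG₀F x hx]
  have hGK : ∀ x ∈ V, x ∉ K → η / 2 ≤ ‖G x‖ := fun x hx hxK => by
    have h3 := norm_sub_norm_le (F x) (G x)
    rw [norm_sub_rev (F x) (G x)] at h3
    linarith [hGF x hx, hKη x hx hxK]
  have hGd : HasDeg G V d := by
    refine h.homotopy hF hG.continuous hV hVb hK hKV (show 0 < η / 2 by positivity)
      fun x hx hxK t ht => ?_
    have h1 := norm_segment_sub_le (a := F x) (c := F x) (by simp; positivity) (hGF x hx) ht
    have h3 := norm_sub_norm_le (F x) (F x + t • (G x - F x))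
    rw [norm_sub_rev (F x) (F x + _)] at h3
    linarith [hKη x hx hxK]
  set Z : Set E := {x ∈ K | G x = 0} with hZ
  have hZc : IsCompact Z := hK.inter_right (isClosed_eq hG.continuous continuous_const)
  have hdet : ∀ x ∈ Z, (fderiv ℝ G x).det ≠ 0 := fun x hx h0 => hyreg
    ⟨x, by rwa [mem_setOf_eq, ← hfd], by
      have := hx.2
      simpa [hGdef, sub_eq_zero] using this⟩
  have hcd : Continuous fun x => (fderiv ℝ G x).det :=
    ContinuousLinearMap.continuous_det.comp (hG.continuous_fderiv one_ne_zero)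
  have hloc : ∀ x ∈ Z, ∃ W : Set E, IsOpen W ∧ x ∈ W ∧ W ⊆ V ∧ InjOn G W ∧ ∃ m : ℤ, ∀ z ∈ W,
      (fderiv ℝ G z).det = m * |(fderiv ℝ G z).det| := by
    intro x hx
    have h1 : HasStrictFDerivAt G (fderiv ℝ G x) x := hG.contDiffAt.hasStrictFDerivAt one_ne_zero
    let L : E ≃L[ℝ] E := (LinearMap.equivOfDetNeZero (fderiv ℝ G x : E →ₗ[ℝ] E) (hdet x hx)).toContinuousLinearEquiv
    have hL : (L : E →L[ℝ] E) = fderiv ℝ G x := by ext z; rfl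
    rw [← hL] at h1
    set e := h1.toOpenPartialHomeomorph G
    have hinj : InjOn G e.source := e.injOn
    have hxe : x ∈ e.source := h1.mem_toOpenPartialHomeomorph_source
    rcases (hdet x hx).lt_or_gt with hneg | hpos
    · refine ⟨e.source ∩ V ∩ {z | (fderiv ℝ G z).det < 0},
        (e.open_source.inter hV).inter (isOpen_lt hcd continuous_const),
        ⟨⟨hxe, hKV hx.1⟩, hneg⟩, fun z hz => hz.1.2, hinj.mono fun z hz => hz.1.1, -1, fun z hz => ?_⟩
      rw [abs_of_neg hz.2]; simp
    · refine ⟨e.source ∩ V ∩ {z | 0 < (fderiv ℝ G z).det},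
        (e.open_source.inter hV).inter (isOpen_lt continuous_const hcd),
        ⟨⟨hxe, hKV hx.1⟩, hpos⟩, fun z hz => hz.1.2, hinj.mono fun z hz => hz.1.1, 1, fun z hz => ?_⟩
      rw [abs_of_pos hz.2]; simp
  choose! W hWo hxW hWV hWinj m hm using hloc
  have hfin : Z.Finite := by
    obtain ⟨t, hZt⟩ := hZc.elim_nhds_subcover' (fun x _ => W x) fun x hx => (hWo x hx).mem_nhds (hxW x hx)
    refine (t.finite_toSet.image Subtype.val).subset fun z hz => ?_
    have hz' := hZt hz
    simp only [mem_iUnion] at hz'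
    obtain ⟨x, hxt, hzx⟩ := hz'
    exact ⟨x, hxt, hWinj x.1 x.2 (hxW x.1 x.2) hzx (x.2.2.trans hz.2.symm)⟩
  obtain ⟨S, hS, hSd⟩ := hfin.t2_separation
  set W' : E → Set E := fun x => W x ∩ S x with hW'
  have hW'o : ∀ x ∈ hfin.toFinset, IsOpen (W' x) := fun x hx =>
    (hWo x (hfin.mem_toFinset.1 hx)).inter (hS x).2
  have hdeg : ∀ x ∈ hfin.toFinset, HasDeg G (W' x) (m x) := fun x hx => by
    have hxZ := hfin.mem_toFinset.1 hx
    exact hasDeg_of_injOn hG (hW'o x hx) ⟨hxW x hxZ, (hS x).1⟩ hxZ.2 (hdet x hxZ)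
      ((hWinj x hxZ).mono inter_subset_left) fun z hz => hm x hxZ z hz.1
  have hball : ∀ x ∈ hfin.toFinset, ∃ r > 0, closedBall x r ⊆ W' x := fun x hx => by
    have hxZ := hfin.mem_toFinset.1 hx
    exact Metric.nhds_basis_closedBall.mem_iff.1 ((hW'o x hx).mem_nhds ⟨hxW x hxZ, (hS x).1⟩)
  choose! r hr hrW using hball
  obtain ⟨δ, hδ, hδ'⟩ : ∃ δ > 0, ∀ x ∈ V, x ∉ ⋃ i ∈ hfin.toFinset, closedBall i (r i) → δ ≤ ‖G x‖ := by
    set C := K \ ⋃ i ∈ hfin.toFinset, ball i (r i) with hC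
    have hCc : IsCompact C := hK.diff (isOpen_biUnion fun _ _ => isOpen_ball)
    obtain ⟨δ, hδ, hδC⟩ : ∃ δ > 0, ∀ x ∈ C, δ ≤ ‖G x‖ := by
      rcases C.eq_empty_or_nonempty with hE | hE
      · exact ⟨1, one_pos, by simp [hE]⟩
      · obtain ⟨x, hx, hmin⟩ := hCc.exists_isMinOn hE hG.continuous.norm.continuousOn
        refine ⟨‖G x‖, norm_pos_iff.2 fun h0 => hx.2 ?_, fun z hz => hmin hz⟩
        have hxZ : x ∈ hfin.toFinset := hfin.mem_toFinset.2 ⟨hx.1, h0⟩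
        exact mem_iUnion₂.2 ⟨x, hxZ, mem_ball_self (hr x hxZ)⟩
    refine ⟨min δ (η / 2), by positivity, fun x hx hxU => ?_⟩
    by_cases hxK : x ∈ K
    · refine (min_le_left _ _).trans (hδC x ⟨hxK, fun hh => hxU ?_⟩)
      exact iUnion₂_mono (fun i _ => ball_subset_closedBall) hh
    · exact (min_le_right _ _).trans (hGK x hx hxK)
  have hsum := HasDeg.sum hG.continuous hV hVb hfin.toFinset hW'o
    (fun x hx => inter_subset_left.trans (hWV x (hfin.mem_toFinset.1 hx)))
    (fun x hx z hz hxz => (hSd (by simpa using hx) (by simpa using hz) hxz).mono inter_subset_right inter_subset_right)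
    (fun x _ => isCompact_closedBall x (r x)) hrW hδ hδ' hdeg
  exact ⟨∑ i ∈ hfin.toFinset, m i, by
    rw [hGd.unique hG.continuous hV hVb hsum]; push_cast; rfl⟩

end Degree

theorem exists_pos_le_norm_of_isCompact {α F : Type*} [TopologicalSpace α] [NormedAddCommGroup F]
    {C : Set α} (hC : IsCompact C) {f : α → F} (hf : ContinuousOn f C) (h0 : ∀ x ∈ C, f x ≠ 0) :
    ∃ η > 0, ∀ x ∈ C, η ≤ ‖f x‖ := by
  rcases C.eq_empty_or_nonempty with hE | hE
  · exact ⟨1, one_pos, by simp [hE]⟩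
  · obtain ⟨x, hx, hmin⟩ := hC.exists_isMinOn hE hf.norm
    exact ⟨‖f x‖, norm_pos_iff.2 (h0 x hx), fun z hz => hmin hz⟩

section LocalDegree
variable {E : Type*} [NormedAddCommGroup E] [InnerProductSpace ℝ E] [FiniteDimensional ℝ E]
  [MeasurableSpace E] [BorelSpace E]

theorem exists_pos_le_norm_annulus {F : E → E} (hF : Continuous F) {ζ z : E} {ρ ρ' : ℝ}
    (hρ' : 0 < ρ') (h0 : ∀ x ∈ closedBall ζ ρ, x ≠ z → F x ≠ 0) :
    ∃ η > 0, ∀ x ∈ closedBall ζ ρ, x ∉ closedBall z (ρ' / 2) → η ≤ ‖F x‖ := by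
  obtain ⟨η, hη, h⟩ := exists_pos_le_norm_of_isCompact
    ((isCompact_closedBall ζ ρ).diff (isOpen_ball (x := z) (ε := ρ' / 2))) hF.continuousOn
    fun x hx => h0 x hx.1 (by
      rintro rfl
      exact hx.2 (mem_ball_self (by positivity)))
  exact ⟨η, hη, fun x hx hxz => h x ⟨hx, fun hh => hxz (ball_subset_closedBall hh)⟩⟩

variable [Nontrivial E]

theorem exists_int_hasDeg {F : E → E} (hF : Continuous F) {ζ : E} {ρ : ℝ} (hρ : 0 < ρ)
    (h0 : ∀ x ∈ closedBall ζ ρ, x ≠ ζ → F x ≠ 0) : ∃ m : ℤ, HasDeg F (ball ζ ρ) m := by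
  obtain ⟨η, hη, h⟩ := exists_pos_le_norm_annulus hF hρ h0
  obtain ⟨d, hd⟩ := exists_hasDeg hF isBounded_ball (isCompact_closedBall ζ (ρ / 2))
    (closedBall_subset_ball (by linarith)) hη fun x hx hxK => h x (ball_subset_closedBall hx) hxK
  obtain ⟨m, rfl⟩ := hd.int hF isOpen_ball isBounded_ball
  exact ⟨m, hd⟩

theorem HasDeg.homotopy_ball {F₁ F₂ : E → E} (hF₁ : Continuous F₁) (hF₂ : Continuous F₂)
    {ζ : E} {ρ : ℝ} (hρ : 0 < ρ) {d : ℝ} (h₁ : HasDeg F₁ (ball ζ ρ) d)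
    (h0 : ∀ x ∈ closedBall ζ ρ, x ≠ ζ → ∀ t ∈ Icc (0 : ℝ) 1, F₁ x + t • (F₂ x - F₁ x) ≠ 0) :
    HasDeg F₂ (ball ζ ρ) d := by
  obtain ⟨η, hη, h⟩ := exists_pos_le_norm_of_isCompact
    (((isCompact_closedBall ζ ρ).diff (isOpen_ball (x := ζ) (ε := ρ / 2))).prod
      (isCompact_Icc (a := (0 : ℝ)) (b := 1)))
    (f := fun p : E × ℝ => F₁ p.1 + p.2 • (F₂ p.1 - F₁ p.1))
    (by fun_prop)
    fun x hx => h0 x.1 hx.1.1 (by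
      intro hxe
      exact hx.1.2 (hxe ▸ mem_ball_self (by positivity))) x.2 hx.2
  exact h₁.homotopy hF₁ hF₂ isOpen_ball isBounded_ball (isCompact_closedBall ζ (ρ / 2))
    (closedBall_subset_ball (by linarith)) hη fun x hx hxK t ht =>
      h (x, t) ⟨⟨ball_subset_closedBall hx, fun hh => hxK (ball_subset_closedBall hh)⟩, ht⟩

theorem HasDeg.excision_ball {F : E → E} (hF : Continuous F) {ζ z : E} {ρ ρ' : ℝ}
    (hρ' : 0 < ρ') (hsub : closedBall z ρ' ⊆ ball ζ ρ)
    (h0 : ∀ x ∈ closedBall ζ ρ, x ≠ z → F x ≠ 0) {d : ℝ} (hd : HasDeg F (ball ζ ρ) d) :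
    HasDeg F (ball z ρ') d := by
  obtain ⟨m, hm⟩ := exists_int_hasDeg hF hρ' fun x hx hxz =>
    h0 x (ball_subset_closedBall (hsub hx)) hxz
  obtain ⟨η, hη, h⟩ := exists_pos_le_norm_annulus hF hρ' h0
  have := HasDeg.sum (ι := Unit) hF isOpen_ball isBounded_ball {()}
    (W := fun _ => ball z ρ') (K := fun _ => closedBall z (ρ' / 2)) (V := ball ζ ρ)
    (fun _ _ => isOpen_ball) (fun _ _ => ball_subset_closedBall.trans hsub) (by simp)
    (fun _ _ => isCompact_closedBall _ _)
    (fun _ _ => closedBall_subset_ball (by linarith)) hη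
    (fun x hx hxK => h x (ball_subset_closedBall hx) (by simpa using hxK)) (d := fun _ => (m : ℝ))
    (fun _ _ => hm)
  rw [hd.unique hF isOpen_ball isBounded_ball this]
  simpa using hm

/-- `F` is injective near `ζ` and has local degree `d` there. -/
def LocDeg (F : E → E) (ζ : E) (d : ℝ) : Prop :=
  ∃ ρ > 0, InjOn F (closedBall ζ ρ) ∧ HasDeg (fun x => F x - F ζ) (ball ζ ρ) d

theorem sub_ne_zero_of_injOn {α G : Type*} [AddGroup G] {F : α → G} {s : Set α} (h : InjOn F s)
    {ζ : α} (hζ : ζ ∈ s) :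
    ∀ x ∈ s, x ≠ ζ → F x - F ζ ≠ 0 := fun _ hx hne h0 => hne (h hx hζ (sub_eq_zero.1 h0))

theorem exists_int_locDeg {F : E → E} (hF : Continuous F) {ζ : E} {ρ : ℝ} (hρ : 0 < ρ)
    (h : InjOn F (closedBall ζ ρ)) : ∃ m : ℤ, LocDeg F ζ m := by
  obtain ⟨m, hm⟩ := exists_int_hasDeg (hF.sub continuous_const) hρ
    (sub_ne_zero_of_injOn h (mem_closedBall_self hρ.le))
  exact ⟨m, ρ, hρ, h, hm⟩

theorem LocDeg.shrink {F : E → E} (hF : Continuous F) {ζ : E} {d : ℝ} (h : LocDeg F ζ d) :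
    ∃ ρ₀ > 0, ∀ ρ, 0 < ρ → ρ ≤ ρ₀ → InjOn F (closedBall ζ ρ) ∧
      HasDeg (fun x => F x - F ζ) (ball ζ ρ) d := by
  obtain ⟨ρ, hρ, hinj, hd⟩ := h
  refine ⟨ρ / 2, by positivity, fun ρ' hρ' hle =>
    ⟨hinj.mono (closedBall_subset_closedBall (by linarith)), ?_⟩⟩
  exact hd.excision_ball (hF.sub continuous_const) hρ' (closedBall_subset_ball (by linarith))
    (sub_ne_zero_of_injOn hinj (mem_closedBall_self hρ.le))

theorem LocDeg.unique {F : E → E} (hF : Continuous F) {ζ : E} {d d' : ℝ} (h : LocDeg F ζ d)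
    (h' : LocDeg F ζ d') : d = d' := by
  obtain ⟨ρ, hρ, H⟩ := h.shrink hF
  obtain ⟨ρ', hρ', H'⟩ := h'.shrink hF
  exact (H _ (lt_min hρ hρ') (min_le_left _ _)).2.unique (hF.sub continuous_const) isOpen_ball
    isBounded_ball (H' _ (lt_min hρ hρ') (min_le_right _ _)).2

theorem HasDeg.eventually_sub_const {F : E → E} (hF : Continuous F) {ζ z : E} {ρ : ℝ} (hρ : 0 < ρ)
    (h0 : ∀ x ∈ closedBall ζ ρ, x ≠ ζ → F x - z ≠ 0) {d : ℝ}
    (hd : HasDeg (fun x => F x - z) (ball ζ ρ) d) :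
    ∀ᶠ z' in 𝓝 z, HasDeg (fun x => F x - z') (ball ζ ρ) d := by
  obtain ⟨η, hη, h⟩ := exists_pos_le_norm_annulus (hF.sub continuous_const) hρ h0
  filter_upwards [ball_mem_nhds z (show 0 < η / 2 by positivity)] with z' hz'
  refine hd.homotopy (hF.sub continuous_const) (hF.sub continuous_const) isOpen_ball isBounded_ball
    (isCompact_closedBall ζ (ρ / 2)) (closedBall_subset_ball (by linarith))
    (show 0 < η / 2 by positivity) fun x hx hxK t ht => ?_
  have h1 := h x (ball_subset_closedBall hx) hxK
  have h2 := norm_segment_sub_le (a := F x - z) (b := F x - z') (c := F x - z) (ε := η / 2)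
    (by simp; positivity) (by
      rw [mem_ball, dist_eq_norm, norm_sub_rev] at hz'
      rw [sub_sub_sub_cancel_left]; exact hz'.le) ht
  have h3 := norm_sub_norm_le (F x - z) (F x - z + t • ((F x - z') - (F x - z)))
  rw [norm_sub_rev (F x - z)] at h3
  show η / 2 ≤ ‖F x - z + t • ((F x - z') - (F x - z))‖
  replace h1 : η ≤ ‖F x - z‖ := h1
  linarith

theorem LocDeg.eventually {F : E → E} (hF : Continuous F) {ζ : E} {d : ℝ} (h : LocDeg F ζ d) :
    ∀ᶠ ζ' in 𝓝 ζ, LocDeg F ζ' d := by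
  obtain ⟨ρ, hρ, hinj, hd⟩ := h
  have h1 := hd.eventually_sub_const hF hρ (sub_ne_zero_of_injOn hinj (mem_closedBall_self hρ.le))
  filter_upwards [hF.continuousAt.eventually h1, ball_mem_nhds ζ hρ] with ζ' hζ' hζ'b
  obtain ⟨ρ', hρ', hsub⟩ := Metric.nhds_basis_closedBall.mem_iff.1 (isOpen_ball.mem_nhds hζ'b)
  exact ⟨ρ', hρ', hinj.mono (hsub.trans ball_subset_closedBall),
    hζ'.excision_ball (hF.sub continuous_const) hρ' hsub
      (sub_ne_zero_of_injOn hinj (ball_subset_closedBall hζ'b))⟩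

end LocalDegree

section ComplexDegree
attribute [local instance] InnerProductSpace.complexToReal
variable {E : Type*} [NormedAddCommGroup E] [InnerProductSpace ℂ E] [FiniteDimensional ℂ E]

theorem exists_segment_path (A : E →L[ℂ] E) (hA : Function.Injective A) :
    ∃ μ : ℂ, (∀ v : E, v ≠ 0 → ∀ t ∈ Icc (0 : ℝ) 1, v + t • (μ • A v - v) ≠ 0) ∧
      ∀ v : E, v ≠ 0 → ∀ t ∈ Icc (0 : ℝ) 1, μ • A v + t • (A v - μ • A v) ≠ 0 := by
  have hfin : (Set.range fun k : ℕ => (1 + k * Complex.I : ℂ)).Infinite := by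
    apply Set.infinite_range_of_injective
    intro a b hab
    have := congrArg Complex.im hab
    simpa using this
  -- the parameters for which some point of the first segment is singular
  have hbad : {k : ℕ | ∃ c : ℝ, 0 < c ∧
      Module.End.HasEigenvalue (A : E →ₗ[ℂ] E) (-c / (1 + k * Complex.I))}.Finite := by
    have hev := Module.End.finite_hasEigenvalue (A : E →ₗ[ℂ] E)
    choose! c hc hcE using fun k (hk : k ∈ {k : ℕ | ∃ c : ℝ, 0 < c ∧
      Module.End.HasEigenvalue (A : E →ₗ[ℂ] E) (-c / (1 + k * Complex.I))}) => hk
    refine Set.Finite.of_finite_image (f := fun k : ℕ => (-(c k : ℂ) / (1 + k * Complex.I)))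
      (hev.subset ?_) ?_
    · rintro _ ⟨k, hk, rfl⟩
      exact hcE k hk
    · intro k hk j hj hkj
      have hne : ∀ k : ℕ, (1 + k * Complex.I : ℂ) ≠ 0 := fun k h => by
        have := congrArg Complex.re h
        simp at this
      simp only at hkj
      rw [div_eq_div_iff (hne _) (hne _)] at hkj
      have h1 := congrArg Complex.re hkj
      have h2 := congrArg Complex.im hkj
      simp at h1 h2
      have h3 : c j * ((k : ℝ) - j) = 0 := by rw [h1] at h2; linarith
      rcases mul_eq_zero.1 h3 with h4 | h4
      · exact absurd h4 (hc j hj).ne'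
      · exact_mod_cast sub_eq_zero.1 h4
  obtain ⟨k, hk⟩ := hbad.infinite_compl.nonempty
  have hμ0 : (1 + k * Complex.I : ℂ) ≠ 0 := fun h => by
    have := congrArg Complex.re h
    simp at this
  refine ⟨1 + k * Complex.I, fun v hv t ht h0 => ?_, fun v hv t ht h0 => ?_⟩
  · rcases eq_or_lt_of_le ht.1 with rfl | ht0
    · simp at h0; exact hv h0
    rcases eq_or_lt_of_le ht.2 with rfl | ht1
    · have : (1 + k * Complex.I : ℂ) • A v = 0 := by simpa using h0
      rcases smul_eq_zero.1 this with h | h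
      · exact hμ0 h
      · exact hv (hA (by simpa using h))
    · apply hk
      refine ⟨(1 - t) / t, div_pos (by linarith) ht0, ?_⟩
      apply Module.End.hasEigenvalue_of_hasEigenvector (x := v)
      refine ⟨Module.End.mem_eigenspace_iff.2 ?_, hv⟩
      have h1 : (t * (1 + k * Complex.I) : ℂ) • A v = (-(1 - t) : ℂ) • v := by
        have h2 : v + t • ((1 + k * Complex.I : ℂ) • A v - v) =
          (t * (1 + k * Complex.I) : ℂ) • A v - (-(1 - t) : ℂ) • v := by
          rw [← Complex.coe_smul]
          module
        rw [h2] at h0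
        exact sub_eq_zero.1 h0
      have htc : (t : ℂ) ≠ 0 := by exact_mod_cast ht0.ne'
      have h3 : A v = (t * (1 + k * Complex.I) : ℂ)⁻¹ • ((t * (1 + k * Complex.I) : ℂ) • A v) := by
        rw [smul_smul, inv_mul_cancel₀ (mul_ne_zero htc hμ0), one_smul]
      show A v = _
      rw [h3, h1, smul_smul]
      congr 1
      push_cast
      field_simp
  · have h2 : (1 + k * Complex.I : ℂ) • A v + t • (A v - (1 + k * Complex.I : ℂ) • A v) =
        (1 + (1 - t) * k * Complex.I : ℂ) • A v := by
      rw [← Complex.coe_smul]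
      module
    rw [h2] at h0
    rcases smul_eq_zero.1 h0 with h | h
    · have := congrArg Complex.re h
      simp at this
    · exact hv (hA (by simpa using h))

variable [MeasurableSpace E] [BorelSpace E]

theorem LocDeg.comp [Nontrivial E] {θ F H : E → E} (hθ : Continuous θ) (hF : Continuous F) {ζ : E} {d : ℝ}
    (h : LocDeg θ ζ d) {A : E →L[ℂ] E} (hH : HasStrictFDerivAt H A (θ ζ))
    (hA : Function.Injective A) (hFH : ∀ᶠ x in 𝓝 ζ, F x = H (θ x)) : LocDeg F ζ d := by
  obtain ⟨c, hc, hcA⟩ : ∃ c > 0, ∀ v, c * ‖v‖ ≤ ‖A v‖ := by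
    obtain ⟨K, hK, hKA⟩ := LinearMap.exists_antilipschitzWith (A : E →ₗ[ℂ] E)
      (LinearMap.ker_eq_bot.2 hA)
    refine ⟨(K : ℝ)⁻¹, by positivity, fun v => ?_⟩
    rw [inv_mul_le_iff₀ (by positivity)]
    simpa using hKA.le_mul_norm (x := v) (by simp)
  have hev : ∀ᶠ p : E × E in 𝓝 (θ ζ, θ ζ), ‖H p.1 - H p.2 - A (p.1 - p.2)‖ ≤ c / 2 * ‖p.1 - p.2‖ :=
    hH.isLittleO.def (by positivity)
  have hev3 : ∀ᶠ p : E × E in 𝓝 (ζ, ζ),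
      ‖H (θ p.1) - H (θ p.2) - A (θ p.1 - θ p.2)‖ ≤ c / 2 * ‖θ p.1 - θ p.2‖ :=
    (hθ.continuousAt.prodMap' hθ.continuousAt).eventually hev
  rw [nhds_prod_eq] at hev3
  obtain ⟨U, hU, hUH⟩ := Filter.mem_prod_same_iff.1 hev3
  obtain ⟨ρ₁, hρ₁, hρ₁'⟩ := Metric.nhds_basis_closedBall.mem_iff.1 (Filter.inter_mem hU hFH)
  obtain ⟨ρ₀, hρ₀, hρ₀'⟩ := h.shrink hθ
  set ρ := min ρ₀ ρ₁ with hρdef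
  have hρ : 0 < ρ := lt_min hρ₀ hρ₁
  obtain ⟨hinj, hd⟩ := hρ₀' ρ hρ (min_le_left _ _)
  have hsub : closedBall ζ ρ ⊆ U ∩ {x | F x = H (θ x)} :=
    (closedBall_subset_closedBall (min_le_right _ _)).trans hρ₁'
  have hest : ∀ x ∈ closedBall ζ ρ, ∀ y ∈ closedBall ζ ρ,
      ‖F x - F y - A (θ x - θ y)‖ ≤ c / 2 * ‖θ x - θ y‖ := fun x hx y hy => by
    rw [(hsub hx).2, (hsub hy).2]
    exact hUH (show (x, y) ∈ U ×ˢ U from ⟨(hsub hx).1, (hsub hy).1⟩)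
  have hζ : ζ ∈ closedBall ζ ρ := mem_closedBall_self hρ.le
  refine ⟨ρ, hρ, fun x hx y hy hxy => hinj hx hy ?_, ?_⟩
  · have h1 := hest x hx y hy
    rw [hxy, sub_self, zero_sub, norm_neg] at h1
    have h2 := hcA (θ x - θ y)
    have h3 : ‖θ x - θ y‖ ≤ 0 := by nlinarith [norm_nonneg (θ x - θ y)]
    exact sub_eq_zero.1 (norm_le_zero_iff.1 h3)
  · obtain ⟨μ, hμ1, hμ2⟩ := exists_segment_path A hA
    have hne : ∀ x ∈ closedBall ζ ρ, x ≠ ζ → θ x - θ ζ ≠ 0 := sub_ne_zero_of_injOn hinj hζ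
    have d1 : HasDeg (fun x => μ • A (θ x - θ ζ)) (ball ζ ρ) d :=
      hd.homotopy_ball (by fun_prop) (by fun_prop) hρ fun x hx hxζ t ht => hμ1 _ (hne x hx hxζ) t ht
    have d2 : HasDeg (fun x => A (θ x - θ ζ)) (ball ζ ρ) d :=
      d1.homotopy_ball (by fun_prop) (by fun_prop) hρ fun x hx hxζ t ht => hμ2 _ (hne x hx hxζ) t ht
    refine d2.homotopy_ball (by fun_prop) (by fun_prop) hρ fun x hx hxζ t ht h0 => ?_
    have h1 := norm_segment_sub_le (a := A (θ x - θ ζ)) (b := F x - F ζ) (c := A (θ x - θ ζ))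
      (ε := c / 2 * ‖θ x - θ ζ‖) (by simp; positivity) (hest x hx ζ hζ) ht
    rw [h0, zero_sub, norm_neg] at h1
    have h2 := hcA (θ x - θ ζ)
    have h3 := norm_pos_iff.2 (hne x hx hxζ)
    nlinarith

end ComplexDegree

section Holomorphic
variable {E F : Type*} [NormedAddCommGroup E] [NormedSpace ℂ E] [NormedAddCommGroup F]
  [NormedSpace ℂ F]

theorem norm_fderiv_le_of_ball {f : E → F} {x : E} {r C : ℝ} (hr : 0 < r) (hC : 0 ≤ C)
    (hf : ∀ y ∈ ball x r, DifferentiableAt ℂ f y) (hb : ∀ y ∈ ball x r, ‖f y‖ ≤ C) :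
    ‖fderiv ℂ f x‖ ≤ 2 * C / r := by
  refine ContinuousLinearMap.opNorm_le_bound _ (by positivity) fun v => ?_
  rcases eq_or_ne v 0 with rfl | hv
  · simp
  have hv' := norm_pos_iff.2 hv
  set s := r / (2 * ‖v‖) with hs
  have hs0 : 0 < s := by positivity
  have hmem : ∀ t ∈ closedBall (0 : ℂ) s, x + t • v ∈ ball x r := fun t ht => by
    rw [mem_closedBall_zero_iff] at ht
    rw [mem_ball, dist_eq_norm, add_sub_cancel_left, norm_smul]
    calc ‖t‖ * ‖v‖ ≤ s * ‖v‖ := by gcongr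
      _ = r / 2 := by rw [hs]; field_simp
      _ < r := by linarith
  have hd : ∀ t ∈ closedBall (0 : ℂ) s, DifferentiableAt ℂ (fun t : ℂ => f (x + t • v)) t :=
    fun t ht => (hf _ (hmem t ht)).comp t (by fun_prop)
  have h1 := Complex.norm_deriv_le_of_forall_mem_sphere_norm_le (c := (0 : ℂ)) hs0
    (f := fun t : ℂ => f (x + t • v)) (C := C)
    ⟨fun t ht => (hd t (ball_subset_closedBall ht)).differentiableWithinAt, by
      rw [closure_ball _ hs0.ne']
      exact fun t ht => (hd t ht).continuousAt.continuousWithinAt⟩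
    fun t ht => hb _ (hmem t (sphere_subset_closedBall ht))
  have h2 : deriv (fun t : ℂ => f (x + t • v)) 0 = fderiv ℂ f x v := by
    have h3 : HasFDerivAt f (fderiv ℂ f x) (x + (0 : ℂ) • v) := by
      simpa using (hf x (mem_ball_self hr)).hasFDerivAt
    have h4 : HasDerivAt (fun t : ℂ => x + t • v) v 0 := by
      simpa using ((hasDerivAt_id (0 : ℂ)).smul_const v).const_add x
    exact (h3.comp_hasDerivAt (0 : ℂ) h4).deriv
  rw [h2] at h1
  refine h1.trans (le_of_eq ?_)
  rw [hs]
  field_simp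

theorem exists_lipschitz_fderiv {f : E → F} {β : Set E} (hβ : IsOpen β)
    (hf : DifferentiableOn ℂ f β) {x₀ : E} (hx₀ : x₀ ∈ β) :
    ∃ r > 0, ∃ C ≥ 0, ball x₀ r ⊆ β ∧ (∀ x ∈ ball x₀ r, ∀ y ∈ ball x₀ r,
      ‖fderiv ℂ f x - fderiv ℂ f y‖ ≤ C * ‖x - y‖) := by
  have hd : ∀ x ∈ β, DifferentiableAt ℂ f x := fun x hx => (hf x hx).differentiableAt (hβ.mem_nhds hx)
  have hbd : ∀ᶠ x in 𝓝 x₀, ‖f x‖ ≤ ‖f x₀‖ + 1 := by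
    have := (hd x₀ hx₀).continuousAt.norm.eventually_lt continuousAt_const (show ‖f x₀‖ < ‖f x₀‖ + 1 by simp)
    exact this.mono fun x hx => hx.le
  obtain ⟨R, hR, hRs⟩ := Metric.mem_nhds_iff.1 (Filter.inter_mem (hβ.mem_nhds hx₀) hbd)
  set M := ‖f x₀‖ + 1 with hM
  have hM0 : 0 ≤ M := by positivity
  have hb1 : ∀ x ∈ ball x₀ (R / 2), ‖fderiv ℂ f x‖ ≤ 2 * M / (R / 2) := fun x hx => by
    have hsub : ball x (R / 2) ⊆ ball x₀ R := ball_subset_ball' (by rw [mem_ball] at hx; linarith)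
    exact norm_fderiv_le_of_ball (by positivity) hM0 (fun y hy => hd y (hRs (hsub hy)).1)
      fun y hy => (hRs (hsub hy)).2
  have hlip : ∀ x ∈ ball x₀ (R / 2), ∀ y ∈ ball x₀ (R / 2), ‖f y - f x‖ ≤ 2 * M / (R / 2) * ‖y - x‖ :=
    fun x hx y hy => (convex_ball x₀ (R / 2)).norm_image_sub_le_of_norm_fderiv_le (𝕜 := ℂ)
      (fun z hz => hd z (hRs (ball_subset_ball (by linarith) hz)).1) hb1 hx hy
  refine ⟨R / 8, by positivity, 2 * (2 * M / (R / 2)) / (R / 4), by positivity,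
    fun x hx => (hRs (ball_subset_ball (by linarith) hx)).1, fun x hx y hy => ?_⟩
  have hsub : ∀ z ∈ ball y (R / 4), z ∈ ball x₀ (R / 2) ∧ z + (x - y) ∈ ball x₀ (R / 2) := fun z hz => by
    rw [mem_ball, dist_eq_norm] at *
    constructor
    · calc ‖z - x₀‖ = ‖(z - y) + (y - x₀)‖ := by congr 1; abel
        _ ≤ ‖z - y‖ + ‖y - x₀‖ := norm_add_le _ _
        _ < _ := by linarith
    · rw [mem_ball, dist_eq_norm]
      calc ‖z + (x - y) - x₀‖ = ‖(z - y) + (x - x₀)‖ := by congr 1; abel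
        _ ≤ ‖z - y‖ + ‖x - x₀‖ := norm_add_le _ _
        _ < _ := by linarith
  have hsubd : ∀ z ∈ ball x₀ (R / 2), DifferentiableAt ℂ f z := fun z hz =>
    hd z (hRs (ball_subset_ball (by linarith) hz)).1
  have hd1 : ∀ z ∈ ball y (R / 4), DifferentiableAt ℂ (fun z => f (z + (x - y))) z := fun z hz =>
    (hsubd _ (hsub z hz).2).comp z (by fun_prop)
  have h1 := norm_fderiv_le_of_ball (f := fun z => f (z + (x - y)) - f z) (x := y) (r := R / 4)
    (C := 2 * M / (R / 2) * ‖x - y‖) (by positivity) (by positivity)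
    (fun z hz => (hd1 z hz).sub (hsubd _ (hsub z hz).1))
    fun z hz => by simpa using hlip z (hsub z hz).1 _ (hsub z hz).2
  have hyy := mem_ball_self (x := y) (show 0 < R / 4 by positivity)
  have h2 : fderiv ℂ (fun z => f (z + (x - y)) - f z) y = fderiv ℂ f x - fderiv ℂ f y := by
    rw [fderiv_fun_sub (hd1 y hyy) (hsubd y (hsub y hyy).1), fderiv_comp_add_right]
    simp
  rw [h2] at h1
  refine h1.trans (le_of_eq ?_)
  ring

theorem norm_sub_sub_fderiv_le {f : E → F} {x₀ : E} {r C : ℝ} (hC : 0 ≤ C)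
    (hd : ∀ x ∈ ball x₀ r, DifferentiableAt ℂ f x)
    (h : ∀ x ∈ ball x₀ r, ∀ y ∈ ball x₀ r, ‖fderiv ℂ f x - fderiv ℂ f y‖ ≤ C * ‖x - y‖)
    {x y y' : E} (hx : x ∈ ball x₀ r) (hy : y ∈ ball x₀ r) (hy' : y' ∈ ball x₀ r) {δ : ℝ}
    (hyx : ‖y - x‖ ≤ δ) (hyx' : ‖y' - x‖ ≤ δ) :
    ‖f y - f y' - fderiv ℂ f x (y - y')‖ ≤ C * δ * ‖y - y'‖ := by
  have hconv : Convex ℝ (ball x₀ r ∩ closedBall x δ) := (convex_ball x₀ r).inter (convex_closedBall x δ)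
  refine hconv.norm_image_sub_le_of_norm_hasFDerivWithin_le' (𝕜 := ℂ) (f' := fun z => fderiv ℂ f z)
    (fun z hz => (hd z hz.1).hasFDerivAt.hasFDerivWithinAt) (fun z hz => ?_)
    ⟨hy', by rwa [mem_closedBall, dist_eq_norm]⟩ ⟨hy, by rwa [mem_closedBall, dist_eq_norm]⟩
  refine (h z hz.1 x hx).trans ?_
  have := hz.2
  rw [mem_closedBall, dist_eq_norm] at this
  gcongr

theorem hasStrictFDerivAt_of_differentiableOn {f : E → F} {β : Set E} (hβ : IsOpen β)
    (hf : DifferentiableOn ℂ f β) {x₀ : E} (hx₀ : x₀ ∈ β) :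
    HasStrictFDerivAt f (fderiv ℂ f x₀) x₀ := by
  obtain ⟨r, hr, C, hC, hsub, h⟩ := exists_lipschitz_fderiv hβ hf hx₀
  refine hasStrictFDerivAt_of_hasFDerivAt_of_continuousAt (f' := fun x => fderiv ℂ f x) ?_ ?_
  · filter_upwards [hβ.mem_nhds hx₀] with x hx using ((hf x hx).differentiableAt (hβ.mem_nhds hx)).hasFDerivAt
  · have h1 : Tendsto (fun x => C * ‖x - x₀‖) (𝓝 x₀) (𝓝 0) := by
      have : Continuous fun x => C * ‖x - x₀‖ := by fun_prop
      simpa using this.tendsto x₀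
    rw [ContinuousAt, tendsto_iff_norm_sub_tendsto_zero]
    refine squeeze_zero' (Eventually.of_forall fun _ => norm_nonneg _) ?_ h1
    filter_upwards [ball_mem_nhds x₀ hr] with x hx using h x hx x₀ (mem_ball_self hr)

end Holomorphic

section Graphs
variable {E Y : Type*} [NormedAddCommGroup E] [NormedSpace ℂ E] [NormedAddCommGroup Y]
  [NormedSpace ℂ Y]

/-- In the open set `W`, the set `M` is the image of the holomorphic section `g` (defined on the
open set `β`) of the linear projection `π`. -/
structure IsGraph (M W : Set Y) (π : Y →L[ℂ] E) (g : E → Y) (β : Set E) : Prop where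
  isOpen_W : IsOpen W
  isOpen_β : IsOpen β
  diff : DifferentiableOn ℂ g β
  proj : ∀ x ∈ β, π (g x) = x
  eq : M ∩ W = g '' β

variable (E) in
/-- `M` is a holomorphic graph over `E` near `p`. -/
def Good (M : Set Y) (p : Y) : Prop :=
  ∃ (π : Y →L[ℂ] E) (W : Set Y) (g : E → Y) (β : Set E), p ∈ W ∧ IsGraph M W π g β

variable {M W : Set Y} {π : Y →L[ℂ] E} {g : E → Y} {β : Set E}

theorem IsGraph.proj_mem (h : IsGraph M W π g β) {q : Y} (hq : q ∈ M) (hqW : q ∈ W) : π q ∈ β := by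
  obtain ⟨x, hx, rfl⟩ : q ∈ g '' β := h.eq ▸ mem_inter hq hqW
  rwa [h.proj x hx]

theorem IsGraph.apply_proj (h : IsGraph M W π g β) {q : Y} (hq : q ∈ M) (hqW : q ∈ W) :
    g (π q) = q := by
  obtain ⟨x, hx, rfl⟩ : q ∈ g '' β := h.eq ▸ mem_inter hq hqW
  rw [h.proj x hx]

theorem IsGraph.mem (h : IsGraph M W π g β) {x : E} (hx : x ∈ β) : g x ∈ M ∧ g x ∈ W := by
  have : g x ∈ M ∩ W := h.eq ▸ mem_image_of_mem g hx
  exact this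

theorem IsGraph.hasStrictFDerivAt (h : IsGraph M W π g β) {x : E} (hx : x ∈ β) :
    HasStrictFDerivAt g (fderiv ℂ g x) x :=
  hasStrictFDerivAt_of_differentiableOn h.isOpen_β h.diff hx

theorem IsGraph.proj_fderiv (h : IsGraph M W π g β) {x : E} (hx : x ∈ β) (v : E) :
    π (fderiv ℂ g x v) = v := by
  have h1 : HasFDerivAt (fun x => π (g x)) (π.comp (fderiv ℂ g x)) x :=
    π.hasFDerivAt.comp x (h.hasStrictFDerivAt hx).hasFDerivAt
  have h2 : HasFDerivAt (fun x => π (g x)) (ContinuousLinearMap.id ℂ E) x :=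
    (hasFDerivAt_id x).congr_of_eventuallyEq (by
      filter_upwards [h.isOpen_β.mem_nhds hx] with y hy using h.proj y hy)
  exact DFunLike.congr_fun (h1.unique h2) v

/-- Changing from one graph representation to another has invertible derivative. -/
theorem IsGraph.injective_proj_fderiv (h : IsGraph M W π g β) {W' : Set Y} {π' : Y →L[ℂ] E}
    {g' : E → Y} {β' : Set E} (h' : IsGraph M W' π' g' β') {q : Y} (hq : q ∈ M) (hqW : q ∈ W)
    (hqW' : q ∈ W') : Function.Injective (π'.comp (fderiv ℂ g (π q))) := by
  have hx := h.proj_mem hq hqW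
  have hx' := h'.proj_mem hq hqW'
  have hgd := (h.hasStrictFDerivAt hx).hasFDerivAt
  have hq' := h.apply_proj hq hqW
  have hgd' : HasFDerivAt g' (fderiv ℂ g' (π' q)) (π' (g (π q))) := by
    rw [hq']; exact (h'.hasStrictFDerivAt hx').hasFDerivAt
  have h1 : HasFDerivAt (fun x => g' (π' (g x)))
      ((fderiv ℂ g' (π' q)).comp (π'.comp (fderiv ℂ g (π q)))) (π q) :=
    hgd'.comp (π q) (π'.hasFDerivAt.comp (π q) hgd)
  have h2 : HasFDerivAt (fun x => g' (π' (g x))) (fderiv ℂ g (π q)) (π q) := by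
    refine hgd.congr_of_eventuallyEq ?_
    have : ∀ᶠ x in 𝓝 (π q), g x ∈ W' := hgd.continuousAt.eventually
      (by rw [hq']; exact h'.isOpen_W.mem_nhds hqW')
    filter_upwards [this, h.isOpen_β.mem_nhds hx] with x hxW hxβ
    exact h'.apply_proj (h.mem hxβ).1 hxW
  have h3 := h1.unique h2
  intro v w hvw
  have h4 := DFunLike.congr_fun h3 v
  have h5 := DFunLike.congr_fun h3 w
  have h6 : fderiv ℂ g (π q) v = fderiv ℂ g (π q) w := by
    rw [← h4, ← h5]
    exact congrArg (fderiv ℂ g' (π' q)) hvw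
  rw [← h.proj_fderiv hx v, ← h.proj_fderiv hx w, h6]

end Graphs

section ZeroOfDegree
variable {E : Type*} [NormedAddCommGroup E] [InnerProductSpace ℝ E] [FiniteDimensional ℝ E]
  [MeasurableSpace E] [BorelSpace E] [Nontrivial E]

theorem HasDeg.exists_zero {F : E → E} (hF : Continuous F) {V : Set E} (hV : IsOpen V)
    (hVb : Bornology.IsBounded V) {d : ℝ} (h : HasDeg F V d) (hd : d ≠ 0) : ∃ x ∈ V, F x = 0 := by
  by_contra! hcon
  obtain ⟨K, η, hK, hKV, hη, hKη, -⟩ := id h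
  obtain ⟨η', hη', hη'K⟩ := exists_pos_le_norm_of_isCompact hK hF.continuousOn fun x hx => hcon x (hKV hx)
  have h0 := HasDeg.sum (ι := Unit) hF hV hVb ∅ (W := fun _ => ∅) (K := fun _ => ∅) (d := fun _ => 0)
    (by simp) (by simp) (by simp) (by simp) (by simp) (show 0 < min η η' by positivity)
    (fun x hx _ => by
      by_cases hxK : x ∈ K
      · exact (min_le_right _ _).trans (hη'K x hxK)
      · exact (min_le_left _ _).trans (hKη x hx hxK)) (by simp)
  exact hd (by simpa using h.unique hF hV hVb h0)

/-- Additivity of the degree over the fibre of a map all of whose local degrees equal `D`. -/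
theorem HasDeg.card_mul {F : E → E} (hF : Continuous F) {ζ₀ z : E} {r : ℝ}
    {d : ℝ} (h : HasDeg (fun x => F x - z) (ball ζ₀ r) d) {D : ℝ}
    (hZ : ∀ ζ ∈ closedBall ζ₀ r, F ζ = z → ζ ∈ ball ζ₀ r ∧ LocDeg F ζ D) :
    ∃ hfin : {ζ ∈ closedBall ζ₀ r | F ζ = z}.Finite, d = hfin.toFinset.card * D := by
  set Z := {ζ ∈ closedBall ζ₀ r | F ζ = z} with hZdef
  have hZc : IsCompact Z := (isCompact_closedBall ζ₀ r).inter_right (isClosed_eq hF continuous_const)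
  have hfin : Z.Finite := by
    have hsh : ∀ ζ ∈ Z, ∃ ρ > 0, InjOn F (closedBall ζ ρ) := fun ζ hζ => by
      obtain ⟨ρ, hρ, hinj, -⟩ := (hZ ζ hζ.1 hζ.2).2
      exact ⟨ρ, hρ, hinj⟩
    choose! ρ hρ hinj using hsh
    obtain ⟨t, hZt⟩ := hZc.elim_nhds_subcover' (fun x _ => closedBall x (ρ x))
      fun x hx => closedBall_mem_nhds x (hρ x hx)
    refine (t.finite_toSet.image Subtype.val).subset fun y hy => ?_
    have hy' := hZt hy
    simp only [mem_iUnion] at hy'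
    obtain ⟨x, hxt, hyx⟩ := hy'
    exact ⟨x, hxt, hinj x.1 x.2 (mem_closedBall_self (hρ _ x.2).le) hyx (x.2.2.trans hy.2.symm)⟩
  refine ⟨hfin, ?_⟩
  obtain ⟨S, hS, hSd⟩ := hfin.t2_separation
  have hball : ∀ x ∈ Z, ∃ ρ > 0, closedBall x ρ ⊆ S x ∩ ball ζ₀ r ∧
      HasDeg (fun y => F y - z) (ball x ρ) D := fun x hx => by
    obtain ⟨ρ₁, hρ₁, h1⟩ := Metric.nhds_basis_closedBall.mem_iff.1
      (((hS x).2.inter isOpen_ball).mem_nhds ⟨(hS x).1, (hZ x hx.1 hx.2).1⟩)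
    obtain ⟨ρ₀, hρ₀, h0⟩ := (hZ x hx.1 hx.2).2.shrink hF
    refine ⟨min ρ₀ ρ₁, lt_min hρ₀ hρ₁, (closedBall_subset_closedBall (min_le_right _ _)).trans h1, ?_⟩
    have := (h0 _ (lt_min hρ₀ hρ₁) (min_le_left _ _)).2
    rwa [hx.2] at this
  choose! ρ hρ hρs hρd using hball
  have hmem : ∀ x ∈ hfin.toFinset, x ∈ Z := fun x hx => hfin.mem_toFinset.1 hx
  obtain ⟨η, hη, hη'⟩ := exists_pos_le_norm_of_isCompact (f := fun y => F y - z)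
    ((isCompact_closedBall ζ₀ r).diff (isOpen_biUnion (s := Z) (f := fun x => ball x (ρ x / 2))
      fun _ _ => isOpen_ball)) (by fun_prop) fun y hy h0 => hy.2 (mem_iUnion₂.2
        ⟨y, ⟨hy.1, sub_eq_zero.1 h0⟩, mem_ball_self (by
          have := hρ y ⟨hy.1, sub_eq_zero.1 h0⟩
          positivity)⟩)
  have hsum := HasDeg.sum (hF.sub continuous_const) isOpen_ball isBounded_ball hfin.toFinset
    (W := fun x => ball x (ρ x)) (K := fun x => closedBall x (ρ x / 2)) (fun _ _ => isOpen_ball)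
    (fun x hx => ball_subset_closedBall.trans ((hρs x (hmem x hx)).trans inter_subset_right))
    (fun x hx y hy hxy => (hSd (by simpa using hx) (by simpa using hy) hxy).mono
      (ball_subset_closedBall.trans ((hρs x (by simpa using hx)).trans inter_subset_left))
      (ball_subset_closedBall.trans ((hρs y (by simpa using hy)).trans inter_subset_left)))
    (fun x _ => isCompact_closedBall _ _)
    (fun x hx => closedBall_subset_ball (by linarith [hρ x (hmem x hx)])) hη
    (fun y hy hyU => hη' y ⟨ball_subset_closedBall hy, fun hh => hyU (by
      simp only [mem_iUnion] at hh ⊢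
      obtain ⟨x, hx, hyx⟩ := hh
      exact ⟨x, hfin.mem_toFinset.2 hx, ball_subset_closedBall hyx⟩)⟩)
    (d := fun _ => D) (fun x hx => hρd x (hmem x hx))
  rw [h.unique (hF.sub continuous_const) isOpen_ball isBounded_ball hsum]
  simp

end ZeroOfDegree

section Param
attribute [local instance] InnerProductSpace.complexToReal
variable {E Y : Type*} [NormedAddCommGroup E] [InnerProductSpace ℂ E] [FiniteDimensional ℂ E]
  [MeasurableSpace E] [BorelSpace E] [NormedAddCommGroup Y] [NormedSpace ℂ Y]
  {M : Set Y} {h : E → Y} {ζ₀ : E} {r : ℝ}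

/-- `κ` restricts to a local biholomorphism of `M` near `q`. -/
def RegularOn (M : Set Y) (κ : Y → E) (q : Y) : Prop :=
  ∃ (π : Y →L[ℂ] E) (W : Set Y) (g : E → Y) (β : Set E), q ∈ W ∧ IsGraph M W π g β ∧
    Function.Injective ((fderiv ℂ κ q).comp (fderiv ℂ g (π q)))

theorem locDeg_of_regularOn [Nontrivial E] (hc : Continuous h) (hM : ∀ ζ ∈ closedBall ζ₀ r, h ζ ∈ M)
    {ζ : E} (hζ : ζ ∈ ball ζ₀ r) {π : Y →L[ℂ] E} {W : Set Y} {g : E → Y} {β : Set E}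
    (hG : IsGraph M W π g β) (hW : h ζ ∈ W) {d : ℝ} (hd : LocDeg (fun x => π (h x)) ζ d)
    {κ : Y → E} (hκ : Differentiable ℂ κ)
    (hinj : Function.Injective ((fderiv ℂ κ (h ζ)).comp (fderiv ℂ g (π (h ζ))))) :
    LocDeg (fun x => κ (h x)) ζ d := by
  have hζM := hM ζ (ball_subset_closedBall hζ)
  have hx := hG.proj_mem hζM hW
  have hq := hG.apply_proj hζM hW
  have hκs : HasStrictFDerivAt κ (fderiv ℂ κ (h ζ)) (g (π (h ζ))) := by
    rw [hq]
    exact hasStrictFDerivAt_of_differentiableOn isOpen_univ hκ.differentiableOn (mem_univ _)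
  refine LocDeg.comp (θ := fun x => π (h x)) (H := fun x => κ (g x)) (π.continuous.comp hc)
    (hκ.continuous.comp hc) hd (hκs.comp (π (h ζ)) (hG.hasStrictFDerivAt hx)) hinj ?_
  filter_upwards [hc.continuousAt.eventually (hG.isOpen_W.mem_nhds hW), isOpen_ball.mem_nhds hζ] with x hxW hxb
  simp only [Function.comp_apply, hG.apply_proj (hM x (ball_subset_closedBall hxb)) hxW]

theorem exists_common_locDeg [Nontrivial E] (hc : Continuous h) (hi : InjOn h (closedBall ζ₀ r))
    (hM : ∀ ζ ∈ closedBall ζ₀ r, h ζ ∈ M) (hgood : ∀ ζ ∈ closedBall ζ₀ r, Good E M (h ζ)) (hr : 0 < r) :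
    ∃ D : ℤ, ∀ ζ ∈ ball ζ₀ r, ∀ κ : Y → E, Differentiable ℂ κ → RegularOn M κ (h ζ) →
      LocDeg (fun x => κ (h x)) ζ D := by
  have hdiff : ∀ (π : Y →L[ℂ] E) (q : Y), fderiv ℂ π q = π := fun π q => π.fderiv
  have hP : ∀ ζ ∈ ball ζ₀ r, ∃ m : ℤ, ∀ (π : Y →L[ℂ] E) (W : Set Y) (g : E → Y) (β : Set E),
      h ζ ∈ W → IsGraph M W π g β → LocDeg (fun x => π (h x)) ζ m := by
    intro ζ hζ
    obtain ⟨π, W, g, β, hW, hG⟩ := hgood ζ (ball_subset_closedBall hζ)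
    obtain ⟨ρ, hρ, hρs⟩ := Metric.nhds_basis_closedBall.mem_iff.1
      (Filter.inter_mem (hc.continuousAt.preimage_mem_nhds (hG.isOpen_W.mem_nhds hW)) (isOpen_ball.mem_nhds hζ))
    obtain ⟨m, hm⟩ := exists_int_locDeg (F := fun x => π (h x)) (π.continuous.comp hc) hρ
      fun x hx y hy hxy => by
        have hxb := ball_subset_closedBall (hρs hx).2
        have hyb := ball_subset_closedBall (hρs hy).2
        apply hi hxb hyb
        rw [← hG.apply_proj (hM x hxb) (hρs hx).1, ← hG.apply_proj (hM y hyb) (hρs hy).1]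
        exact congrArg g hxy
    refine ⟨m, fun π' W' g' β' hW' hG' => ?_⟩
    refine locDeg_of_regularOn hc hM hζ hG hW hm π'.differentiable ?_
    rw [hdiff]
    exact hG.injective_proj_fderiv hG' (hM ζ (ball_subset_closedBall hζ)) hW hW'
  choose! m hm using hP
  have hloc : ∀ ζ ∈ ball ζ₀ r, ∀ᶠ ζ' in 𝓝 ζ, m ζ' = m ζ := by
    intro ζ hζ
    obtain ⟨π, W, g, β, hW, hG⟩ := hgood ζ (ball_subset_closedBall hζ)
    have h1 := (hm ζ hζ π W g β hW hG).eventually (F := fun x => π (h x)) (π.continuous.comp hc)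
    filter_upwards [h1, hc.continuousAt.eventually (hG.isOpen_W.mem_nhds hW), isOpen_ball.mem_nhds hζ]
      with ζ' h1 h2 h3
    exact_mod_cast (hm ζ' h3 π W g β h2 hG).unique (π.continuous.comp hc) h1
  have hcont : ContinuousOn m (ball ζ₀ r) := fun ζ hζ =>
    (continuousAt_const.congr (f := fun _ => m ζ) ((hloc ζ hζ).mono fun _ h => h.symm)).continuousWithinAt
  refine ⟨m ζ₀, fun ζ hζ κ hκ ⟨π, W, g, β, hW, hG, hinj⟩ => ?_⟩
  have hpre : IsPreconnected (ball ζ₀ r) := (convex_ball ζ₀ r).isPreconnected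
  rw [hpre.constant hcont (mem_ball_self hr) hζ]
  exact locDeg_of_regularOn hc hM hζ hG hW (hm ζ hζ π W g β hW hG) hκ hinj

theorem volume_image_singular_eq_zero (hc : Continuous h)
    (hM : ∀ ζ ∈ closedBall ζ₀ r, h ζ ∈ M) (hgood : ∀ ζ ∈ closedBall ζ₀ r, Good E M (h ζ))
    {κ : Y → E} (hκ : Differentiable ℂ κ) :
    volume ((fun x => κ (h x)) '' {ζ ∈ closedBall ζ₀ r | ¬ RegularOn M κ (h ζ)}) = 0 := by
  suffices H : volume ((fun x => κ (h x)) '' (closedBall ζ₀ r ∩ {ζ | ζ ∈ closedBall ζ₀ r ∧ ¬ RegularOn M κ (h ζ)})) = 0 by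
    have hsub : {ζ ∈ closedBall ζ₀ r | ¬ RegularOn M κ (h ζ)} ⊆
        closedBall ζ₀ r ∩ {ζ | ζ ∈ closedBall ζ₀ r ∧ ¬ RegularOn M κ (h ζ)} := fun x hx => ⟨hx.1, hx⟩
    exact measure_mono_null (image_mono hsub) H
  refine (isCompact_closedBall ζ₀ r).induction_on
    (p := fun s => volume ((fun x => κ (h x)) '' (s ∩ {ζ | ζ ∈ closedBall ζ₀ r ∧ ¬ RegularOn M κ (h ζ)})) = 0)
    (by simp) (fun s t hst ht => measure_mono_null (image_mono (inter_subset_inter_left _ hst)) ht)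
    (fun s t hs ht => by
      rw [union_inter_distrib_right, image_union]
      exact measure_union_null hs ht) fun ζ hζ => ?_
  obtain ⟨π, W, g, β, hW, hG⟩ := hgood ζ hζ
  refine ⟨_, mem_nhdsWithin_of_mem_nhds (hc.continuousAt.preimage_mem_nhds (hG.isOpen_W.mem_nhds hW)), ?_⟩
  set S : Set E := {x | x ∈ β ∧ ¬ Function.Injective ((fderiv ℂ κ (g x)).comp (fderiv ℂ g x))} with hS
  have h1 : volume ((fun x => κ (g x)) '' S) = 0 := by
    refine addHaar_image_eq_zero_of_det_fderivWithin_eq_zero volume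
      (f' := fun x => ((fderiv ℂ κ (g x)).comp (fderiv ℂ g x)).restrictScalars ℝ) (fun x hx => ?_)
      fun x hx => ?_
    · have h2 : HasFDerivAt (fun x => κ (g x)) ((fderiv ℂ κ (g x)).comp (fderiv ℂ g x)) x :=
        (hκ (g x)).hasFDerivAt.comp x (hG.hasStrictFDerivAt hx.1).hasFDerivAt
      exact (h2.restrictScalars ℝ).hasFDerivWithinAt
    · by_contra hdet
      exact hx.2 (LinearMap.equivOfDetNeZero _ hdet).injective
  refine measure_mono_null ?_ h1
  rintro _ ⟨ζ', ⟨hW', hb, hreg⟩, rfl⟩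
  have hq := hG.apply_proj (hM ζ' hb) hW'
  refine ⟨π (h ζ'), ⟨hG.proj_mem (hM ζ' hb) hW', fun hinj => hreg ⟨π, W, g, β, hW', hG, ?_⟩⟩, by
    simp only [hq]⟩
  rwa [hq] at hinj

theorem injective_smul_add_of_not_hasEigenvalue (A : E →L[ℂ] E) {s : ℂ}
    (hs : ¬ Module.End.HasEigenvalue (A : E →ₗ[ℂ] E) (-s)) :
    Function.Injective (fun v => A v + s • v) := by
  intro v w hvw
  by_contra hne
  apply hs
  apply Module.End.hasEigenvalue_of_hasEigenvector (x := v - w)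
  refine ⟨Module.End.mem_eigenspace_iff.2 ?_, sub_ne_zero.2 hne⟩
  show A (v - w) = _
  rw [map_sub]
  simp only at hvw
  have h1 : A v - A w + s • (v - w) = 0 := by
    rw [smul_sub, sub_add_sub_comm, hvw, sub_self]
  rw [eq_neg_of_add_eq_zero_left h1, neg_smul]

theorem exists_regular_perturbation (hc : Continuous h)
    {f : Y → E} (hf : Differentiable ℂ f) {q₁ q₂ : Y} (hq : q₁ ≠ q₂) (hq₁ : q₁ ∈ M) (hq₂ : q₂ ∈ M)
    (h₁ : Good E M q₁) (h₂ : Good E M q₂) {ε : ℝ} (hε : 0 < ε) :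
    ∃ κ : Y → E, Differentiable ℂ κ ∧ κ q₁ = f q₁ ∧ κ q₂ = f q₂ ∧ RegularOn M κ q₁ ∧ RegularOn M κ q₂ ∧
      ∀ ζ ∈ closedBall ζ₀ r, ‖κ (h ζ) - f (h ζ)‖ ≤ ε := by
  obtain ⟨π₁, W₁, g₁, β₁, hW₁, hG₁⟩ := h₁
  obtain ⟨π₂, W₂, g₂, β₂, hW₂, hG₂⟩ := h₂
  obtain ⟨l, hl⟩ : ∃ l : Y →L[ℂ] ℂ, l (q₁ - q₂) = 1 := by
    obtain ⟨l, hl⟩ := SeparatingDual.exists_ne_zero (R := ℂ) (sub_ne_zero.2 hq)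
    exact ⟨(l (q₁ - q₂))⁻¹ • l, by
      rw [ContinuousLinearMap.smul_apply, smul_eq_mul, inv_mul_cancel₀ hl]⟩
  set Ψ : Y → E := fun x => (l (x - q₂)) ^ 2 • π₁ (x - q₁) + (l (x - q₁)) ^ 2 • π₂ (x - q₂) with hΨ
  have hΨd : Differentiable ℂ Ψ := by fun_prop
  have hl' : l (q₂ - q₁) = -1 := by rw [← neg_sub, map_neg, hl]
  have hd1 : HasFDerivAt Ψ π₁ q₁ := by
    have a1 : HasFDerivAt (fun x : Y => l (x - q₂)) l q₁ := l.hasFDerivAt.comp q₁ ((hasFDerivAt_id q₁).sub_const q₂)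
    have a2 : HasFDerivAt (fun x : Y => l (x - q₁)) l q₁ := l.hasFDerivAt.comp q₁ ((hasFDerivAt_id q₁).sub_const q₁)
    have a3 : HasFDerivAt (fun x : Y => π₁ (x - q₁)) π₁ q₁ := π₁.hasFDerivAt.comp q₁ ((hasFDerivAt_id q₁).sub_const q₁)
    have a4 : HasFDerivAt (fun x : Y => π₂ (x - q₂)) π₂ q₁ := π₂.hasFDerivAt.comp q₁ ((hasFDerivAt_id q₁).sub_const q₂)
    have := ((a1.pow 2).smul a3).add ((a2.pow 2).smul a4)
    refine this.congr_fderiv ?_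
    ext v
    simp [hl]
  have hd2 : HasFDerivAt Ψ π₂ q₂ := by
    have a1 : HasFDerivAt (fun x : Y => l (x - q₂)) l q₂ := l.hasFDerivAt.comp q₂ ((hasFDerivAt_id q₂).sub_const q₂)
    have a2 : HasFDerivAt (fun x : Y => l (x - q₁)) l q₂ := l.hasFDerivAt.comp q₂ ((hasFDerivAt_id q₂).sub_const q₁)
    have a3 : HasFDerivAt (fun x : Y => π₁ (x - q₁)) π₁ q₂ := π₁.hasFDerivAt.comp q₂ ((hasFDerivAt_id q₂).sub_const q₁)
    have a4 : HasFDerivAt (fun x : Y => π₂ (x - q₂)) π₂ q₂ := π₂.hasFDerivAt.comp q₂ ((hasFDerivAt_id q₂).sub_const q₂)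
    have := ((a1.pow 2).smul a3).add ((a2.pow 2).smul a4)
    refine this.congr_fderiv ?_
    ext v
    simp [hl']
  obtain ⟨C, hC⟩ := (isCompact_closedBall ζ₀ r).exists_bound_of_continuousOn
    (hΨd.continuous.comp hc).continuousOn
  set C' := max C 1 with hC'
  have hC'0 : 0 < C' := by positivity
  set A₁ : E →L[ℂ] E := (fderiv ℂ f q₁).comp (fderiv ℂ g₁ (π₁ q₁))
  set A₂ : E →L[ℂ] E := (fderiv ℂ f q₂).comp (fderiv ℂ g₂ (π₂ q₂))
  have hfin : ∀ A : E →L[ℂ] E, {s : ℂ | Module.End.HasEigenvalue (A : E →ₗ[ℂ] E) (-s)}.Finite := fun A =>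
    Set.Finite.preimage neg_injective.injOn (Module.End.finite_hasEigenvalue (A : E →ₗ[ℂ] E))
  obtain ⟨s, hs, hsb⟩ := ((infinite_of_mem_nhds (0 : ℂ) (ball_mem_nhds 0 (show 0 < ε / C' by positivity))).diff
    ((hfin A₁).union (hfin A₂))).nonempty
  rw [mem_union, not_or] at hsb
  rw [mem_ball_zero_iff, lt_div_iff₀ hC'0] at hs
  have hκ1 : HasFDerivAt (fun x => f x + s • Ψ x) (fderiv ℂ f q₁ + s • π₁) q₁ :=
    (hf q₁).hasFDerivAt.add (hd1.const_smul s)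
  have hκ2 : HasFDerivAt (fun x => f x + s • Ψ x) (fderiv ℂ f q₂ + s • π₂) q₂ :=
    (hf q₂).hasFDerivAt.add (hd2.const_smul s)
  refine ⟨fun x => f x + s • Ψ x, by fun_prop, by simp [hΨ], by simp [hΨ],
    ⟨π₁, W₁, g₁, β₁, hW₁, hG₁, ?_⟩, ⟨π₂, W₂, g₂, β₂, hW₂, hG₂, ?_⟩, fun ζ hζ => ?_⟩
  · rw [hκ1.fderiv]
    convert injective_smul_add_of_not_hasEigenvalue A₁ hsb.1 using 1
    funext v
    simp [A₁, hG₁.proj_fderiv (hG₁.proj_mem hq₁ hW₁)]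
  · rw [hκ2.fderiv]
    convert injective_smul_add_of_not_hasEigenvalue A₂ hsb.2 using 1
    funext v
    simp [A₂, hG₂.proj_fderiv (hG₂.proj_mem hq₂ hW₂)]
  · rw [add_sub_cancel_left, norm_smul]
    have h1 : ‖Ψ (h ζ)‖ ≤ C' := (hC ζ hζ).trans (le_max_left _ _)
    exact (mul_le_mul_of_nonneg_left h1 (norm_nonneg s)).trans hs.le

theorem injOn_comp_of_near_id [Nontrivial E] (hc : Continuous h) (hi : InjOn h (closedBall ζ₀ r))
    (hM : ∀ ζ ∈ closedBall ζ₀ r, h ζ ∈ M) (hgood : ∀ ζ ∈ closedBall ζ₀ r, Good E M (h ζ)) (hr : 0 < r)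
    {f : Y → E} (hf : Differentiable ℂ f) (hfh : ∀ ζ ∈ closedBall ζ₀ r, ‖f (h ζ) - ζ‖ ≤ r / 10) :
    InjOn (fun ζ => f (h ζ)) (ball ζ₀ (r / 2)) := by
  intro ζ₁ h₁ ζ₂ h₂ heq
  by_contra hne
  have hsubb : ball ζ₀ (r / 2) ⊆ ball ζ₀ r := ball_subset_ball (by linarith)
  have hb₁ := ball_subset_closedBall (hsubb h₁)
  have hb₂ := ball_subset_closedBall (hsubb h₂)
  obtain ⟨D, hD⟩ := exists_common_locDeg hc hi hM hgood hr
  obtain ⟨κ, hκ, hκ₁, hκ₂, hr₁, hr₂, hκf⟩ := exists_regular_perturbation (ζ₀ := ζ₀) (r := r) hc hf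
    (fun h => hne (hi hb₁ hb₂ h)) (hM _ hb₁) (hM _ hb₂)
    (hgood _ hb₁) (hgood _ hb₂) (show 0 < r / 40 by positivity)
  have hκd : ∀ ζ ∈ closedBall ζ₀ r, ‖κ (h ζ) - ζ‖ ≤ r / 8 := fun ζ hζ => by
    have := norm_add_le (κ (h ζ) - f (h ζ)) (f (h ζ) - ζ)
    rw [sub_add_sub_cancel] at this
    linarith [hκf ζ hζ, hfh ζ hζ]
  set F : E → E := fun ζ => κ (h ζ) with hFdef
  have hF : Continuous F := hκ.continuous.comp hc
  have hFeq : F ζ₂ = F ζ₁ := by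
    simp only [hFdef, hκ₁, hκ₂]; exact heq.symm
  have l₁ : LocDeg F ζ₁ D := hD ζ₁ (hsubb h₁) κ hκ hr₁
  have l₂ : LocDeg F ζ₂ D := hD ζ₂ (hsubb h₂) κ hκ hr₂
  have hzmem : F ζ₁ ∈ ball ζ₀ (3 * r / 4) := by
    have a1 := hκd ζ₁ hb₁
    rw [mem_ball, dist_eq_norm] at h₁ ⊢
    have := norm_add_le (F ζ₁ - ζ₁) (ζ₁ - ζ₀)
    rw [sub_add_sub_cancel] at this
    change ‖F ζ₁ - ζ₁‖ ≤ r / 8 at a1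
    linarith
  obtain ⟨ρ₁, hρ₁, s₁⟩ := l₁.shrink hF
  obtain ⟨ρ₂, hρ₂, s₂⟩ := l₂.shrink hF
  have hdist : 0 < dist ζ₁ ζ₂ := dist_pos.2 hne
  have hb1 : 0 < r / 2 - dist ζ₁ ζ₀ := sub_pos.2 h₁
  have hb2 : 0 < r / 2 - dist ζ₂ ζ₀ := sub_pos.2 h₂
  set ρ := min (min ρ₁ ρ₂) (min (dist ζ₁ ζ₂ / 2) (min (r / 2 - dist ζ₁ ζ₀) (r / 2 - dist ζ₂ ζ₀))) with hρdef
  have hρ : 0 < ρ := by positivity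
  have e1 : ρ ≤ ρ₁ := (min_le_left _ _).trans (min_le_left _ _)
  have e2 : ρ ≤ ρ₂ := (min_le_left _ _).trans (min_le_right _ _)
  have e3 : ρ ≤ dist ζ₁ ζ₂ / 2 := (min_le_right _ _).trans (min_le_left _ _)
  have e4 : ρ ≤ r / 2 - dist ζ₁ ζ₀ := (min_le_right _ _).trans ((min_le_right _ _).trans (min_le_left _ _))
  have e5 : ρ ≤ r / 2 - dist ζ₂ ζ₀ := (min_le_right _ _).trans ((min_le_right _ _).trans (min_le_right _ _))
  obtain ⟨i₁, d₁⟩ := s₁ ρ hρ e1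
  obtain ⟨i₂, d₂⟩ := s₂ ρ hρ e2
  have ev₁ := d₁.eventually_sub_const hF hρ (sub_ne_zero_of_injOn i₁ (mem_closedBall_self hρ.le))
  have ev₂ := d₂.eventually_sub_const hF hρ (sub_ne_zero_of_injOn i₂ (mem_closedBall_self hρ.le))
  rw [hFeq] at ev₂
  have ev := (ev₁.and ev₂).and (isOpen_ball.mem_nhds hzmem)
  obtain ⟨z, ⟨⟨hz₁, hz₂⟩, hz⟩, hzN⟩ : ∃ z, ((HasDeg (fun x => F x - z) (ball ζ₁ ρ) D ∧
      HasDeg (fun x => F x - z) (ball ζ₂ ρ) D) ∧ z ∈ ball ζ₀ (3 * r / 4)) ∧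
      z ∉ F '' {ζ ∈ closedBall ζ₀ r | ¬ RegularOn M κ (h ζ)} := by
    by_contra! hcon
    exact (Measure.measure_pos_of_mem_nhds volume ev).ne'
      (measure_mono_null (fun z hz => hcon z hz) (volume_image_singular_eq_zero hc hM hgood hκ))
  have hdeg : HasDeg (fun x => F x - z) (ball ζ₀ r) 1 := by
    have hzr : z ∈ ball ζ₀ r := ball_subset_ball (by linarith) hz
    refine (hasDeg_sub_const isOpen_ball hzr).homotopy (by fun_prop) (by fun_prop) isOpen_ball isBounded_ball
      (isCompact_closedBall ζ₀ (15 * r / 16)) (closedBall_subset_ball (by linarith))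
      (show 0 < r / 16 by positivity) fun x hx hxK t ht => ?_
    have a1 := norm_segment_sub_le (a := x - z) (b := F x - z) (c := x - z) (ε := r / 8)
      (by simp; positivity) (by
        rw [sub_sub_sub_cancel_right]; exact hκd x (ball_subset_closedBall hx)) ht
    have a2 := norm_sub_norm_le (x - z) (x - z + t • ((F x - z) - (x - z)))
    rw [norm_sub_rev (x - z)] at a2
    rw [mem_closedBall, not_le, dist_eq_norm] at hxK
    rw [mem_ball, dist_eq_norm] at hz
    have a3 := norm_add_le (x - z) (z - ζ₀)
    rw [sub_add_sub_cancel] at a3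
    linarith
  obtain ⟨hfin, hcard⟩ := hdeg.card_mul hF (D := D) fun ζ hζ hζz => by
    have a1 : ζ ∈ ball ζ₀ r := by
      have a2 := hκd ζ hζ
      change ‖F ζ - ζ‖ ≤ r / 8 at a2
      rw [hζz] at a2
      rw [mem_ball, dist_eq_norm] at hz ⊢
      rw [norm_sub_rev] at a2
      have := norm_add_le (ζ - z) (z - ζ₀)
      rw [sub_add_sub_cancel] at this
      linarith
    refine ⟨a1, hD ζ a1 κ hκ ?_⟩
    by_contra hreg
    exact hzN ⟨ζ, ⟨hζ, hreg⟩, hζz⟩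
  have hcard' : (hfin.toFinset.card : ℤ) * D = 1 := by exact_mod_cast hcard.symm
  have hD0 : (D : ℝ) ≠ 0 := by
    rintro h0
    have : D = 0 := by exact_mod_cast h0
    rw [this, mul_zero] at hcard'
    exact zero_ne_one hcard'
  have hc1 : hfin.toFinset.card = 1 := by
    rcases Int.mul_eq_one_iff_eq_one_or_neg_one.1 hcard' with h | h
    · exact_mod_cast h.1
    · omega
  obtain ⟨x₁, hx₁, hx₁0⟩ := hz₁.exists_zero (by fun_prop) isOpen_ball isBounded_ball hD0
  obtain ⟨x₂, hx₂, hx₂0⟩ := hz₂.exists_zero (by fun_prop) isOpen_ball isBounded_ball hD0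
  have hm : ∀ {ζ x : E}, ρ ≤ r / 2 - dist ζ ζ₀ → x ∈ ball ζ ρ → F x - z = 0 → x ∈ hfin.toFinset :=
    fun {ζ x} hρζ hx h0 => by
      rw [Set.Finite.mem_toFinset]
      refine ⟨?_, sub_eq_zero.1 h0⟩
      rw [mem_ball] at hx
      rw [mem_closedBall]
      linarith [dist_triangle x ζ ζ₀]
  have hxx := Finset.card_le_one.1 hc1.le x₁ (hm e4 hx₁ hx₁0) x₂ (hm e5 hx₂ hx₂0)
  rw [mem_ball] at hx₁ hx₂
  rw [← hxx] at hx₂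
  linarith [dist_triangle_left ζ₁ ζ₂ x₁]

end Param

section
attribute [local instance] InnerProductSpace.complexToReal
variable {E Y : Type*} [NormedAddCommGroup E] [InnerProductSpace ℂ E] [FiniteDimensional ℂ E]
  [MeasurableSpace E] [BorelSpace E] [NormedAddCommGroup Y] [NormedSpace ℂ Y] [FiniteDimensional ℂ Y]
  {M : Set Y} {h : E → Y} {ζ₀ : E} {r : ℝ}

/-- A parametrization of `M` which is almost inverse to the linear map `π` makes `π`
injective in a quantitative way. -/
theorem norm_le_mul_norm_map_sub (hc : ContinuousOn h (closedBall ζ₀ r)) (hi : InjOn h (closedBall ζ₀ r))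
    (hM : ∀ ζ ∈ closedBall ζ₀ r, h ζ ∈ M) (hgood : ∀ ζ ∈ closedBall ζ₀ r, Good E M (h ζ)) (hr : 0 < r)
    (π : Y →L[ℂ] E) (c : E) (hπ : ∀ ζ ∈ closedBall ζ₀ r, ‖π (h ζ) - ζ - c‖ ≤ r / 20)
    {C : ℝ} (hC : 0 ≤ C) (hh : ∀ ζ ∈ closedBall ζ₀ r, ‖h ζ - h ζ₀‖ ≤ C * r) {ζ₁ ζ₂ : E}
    (h₁ : ζ₁ ∈ ball ζ₀ (r / 2)) (h₂ : ζ₂ ∈ ball ζ₀ (r / 2)) :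
    ‖h ζ₁ - h ζ₂‖ ≤ 20 * C * ‖π (h ζ₁ - h ζ₂)‖ := by
  rcases eq_or_ne ζ₁ ζ₂ with rfl | hne
  · simp
  have : Nontrivial E := ⟨ζ₁, ζ₂, hne⟩
  have : TietzeExtension Y := TietzeExtension.of_tvs ℂ
  obtain ⟨H, hH⟩ := ContinuousMap.exists_restrict_eq (isClosed_closedBall (x := ζ₀) (ε := r))
    ⟨_, hc.restrict⟩
  have hHh : ∀ ζ ∈ closedBall ζ₀ r, H ζ = h ζ := fun ζ hζ => by
    have := congrArg (fun f => f ⟨ζ, hζ⟩) hH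
    simpa using this
  have hsub : ball ζ₀ (r / 2) ⊆ closedBall ζ₀ r := fun x hx => by
    rw [mem_ball] at hx; rw [mem_closedBall]; linarith
  by_contra! hcon
  have hw : h ζ₁ - h ζ₂ ≠ 0 := sub_ne_zero.2 fun e => hne (hi (hsub h₁) (hsub h₂) e)
  set w := h ζ₁ - h ζ₂
  obtain ⟨l, hl1, hlw⟩ := exists_dual_vector ℂ w (norm_ne_zero_iff.2 hw)
  have hw0 : 0 < ‖w‖ := norm_pos_iff.2 hw
  set A : Y →L[ℂ] E := l.smulRight ((‖w‖ : ℂ)⁻¹ • π w) with hA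
  replace hlw : l w = ((‖w‖ : ℝ) : ℂ) := hlw
  have hAw : A w = π w := by
    rw [hA, ContinuousLinearMap.smulRight_apply, hlw, smul_smul, mul_inv_cancel₀, one_smul]
    exact_mod_cast hw0.ne'
  have hAn : ∀ y, ‖A y‖ ≤ ‖π w‖ / ‖w‖ * ‖y‖ := fun y => by
    rw [hA, ContinuousLinearMap.smulRight_apply, norm_smul, norm_smul, norm_inv, Complex.norm_real,
      norm_norm]
    have := l.le_opNorm y
    rw [hl1, one_mul] at this
    calc ‖l y‖ * (‖w‖⁻¹ * ‖π w‖) ≤ ‖y‖ * (‖w‖⁻¹ * ‖π w‖) := by gcongr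
      _ = _ := by ring
  have hq : ‖π w‖ / ‖w‖ * (C * r) ≤ r / 20 := by
    rw [div_mul_eq_mul_div, div_le_iff₀ hw0]
    nlinarith
  have key := injOn_comp_of_near_id (h := H) (M := M) (ζ₀ := ζ₀) (r := r)
    (f := fun y => π y - c - A (y - h ζ₀)) H.continuous (hi.congr fun ζ hζ => (hHh ζ hζ).symm)
    (fun ζ hζ => by rw [hHh ζ hζ]; exact hM ζ hζ) (fun ζ hζ => by rw [hHh ζ hζ]; exact hgood ζ hζ) hr
    (by fun_prop) (fun ζ hζ => by
      rw [hHh ζ hζ]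
      have a1 := hπ ζ hζ
      have a2 := (hAn (h ζ - h ζ₀)).trans
        ((mul_le_mul_of_nonneg_left (hh ζ hζ) (by positivity)).trans hq)
      have a3 := norm_sub_le (π (h ζ) - ζ - c) (A (h ζ - h ζ₀))
      have a4 : π (h ζ) - c - A (h ζ - h ζ₀) - ζ = π (h ζ) - ζ - c - A (h ζ - h ζ₀) := by abel
      rw [a4]
      linarith)
  refine hne (key h₁ h₂ ?_)
  simp only [hHh _ (hsub h₁), hHh _ (hsub h₂)]
  have : π (h ζ₁) - π (h ζ₂) = A (h ζ₁) - A (h ζ₂) := by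
    rw [← map_sub, ← map_sub]; exact hAw.symm
  rw [map_sub, map_sub]
  have e := sub_eq_sub_iff_sub_eq_sub.1 this
  have t : ∀ u v : E, u - c - (v - A (h ζ₀)) = u - v - c + A (h ζ₀) := fun u v => by abel
  rw [t, t, e]

end

section HasParam
variable {E Y : Type*} [NormedAddCommGroup E] [NormedSpace ℂ E] [NormedAddCommGroup Y]
  [NormedSpace ℂ Y]

variable (E) in
/-- `M` has, near `p`, a continuous parametrization which is an immersion at the centre. -/
def HasParam (M : Set Y) (p : Y) : Prop :=
  ∃ (h : E → Y) (k : Y → E) (L : E →L[ℂ] Y) (r : ℝ), 0 < r ∧ h 0 = p ∧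
    ContinuousOn h (closedBall 0 r) ∧ MapsTo h (closedBall 0 r) M ∧
    (∀ ζ ∈ closedBall 0 r, k (h ζ) = ζ) ∧ ContinuousWithinAt k M p ∧
    (∀ᶠ q in 𝓝[M] p, h (k q) = q) ∧ HasFDerivAt h L 0 ∧ Function.Injective L

/-- Quantitative normalized parametrization. -/
structure StdParam (M : Set Y) (π : Y →L[ℂ] E) (m s t ε : ℝ) (p : Y) (h : E → Y) (L : E →L[ℂ] Y) :
    Prop where
  zero : h 0 = p
  cont : ContinuousOn h (closedBall 0 s)
  inj : InjOn h (closedBall 0 s)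
  maps : MapsTo h (closedBall 0 s) M
  proj : ∀ v, π (L v) = v
  norm_le : ‖L‖ ≤ m
  approx : ∀ ζ ∈ closedBall 0 s, ‖h ζ - p - L ζ‖ ≤ ε * ‖ζ‖
  cover : M ∩ ball p t ⊆ h '' closedBall 0 s

theorem HasParam.exists_stdParam [FiniteDimensional ℂ E] [FiniteDimensional ℂ Y] {M : Set Y} {p : Y}
    (hp : HasParam E M p) {D : Set (Y →L[ℂ] E)} (hD : Dense D) {ε : (Y →L[ℂ] E) → ℕ → ℝ}
    (hε : ∀ π m, 0 < ε π m) :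
    ∃ π ∈ D, ∃ m i j : ℕ, ∃ h L, StdParam M π (m + 1) (1 / (i + 1)) (1 / (j + 1)) (ε π m) p h L := by
  obtain ⟨h, k, L, r, hr, h0, hc, hm, hk, hkc, hhk, hd, hL⟩ := hp
  obtain ⟨π₀, hπ₀⟩ : ∃ π₀ : Y →L[ℂ] E, ∀ v, π₀ (L v) = v := by
    obtain ⟨g, hg⟩ := (L : E →ₗ[ℂ] Y).exists_leftInverse_of_injective (LinearMap.ker_eq_bot.2 hL)
    exact ⟨LinearMap.toContinuousLinearMap g, fun v => by
      simpa using DFunLike.congr_fun hg v⟩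
  have := FiniteDimensional.complete ℂ E
  obtain ⟨π, ⟨B, hB⟩, hπD⟩ : ∃ π, (π.comp L) ∈ range ((↑) : (E ≃L[ℂ] E) → (E →L[ℂ] E)) ∧ π ∈ D := by
    have hcont : Continuous fun π : Y →L[ℂ] E => π.comp L := by fun_prop
    have hopen := (ContinuousLinearEquiv.isOpen (𝕜 := ℂ) (E := E) (F := E)).preimage hcont
    refine hD.inter_open_nonempty _ hopen ⟨π₀, ContinuousLinearEquiv.refl ℂ E, ?_⟩
    ext v; simp [hπ₀]
  have hB' : ∀ v, B v = π (L v) := fun v => DFunLike.congr_fun hB v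
  set L' : E →L[ℂ] Y := L.comp (B.symm : E →L[ℂ] E)
  obtain ⟨m, hm'⟩ := exists_nat_ge ‖L'‖
  have hd' : HasFDerivAt (fun ζ => h (B.symm ζ)) L' 0 := by
    have : HasFDerivAt h L (B.symm 0) := by rwa [map_zero]
    exact this.comp 0 B.symm.hasFDerivAt
  have ev1 : ∀ᶠ ζ : E in 𝓝 0, ‖h (B.symm ζ) - p - L' ζ‖ ≤ ε π m * ‖ζ‖ := by
    have := hd'.isLittleO.bound (hε π m)
    simpa [h0] using this
  have ev2 : ∀ᶠ ζ : E in 𝓝 0, B.symm ζ ∈ closedBall 0 r :=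
    B.symm.continuous.continuousAt.eventually (by
      rw [map_zero]; exact closedBall_mem_nhds 0 hr)
  obtain ⟨δ, hδ, hδs⟩ := Metric.eventually_nhds_iff_ball.1 (ev1.and ev2)
  obtain ⟨i, hi⟩ := exists_nat_one_div_lt hδ
  have hs : closedBall (0 : E) (1 / (i + 1)) ⊆ ball 0 δ := closedBall_subset_ball hi
  have hi0 : (0 : ℝ) < 1 / (i + 1) := by positivity
  have hkp : k p = 0 := by rw [← h0]; exact hk 0 (by simp [hr.le])
  have ev3 : ∀ᶠ q in 𝓝[M] p, B (k q) ∈ closedBall 0 (1 / (i + 1 : ℝ)) :=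
    (B.continuous.continuousAt.comp_continuousWithinAt hkc).eventually (by
      rw [Function.comp_apply, hkp, map_zero]; exact closedBall_mem_nhds _ hi0)
  obtain ⟨δ', hδ', hδs'⟩ := Metric.mem_nhdsWithin_iff.1 (ev3.and hhk)
  obtain ⟨j, hj⟩ := exists_nat_one_div_lt hδ'
  refine ⟨π, hπD, m, i, j, fun ζ => h (B.symm ζ), L', ⟨by simp [h0], ?_, ?_, ?_, ?_, ?_, ?_, ?_⟩⟩
  · exact hc.comp B.symm.continuous.continuousOn fun ζ hζ => (hδs ζ (hs hζ)).2
  · intro x hx y hy hxy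
    have := congrArg k hxy
    rw [hk _ (hδs x (hs hx)).2, hk _ (hδs y (hs hy)).2] at this
    exact B.symm.injective this
  · exact fun ζ hζ => hm (hδs ζ (hs hζ)).2
  · intro v
    show π (L (B.symm v)) = v
    rw [← hB', B.apply_symm_apply]
  · linarith
  · exact fun ζ hζ => (hδs ζ (hs hζ)).1
  · rintro q ⟨hqM, hq⟩
    obtain ⟨a1, a2⟩ := hδs' ⟨ball_subset_ball hj.le hq, hqM⟩
    exact ⟨B (k q), a1, by simpa using a2⟩

end HasParam

section
attribute [local instance] InnerProductSpace.complexToReal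
variable {E Y : Type*} [NormedAddCommGroup E] [InnerProductSpace ℂ E] [FiniteDimensional ℂ E]
  [MeasurableSpace E] [BorelSpace E] [NormedAddCommGroup Y] [NormedSpace ℂ Y] [FiniteDimensional ℂ Y]
  {M : Set Y} {π : Y →L[ℂ] E} {m s t ε : ℝ} {p : Y} {h : E → Y} {L : E →L[ℂ] Y}

theorem StdParam.exists_preimage (S : StdParam M π m s t ε p h L) (hε : (‖π‖ + 1) * ε ≤ 1 / 2)
    (hε0 : 0 ≤ ε) {q : Y} (hq : q ∈ M) (hqt : q ∈ ball p t) :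
    ∃ ζ ∈ closedBall (0 : E) s, h ζ = q ∧ ‖ζ‖ ≤ 2 * ‖π (q - p)‖ ∧ ‖q - p‖ ≤ (m + 1) * ‖ζ‖ := by
  obtain ⟨ζ, hζ, rfl⟩ := S.cover ⟨hq, hqt⟩
  have a1 := S.approx ζ hζ
  have a2 : ‖π (h ζ - p - L ζ)‖ ≤ ‖ζ‖ / 2 := by
    have := (π.le_opNorm _).trans (mul_le_mul_of_nonneg_left a1 (norm_nonneg π))
    nlinarith [norm_nonneg ζ, mul_nonneg hε0 (norm_nonneg ζ)]
  refine ⟨ζ, hζ, rfl, ?_, ?_⟩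
  · have := norm_sub_le (π (h ζ - p)) (π (h ζ - p - L ζ))
    rw [← map_sub, sub_sub_cancel, S.proj] at this
    linarith
  · have a3 := norm_add_le (h ζ - p - L ζ) (L ζ)
    rw [sub_add_cancel] at a3
    have a4 := (L.le_opNorm ζ).trans (mul_le_mul_of_nonneg_right S.norm_le (norm_nonneg ζ))
    have : ε ≤ 1 := by nlinarith [norm_nonneg π]
    nlinarith [norm_nonneg ζ]

set_option maxHeartbeats 1000000 in
theorem StdParam.antilipschitz (hm : 1 ≤ m) (hε : ε = 1 / (1000 * m ^ 2 * (‖π‖ + 1) ^ 3))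
    (S : StdParam M π m s t ε p h L) {q q' : Y} {ρ : ℝ} (hρ : 0 < ρ) (hq : q ∈ M) (hq' : q' ∈ M)
    (hgood : ∀ x ∈ M, ‖x - q‖ < ρ → Good E M x) (hqp : ‖q - p‖ ≤ 2 * ρ) (hqt : q ∈ ball p t)
    (hqt' : q' ∈ ball p t) (hs : (4 * (‖π‖ + 1) + 1) * ρ ≤ s) :
    ‖q - q'‖ ≤ 40 * m * ‖π (q - q')‖ := by
  set P := ‖π‖ + 1 with hP
  have hP1 : 1 ≤ P := by linarith [norm_nonneg π]
  have hπP : ∀ y, ‖π y‖ ≤ P * ‖y‖ := fun y =>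
    (π.le_opNorm y).trans (mul_le_mul_of_nonneg_right (by linarith) (norm_nonneg y))
  have hε0 : 0 < ε := by rw [hε]; positivity
  have k3 : ε * m ^ 2 * P ^ 3 = 1 / 1000 := by rw [hε]; field_simp
  have hm0 : 0 < m := by linarith
  have hP0 : 0 < P := by linarith
  have k2 : ε * P ^ 2 * m ≤ 1 / 1000 := by
    rw [← k3]
    have : 1 ≤ m * P := one_le_mul_of_one_le_of_one_le hm hP1
    have h2 : 0 ≤ ε * P ^ 2 * m := by positivity
    nlinarith
  have k1 : ε * P ≤ 1 / 1000 := by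
    refine le_trans ?_ k2
    have : 1 ≤ m * P := one_le_mul_of_one_le_of_one_le hm hP1
    have h2 : 0 ≤ ε * P := by positivity
    nlinarith
  have hPε : P * ε ≤ 1 / 2 := by linarith
  obtain ⟨ζ₁, hζ₁, h₁, n₁, -⟩ := S.exists_preimage hPε hε0.le hq hqt
  obtain ⟨ζ₂, hζ₂, h₂, n₂, -⟩ := S.exists_preimage hPε hε0.le hq' hqt'
  set D := ‖q - q'‖ with hD
  have hD0 : 0 ≤ D := norm_nonneg _
  have hqp' : ‖q' - p‖ ≤ 2 * ρ + D := by
    have := norm_add_le (q' - q) (q - p)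
    rw [sub_add_sub_cancel, norm_sub_rev q' q] at this
    linarith
  have N₁ : ‖ζ₁‖ ≤ 4 * P * ρ := by nlinarith [hπP (q - p)]
  have N₂ : ‖ζ₂‖ ≤ 2 * P * (2 * ρ + D) := by nlinarith [hπP (q' - p)]
  have b₁ := S.approx ζ₁ hζ₁
  have b₂ := S.approx ζ₂ hζ₂
  rw [h₁] at b₁
  rw [h₂] at b₂
  set e := (q - p - L ζ₁) - (q' - p - L ζ₂) with he
  have hee : q - q' = L (ζ₁ - ζ₂) + e := by rw [he, map_sub]; abel
  have hen : ‖e‖ ≤ ε * P * (8 * ρ + 2 * D) := by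
    have := norm_sub_le (q - p - L ζ₁) (q' - p - L ζ₂)
    rw [← he] at this
    nlinarith
  have hπe : π (q - q') = ζ₁ - ζ₂ + π e := by rw [hee, map_add, S.proj]
  have hζe : ‖ζ₁ - ζ₂‖ ≤ ‖π (q - q')‖ + P * ‖e‖ := by
    have := norm_sub_le (π (q - q')) (π e)
    rw [hπe, add_sub_cancel_right, ← hπe] at this
    linarith [hπP e]
  rcases le_or_gt (ρ / (16 * m * P)) D with hA | hB
  · rw [div_le_iff₀ (by positivity)] at hA
    have e1 : m * P * ‖e‖ ≤ 13 / 100 * D := by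
      have a1 : 8 * ρ + 2 * D ≤ 130 * (m * P * D) := by
        have : 1 ≤ m * P := one_le_mul_of_one_le_of_one_le hm hP1
        nlinarith
      calc m * P * ‖e‖ ≤ m * P * (ε * P * (130 * (m * P * D))) := by
            gcongr; exact hen.trans (mul_le_mul_of_nonneg_left a1 (by positivity))
        _ = 130 * (ε * m ^ 2 * P ^ 3) * D := by ring
        _ = 13 / 100 * D := by rw [k3]; ring
    have e2 : ‖e‖ ≤ 13 / 100 * D := by
      refine le_trans ?_ e1
      have : 1 ≤ m * P := one_le_mul_of_one_le_of_one_le hm hP1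
      nlinarith [norm_nonneg e]
    have e3 : D ≤ m * ‖ζ₁ - ζ₂‖ + ‖e‖ := by
      have := norm_add_le (L (ζ₁ - ζ₂)) e
      rw [← hee] at this
      have := (L.le_opNorm (ζ₁ - ζ₂)).trans (mul_le_mul_of_nonneg_right S.norm_le (norm_nonneg _))
      linarith
    have e4 : m * ‖ζ₁ - ζ₂‖ ≤ m * ‖π (q - q')‖ + m * P * ‖e‖ := by nlinarith
    nlinarith [mul_nonneg hm0.le (norm_nonneg (π (q - q')))]
  · rw [lt_div_iff₀ (by positivity)] at hB
    set r := ρ / (4 * m) with hr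
    have hr0 : 0 < r := by positivity
    have hrm : m * r = ρ / 4 := by rw [hr]; field_simp
    have hrρ : r ≤ ρ := by rw [hr]; apply div_le_self hρ.le; linarith
    have hk2 : ε * P ^ 2 * ρ ≤ 4 * r / 1000 := by
      have : ε * P ^ 2 * ρ = 4 * (ε * P ^ 2 * m) * r := by
        have : ρ = 4 * (m * r) := by rw [hrm]; ring
        rw [this]; ring
      rw [this]; nlinarith
    have hnorm : ∀ ζ ∈ closedBall ζ₁ r, ‖ζ‖ ≤ (4 * P + 1) * ρ := fun ζ hζ => by
      rw [mem_closedBall, dist_eq_norm] at hζ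
      have := norm_add_le (ζ - ζ₁) ζ₁
      rw [sub_add_cancel] at this
      linarith
    have hsub : closedBall ζ₁ r ⊆ closedBall 0 s := fun ζ hζ => by
      rw [mem_closedBall_zero_iff]; exact (hnorm ζ hζ).trans hs
    have happ : ∀ ζ ∈ closedBall ζ₁ r, ‖h ζ - p - L ζ‖ ≤ 5 * (ε * P * ρ) := fun ζ hζ =>
      (S.approx ζ (hsub hζ)).trans (by
        have a1 := hnorm ζ hζ
        have a2 : (4 * P + 1) * ρ ≤ 5 * P * ρ := by nlinarith
        nlinarith)
    have hhd : ∀ ζ ∈ closedBall ζ₁ r, ‖h ζ - h ζ₁‖ ≤ 2 * m * r := fun ζ hζ => by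
      have a1 := happ ζ hζ
      have a2 := happ ζ₁ (mem_closedBall_self hr0.le)
      have a3 := norm_add_le (L (ζ - ζ₁)) ((h ζ - p - L ζ) - (h ζ₁ - p - L ζ₁))
      have a4 : L (ζ - ζ₁) + ((h ζ - p - L ζ) - (h ζ₁ - p - L ζ₁)) = h ζ - h ζ₁ := by
        rw [map_sub]; abel
      rw [a4] at a3
      have a5 := norm_sub_le (h ζ - p - L ζ) (h ζ₁ - p - L ζ₁)
      have a6 := (L.le_opNorm (ζ - ζ₁)).trans (mul_le_mul_of_nonneg_right S.norm_le (norm_nonneg _))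
      rw [mem_closedBall, dist_eq_norm] at hζ
      have a7 : ε * P * ρ ≤ 1 / 1000 * ρ := by gcongr
      nlinarith
    have key := norm_le_mul_norm_map_sub (M := M) (h := h) (ζ₀ := ζ₁) (r := r)
      (S.cont.mono hsub) (S.inj.mono hsub)
      (fun ζ hζ => S.maps (hsub hζ)) (fun ζ hζ => hgood _ (S.maps (hsub hζ)) (by
        have := hhd ζ hζ
        rw [h₁] at this
        nlinarith)) hr0 π (π p) (fun ζ hζ => by
          have a1 := hπP (h ζ - p - L ζ)
          rw [map_sub, map_sub, S.proj, sub_right_comm] at a1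
          have a2 := happ ζ hζ
          nlinarith) (C := 2 * m) (by positivity) hhd (ζ₁ := ζ₁) (ζ₂ := ζ₂)
      (mem_ball_self (by positivity)) (by
        rw [mem_ball, dist_eq_norm, norm_sub_rev]
        have a1 := hπP (q - q')
        rw [← hD] at a1
        have a2 : P * D < r / 4 := by
          have : (16 * m) * (P * D) < (16 * m) * (r / 4) := by nlinarith
          exact lt_of_mul_lt_mul_left this (by positivity)
        have a3 : D ≤ ρ / 16 := by nlinarith [one_le_mul_of_one_le_of_one_le hm hP1]
        have a4 : P * ‖e‖ ≤ ε * P ^ 2 * (8 * ρ + 2 * D) := by nlinarith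
        have a5 : ε * P ^ 2 * (8 * ρ + 2 * D) ≤ ε * P ^ 2 * (9 * ρ) := by
          gcongr; linarith
        linarith)
    rw [h₁, h₂] at key
    linarith

end

section
variable {E Y : Type*} [NormedAddCommGroup E] [NormedSpace ℂ E] [FiniteDimensional ℂ E]
  [NormedAddCommGroup Y] [NormedSpace ℂ Y] [FiniteDimensional ℂ Y]
  {M : Set Y}

theorem isClosed_not_good (hM : IsClosed M) : IsClosed {p ∈ M | ¬ Good E M p} := by
  rw [← isOpen_compl_iff, isOpen_iff_mem_nhds]
  intro p hp
  by_cases hpM : p ∈ M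
  · have hg : Good E M p := by
      by_contra h
      exact hp ⟨hpM, h⟩
    obtain ⟨π, W, g, β, hW, hG⟩ := hg
    filter_upwards [hG.isOpen_W.mem_nhds hW] with q hq hq'
    exact hq'.2 ⟨π, W, g, β, hq, hG⟩
  · filter_upwards [hM.isOpen_compl.mem_nhds hpM] with q hq hq'
    exact hq hq'.1

/-- If a linear map `π` is bounded below on `M` near `p`, then `M` is a graph near `p`. -/
theorem good_of_antilipschitz (hM : IsClosed M) (hpar : ∀ p ∈ M, HasParam E M p) {p : Y} (hp : p ∈ M)
    (π : Y →L[ℂ] E) {C R : ℝ} (hC : 0 < C) (hR : 0 < R)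
    (hanti : ∀ q ∈ M ∩ ball p R, ∀ q' ∈ M ∩ ball p R, ‖q - q'‖ ≤ C * ‖π (q - q')‖) : Good E M p := by
  have := FiniteDimensional.proper ℂ Y
  set δ := R / (8 * C) with hδ
  have hδ0 : 0 < δ := by positivity
  -- the derivative of a parametrization followed by `π` is invertible
  have hinj : ∀ x ∈ M ∩ ball p R, ∀ (h : E → Y) (L : E →L[ℂ] Y) (r : ℝ), 0 < r → h 0 = x →
      MapsTo h (closedBall 0 r) M → HasFDerivAt h L 0 → Function.Injective L →
      Function.Injective (π.comp L) := by
    intro x hx h L r hr h0 hm hd hL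
    rw [injective_iff_map_eq_zero]
    intro v hv
    by_contra hv0
    have hLv : 0 < ‖L v‖ := norm_pos_iff.2 fun h => hv0 (hL (by rw [h, map_zero]))
    have hvn : 0 < ‖v‖ := norm_pos_iff.2 hv0
    set c := ‖L v‖ / (4 * (1 + C * ‖π‖) * ‖v‖) with hc
    have hc0 : 0 < c := by positivity
    have e1 := hd.isLittleO.bound hc0
    have e2 : ∀ᶠ ζ : E in 𝓝 0, h ζ ∈ ball p R := hd.continuousAt.eventually (by
      rw [h0]; exact isOpen_ball.mem_nhds hx.2)
    obtain ⟨τ, hτ, hτs⟩ := Metric.eventually_nhds_iff_ball.1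
      ((e1.and e2).and (closedBall_mem_nhds (0 : E) hr))
    set s := τ / (2 * ‖v‖) with hs
    have hs0 : 0 < s := by positivity
    have hsv : ‖(s : ℂ) • v‖ = s * ‖v‖ := by
      rw [norm_smul, Complex.norm_real, Real.norm_of_nonneg hs0.le]
    obtain ⟨⟨f1, f2⟩, f3⟩ := hτs ((s : ℂ) • v) (by
      rw [mem_ball_zero_iff, hsv, hs, div_mul_eq_mul_div, div_lt_iff₀ (by positivity)]
      nlinarith)
    rw [sub_zero, map_smul, h0, hsv] at f1
    have f4 := hanti _ ⟨hm f3, f2⟩ x hx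
    set w := h ((s : ℂ) • v) - x
    have f5 : π w = π (w - (s : ℂ) • L v) := by
      rw [map_sub π w, map_smul, show π (L v) = 0 from hv, smul_zero, sub_zero]
    have f6 := π.le_opNorm (w - (s : ℂ) • L v)
    have f7 := norm_sub_le w (w - (s : ℂ) • L v)
    rw [sub_sub_cancel, norm_smul, Complex.norm_real, Real.norm_of_nonneg hs0.le] at f7
    rw [f5] at f4
    have f8 : (1 + C * ‖π‖) * (c * (s * ‖v‖)) = s * ‖L v‖ / 4 := by
      rw [hc]; field_simp
    have f9 : (1 + C * ‖π‖) * ‖w - (s : ℂ) • L v‖ ≤ s * ‖L v‖ / 4 := by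
      rw [← f8]; gcongr
    have f10 : C * ‖π (w - (s : ℂ) • L v)‖ ≤ C * (‖π‖ * ‖w - (s : ℂ) • L v‖) := by gcongr
    have : 0 < s * ‖L v‖ := by positivity
    nlinarith
  have hsurj : ∀ y ∈ ball (π p) δ, ∃ x ∈ M ∩ ball p (R / 2), π x = y := by
    intro y hy
    have hcpt : IsCompact (M ∩ closedBall p (R / 2)) := (isCompact_closedBall p _).inter_left hM
    obtain ⟨x, hx, hmin⟩ := hcpt.exists_isMinOn (f := fun x => ‖π x - y‖)
      ⟨p, hp, mem_closedBall_self (by positivity)⟩ (by fun_prop)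
    have hmin' : ∀ x' ∈ M ∩ closedBall p (R / 2), ‖π x - y‖ ≤ ‖π x' - y‖ := fun x' hx' => hmin hx'
    have hxR : x ∈ ball p R := closedBall_subset_ball (by linarith) hx.2
    have hxp : x ∈ ball p (R / 2) := by
      have a1 := hmin' p ⟨hp, mem_closedBall_self (by positivity)⟩
      rw [mem_ball, dist_eq_norm, norm_sub_rev] at hy
      have a2 := norm_add_le (π x - y) (y - π p)
      rw [sub_add_sub_cancel, ← map_sub, norm_sub_rev y] at a2
      have a3 := hanti x ⟨hx.1, hxR⟩ p ⟨hp, mem_ball_self hR⟩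
      rw [mem_ball, dist_eq_norm]
      have a4 : C * ‖π (x - p)‖ < C * (2 * δ) := by gcongr; linarith
      have a5 : C * (2 * δ) = R / 4 := by rw [hδ]; field_simp; norm_num
      linarith
    refine ⟨x, ⟨hx.1, hxp⟩, ?_⟩
    by_contra hne
    obtain ⟨h, k, L, r, hr, h0, -, hm, -, -, -, hd, hL⟩ := hpar x hx.1
    have hi := hinj x ⟨hx.1, hxR⟩ h L r hr h0 hm hd hL
    obtain ⟨v, hv⟩ := (LinearMap.injective_iff_surjective (f := (π.comp L : E →ₗ[ℂ] E))).1 hi (y - π x)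
    have hv' : π (L v) = y - π x := hv
    have hw : 0 < ‖y - π x‖ := norm_pos_iff.2 (sub_ne_zero.2 (Ne.symm hne))
    have hvn : 0 < ‖v‖ := norm_pos_iff.2 fun h => by
      rw [h, map_zero, map_zero] at hv'; rw [← hv', norm_zero] at hw; exact lt_irrefl _ hw
    have hd' : HasFDerivAt (fun ζ => π (h ζ)) (π.comp L) 0 := π.hasFDerivAt.comp (0 : E) hd
    have e1 := hd'.isLittleO.bound (show 0 < ‖y - π x‖ / (2 * ‖v‖) by positivity)
    have e2 : ∀ᶠ ζ : E in 𝓝 0, h ζ ∈ ball p (R / 2) := hd.continuousAt.eventually (by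
      rw [h0]; exact isOpen_ball.mem_nhds hxp)
    obtain ⟨τ, hτ, hτs⟩ := Metric.eventually_nhds_iff_ball.1
      ((e1.and e2).and (closedBall_mem_nhds (0 : E) hr))
    set s := min (τ / (2 * ‖v‖)) 1 with hs
    have hs0 : 0 < s := by positivity
    have hs1 : s ≤ 1 := min_le_right _ _
    have hsv : ‖(s : ℂ) • v‖ = s * ‖v‖ := by
      rw [norm_smul, Complex.norm_real, Real.norm_of_nonneg hs0.le]
    obtain ⟨⟨f1, f2⟩, f3⟩ := hτs ((s : ℂ) • v) (by
      rw [mem_ball_zero_iff, hsv]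
      have : s * ‖v‖ ≤ τ / (2 * ‖v‖) * ‖v‖ := by gcongr; exact min_le_left _ _
      have e : τ / (2 * ‖v‖) * ‖v‖ = τ / 2 := by field_simp
      linarith)
    rw [sub_zero, map_smul, h0, hsv, ContinuousLinearMap.comp_apply, hv'] at f1
    have f4 := hmin' _ ⟨hm f3, ball_subset_closedBall f2⟩
    have f5 : ‖y - π x‖ / (2 * ‖v‖) * (s * ‖v‖) = s * ‖y - π x‖ / 2 := by field_simp
    rw [f5] at f1
    have f6 := norm_add_le (π (h ((s : ℂ) • v)) - π x - (s : ℂ) • (y - π x))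
      (((1 - s : ℝ) : ℂ) • (π x - y))
    have f7 : π (h ((s : ℂ) • v)) - π x - (s : ℂ) • (y - π x) + ((1 - s : ℝ) : ℂ) • (π x - y) =
        π (h ((s : ℂ) • v)) - y := by
      push_cast
      module
    rw [f7, norm_smul, Complex.norm_real, Real.norm_of_nonneg (by linarith), norm_sub_rev (π x)] at f6
    rw [norm_sub_rev (π x)] at f4
    have : 0 < s * ‖y - π x‖ := by positivity
    nlinarith
  choose! g hg hgπ using hsurj
  have hgR : ∀ y ∈ ball (π p) δ, g y ∈ M ∩ ball p R := fun y hy =>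
    ⟨(hg y hy).1, ball_subset_ball (by linarith) (hg y hy).2⟩
  have hlip : ∀ y ∈ ball (π p) δ, ∀ y' ∈ ball (π p) δ, ‖g y - g y'‖ ≤ C * ‖y - y'‖ := fun y hy y' hy' => by
    have := hanti _ (hgR y hy) _ (hgR y' hy')
    rwa [map_sub, hgπ y hy, hgπ y' hy'] at this
  refine ⟨π, ball p (R / 2) ∩ π ⁻¹' ball (π p) δ, g, ball (π p) δ,
    ⟨mem_ball_self (by positivity), mem_ball_self hδ0⟩,
    isOpen_ball.inter (isOpen_ball.preimage π.continuous), isOpen_ball, fun y₀ hy₀ => ?_, hgπ, ?_⟩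
  · obtain ⟨h, k, L, r, hr, h0, -, hm, hkh, hkc, hhk, hd, hL⟩ := hpar (g y₀) (hg y₀ hy₀).1
    have hi := hinj _ (hgR y₀ hy₀) h L r hr h0 hm hd hL
    have := FiniteDimensional.complete ℂ E
    set B := LinearEquiv.ofInjectiveEndo (π.comp L : E →ₗ[ℂ] E) hi
    set B' : E ≃L[ℂ] E := B.toContinuousLinearEquiv with hB'
    have hBL : (B' : E →L[ℂ] E) = π.comp L := by ext v; rfl
    have hgc : ContinuousAt g y₀ := by
      rw [Metric.continuousAt_iff]
      intro ε hε
      obtain ⟨η, hη, hηs⟩ := Metric.isOpen_iff.1 isOpen_ball y₀ hy₀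
      refine ⟨min η (ε / C), by positivity, fun {y} hy => ?_⟩
      rw [dist_eq_norm]
      have := hlip y (hηs (hy.trans_le (min_le_left _ _))) y₀ hy₀
      have h2 := hy.trans_le (min_le_right _ _)
      rw [lt_div_iff₀ hC, dist_eq_norm] at h2
      linarith
    have hgM : Tendsto g (𝓝 y₀) (𝓝[M] (g y₀)) := tendsto_nhdsWithin_iff.2 ⟨hgc, by
      filter_upwards [isOpen_ball.mem_nhds hy₀] with y hy using (hg y hy).1⟩
    have hk0 : k (g y₀) = 0 := by rw [← h0]; exact hkh 0 (mem_closedBall_self hr.le)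
    have hkg : ContinuousAt (fun y => k (g y)) y₀ := hkc.tendsto.comp hgM
    have hd' : HasFDerivAt (fun ζ => π (h ζ)) (B' : E →L[ℂ] E) (k (g y₀)) := by
      rw [hBL, hk0]; exact π.hasFDerivAt.comp (0 : E) hd
    have hev := hgM.eventually hhk
    have h1 := HasFDerivAt.of_local_left_inverse (g := fun y => k (g y)) hkg hd' (by
      filter_upwards [hev, isOpen_ball.mem_nhds hy₀] with y hy hyb
      rw [hy, hgπ y hyb])
    have h2 : HasFDerivAt h L (k (g y₀)) := by rwa [hk0]
    exact ((h2.comp y₀ h1).congr_of_eventuallyEq (by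
      filter_upwards [hev] with y hy using hy.symm)).differentiableAt.differentiableWithinAt
  · ext q
    constructor
    · rintro ⟨hqM, hq, hqπ⟩
      refine ⟨π q, hqπ, ?_⟩
      have := hanti q ⟨hqM, ball_subset_ball (by linarith) hq⟩ _ (hgR _ hqπ)
      rw [map_sub, hgπ _ hqπ, sub_self, norm_zero, mul_zero] at this
      exact (sub_eq_zero.1 (norm_le_zero_iff.1 this)).symm
    · rintro ⟨y, hy, rfl⟩
      refine ⟨(hg y hy).1, (hg y hy).2, ?_⟩
      rwa [mem_preimage, hgπ y hy]

end

section
attribute [local instance] InnerProductSpace.complexToReal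
variable {E Y : Type*} [NormedAddCommGroup E] [InnerProductSpace ℂ E] [FiniteDimensional ℂ E]
  [MeasurableSpace E] [BorelSpace E] [NormedAddCommGroup Y] [NormedSpace ℂ Y] [FiniteDimensional ℂ Y]
  {M : Set Y}

theorem good_of_hasParam (hM : IsClosed M) (hpar : ∀ p ∈ M, HasParam E M p) {p : Y} (hp : p ∈ M) :
    Good E M p := by
  by_contra hpg
  have := FiniteDimensional.proper ℂ Y
  have := FiniteDimensional.proper ℂ (Y →L[ℂ] E)
  set B : Set Y := {p ∈ M | ¬ Good E M p} with hB
  have hBc : IsClosed B := isClosed_not_good hM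
  set ε : (Y →L[ℂ] E) → ℕ → ℝ := fun π m => 1 / (1000 * ((m : ℝ) + 1) ^ 2 * (‖π‖ + 1) ^ 3) with hε
  have hεpos : ∀ π m, 0 < ε π m := fun π m => by simp only [hε]; positivity
  set D := TopologicalSpace.denseSeq (Y →L[ℂ] E)
  set S : ℕ × ℕ × ℕ × ℕ → Set Y := fun d => {p ∈ B | ∃ h L, StdParam M (D d.1) (d.2.1 + 1)
    (1 / (d.2.2.1 + 1)) (1 / (d.2.2.2 + 1)) (ε (D d.1) d.2.1) p h L} with hS
  have : CompleteSpace B := hBc.completeSpace_coe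
  have : Nonempty B := ⟨⟨p, hp, hpg⟩⟩
  obtain ⟨⟨a, m, i, j⟩, hd⟩ := nonempty_interior_of_iUnion_of_closed
    (f := fun d => ((↑) : B → Y) ⁻¹' closure (S d)) (fun d => isClosed_closure.preimage continuous_subtype_val) (by
      rw [eq_univ_iff_forall]
      rintro ⟨q, hq⟩
      obtain ⟨π, ⟨a, rfl⟩, m, i, j, h, L, hst⟩ := (hpar q hq.1).exists_stdParam
        (TopologicalSpace.denseRange_denseSeq (Y →L[ℂ] E)) hεpos
      rw [mem_iUnion]
      exact ⟨(a, m, i, j), subset_closure ⟨hq, h, L, hst⟩⟩)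
  obtain ⟨⟨p₀, hp₀⟩, hp₀i⟩ := hd
  rw [mem_interior_iff_mem_nhds, Metric.mem_nhds_iff] at hp₀i
  obtain ⟨R, hR, hRs⟩ := hp₀i
  have hRS : ∀ q ∈ B, dist q p₀ < R → q ∈ closure (S (a, m, i, j)) := fun q hq hqR =>
    hRs (show (⟨q, hq⟩ : B) ∈ ball ⟨p₀, hp₀⟩ R from hqR)
  set π := D a with hπ
  set s : ℝ := 1 / (i + 1) with hs
  set t : ℝ := 1 / (j + 1) with ht
  set P := ‖π‖ + 1 with hP
  have hs0 : 0 < s := by positivity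
  have ht0 : 0 < t := by positivity
  have hP1 : 1 ≤ P := by linarith [norm_nonneg π]
  have hm1 : (1 : ℝ) ≤ m + 1 := by linarith [Nat.cast_nonneg (α := ℝ) m]
  set R' := min (min (R / 4) (t / 4)) (s / (4 * P + 1)) with hR'
  have hR'0 : 0 < R' := by positivity
  have r1 : R' ≤ R / 4 := (min_le_left _ _).trans (min_le_left _ _)
  have r2 : R' ≤ t / 4 := (min_le_left _ _).trans (min_le_right _ _)
  have r3 : (4 * P + 1) * R' ≤ s := by
    have : R' ≤ s / (4 * P + 1) := min_le_right _ _
    rwa [le_div_iff₀ (by positivity), mul_comm] at this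
  have hPε : P * ε π m ≤ 1 / 2 := by
    simp only [hε, ← hP]
    rw [mul_one_div, div_le_iff₀ (by positivity)]
    have h1 : 1 ≤ ((m : ℝ) + 1) ^ 2 := one_le_pow₀ hm1
    have h2 : P ≤ P ^ 3 := le_self_pow₀ hP1 (by norm_num)
    nlinarith
  -- the cone condition at bad points
  have hcone : ∀ q ∈ B, dist q p₀ < R' → ∀ q' ∈ M, dist q' p₀ < R' →
      ‖q' - q‖ ≤ 40 * (m + 1) * ‖π (q' - q)‖ := by
    intro q hq hqR q' hq' hq'R
    have hqc := hRS q hq (by linarith)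
    have hclosed : IsClosed {x : Y | ‖q' - x‖ ≤ 40 * (m + 1) * ‖π (q' - x)‖} :=
      isClosed_le (by fun_prop) (by fun_prop)
    have hqt : q ∈ ball q' t := by
      have := dist_triangle_right q q' p₀
      rw [mem_ball]; linarith
    have hsub : ball q' t ∩ S (a, m, i, j) ⊆ {x : Y | ‖q' - x‖ ≤ 40 * (m + 1) * ‖π (q' - x)‖} := by
      rintro x ⟨hx, hxB, h, L, hst⟩
      obtain ⟨ζ, -, -, n1, n2⟩ := hst.exists_preimage hPε (hεpos _ _).le hq' (by rwa [mem_ball_comm])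
      show ‖q' - x‖ ≤ 40 * (m + 1) * ‖π (q' - x)‖
      dsimp only at n2
      nlinarith [norm_nonneg (π (q' - x))]
    exact closure_minimal hsub hclosed (mem_closure_iff_nhds.2 fun u hu => by
      obtain ⟨z, hz1, hz2⟩ := mem_closure_iff_nhds.1 hqc (u ∩ ball q' t)
        (inter_mem hu (isOpen_ball.mem_nhds hqt))
      exact ⟨z, hz1.1, hz1.2, hz2⟩)
  refine hp₀.2 (good_of_antilipschitz hM hpar hp₀.1 π (C := 40 * (m + 1)) (by positivity) hR'0 ?_)
  rintro q ⟨hq, hqR⟩ q' ⟨hq', hq'R⟩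
  rw [mem_ball] at hqR hq'R
  by_cases hq'B : q' ∈ B
  · exact hcone q' hq'B hq'R q hq hqR
  by_cases hqB : q ∈ B
  · have := hcone q hqB hqR q' hq' hq'R
    rwa [norm_sub_rev, ← norm_neg (π _), ← map_neg, neg_sub] at this
  obtain ⟨p, hpB, hpd⟩ := hBc.exists_infDist_eq_dist ⟨p₀, hp₀⟩ q
  set ρ := dist q p with hρ
  have hρ0 : 0 < ρ := dist_pos.2 fun e => hqB (e ▸ hpB)
  have hρR : ρ < R' := by
    rw [← hpd]; exact (infDist_le_dist_of_mem hp₀).trans_lt hqR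
  have hpp₀ : dist p p₀ < 2 * R' := by
    have := dist_triangle_left p p₀ q
    linarith
  obtain ⟨p', ⟨hp'B, h, L, hst⟩, hp'⟩ := Metric.mem_closure_iff.1 (hRS p hpB (by linarith)) ρ hρ0
  have hqp' : dist q p' ≤ 2 * ρ := by
    have := dist_triangle q p p'
    linarith
  refine hst.antilipschitz hm1 rfl hρ0 hq hq' (fun x hx hxq => ?_) (by rwa [← dist_eq_norm])
    (by rw [mem_ball]; linarith) ?_ ?_
  · by_contra hxg
    have := infDist_le_dist_of_mem (x := q) (show x ∈ B from ⟨hx, hxg⟩)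
    rw [hpd, dist_comm, dist_eq_norm] at this
    linarith
  · have h1 := dist_triangle q' p₀ p
    have h2 := dist_triangle q' p p'
    rw [dist_comm p₀] at h1
    rw [mem_ball]
    change _ < t
    linarith
  · refine le_trans ?_ r3
    gcongr

end

/-- The normalized arc length of the unit circle, parametrized by angle. -/
noncomputable def arcMeasure : Measure ℝ :=
  ENNReal.ofReal (2 * Real.pi)⁻¹ • (volume.restrict (Ioc 0 (2 * Real.pi)))

section arc

variable {G : Type*} [NormedAddCommGroup G] [NormedSpace ℂ G]

lemma integral_arcMeasure (F : ℝ → G) :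
    ∫ t, F t ∂arcMeasure = (2 * Real.pi)⁻¹ • ∫ t in (0:ℝ)..2 * Real.pi, F t := by
  have hp : (0:ℝ) ≤ 2 * Real.pi := by positivity
  rw [arcMeasure, MeasureTheory.integral_smul_measure, intervalIntegral.integral_of_le hp,
    ENNReal.toReal_ofReal (by positivity)]

instance : IsProbabilityMeasure arcMeasure := by
  constructor
  have hp : (0:ℝ) < 2 * Real.pi := by positivity
  simp only [arcMeasure, Measure.smul_apply, Measure.restrict_apply_univ, Real.volume_Ioc,
    smul_eq_mul, sub_zero]
  rw [← ENNReal.ofReal_mul (by positivity), inv_mul_cancel₀ hp.ne', ENNReal.ofReal_one]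

lemma integral_arcMeasure_circleMap (F : ℂ → G) :
    ∫ t, F (circleMap 0 1 t) ∂arcMeasure = Real.circleAverage F 0 1 := by
  rw [integral_arcMeasure, Real.circleAverage_def]

lemma integral_cauchy {F : ℂ → G} [CompleteSpace G] (hF : DiffContOnCl ℂ F (ball 0 1)) {z : ℂ}
    (hz : z ∈ ball (0:ℂ) 1) :
    ∫ t, (circleMap 0 1 t / (circleMap 0 1 t - z)) • F (circleMap 0 1 t) ∂arcMeasure = F z := by
  rw [integral_arcMeasure_circleMap (fun u => (u / (u - z)) • F u),
    Real.circleAverage_eq_circleIntegral one_ne_zero]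
  have h := hF.two_pi_i_inv_smul_circleIntegral_sub_inv_smul hz
  rw [← h]
  congr 1
  apply circleIntegral.integral_congr zero_le_one
  intro u hu
  have hu0 : u ≠ 0 := by rintro rfl; simp at hu
  simp only [sub_zero, smul_smul]
  congr 1
  field_simp

lemma continuous_comp_circleMap {X : Type*} [TopologicalSpace X] {F : ℂ → X}
    (hF : ContinuousOn F (closedBall 0 1)) :
    Continuous fun t => F (circleMap 0 1 t) := by
  refine hF.comp_continuous (continuous_circleMap 0 1) fun t => ?_
  exact sphere_subset_closedBall (circleMap_mem_sphere 0 zero_le_one t)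

lemma exists_bound_comp_circleMap {F : ℂ → G} (hF : ContinuousOn F (closedBall 0 1)) :
    ∃ C : ℝ, ∀ t, ‖F (circleMap 0 1 t)‖ ≤ C := by
  obtain ⟨C, hC⟩ := (isCompact_closedBall (0:ℂ) 1).exists_bound_of_continuousOn hF
  exact ⟨C, fun t => hC _ (sphere_subset_closedBall (circleMap_mem_sphere 0 zero_le_one t))⟩

lemma memLp_comp_circleMap {F : ℂ → G} (hF : ContinuousOn F (closedBall 0 1)) (p : ENNReal) :
    MemLp (fun t => F (circleMap 0 1 t)) p arcMeasure := by
  obtain ⟨C, hC⟩ := exists_bound_comp_circleMap hF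
  exact MemLp.of_bound (continuous_comp_circleMap hF).aestronglyMeasurable C
    (Eventually.of_forall hC)

lemma continuous_cauchyKernel {z : ℂ} (hz : z ∈ ball (0:ℂ) 1) :
    Continuous fun t => circleMap 0 1 t / (circleMap 0 1 t - z) := by
  refine (continuous_circleMap 0 1).div ((continuous_circleMap 0 1).sub continuous_const) ?_
  intro t h
  have h1 : ‖circleMap 0 1 t‖ = 1 := by simp
  rw [sub_eq_zero.1 h] at h1
  simp at hz
  linarith

lemma norm_circleMap_sub_ge (z : ℂ) (t : ℝ) : 1 - ‖z‖ ≤ ‖circleMap 0 1 t - z‖ := by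
  have h1 : ‖circleMap 0 1 t‖ = 1 := by simp
  have := norm_sub_norm_le (circleMap 0 1 t) z
  linarith

lemma norm_cauchyKernel_le {z : ℂ} (hz : z ∈ ball (0:ℂ) 1) (t : ℝ) :
    ‖circleMap 0 1 t / (circleMap 0 1 t - z)‖ ≤ (1 - ‖z‖)⁻¹ := by
  have h1 : ‖circleMap 0 1 t‖ = 1 := by simp
  have hz' : ‖z‖ < 1 := by simpa using hz
  rw [norm_div, h1, one_div]
  exact inv_anti₀ (by linarith) (norm_circleMap_sub_ge z t)

lemma integrable_cauchyKernel_smul {F : ℝ → G} (hF : Integrable F arcMeasure) {z : ℂ}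
    (hz : z ∈ ball (0:ℂ) 1) :
    Integrable (fun t => (circleMap 0 1 t / (circleMap 0 1 t - z)) • F t) arcMeasure :=
  hF.bdd_smul (1 - ‖z‖)⁻¹ (continuous_cauchyKernel hz).aestronglyMeasurable
    (Eventually.of_forall (norm_cauchyKernel_le hz))

lemma differentiableOn_integral_cauchyKernel [CompleteSpace G] {F : ℝ → G}
    (hF : Integrable F arcMeasure) :
    DifferentiableOn ℂ
      (fun z => ∫ t, (circleMap 0 1 t / (circleMap 0 1 t - z)) • F t ∂arcMeasure) (ball 0 1) := by
  intro z₀ hz₀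
  have hz₀' : ‖z₀‖ < 1 := by simpa using hz₀
  set r := (1 + ‖z₀‖) / 2 with hr
  have hr1 : r < 1 := by rw [hr]; linarith
  have hs : ball (0:ℂ) r ∈ 𝓝 z₀ := isOpen_ball.mem_nhds (by simp [hr]; linarith)
  have hsub : ball (0:ℂ) r ⊆ ball 0 1 := ball_subset_ball hr1.le
  have hn : ∀ t, ‖circleMap 0 1 t‖ = 1 := by simp
  have hlow : ∀ z ∈ ball (0:ℂ) r, ∀ t, 1 - r ≤ ‖circleMap 0 1 t - z‖ := fun z hz t => by
    have : ‖z‖ < r := by simpa using hz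
    linarith [norm_circleMap_sub_ge z t]
  have hne : ∀ z ∈ ball (0:ℂ) r, ∀ t, circleMap 0 1 t - z ≠ 0 := fun z hz t h => by
    have := hlow z hz t
    rw [h, norm_zero] at this
    linarith
  refine (_root_.hasDerivAt_integral_of_dominated_loc_of_deriv_le
    (F' := fun z t => (circleMap 0 1 t / (circleMap 0 1 t - z) ^ 2) • F t)
    (bound := fun t => (1 / (1 - r) ^ 2) * ‖F t‖) hs ?_ ?_ ?_ ?_ ?_ ?_).2.differentiableAt.differentiableWithinAt
  · filter_upwards [hs] with z hz
    exact (integrable_cauchyKernel_smul hF (hsub hz)).aestronglyMeasurable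
  · exact integrable_cauchyKernel_smul hF hz₀
  · refine AEStronglyMeasurable.smul (Continuous.aestronglyMeasurable ?_) hF.aestronglyMeasurable
    refine (continuous_circleMap 0 1).div
      (((continuous_circleMap 0 1).sub continuous_const).pow 2) fun t => ?_
    exact pow_ne_zero 2 (hne z₀ (mem_of_mem_nhds hs) t)
  · refine Eventually.of_forall fun t z hz => ?_
    rw [norm_smul, norm_div, norm_pow, hn]
    gcongr
    exact hlow z hz t
  · exact hF.norm.const_mul _
  · refine Eventually.of_forall fun t z hz => ?_
    have h1 : HasDerivAt (fun z => circleMap 0 1 t / (circleMap 0 1 t - z))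
        (circleMap 0 1 t / (circleMap 0 1 t - z) ^ 2) z := by
      have h2 : HasDerivAt (fun z => circleMap 0 1 t - z) (-1) z := by
        simpa using (hasDerivAt_id z).const_sub (circleMap 0 1 t)
      have h3 := (hasDerivAt_const z (circleMap 0 1 t)).div h2 (hne z hz t)
      exact h3.congr_deriv (by ring)
    exact h1.smul_const (F t)

/-- The antiholomorphic part of the Poisson kernel, extended holomorphically in `u`. -/
noncomputable def conjKernel (z u : ℂ) : ℂ := starRingEnd ℂ z * u / (1 - starRingEnd ℂ z * u)

lemma one_sub_conj_mul_ne_zero {z u : ℂ} (hz : z ∈ ball (0:ℂ) 1) (hu : ‖u‖ * ‖z‖ < 1) :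
    1 - starRingEnd ℂ z * u ≠ 0 := by
  intro h
  have : ‖starRingEnd ℂ z * u‖ = 1 := by rw [← sub_eq_zero.1 h, norm_one]
  rw [norm_mul, RCLike.norm_conj] at this
  nlinarith

lemma analyticOnNhd_conjKernel {z : ℂ} (hz : z ∈ ball (0:ℂ) 1) :
    AnalyticOnNhd ℂ (conjKernel z) (closedBall 0 1) := by
  intro u hu
  have hz' : ‖z‖ < 1 := by simpa using hz
  have hu' : ‖u‖ ≤ 1 := by simpa using hu
  unfold conjKernel
  refine AnalyticAt.div (by fun_prop) (by fun_prop) (one_sub_conj_mul_ne_zero hz ?_)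
  nlinarith [norm_nonneg z, norm_nonneg u]

lemma conjKernel_zero (z : ℂ) : conjKernel z 0 = 0 := by simp [conjKernel]

/-- The Poisson kernel on the unit circle. -/
noncomputable def arcPoisson (z : ℂ) (t : ℝ) : ℝ :=
  (1 - ‖z‖ ^ 2) / ‖circleMap 0 1 t - z‖ ^ 2

lemma arcPoisson_eq {z : ℂ} (hz : z ∈ ball (0:ℂ) 1) (t : ℝ) :
    (arcPoisson z t : ℂ) =
      circleMap 0 1 t / (circleMap 0 1 t - z) + conjKernel z (circleMap 0 1 t) := by
  have hn : ‖circleMap 0 1 t‖ = 1 := by simp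
  have hz' : ‖z‖ < 1 := by simpa using hz
  set u := circleMap 0 1 t
  have h1 : u - z ≠ 0 := by
    intro h; rw [sub_eq_zero.1 h] at hn; linarith
  have h2 := one_sub_conj_mul_ne_zero (u := u) hz (by rw [hn]; linarith)
  have hu : u * starRingEnd ℂ u = 1 := by rw [Complex.mul_conj']; simp [hn]
  have h3 : (starRingEnd ℂ) u - (starRingEnd ℂ) z ≠ 0 := by
    rw [← map_sub]; exact (map_ne_zero _).2 h1
  rw [arcPoisson]
  push_cast
  rw [← Complex.mul_conj', ← Complex.mul_conj', map_sub, conjKernel]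
  have h4 : 1 - starRingEnd ℂ z * u = u * (starRingEnd ℂ u - starRingEnd ℂ z) := by
    rw [mul_sub, hu]; ring
  have hu0 : u ≠ 0 := by rintro h; rw [h] at hn; simp at hn
  rw [h4]
  generalize starRingEnd ℂ u = a at *
  generalize starRingEnd ℂ z = b at *
  rw [mul_comm b u, mul_div_mul_left _ _ hu0, div_add_div _ _ h1 h3]
  congr 1
  linear_combination (-1 : ℂ) * hu

lemma arcPoisson_nonneg {z : ℂ} (hz : z ∈ ball (0:ℂ) 1) (t : ℝ) : 0 ≤ arcPoisson z t := by
  have hz' : ‖z‖ < 1 := by simpa using hz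
  unfold arcPoisson
  have := norm_nonneg z
  apply div_nonneg _ (by positivity)
  nlinarith

lemma continuous_arcPoisson {z : ℂ} (hz : z ∈ ball (0:ℂ) 1) : Continuous (arcPoisson z) := by
  have hz' : ‖z‖ < 1 := by simpa using hz
  refine continuous_const.div (by fun_prop) fun t => ?_
  have := norm_circleMap_sub_ge z t
  have : 0 < ‖circleMap 0 1 t - z‖ := by linarith
  positivity

lemma arcPoisson_mul_sq {z : ℂ} (hz : z ∈ ball (0:ℂ) 1) (t : ℝ) :
    arcPoisson z t * ‖circleMap 0 1 t - z‖ ^ 2 = 1 - ‖z‖ ^ 2 := by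
  have hz' : ‖z‖ < 1 := by simpa using hz
  have := norm_circleMap_sub_ge z t
  have : 0 < ‖circleMap 0 1 t - z‖ := by linarith
  unfold arcPoisson
  field_simp

lemma arcPoisson_le {z : ℂ} (hz : z ∈ ball (0:ℂ) 1) (t : ℝ) :
    ‖arcPoisson z t‖ ≤ (1 - ‖z‖ ^ 2) / (1 - ‖z‖) ^ 2 := by
  have hz' : ‖z‖ < 1 := by simpa using hz
  rw [Real.norm_of_nonneg (arcPoisson_nonneg hz t), arcPoisson]
  have := norm_circleMap_sub_ge z t
  have h0 := norm_nonneg z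
  have : 0 ≤ 1 - ‖z‖ ^ 2 := by nlinarith
  gcongr

lemma integrable_conjKernel_smul {F : ℝ → G} (hF : Integrable F arcMeasure) {z : ℂ}
    (hz : z ∈ ball (0:ℂ) 1) :
    Integrable (fun t => conjKernel z (circleMap 0 1 t) • F t) arcMeasure := by
  have h := (analyticOnNhd_conjKernel hz).continuousOn
  obtain ⟨C, hC⟩ := exists_bound_comp_circleMap h
  exact hF.bdd_smul C (continuous_comp_circleMap h).aestronglyMeasurable (Eventually.of_forall hC)

lemma integrable_arcPoisson_smul {G : Type*} [NormedAddCommGroup G] [NormedSpace ℝ G]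
    {F : ℝ → G} (hF : Integrable F arcMeasure) {z : ℂ} (hz : z ∈ ball (0:ℂ) 1) :
    Integrable (fun t => arcPoisson z t • F t) arcMeasure :=
  hF.bdd_smul _ (continuous_arcPoisson hz).aestronglyMeasurable
    (Eventually.of_forall (arcPoisson_le hz))

/-- Splitting of the Poisson integral into its Cauchy part and its conjugate part. -/
lemma integral_arcPoisson_smul [CompleteSpace G] {F : ℝ → G} (hF : Integrable F arcMeasure) {z : ℂ}
    (hz : z ∈ ball (0:ℂ) 1) :
    ∫ t, (arcPoisson z t : ℂ) • F t ∂arcMeasure =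
      ∫ t, (circleMap 0 1 t / (circleMap 0 1 t - z)) • F t ∂arcMeasure +
      ∫ t, conjKernel z (circleMap 0 1 t) • F t ∂arcMeasure := by
  rw [← MeasureTheory.integral_add (integrable_cauchyKernel_smul hF hz)
    (integrable_conjKernel_smul hF hz)]
  refine MeasureTheory.integral_congr_ae (Eventually.of_forall fun t => ?_)
  simp only [arcPoisson_eq hz, add_smul]

lemma integral_analytic {F : ℂ → G} [CompleteSpace G] (hF : DiffContOnCl ℂ F (ball 0 1)) :
    ∫ t, F (circleMap 0 1 t) ∂arcMeasure = F 0 := by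
  have h := integral_cauchy hF (z := 0) (by simp)
  rw [← h]
  refine MeasureTheory.integral_congr_ae (Eventually.of_forall fun t => ?_)
  have : circleMap 0 1 t ≠ 0 := circleMap_ne_center one_ne_zero
  simp [this]

lemma diffContOnCl_of_analyticOnNhd {F : ℂ → G} (hF : AnalyticOnNhd ℂ F (closedBall 0 1)) :
    DiffContOnCl ℂ F (ball 0 1) := by
  refine DifferentiableOn.diffContOnCl ?_
  rw [closure_ball _ one_ne_zero]
  exact hF.differentiableOn

lemma integral_arcPoisson {z : ℂ} (hz : z ∈ ball (0:ℂ) 1) : ∫ t, arcPoisson z t ∂arcMeasure = 1 := by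
  have h := integral_arcPoisson_smul (F := fun _ => (1:ℂ)) (integrable_const _) hz
  have h1 := integral_cauchy (F := fun _ => (1:ℂ)) diffContOnCl_const hz
  have h2 := integral_analytic (diffContOnCl_of_analyticOnNhd (analyticOnNhd_conjKernel hz))
  simp only [smul_eq_mul, mul_one] at h h1
  rw [h1, h2, conjKernel_zero, add_zero, integral_complex_ofReal] at h
  exact_mod_cast h

end arc

lemma integral_mul_le_sqrt {α : Type*} [MeasurableSpace α] {μ : Measure α} {f g : α → ℝ}
    (hf0 : ∀ a, 0 ≤ f a) (hg0 : ∀ a, 0 ≤ g a) (hf : MemLp f 2 μ) (hg : MemLp g 2 μ) :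
    ∫ a, f a * g a ∂μ ≤ √(∫ a, f a ^ 2 ∂μ) * √(∫ a, g a ^ 2 ∂μ) := by
  have h := integral_mul_le_Lp_mul_Lq_of_nonneg (μ := μ) (f := f) (g := g) Real.HolderConjugate.two_two
    (ae_of_all _ hf0) (ae_of_all _ hg0) (by simpa using hf) (by simpa using hg)
  simpa [Real.sqrt_eq_rpow] using h

section

variable {V : Type*} [NormedAddCommGroup V] [InnerProductSpace ℂ V] [FiniteDimensional ℂ V]
  {W : Type*} [NormedAddCommGroup W] [NormedSpace ℂ W]

lemma continuousOn_clm_apply {T : ℂ → W →L[ℂ] V} (hT : ContinuousOn T (closedBall 0 1))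
    {p : ℂ → W} (hp : AnalyticOnNhd ℂ p (closedBall 0 1)) :
    ContinuousOn (fun u => T u (p u)) (closedBall 0 1) :=
  hT.clm_apply hp.continuousOn

/-- The vector of minimal norm in the affine space `T v - closure {T p : p 0 = 0}` of `L²`. -/
lemma exists_extremal {T : ℂ → W →L[ℂ] V} (hT : ContinuousOn T (closedBall 0 1)) (v : W) :
    ∃ η : ℝ → V, MemLp η 2 arcMeasure ∧
      (∀ p : ℂ → W, AnalyticOnNhd ℂ p (closedBall 0 1) → p 0 = 0 →
        ∫ t, inner ℂ (η t) (T (circleMap 0 1 t) (p (circleMap 0 1 t))) ∂arcMeasure = 0) ∧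
      ∃ ψ : ℕ → ℂ → W, (∀ j, AnalyticOnNhd ℂ (ψ j) (closedBall 0 1) ∧ ψ j 0 = v) ∧
        Tendsto (fun j => ∫ t, ‖η t - T (circleMap 0 1 t) (ψ j (circleMap 0 1 t))‖ ^ 2 ∂arcMeasure)
          atTop (𝓝 0) := by
  classical
  let PP : Submodule ℂ (ℂ → W) :=
    { carrier := {p | AnalyticOnNhd ℂ p (closedBall 0 1) ∧ p 0 = 0}
      add_mem' := fun {p q} hp hq => ⟨hp.1.add hq.1, by simp [hp.2, hq.2]⟩
      zero_mem' := ⟨analyticOnNhd_const, rfl⟩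
      smul_mem' := fun c p hp => ⟨analyticOnNhd_const.smul hp.1, by simp [hp.2]⟩ }
  have hm : ∀ p : ℂ → W, AnalyticOnNhd ℂ p (closedBall 0 1) →
      MemLp (fun t => T (circleMap 0 1 t) (p (circleMap 0 1 t))) 2 arcMeasure := fun p hp =>
    memLp_comp_circleMap (continuousOn_clm_apply hT hp) 2
  let Λ : PP →ₗ[ℂ] Lp V 2 arcMeasure :=
    { toFun := fun p => (hm p.1 p.2.1).toLp _
      map_add' := fun p q => by
        rw [← MemLp.toLp_add]
        congr 1
        ext t
        simp
      map_smul' := fun c p => by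
        rw [RingHom.id_apply, ← MemLp.toLp_const_smul]
        congr 1
        ext t
        simp }
  let H : Submodule ℂ (Lp V 2 (arcMeasure)) := (LinearMap.range Λ).topologicalClosure
  have hHc : IsClosed (H : Set (Lp V 2 arcMeasure)) := Submodule.isClosed_topologicalClosure _
  have : CompleteSpace H := hHc.completeSpace_coe
  have hmv := hm (fun _ => v) analyticOnNhd_const
  set e : Lp V 2 arcMeasure := hmv.toLp _ with he
  set η : Lp V 2 arcMeasure := e - H.starProjection e with hη
  have hηp : η ∈ Hᗮ := Submodule.sub_starProjection_mem_orthogonal e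
  refine ⟨η, Lp.memLp η, ?_, ?_⟩
  · intro p hp hp0
    have h1 : Λ ⟨p, hp, hp0⟩ ∈ H :=
      Submodule.le_topologicalClosure _ (LinearMap.mem_range_self _ _)
    have h2 := Submodule.inner_left_of_mem_orthogonal h1 hηp
    rw [L2.inner_def] at h2
    refine (MeasureTheory.integral_congr_ae ?_).trans h2
    filter_upwards [(hm p hp).coeFn_toLp] with t ht
    have : (Λ ⟨p, hp, hp0⟩ : ℝ → V) t = T (circleMap 0 1 t) (p (circleMap 0 1 t)) := ht
    rw [this]
  · have h1 : H.starProjection e ∈ closure (LinearMap.range Λ : Set (Lp V 2 arcMeasure)) := by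
      have : H.starProjection e ∈ H := Submodule.starProjection_apply_mem _ _
      exact this
    obtain ⟨x, hx, hlim⟩ := mem_closure_iff_seq_limit.1 h1
    choose p hp using hx
    refine ⟨fun j u => v - (p j).1 u, fun j => ⟨analyticOnNhd_const.sub (p j).2.1, ?_⟩, ?_⟩
    · simp [(p j).2.2]
    have h2 : Tendsto (fun j => ‖x j - H.starProjection e‖ ^ 2) atTop (𝓝 0) := by
      have := (tendsto_iff_norm_sub_tendsto_zero.1 hlim).pow 2
      simpa using this
    refine h2.congr fun j => ?_
    have h3 : ‖x j - H.starProjection e‖ ^ 2 =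
        ∫ t, ‖(x j - H.starProjection e : Lp V 2 arcMeasure) t‖ ^ 2 ∂arcMeasure := by
      have h4 := L2.inner_def (𝕜 := ℂ) (x j - H.starProjection e) (x j - H.starProjection e)
      rw [inner_self_eq_norm_sq_to_K] at h4
      have h5 : ∀ t, inner ℂ ((x j - H.starProjection e : Lp V 2 arcMeasure) t)
          ((x j - H.starProjection e : Lp V 2 arcMeasure) t) =
          ((‖(x j - H.starProjection e : Lp V 2 arcMeasure) t‖ ^ 2 : ℝ) : ℂ) := fun t => by
        rw [inner_self_eq_norm_sq_to_K]; simp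
      simp_rw [h5] at h4
      rw [integral_complex_ofReal] at h4
      refine Complex.ofReal_injective ?_
      rw [Complex.ofReal_pow]
      exact h4
    rw [h3]
    refine MeasureTheory.integral_congr_ae ?_
    have hpj : x j = (hm (p j).1 (p j).2.1).toLp _ := (hp j).symm
    filter_upwards [(hm (p j).1 (p j).2.1).coeFn_toLp, hmv.coeFn_toLp,
      Lp.coeFn_sub (x j) (H.starProjection e), Lp.coeFn_sub e (H.starProjection e)]
      with t h7 h8 h9 h10
    rw [h9, hη, h10]
    simp only [Pi.sub_apply, map_sub]
    rw [he, h8, hpj, h7]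
    congr 2
    abel

end

section

variable {V : Type*} [NormedAddCommGroup V] [InnerProductSpace ℂ V] [FiniteDimensional ℂ V]
  {W : Type*} [NormedAddCommGroup W] [NormedSpace ℂ W]

/-- Properties of the extremal vector produced by `exists_extremal`. -/
structure IsExtremal (T : ℂ → W →L[ℂ] V) (v : W) (η : ℝ → V) (ψ : ℕ → ℂ → W) : Prop where
  cont : ContinuousOn T (closedBall 0 1)
  memLp : MemLp η 2 arcMeasure
  orth : ∀ p : ℂ → W, AnalyticOnNhd ℂ p (closedBall 0 1) → p 0 = 0 →
        ∫ t, inner ℂ (η t) (T (circleMap 0 1 t) (p (circleMap 0 1 t))) ∂arcMeasure = 0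
  analytic : ∀ j, AnalyticOnNhd ℂ (ψ j) (closedBall 0 1)
  apply_zero : ∀ j, ψ j 0 = v
  tendsto : Tendsto
    (fun j => ∫ t, ‖η t - T (circleMap 0 1 t) (ψ j (circleMap 0 1 t))‖ ^ 2 ∂arcMeasure)
          atTop (𝓝 0)

lemma memLp_clm_apply {T : ℂ → W →L[ℂ] V} (hT : ContinuousOn T (closedBall 0 1))
    {p : ℂ → W} (hp : AnalyticOnNhd ℂ p (closedBall 0 1)) :
    MemLp (fun t => T (circleMap 0 1 t) (p (circleMap 0 1 t))) 2 arcMeasure :=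
  memLp_comp_circleMap (continuousOn_clm_apply hT hp) 2

namespace IsExtremal

variable {T : ℂ → W →L[ℂ] V} {v : W} {η : ℝ → V} {ψ : ℕ → ℂ → W}

/-- The minimal norm. -/
noncomputable def cst (η : ℝ → V) : ℝ := √(∫ t, ‖η t‖ ^ 2 ∂arcMeasure)

lemma memLp_sub (h : IsExtremal T v η ψ) (j : ℕ) :
    MemLp (fun t => η t - T (circleMap 0 1 t) (ψ j (circleMap 0 1 t))) 2 arcMeasure :=
  h.memLp.sub (memLp_clm_apply h.cont (h.analytic j))

lemma tendsto_integral (h : IsExtremal T v η ψ) {G : Type*} [NormedAddCommGroup G]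
    [NormedSpace ℝ G] (F : ℕ → ℝ → G) (a : ℝ → ℝ) (ha : MemLp a 2 arcMeasure)
    (ha0 : ∀ t, 0 ≤ a t)
    (hF : ∀ j t, ‖F j t‖ ≤ a t * ‖η t - T (circleMap 0 1 t) (ψ j (circleMap 0 1 t))‖) :
    Tendsto (fun j => ∫ t, F j t ∂arcMeasure) atTop (𝓝 0) := by
  have h1 : Tendsto (fun j => √(∫ t, a t ^ 2 ∂arcMeasure) *
      √(∫ t, ‖η t - T (circleMap 0 1 t) (ψ j (circleMap 0 1 t))‖ ^ 2 ∂arcMeasure)) atTop (𝓝 0) := by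
    have := (h.tendsto.sqrt).const_mul (√(∫ t, a t ^ 2 ∂arcMeasure))
    simpa using this
  refine squeeze_zero_norm (fun j => ?_) h1
  have hj := (h.memLp_sub j).norm
  have hi : Integrable (fun t => a t * ‖η t - T (circleMap 0 1 t) (ψ j (circleMap 0 1 t))‖)
      arcMeasure := ha.integrable_mul hj
  refine (MeasureTheory.norm_integral_le_of_norm_le hi (ae_of_all _ (hF j))).trans ?_
  exact integral_mul_le_sqrt ha0 (fun _ => norm_nonneg _) ha hj

lemma integrable_inner (h : IsExtremal T v η ψ) {g : ℝ → V} (hg : MemLp g 2 arcMeasure) :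
    Integrable (fun t => inner ℂ (η t) (g t)) arcMeasure := by
  have h1 : Integrable (fun t => ‖η t‖ * ‖g t‖) arcMeasure := h.memLp.norm.integrable_mul hg.norm
  refine h1.mono' (h.memLp.aestronglyMeasurable.inner hg.aestronglyMeasurable) (ae_of_all _ ?_)
  exact fun t => norm_inner_le_norm _ _

lemma integral_conjKernel_inner (h : IsExtremal T v η ψ) {z : ℂ} (hz : z ∈ ball (0:ℂ) 1)
    {p : ℂ → W} (hp : AnalyticOnNhd ℂ p (closedBall 0 1)) :
    ∫ t, conjKernel z (circleMap 0 1 t) •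
      inner ℂ (η t) (T (circleMap 0 1 t) (p (circleMap 0 1 t))) ∂arcMeasure = 0 := by
  have h1 := h.orth (fun u => conjKernel z u • p u)
    ((analyticOnNhd_conjKernel hz).smul hp) (by simp [conjKernel_zero])
  refine Eq.trans ?_ h1
  refine MeasureTheory.integral_congr_ae (ae_of_all _ fun t => ?_)
  simp

lemma integral_conjKernel_normSq (h : IsExtremal T v η ψ) {z : ℂ} (hz : z ∈ ball (0:ℂ) 1) :
    ∫ t, conjKernel z (circleMap 0 1 t) • ((‖η t‖ ^ 2 : ℝ) : ℂ) ∂arcMeasure = 0 := by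
  obtain ⟨C, hC⟩ := exists_bound_comp_circleMap (analyticOnNhd_conjKernel hz).continuousOn
  have hC0 : 0 ≤ C := (norm_nonneg _).trans (hC 0)
  have h1 := h.tendsto_integral (fun j t => conjKernel z (circleMap 0 1 t) •
    inner ℂ (η t) (η t - T (circleMap 0 1 t) (ψ j (circleMap 0 1 t)))) (fun t => C * ‖η t‖)
    (h.memLp.norm.const_mul C) (fun t => by positivity) (fun j t => by
      rw [norm_smul, mul_assoc]
      exact mul_le_mul (hC t) (norm_inner_le_norm _ _) (norm_nonneg _) hC0)
  refine tendsto_nhds_unique ?_ h1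
  refine tendsto_const_nhds.congr fun j => ?_
  have h2 := h.integral_conjKernel_inner hz (h.analytic j)
  have i1 := integrable_conjKernel_smul (h.integrable_inner h.memLp) hz
  have i2 := integrable_conjKernel_smul
    (h.integrable_inner (memLp_clm_apply h.cont (h.analytic j))) hz
  have h3 := MeasureTheory.integral_sub i1 i2
  rw [h2, sub_zero] at h3
  calc _ = _ := ?_
    _ = _ := h3.symm
    _ = _ := ?_
  · refine MeasureTheory.integral_congr_ae (ae_of_all _ fun t => ?_)
    simp only
    rw [inner_self_eq_norm_sq_to_K]; simp
  · refine MeasureTheory.integral_congr_ae (ae_of_all _ fun t => ?_)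
    simp only [inner_sub_right, smul_sub]

lemma integral_arcPoisson_normSq (h : IsExtremal T v η ψ) {z : ℂ} (hz : z ∈ ball (0:ℂ) 1) :
    ∫ t, arcPoisson z t * ‖η t‖ ^ 2 ∂arcMeasure = cst η ^ 2 := by
  have hi : Integrable (fun t => ‖η t‖ ^ 2) arcMeasure := h.memLp.norm.integrable_sq
  have hk : ∀ t, circleMap 0 1 t / (circleMap 0 1 t - z) =
      1 + starRingEnd ℂ (conjKernel z (circleMap 0 1 t)) := by
    intro t
    have hn : ‖circleMap 0 1 t‖ = 1 := by simp
    have hz' : ‖z‖ < 1 := by simpa using hz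
    set u := circleMap 0 1 t
    have h1 : u - z ≠ 0 := by
      intro h; rw [sub_eq_zero.1 h] at hn; linarith
    have hu : u * starRingEnd ℂ u = 1 := by rw [Complex.mul_conj']; simp [hn]
    have h2 : 1 - z * starRingEnd ℂ u = starRingEnd ℂ u * (u - z) := by
      rw [mul_sub, mul_comm _ u, hu]; ring
    have h3 : starRingEnd ℂ u ≠ 0 := right_ne_zero_of_mul_eq_one hu
    simp only [conjKernel, map_div₀, map_mul, map_sub, map_one, Complex.conj_conj]
    rw [h2, mul_comm z, mul_div_mul_left _ _ h3]
    field_simp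
    ring
  have h0 := h.integral_conjKernel_normSq hz
  have h1 := integral_arcPoisson_smul (F := fun t => ((‖η t‖ ^ 2 : ℝ) : ℂ)) hi.ofReal hz
  rw [h0, add_zero] at h1
  have i1 := (integrable_conjKernel_smul (F := fun t => ((‖η t‖ ^ 2 : ℝ) : ℂ)) hi.ofReal hz)
  have h2 : ∫ t, starRingEnd ℂ (conjKernel z (circleMap 0 1 t) • ((‖η t‖ ^ 2 : ℝ) : ℂ)) ∂arcMeasure
      = 0 := by
    rw [integral_conj, h0, map_zero]
  have h3 : ∫ t, (((‖η t‖ ^ 2 : ℝ) : ℂ) +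
      starRingEnd ℂ (conjKernel z (circleMap 0 1 t) • ((‖η t‖ ^ 2 : ℝ) : ℂ))) ∂arcMeasure =
      ((∫ t, ‖η t‖ ^ 2 ∂arcMeasure : ℝ) : ℂ) := by
    have i2 : Integrable (fun t => starRingEnd ℂ
        (conjKernel z (circleMap 0 1 t) • ((‖η t‖ ^ 2 : ℝ) : ℂ))) arcMeasure :=
      (RCLike.conjCLE (K := ℂ)).toContinuousLinearMap.integrable_comp i1
    have i3 : Integrable (fun t => ((‖η t‖ ^ 2 : ℝ) : ℂ)) arcMeasure := hi.ofReal
    rw [MeasureTheory.integral_add i3 i2, h2, add_zero, integral_complex_ofReal]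
  have h4 : ((∫ t, arcPoisson z t * ‖η t‖ ^ 2 ∂arcMeasure : ℝ) : ℂ) =
      ((∫ t, ‖η t‖ ^ 2 ∂arcMeasure : ℝ) : ℂ) := by
    rw [← h3, ← integral_complex_ofReal]
    refine Eq.trans ?_ (h1.trans ?_)
    · refine MeasureTheory.integral_congr_ae (ae_of_all _ fun t => ?_)
      simp
    · refine MeasureTheory.integral_congr_ae (ae_of_all _ fun t => ?_)
      simp only [hk, smul_eq_mul, map_mul, Complex.conj_ofReal]
      ring
  rw [cst, Real.sq_sqrt (MeasureTheory.integral_nonneg fun t => by positivity)]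
  exact_mod_cast h4

/-- The Cauchy pairing of the extremal vector with constant sections. -/
noncomputable def pairing (T : ℂ → W →L[ℂ] V) (η : ℝ → V) (z : ℂ) (a : W) : ℂ :=
  ∫ t, (circleMap 0 1 t / (circleMap 0 1 t - z)) • inner ℂ (η t) (T (circleMap 0 1 t) a) ∂arcMeasure

lemma memLp_sqrt_arcPoisson_mul {g : ℝ → ℝ} (hg : MemLp g 2 arcMeasure) {z : ℂ}
    (hz : z ∈ ball (0:ℂ) 1) : MemLp (fun t => √(arcPoisson z t) * g t) 2 arcMeasure := by
  have hm : AEStronglyMeasurable (fun t => √(arcPoisson z t) * g t) arcMeasure :=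
    ((continuous_arcPoisson hz).sqrt).aestronglyMeasurable.mul hg.aestronglyMeasurable
  refine (memLp_two_iff_integrable_sq hm).2 ?_
  have := integrable_arcPoisson_smul hg.integrable_sq hz
  refine this.congr (ae_of_all _ fun t => ?_)
  simp only [smul_eq_mul]
  rw [mul_pow, Real.sq_sqrt (arcPoisson_nonneg hz t)]

lemma integral_arcPoisson_mul_le (h : IsExtremal T v η ψ) {z : ℂ} (hz : z ∈ ball (0:ℂ) 1)
    {g : ℝ → ℝ} (hg : MemLp g 2 arcMeasure) (hg0 : ∀ t, 0 ≤ g t) :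
    ∫ t, arcPoisson z t * (‖η t‖ * g t) ∂arcMeasure ≤
      cst η * √(∫ t, arcPoisson z t * g t ^ 2 ∂arcMeasure) := by
  have h1 := integral_mul_le_sqrt (f := fun t => √(arcPoisson z t) * ‖η t‖)
    (g := fun t => √(arcPoisson z t) * g t) (fun t => by positivity)
    (fun t => mul_nonneg (by positivity) (hg0 t))
    (memLp_sqrt_arcPoisson_mul h.memLp.norm hz) (memLp_sqrt_arcPoisson_mul hg hz)
  have h2 : ∀ t, √(arcPoisson z t) ^ 2 = arcPoisson z t := fun t =>
    Real.sq_sqrt (arcPoisson_nonneg hz t)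
  simp only [mul_pow, h2] at h1
  rw [h.integral_arcPoisson_normSq hz, Real.sqrt_sq (show 0 ≤ cst η from Real.sqrt_nonneg _)] at h1
  refine le_trans (le_of_eq ?_) h1
  refine MeasureTheory.integral_congr_ae (ae_of_all _ fun t => ?_)
  simp only
  nth_rw 1 [← h2 t]
  ring

lemma norm_pairing_le (h : IsExtremal T v η ψ) {z : ℂ} (hz : z ∈ ball (0:ℂ) 1) (a : W) :
    ‖pairing T η z a‖ ≤
      cst η * √(∫ t, arcPoisson z t * ‖T (circleMap 0 1 t) a‖ ^ 2 ∂arcMeasure) := by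
  have hma := memLp_clm_apply h.cont (analyticOnNhd_const (v := a))
  have h1 := integral_arcPoisson_smul (h.integrable_inner hma) hz
  rw [h.integral_conjKernel_inner hz analyticOnNhd_const, add_zero] at h1
  rw [pairing, ← h1]
  refine le_trans ?_ (h.integral_arcPoisson_mul_le hz hma.norm fun t => norm_nonneg _)
  have hi : Integrable (fun t => ‖η t‖ * ‖T (circleMap 0 1 t) a‖) arcMeasure :=
    h.memLp.norm.integrable_mul hma.norm
  refine MeasureTheory.norm_integral_le_of_norm_le (integrable_arcPoisson_smul hi hz)
    (ae_of_all _ fun t => ?_)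
  rw [norm_smul, Complex.norm_real, Real.norm_of_nonneg (arcPoisson_nonneg hz t)]
  exact mul_le_mul_of_nonneg_left (norm_inner_le_norm _ _) (arcPoisson_nonneg hz t)

lemma pairing_zero (h : IsExtremal T v η ψ) : pairing T η 0 v = ((cst η ^ 2 : ℝ) : ℂ) := by
  have hk : pairing T η 0 v = ∫ t, inner ℂ (η t) (T (circleMap 0 1 t) v) ∂arcMeasure := by
    refine MeasureTheory.integral_congr_ae (ae_of_all _ fun t => ?_)
    have : circleMap 0 1 t ≠ 0 := circleMap_ne_center one_ne_zero
    simp [this]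
  have h1 := h.tendsto_integral (fun j t =>
    inner ℂ (η t) (η t - T (circleMap 0 1 t) (ψ j (circleMap 0 1 t)))) (fun t => ‖η t‖)
    h.memLp.norm (fun t => by positivity) (fun j t => norm_inner_le_norm _ _)
  have h2 : ((cst η ^ 2 : ℝ) : ℂ) - pairing T η 0 v = 0 := by
    refine tendsto_nhds_unique (tendsto_const_nhds.congr fun j => ?_) h1
    have hmv := memLp_clm_apply h.cont (analyticOnNhd_const (v := v))
    have hmj := memLp_clm_apply h.cont (h.analytic j)
    have h3 := h.orth (fun u => ψ j u - v) ((h.analytic j).sub analyticOnNhd_const)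
      (by simp [h.apply_zero])
    simp only [map_sub, inner_sub_right] at h3 ⊢
    rw [MeasureTheory.integral_sub (h.integrable_inner hmj) (h.integrable_inner hmv)] at h3
    rw [MeasureTheory.integral_sub (h.integrable_inner h.memLp) (h.integrable_inner hmj), hk,
      sub_eq_zero.1 h3]
    congr 1
    rw [cst, Real.sq_sqrt (MeasureTheory.integral_nonneg fun t => by positivity),
      ← integral_complex_ofReal]
    refine MeasureTheory.integral_congr_ae (ae_of_all _ fun t => ?_)
    simp only
    rw [inner_self_eq_norm_sq_to_K]; simp
  exact (sub_eq_zero.1 h2).symm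

end IsExtremal

end

section

variable {V : Type*} [NormedAddCommGroup V] [InnerProductSpace ℂ V] [FiniteDimensional ℂ V]
  {W : Type*} [NormedAddCommGroup W] [NormedSpace ℂ W]

namespace IsExtremal

variable {T : ℂ → W →L[ℂ] V} {v : W} {η : ℝ → V} {ψ : ℕ → ℂ → W}

lemma integrable_pairing (h : IsExtremal T v η ψ) {z : ℂ} (hz : z ∈ ball (0:ℂ) 1) (a : W) :
    Integrable (fun t => (circleMap 0 1 t / (circleMap 0 1 t - z)) •
      inner ℂ (η t) (T (circleMap 0 1 t) a)) arcMeasure :=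
  integrable_cauchyKernel_smul
    (h.integrable_inner (memLp_clm_apply h.cont (analyticOnNhd_const (v := a)))) hz

lemma pairing_smul (c : ℂ) (z : ℂ) (a : W) :
    pairing T η z (c • a) = c * pairing T η z a := by
  unfold pairing
  rw [← MeasureTheory.integral_const_mul]
  refine MeasureTheory.integral_congr_ae (ae_of_all _ fun t => ?_)
  simp
  ring

lemma pairing_sum (h : IsExtremal T v η ψ) {z : ℂ} (hz : z ∈ ball (0:ℂ) 1) {ι : Type*}
    (s : Finset ι) (a : ι → W) :
    pairing T η z (∑ i ∈ s, a i) = ∑ i ∈ s, pairing T η z (a i) := by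
  unfold pairing
  rw [← MeasureTheory.integral_finsetSum s fun i _ => h.integrable_pairing hz (a i)]
  refine MeasureTheory.integral_congr_ae (ae_of_all _ fun t => ?_)
  simp [Finset.mul_sum]

lemma pairing_eq_sum [FiniteDimensional ℂ W] (h : IsExtremal T v η ψ) {z : ℂ}
    (hz : z ∈ ball (0:ℂ) 1) (a : W) :
    pairing T η z a = ∑ i, ((Module.finBasis ℂ W).coord i).toContinuousLinearMap a *
      pairing T η z (Module.finBasis ℂ W i) := by
  conv_lhs => rw [← (Module.finBasis ℂ W).sum_repr a]
  rw [h.pairing_sum hz]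
  simp [pairing_smul]

lemma differentiableOn_pairing (h : IsExtremal T v η ψ) (a : W) :
    DifferentiableOn ℂ (fun z => pairing T η z a) (ball 0 1) :=
  differentiableOn_integral_cauchyKernel
    (h.integrable_inner (memLp_clm_apply h.cont (analyticOnNhd_const (v := a))))

lemma continuousOn_pairing [FiniteDimensional ℂ W] (h : IsExtremal T v η ψ) :
    ContinuousOn (fun x : ℂ × W => pairing T η x.1 x.2) (ball 0 1 ×ˢ univ) := by
  refine ContinuousOn.congr (f := fun x : ℂ × W =>
    ∑ i, ((Module.finBasis ℂ W).coord i).toContinuousLinearMap x.2 *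
      pairing T η x.1 (Module.finBasis ℂ W i)) ?_ fun x hx => h.pairing_eq_sum hx.1 x.2
  refine continuousOn_finsetSum _ fun i _ => ?_
  refine ContinuousOn.mul (by fun_prop) ?_
  exact (h.differentiableOn_pairing _).continuousOn.comp continuousOn_fst fun x hx => hx.1

lemma differentiableAt_pairing [FiniteDimensional ℂ W] (h : IsExtremal T v η ψ) {z : ℂ}
    (hz : z ∈ ball (0:ℂ) 1) {σ : ℂ → W} (hσ : DifferentiableAt ℂ σ z) :
    DifferentiableAt ℂ (fun z => pairing T η z (σ z)) z := by
  have h1 : DifferentiableAt ℂ (fun z =>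
    ∑ i, ((Module.finBasis ℂ W).coord i).toContinuousLinearMap (σ z) *
      pairing T η z (Module.finBasis ℂ W i)) z := by
    refine DifferentiableAt.fun_sum fun i _ => ?_
    refine DifferentiableAt.mul ?_
      ((h.differentiableOn_pairing _).differentiableAt (isOpen_ball.mem_nhds hz))
    exact (ContinuousLinearMap.differentiableAt _).comp z hσ
  refine h1.congr_of_eventuallyEq ?_
  filter_upwards [isOpen_ball.mem_nhds hz] with w hw
  exact h.pairing_eq_sum hw _

/-- Near the boundary the pairing is bounded by the minimal norm, up to a small error. -/
lemma pairing_boundary (h : IsExtremal T v η ψ) {κ ν : ℝ} (hν : 0 < ν)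
    (hlip : ∀ x ∈ closedBall (0:ℂ) 1, ∀ y ∈ closedBall (0:ℂ) 1, ‖T x - T y‖ ≤ κ * ‖x - y‖)
    (hlow : ∀ x ∈ closedBall (0:ℂ) 1, ∀ a, ν * ‖a‖ ≤ ‖T x a‖) {c : ℝ} (hc : cst η < c) :
    ∃ ρ, 0 < ρ ∧ ρ < 1 ∧ ∀ z : ℂ, ‖z‖ = ρ → ∀ a, ‖pairing T η z a‖ ≤ c * ‖T z a‖ := by
  have hc0 : 0 ≤ cst η := Real.sqrt_nonneg _
  set μ := κ / ν with hμ
  have hlim : Tendsto (fun δ : ℝ => cst η * √(1 + δ + (δ + 1) * δ * μ ^ 2)) (𝓝[>] 0)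
      (𝓝 (cst η)) := by
    have : Continuous (fun δ : ℝ => cst η * √(1 + δ + (δ + 1) * δ * μ ^ 2)) := by fun_prop
    have h1 := this.tendsto 0
    simp only [add_zero, mul_zero, zero_mul, Real.sqrt_one, mul_one] at h1
    exact h1.mono_left nhdsWithin_le_nhds
  have hev := hlim.eventually (gt_mem_nhds hc)
  have hev2 : ∀ᶠ δ : ℝ in 𝓝[>] 0, δ ∈ Ioo (0:ℝ) 1 := Ioo_mem_nhdsGT one_pos
  obtain ⟨δ, hδc, hδ0, hδ1⟩ := (hev.and hev2).exists
  have hs : 0 < 1 - δ ^ 2 := by nlinarith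
  refine ⟨√(1 - δ ^ 2), Real.sqrt_pos.2 hs, ?_, fun z hz a => ?_⟩
  · rw [Real.sqrt_lt' one_pos]; nlinarith
  have hz2 : 1 - ‖z‖ ^ 2 = δ ^ 2 := by rw [hz, Real.sq_sqrt hs.le]; ring
  have hz1 : ‖z‖ < 1 := by nlinarith [norm_nonneg z]
  have hzb : z ∈ ball (0:ℂ) 1 := by simpa using hz1
  have hzc : z ∈ closedBall (0:ℂ) 1 := ball_subset_closedBall hzb
  have hκ0 : ∀ t, ‖T (circleMap 0 1 t) - T z‖ ≤ κ * ‖circleMap 0 1 t - z‖ := fun t =>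
    hlip _ (sphere_subset_closedBall (circleMap_mem_sphere 0 zero_le_one t)) _ hzc
  set b := ‖T z a‖ with hb
  have hb0 : 0 ≤ b := norm_nonneg _
  have hpt : ∀ t, ‖T (circleMap 0 1 t) a‖ ≤ b * (1 + |μ| * ‖circleMap 0 1 t - z‖) := by
    intro t
    have h1 : ‖T (circleMap 0 1 t) a‖ ≤ b + κ * ‖circleMap 0 1 t - z‖ * ‖a‖ := by
      have h2 : T (circleMap 0 1 t) a = T z a + (T (circleMap 0 1 t) - T z) a := by simp
      rw [h2]
      refine (norm_add_le _ _).trans (add_le_add le_rfl ?_)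
      exact (ContinuousLinearMap.le_opNorm _ _).trans
        (mul_le_mul_of_nonneg_right (hκ0 t) (norm_nonneg _))
    have h3 : ‖a‖ ≤ b / ν := by rw [le_div_iff₀' hν]; exact hlow z hzc a
    have h4 : κ * ‖a‖ ≤ |μ| * b := by
      calc κ * ‖a‖ ≤ |κ| * (b / ν) := by
            gcongr
            exact le_abs_self κ
        _ = |μ| * b := by rw [hμ, abs_div, abs_of_pos hν]; ring
    have h5 := mul_le_mul_of_nonneg_right h4 (norm_nonneg (circleMap 0 1 t - z))
    nlinarith
  have hsq : ∀ t, arcPoisson z t * ‖T (circleMap 0 1 t) a‖ ^ 2 ≤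
      b ^ 2 * ((1 + δ) * arcPoisson z t + (δ + 1) * δ * μ ^ 2) := by
    intro t
    have hP := arcPoisson_nonneg hzb t
    set x := ‖circleMap 0 1 t - z‖ with hx
    have hPx : arcPoisson z t * x ^ 2 = δ ^ 2 := by rw [hx, arcPoisson_mul_sq hzb, hz2]
    have h1 : ‖T (circleMap 0 1 t) a‖ ^ 2 ≤ (b * (1 + |μ| * x)) ^ 2 :=
      pow_le_pow_left₀ (norm_nonneg _) (hpt t) 2
    have h2 : δ * (1 + |μ| * x) ^ 2 ≤ δ * (1 + δ) + (1 + δ) * μ ^ 2 * x ^ 2 := by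
      have := sq_nonneg (δ - |μ| * x)
      rw [← sq_abs μ]
      nlinarith
    have h3 : arcPoisson z t * ‖T (circleMap 0 1 t) a‖ ^ 2 ≤
        arcPoisson z t * (b ^ 2 * (1 + |μ| * x) ^ 2) := by
      rw [mul_pow] at h1
      exact mul_le_mul_of_nonneg_left h1 hP
    refine h3.trans ?_
    have h4 : (1 + |μ| * x) ^ 2 ≤ (1 + δ) + (1 + δ) * μ ^ 2 * x ^ 2 / δ := by
      have h6 : δ * ((1 + δ) + (1 + δ) * μ ^ 2 * x ^ 2 / δ) =
        δ * (1 + δ) + (1 + δ) * μ ^ 2 * x ^ 2 := by field_simp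
      rw [← h6] at h2
      exact le_of_mul_le_mul_left h2 hδ0
    calc arcPoisson z t * (b ^ 2 * (1 + |μ| * x) ^ 2)
        ≤ arcPoisson z t * (b ^ 2 * ((1 + δ) + (1 + δ) * μ ^ 2 * x ^ 2 / δ)) := by gcongr
      _ = b ^ 2 * ((1 + δ) * arcPoisson z t + (1 + δ) * μ ^ 2 * (arcPoisson z t * x ^ 2) / δ) := by
          ring
      _ = _ := by rw [hPx]; field_simp; ring
  have hma := memLp_clm_apply h.cont (analyticOnNhd_const (v := a))
  have iP : Integrable (fun t => arcPoisson z t) arcMeasure := by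
    simpa using integrable_arcPoisson_smul (F := fun _ => (1:ℝ)) (integrable_const _) hzb
  have hpoisson : ∫ t, arcPoisson z t * ‖T (circleMap 0 1 t) a‖ ^ 2 ∂arcMeasure ≤
      b ^ 2 * (1 + δ + (δ + 1) * δ * μ ^ 2) := by
    have h1 := MeasureTheory.integral_mono
      (integrable_arcPoisson_smul hma.norm.integrable_sq hzb)
      (((iP.const_mul (1 + δ)).add (integrable_const ((δ + 1) * δ * μ ^ 2))).const_mul (b ^ 2))
      (fun t => hsq t)
    refine h1.trans (le_of_eq ?_)
    rw [MeasureTheory.integral_const_mul]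
    congr 1
    rw [MeasureTheory.integral_add' (iP.const_mul (1 + δ)) (integrable_const _),
      MeasureTheory.integral_const_mul, integral_arcPoisson hzb]
    simp
  refine (h.norm_pairing_le hzb a).trans ?_
  calc cst η * √(∫ t, arcPoisson z t * ‖T (circleMap 0 1 t) a‖ ^ 2 ∂arcMeasure)
      ≤ cst η * √(b ^ 2 * (1 + δ + (δ + 1) * δ * μ ^ 2)) := by gcongr
    _ = (cst η * √(1 + δ + (δ + 1) * δ * μ ^ 2)) * b := by
        rw [Real.sqrt_mul (sq_nonneg _), Real.sqrt_sq hb0]; ring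
    _ ≤ c * b := by gcongr

lemma exists_norm_gt_of_eventually {z₀ : ℂ} {p : ℂ → Prop} (hp : ∀ᶠ z in 𝓝 z₀, p z) :
    ∃ z, ‖z₀‖ < ‖z‖ ∧ p z := by
  obtain ⟨e, he, hz⟩ : ∃ e : ℂ, ‖e‖ = 1 ∧ z₀ = (‖z₀‖ : ℂ) * e := by
    by_cases h : z₀ = 0
    · exact ⟨1, by simp, by simp [h]⟩
    · refine ⟨z₀ / ‖z₀‖, ?_, ?_⟩
      · simp [h]
      · have : (‖z₀‖ : ℂ) ≠ 0 := by simpa using h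
        field_simp
  have h1 : Tendsto (fun s : ℝ => ((‖z₀‖ + s : ℝ) : ℂ) * e) (𝓝[>] 0) (𝓝 z₀) := by
    have : Continuous (fun s : ℝ => ((‖z₀‖ + s : ℝ) : ℂ) * e) := by fun_prop
    have h2 := this.tendsto 0
    rw [add_zero, ← hz] at h2
    exact h2.mono_left nhdsWithin_le_nhds
  have h3 : ∀ᶠ s : ℝ in 𝓝[>] 0, 0 < s := self_mem_nhdsWithin
  obtain ⟨s, hs, hs0⟩ := ((h1.eventually hp).and h3).exists
  refine ⟨_, ?_, hs⟩
  rw [norm_mul, he, Complex.norm_real, Real.norm_of_nonneg (by positivity)]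
  linarith

/-- The maximum principle for the pairing. -/
lemma norm_pairing_zero_le [FiniteDimensional ℂ W] (h : IsExtremal T v η ψ) {κ ν : ℝ} (hν : 0 < ν)
    (hlip : ∀ x ∈ closedBall (0:ℂ) 1, ∀ y ∈ closedBall (0:ℂ) 1, ‖T x - T y‖ ≤ κ * ‖x - y‖)
    (hlow : ∀ x ∈ closedBall (0:ℂ) 1, ∀ a, ν * ‖a‖ ≤ ‖T x a‖)
    (hloc : ∀ z₀ ∈ ball (0:ℂ) 1, ∀ a, ∃ σ : ℂ → W, AnalyticAt ℂ σ z₀ ∧ σ z₀ = a ∧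
      ∀ᶠ z in 𝓝 z₀, ‖T z (σ z)‖ ≤ ‖T z₀ a‖) (a : W) :
    ‖pairing T η 0 a‖ ≤ cst η * ‖T 0 a‖ := by
  have h0c : (0:ℂ) ∈ closedBall (0:ℂ) 1 := by simp
  suffices H : ∀ c, cst η < c → ‖pairing T η 0 a‖ ≤ c * ‖T 0 a‖ by
    have hlim : Tendsto (fun c : ℝ => c * ‖T 0 a‖) (𝓝[>] cst η) (𝓝 (cst η * ‖T 0 a‖)) :=
      ((continuous_id.mul continuous_const).tendsto _).mono_left nhdsWithin_le_nhds
    exact ge_of_tendsto hlim (eventually_mem_nhdsWithin.mono fun c hc => H c hc)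
  intro c hc
  by_contra! hcon
  obtain ⟨ρ, hρ0, hρ1, hρ⟩ := h.pairing_boundary hν hlip hlow hc
  have ha : a ≠ 0 := by
    rintro rfl
    have := pairing_smul (T := T) (η := η) 0 0 (0 : W)
    rw [zero_smul, zero_mul] at this
    simp [this] at hcon
  have hTa : 0 < ‖T 0 a‖ := lt_of_lt_of_le (by positivity) (hlow 0 h0c a)
  have : ProperSpace W := FiniteDimensional.proper ℂ W
  have hsub : closedBall (0:ℂ) ρ ⊆ ball 0 1 := closedBall_subset_ball hρ1
  have hsub' : closedBall (0:ℂ) ρ ⊆ closedBall 0 1 := hsub.trans ball_subset_closedBall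
  have hcontT : ContinuousOn (fun x : ℂ × W => ‖T x.1 x.2‖) (closedBall 0 ρ ×ˢ univ) := by
    refine ContinuousOn.norm (ContinuousOn.clm_apply ?_ continuousOn_snd)
    exact h.cont.comp continuousOn_fst fun x hx => hsub' hx.1
  have hcontP : ContinuousOn (fun x : ℂ × W => ‖pairing T η x.1 x.2‖) (closedBall 0 ρ ×ˢ univ) :=
    (h.continuousOn_pairing.mono (prod_mono hsub le_rfl)).norm
  set D : Set (ℂ × W) := closedBall 0 ρ ×ˢ closedBall 0 ν⁻¹ with hD
  have hDc : IsCompact D := (isCompact_closedBall _ _).prod (isCompact_closedBall _ _)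
  have hDu : D ⊆ closedBall 0 ρ ×ˢ univ := prod_mono le_rfl (subset_univ _)
  set K : Set (ℂ × W) := D ∩ (fun x : ℂ × W => ‖T x.1 x.2‖) ⁻¹' {1} with hK
  have hKc : IsCompact K := hDc.of_isClosed_subset
    ((hcontT.mono hDu).preimage_isClosed_of_isClosed hDc.isClosed isClosed_singleton)
    inter_subset_left
  have hKmem : ∀ z ∈ closedBall (0:ℂ) ρ, ∀ b, ‖T z b‖ = 1 → (z, b) ∈ K := fun z hz b hb => by
    refine ⟨⟨hz, ?_⟩, hb⟩
    have := hlow z (hsub' hz) b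
    rw [hb] at this
    rw [mem_closedBall_zero_iff, ← one_div, le_div_iff₀' hν]
    exact this
  have h0ρ : (0:ℂ) ∈ closedBall (0:ℂ) ρ := by simp [hρ0.le]
  have hKne : ((0:ℂ), ((‖T 0 a‖ : ℂ)⁻¹ • a)) ∈ K := by
    refine hKmem 0 h0ρ _ ?_
    rw [map_smul, norm_smul, norm_inv, Complex.norm_real, norm_norm, inv_mul_cancel₀ hTa.ne']
  have hKD : K ⊆ closedBall 0 ρ ×ˢ univ := inter_subset_left.trans hDu
  obtain ⟨x₁, hx₁K, hx₁⟩ := hKc.exists_isMaxOn ⟨_, hKne⟩ (hcontP.mono hKD)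
  set m := ‖pairing T η x₁.1 x₁.2‖ with hm
  have hmc : c < m := by
    have h1 := hx₁ hKne
    simp only [mem_setOf_eq, pairing_smul, norm_mul, norm_inv, Complex.norm_real, norm_norm] at h1
    refine lt_of_lt_of_le ?_ h1
    rw [← div_eq_inv_mul, lt_div_iff₀ hTa]
    exact hcon
  set K' : Set (ℂ × W) := K ∩ (fun x : ℂ × W => ‖pairing T η x.1 x.2‖) ⁻¹' {m} with hK'
  have hK'c : IsCompact K' := hKc.of_isClosed_subset
    ((hcontP.mono hKD).preimage_isClosed_of_isClosed hKc.isClosed isClosed_singleton)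
    inter_subset_left
  obtain ⟨x₂, hx₂K', hx₂⟩ := hK'c.exists_isMaxOn (f := fun x => ‖x.1‖) ⟨x₁, hx₁K, rfl⟩
    (by fun_prop)
  obtain ⟨z₀, a₀⟩ := x₂
  have hz₀ρ : z₀ ∈ closedBall (0:ℂ) ρ := hx₂K'.1.1.1
  have hT1 : ‖T z₀ a₀‖ = 1 := hx₂K'.1.2
  have hPm : ‖pairing T η z₀ a₀‖ = m := hx₂K'.2
  have hlt : ‖z₀‖ < ρ := by
    refine lt_of_le_of_ne (by simpa using hz₀ρ) fun heq => ?_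
    have := hρ z₀ heq a₀
    rw [hT1, hPm] at this
    linarith
  obtain ⟨σ, hσa, hσ0, hσ⟩ := hloc z₀ (hsub hz₀ρ) a₀
  have hev : ∀ᶠ z in 𝓝 z₀, z ∈ ball (0:ℂ) ρ := isOpen_ball.mem_nhds (by simpa using hlt)
  have hdiff : ∀ᶠ z in 𝓝 z₀, DifferentiableAt ℂ (fun z => pairing T η z (σ z)) z := by
    filter_upwards [hev, hσa.eventually_analyticAt] with z hz hσz
    exact h.differentiableAt_pairing (hsub (ball_subset_closedBall hz)) hσz.differentiableAt
  have hbound : ∀ z ∈ closedBall (0:ℂ) ρ, ∀ b, ‖pairing T η z b‖ ≤ m * ‖T z b‖ := by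
    intro z hz b
    by_cases hb : ‖T z b‖ = 0
    · have hb0 : b = 0 := by
        have := hlow z (hsub' hz) b
        rw [hb] at this
        exact norm_le_zero_iff.1 (by nlinarith [norm_nonneg b])
      have := pairing_smul (T := T) (η := η) 0 z (0 : W)
      rw [zero_smul, zero_mul] at this
      simp [hb0, this]
    · have hb' : 0 < ‖T z b‖ := lt_of_le_of_ne (norm_nonneg _) (Ne.symm hb)
      have h1 := hx₁ (hKmem z hz ((‖T z b‖ : ℂ)⁻¹ • b) (by
        rw [map_smul, norm_smul, norm_inv, Complex.norm_real, norm_norm, inv_mul_cancel₀ hb]))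
      simp only [mem_setOf_eq, pairing_smul, norm_mul, norm_inv, Complex.norm_real,
        norm_norm] at h1
      rw [← div_eq_inv_mul, div_le_iff₀ hb'] at h1
      exact h1
  have hm0 : 0 ≤ m := norm_nonneg _
  have hmax : IsLocalMax (norm ∘ fun z => pairing T η z (σ z)) z₀ := by
    filter_upwards [hev, hσ] with z hz hσz
    simp only [Function.comp_apply, hσ0, hPm]
    rw [hT1] at hσz
    calc _ ≤ m * ‖T z (σ z)‖ := hbound z (ball_subset_closedBall hz) _
      _ ≤ m := mul_le_of_le_one_right hm0 hσz
  have hconst := Complex.norm_eventually_eq_of_isLocalMax hdiff hmax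
  obtain ⟨z, hzgt, ⟨hz, hσz⟩, hzm⟩ := exists_norm_gt_of_eventually ((hev.and hσ).and hconst)
  rw [hσ0, hPm] at hzm
  have hzρ := ball_subset_closedBall hz
  have h1 : ‖T z (σ z)‖ = 1 := by
    refine le_antisymm (hσz.trans hT1.le) ?_
    have := hbound z hzρ (σ z)
    rw [hzm] at this
    by_contra! hlt1
    have hmpos : 0 < m := lt_of_le_of_lt (Real.sqrt_nonneg _) (hc.trans hmc)
    nlinarith
  have h2 := hx₂ (show (z, σ z) ∈ K' from ⟨hKmem z hzρ _ h1, hzm⟩)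
  exact absurd h2 (not_le.2 hzgt)

lemma cst_le [FiniteDimensional ℂ W] (h : IsExtremal T v η ψ) {κ ν : ℝ} (hν : 0 < ν)
    (hlip : ∀ x ∈ closedBall (0:ℂ) 1, ∀ y ∈ closedBall (0:ℂ) 1, ‖T x - T y‖ ≤ κ * ‖x - y‖)
    (hlow : ∀ x ∈ closedBall (0:ℂ) 1, ∀ a, ν * ‖a‖ ≤ ‖T x a‖)
    (hloc : ∀ z₀ ∈ ball (0:ℂ) 1, ∀ a, ∃ σ : ℂ → W, AnalyticAt ℂ σ z₀ ∧ σ z₀ = a ∧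
      ∀ᶠ z in 𝓝 z₀, ‖T z (σ z)‖ ≤ ‖T z₀ a‖) :
    cst η ≤ ‖T 0 v‖ := by
  have h1 := h.norm_pairing_zero_le hν hlip hlow hloc v
  rw [h.pairing_zero, Complex.norm_real, Real.norm_of_nonneg (sq_nonneg _), sq] at h1
  rcases (show 0 ≤ cst η from Real.sqrt_nonneg _).eq_or_lt with h0 | h0
  · rw [← h0]; exact norm_nonneg _
  · exact le_of_mul_le_mul_left h1 h0

end IsExtremal

end

theorem analyticAt_clm_apply {F V W : Type*} [NormedAddCommGroup F] [NormedSpace ℂ F]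
    [NormedAddCommGroup V] [NormedSpace ℂ V] [NormedAddCommGroup W] [NormedSpace ℂ W]
    {B : F → W →L[ℂ] V} {σ : F → W} {z : F} (hB : AnalyticAt ℂ B z) (hσ : AnalyticAt ℂ σ z) :
    AnalyticAt ℂ (fun u => B u (σ u)) z :=
  ((ContinuousLinearMap.id ℂ (W →L[ℂ] V)).analyticAt_bilinear (B z, σ z)).comp₂ hB hσ

theorem analyticAt_clm_comp {F U V W : Type*} [NormedAddCommGroup F] [NormedSpace ℂ F]
    [NormedAddCommGroup V] [NormedSpace ℂ V] [NormedAddCommGroup W] [NormedSpace ℂ W]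
    [NormedAddCommGroup U] [NormedSpace ℂ U]
    {B : F → W →L[ℂ] V} {C : F → U →L[ℂ] W} {z : F} (hB : AnalyticAt ℂ B z)
    (hC : AnalyticAt ℂ C z) : AnalyticAt ℂ (fun u => B u ∘L C u) z :=
  ((ContinuousLinearMap.compL ℂ U W V).analyticAt_bilinear (B z, C z)).comp₂ hB hC

/-- Holomorphic sections of the range of a holomorphic bundle embedding `B` over the disc, bounded
in terms of the weight `w`. -/
theorem exists_bounded_section {V : Type*} [NormedAddCommGroup V] [InnerProductSpace ℂ V]
    [FiniteDimensional ℂ V]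
    {W : Type*} [NormedAddCommGroup W] [NormedSpace ℂ W] [FiniteDimensional ℂ W]
    {B : ℂ → W →L[ℂ] V} {w : ℂ → ℝ} (hB : AnalyticOnNhd ℂ B (closedBall 0 1))
    (hw : ContinuousOn w (closedBall 0 1)) {w₀ : ℝ} (hw₀ : 0 < w₀)
    (hww : ∀ z ∈ closedBall (0:ℂ) 1, w₀ ≤ w z) {κ ν : ℝ} (hν : 0 < ν)
    (hlip : ∀ x ∈ closedBall (0:ℂ) 1, ∀ y ∈ closedBall (0:ℂ) 1,
      ‖(w x : ℂ) • B x - (w y : ℂ) • B y‖ ≤ κ * ‖x - y‖)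
    (hlow : ∀ x ∈ closedBall (0:ℂ) 1, ∀ a, ν * ‖a‖ ≤ w x * ‖B x a‖)
    (hloc : ∀ z₀ ∈ ball (0:ℂ) 1, ∀ a, ∃ σ : ℂ → W, AnalyticAt ℂ σ z₀ ∧ σ z₀ = a ∧
      ∀ᶠ z in 𝓝 z₀, w z * ‖B z (σ z)‖ ≤ w z₀ * ‖B z₀ a‖) (v : W) :
    ∃ S : ℂ → V, DifferentiableOn ℂ S (ball 0 1) ∧ S 0 = B 0 v ∧
      ∀ z ∈ ball (0:ℂ) 1, S z ∈ Set.range (B z) ∧ ‖S z‖ ≤ w 0 * ‖B 0 v‖ / w₀ := by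
  have hwpos : ∀ z ∈ closedBall (0:ℂ) 1, 0 < w z := fun z hz => hw₀.trans_le (hww z hz)
  set T : ℂ → W →L[ℂ] V := fun z => (w z : ℂ) • B z with hTdef
  have hwc : ContinuousOn (fun z => (w z : ℂ)) (closedBall 0 1) :=
    Complex.continuous_ofReal.comp_continuousOn hw
  have hT : ContinuousOn T (closedBall 0 1) := hwc.smul hB.continuousOn
  have hTn : ∀ z ∈ closedBall (0:ℂ) 1, ∀ a, ‖T z a‖ = w z * ‖B z a‖ := fun z hz a => by
    simp only [hTdef, ContinuousLinearMap.smul_apply, norm_smul, Complex.norm_real,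
      Real.norm_of_nonneg (hwpos z hz).le]
  obtain ⟨η, h1, h2, ψ, h3, h4⟩ := exists_extremal hT v
  have h : IsExtremal T v η ψ := ⟨hT, h1, h2, fun j => (h3 j).1, fun j => (h3 j).2, h4⟩
  have h0c : (0:ℂ) ∈ closedBall (0:ℂ) 1 := by simp
  have hc : IsExtremal.cst η ≤ w 0 * ‖B 0 v‖ := by
    rw [← hTn 0 h0c]
    refine h.cst_le hν hlip (fun x hx a => by rw [hTn x hx]; exact hlow x hx a) ?_
    intro z₀ hz₀ a
    obtain ⟨σ, hσ1, hσ2, hσ3⟩ := hloc z₀ hz₀ a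
    refine ⟨σ, hσ1, hσ2, ?_⟩
    filter_upwards [hσ3, isOpen_ball.mem_nhds hz₀] with z hz hzb
    rw [hTn z (ball_subset_closedBall hzb), hTn z₀ (ball_subset_closedBall hz₀)]
    exact hz
  have hU : ∀ t, circleMap 0 1 t ∈ closedBall (0:ℂ) 1 := fun t =>
    sphere_subset_closedBall (circleMap_mem_sphere 0 zero_le_one t)
  set g : ℝ → V := fun t => ((w (circleMap 0 1 t))⁻¹ : ℂ) • η t with hg
  have hwinv : ContinuousOn (fun z => ((w z : ℂ))⁻¹) (closedBall 0 1) :=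
    hwc.inv₀ fun z hz => by exact_mod_cast (hwpos z hz).ne'
  have hwinvle : ∀ t, ‖((w (circleMap 0 1 t) : ℂ))⁻¹‖ ≤ w₀⁻¹ := fun t => by
    rw [norm_inv, Complex.norm_real, Real.norm_of_nonneg (hwpos _ (hU t)).le]
    exact inv_anti₀ hw₀ (hww _ (hU t))
  have hgle : ∀ t, ‖g t‖ ≤ w₀⁻¹ * ‖η t‖ := fun t => by
    rw [hg, norm_smul]
    exact mul_le_mul_of_nonneg_right (hwinvle t) (norm_nonneg _)
  have hgi : Integrable g arcMeasure :=
    (h.memLp.integrable one_le_two).bdd_smul w₀⁻¹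
      (continuous_comp_circleMap hwinv).aestronglyMeasurable (ae_of_all _ hwinvle)
  have hBψ : ∀ j, AnalyticOnNhd ℂ (fun u => B u (ψ j u)) (closedBall 0 1) := fun j u hu =>
    analyticAt_clm_apply (hB u hu) (h.analytic j u hu)
  have hBψi : ∀ j, Integrable (fun t => B (circleMap 0 1 t) (ψ j (circleMap 0 1 t))) arcMeasure :=
    fun j => (memLp_comp_circleMap (hBψ j).continuousOn 2).integrable one_le_two
  have hdiff : ∀ j t, g t - B (circleMap 0 1 t) (ψ j (circleMap 0 1 t)) =
      ((w (circleMap 0 1 t))⁻¹ : ℂ) •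
        (η t - T (circleMap 0 1 t) (ψ j (circleMap 0 1 t))) := fun j t => by
    have : (w (circleMap 0 1 t) : ℂ) ≠ 0 := by exact_mod_cast (hwpos _ (hU t)).ne'
    simp only [hg, hTdef, ContinuousLinearMap.smul_apply, smul_sub, smul_smul,
      inv_mul_cancel₀ this, one_smul]
  -- weak convergence of `B ψ` to `g` against bounded kernels
  have key : ∀ (k : ℝ → ℂ) (C : ℝ), (∀ t, ‖k t‖ ≤ C) →
      (∀ F : ℝ → V, Integrable F arcMeasure → Integrable (fun t => k t • F t) arcMeasure) →
      Tendsto (fun j => ∫ t, k t • B (circleMap 0 1 t) (ψ j (circleMap 0 1 t)) ∂arcMeasure) atTop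
        (𝓝 (∫ t, k t • g t ∂arcMeasure)) := by
    intro k C hk hki
    have hC0 : 0 ≤ C := (norm_nonneg _).trans (hk 0)
    have h5 := h.tendsto_integral
      (fun j t => k t • (g t - B (circleMap 0 1 t) (ψ j (circleMap 0 1 t))))
      (fun _ => C * w₀⁻¹) (memLp_const _) (fun _ => by positivity) (fun j t => by
        rw [norm_smul, hdiff, norm_smul, mul_assoc]
        exact mul_le_mul (hk t) (mul_le_mul_of_nonneg_right (hwinvle t) (norm_nonneg _))
          (by positivity) hC0)
    have h6 := h5.const_sub (∫ t, k t • g t ∂arcMeasure)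
    rw [sub_zero] at h6
    refine h6.congr fun j => ?_
    simp only [smul_sub]
    rw [MeasureTheory.integral_sub (hki _ hgi) (hki _ (hBψi j))]
    abel
  set S : ℂ → V := fun z =>
    ∫ t, (circleMap 0 1 t / (circleMap 0 1 t - z)) • g t ∂arcMeasure with hS
  have hlim : ∀ z ∈ ball (0:ℂ) 1, Tendsto (fun j => B z (ψ j z)) atTop (𝓝 (S z)) := by
    intro z hz
    have := key _ _ (norm_cauchyKernel_le hz) (fun F hF => integrable_cauchyKernel_smul hF hz)
    refine this.congr fun j => ?_
    exact integral_cauchy (diffContOnCl_of_analyticOnNhd (hBψ j)) hz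
  refine ⟨S, differentiableOn_integral_cauchyKernel hgi, ?_, fun z hz => ⟨?_, ?_⟩⟩
  · refine tendsto_nhds_unique (hlim 0 (by simp)) ?_
    simp only [h.apply_zero]
    exact tendsto_const_nhds
  · have hcl : IsClosed (Set.range (B z)) := by
      rw [← ContinuousLinearMap.coe_coe, ← LinearMap.coe_range]
      exact Submodule.closed_of_finiteDimensional _
    exact hcl.mem_of_tendsto (hlim z hz) (Eventually.of_forall fun j => ⟨_, rfl⟩)
  · obtain ⟨C, hC⟩ := exists_bound_comp_circleMap (analyticOnNhd_conjKernel hz).continuousOn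
    have hz0 : ∫ t, conjKernel z (circleMap 0 1 t) • g t ∂arcMeasure = 0 := by
      have := key _ _ hC (fun F hF => integrable_conjKernel_smul hF hz)
      refine tendsto_nhds_unique this (tendsto_const_nhds.congr fun j => ?_)
      have h7 := integral_analytic (diffContOnCl_of_analyticOnNhd
        ((analyticOnNhd_conjKernel hz).smul (hBψ j)))
      simp only [conjKernel_zero, zero_smul] at h7
      exact h7.symm
    have h8 := integral_arcPoisson_smul hgi hz
    rw [hz0, add_zero] at h8
    have h9 := h.integral_arcPoisson_mul_le hz (g := fun _ => 1) (memLp_const _)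
      (fun _ => zero_le_one)
    simp only [one_pow, mul_one, integral_arcPoisson hz, Real.sqrt_one] at h9
    have hηi : Integrable (fun t => ‖η t‖) arcMeasure := (h.memLp.integrable one_le_two).norm
    have h10 : ‖S z‖ ≤ ∫ t, w₀⁻¹ * (arcPoisson z t * ‖η t‖) ∂arcMeasure := by
      rw [hS]
      simp only
      rw [← h8]
      refine MeasureTheory.norm_integral_le_of_norm_le
        ((integrable_arcPoisson_smul hηi hz).const_mul _) (ae_of_all _ fun t => ?_)
      rw [norm_smul, Complex.norm_real, Real.norm_of_nonneg (arcPoisson_nonneg hz t)]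
      have := mul_le_mul_of_nonneg_left (hgle t) (arcPoisson_nonneg hz t)
      linarith
    rw [MeasureTheory.integral_const_mul] at h10
    calc ‖S z‖ ≤ w₀⁻¹ * IsExtremal.cst η := h10.trans (by gcongr)
      _ ≤ w₀⁻¹ * (w 0 * ‖B 0 v‖) := by gcongr
      _ = _ := by rw [div_eq_inv_mul]

section

section Adjugate

variable {W : Type*} [NormedAddCommGroup W] [NormedSpace ℂ W] [FiniteDimensional ℂ W]

theorem analyticAt_matrix_det {m : Type*} [Fintype m] [DecidableEq m] {A : ℂ → Matrix m m ℂ}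
    {z₀ : ℂ} (hA : ∀ i j, AnalyticAt ℂ (fun z => A z i j) z₀) :
    AnalyticAt ℂ (fun z => (A z).det) z₀ := by
  simp only [Matrix.det_apply]
  refine Finset.analyticAt_fun_sum _ fun σ _ => ?_
  simp only [Units.smul_def, zsmul_eq_mul]
  exact analyticAt_const.mul (Finset.analyticAt_fun_prod _ fun i _ => hA _ _)

theorem analyticAt_adjugate {m : Type*} [Fintype m] [DecidableEq m] {A : ℂ → Matrix m m ℂ}
    {z₀ : ℂ} (hA : ∀ i j, AnalyticAt ℂ (fun z => A z i j) z₀) (i j : m) :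
    AnalyticAt ℂ (fun z => (A z).adjugate i j) z₀ := by
  simp only [Matrix.adjugate_apply]
  refine analyticAt_matrix_det fun k l => ?_
  simp only [Matrix.updateRow_apply]
  split_ifs
  · exact analyticAt_const
  · exact hA k l

theorem analyticAt_toMatrix {m : Type*} [Fintype m] [DecidableEq m] (b : Module.Basis m ℂ W)
    {M : ℂ → W →L[ℂ] W} {z₀ : ℂ} (hM : AnalyticAt ℂ M z₀) (i j : m) :
    AnalyticAt ℂ (fun z => LinearMap.toMatrix b b (M z : W →ₗ[ℂ] W) i j) z₀ := by
  simp only [LinearMap.toMatrix_apply]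
  exact ((LinearMap.toContinuousLinearMap (b.coord i)).analyticAt _).comp
    (analyticAt_clm_apply hM analyticAt_const)

theorem analyticAt_det {M : ℂ → W →L[ℂ] W} {z₀ : ℂ} (hM : AnalyticAt ℂ M z₀) :
    AnalyticAt ℂ (fun z => LinearMap.det (M z : W →ₗ[ℂ] W)) z₀ := by
  simp only [← LinearMap.det_toMatrix (Module.finBasis ℂ W)]
  exact analyticAt_matrix_det (analyticAt_toMatrix _ hM)

theorem exists_analytic_adjugate {M : ℂ → W →L[ℂ] W} {z₀ : ℂ} (hM : AnalyticAt ℂ M z₀) :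
    ∃ G : ℂ → W →L[ℂ] W, AnalyticAt ℂ G z₀ ∧
      ∀ z w, M z (G z w) = LinearMap.det (M z : W →ₗ[ℂ] W) • w := by
  set b := Module.finBasis ℂ W
  refine ⟨fun z => ∑ i, ∑ j, (LinearMap.toMatrix b b (M z : W →ₗ[ℂ] W)).adjugate i j •
    LinearMap.toContinuousLinearMap (Matrix.toLin b b (Matrix.single i j 1)), ?_, fun z w => ?_⟩
  · exact Finset.analyticAt_fun_sum _ fun i _ => Finset.analyticAt_fun_sum _ fun j _ =>
      (analyticAt_adjugate (analyticAt_toMatrix b hM) i j).smul analyticAt_const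
  · have h1 : ∀ N : Matrix _ _ ℂ, (∑ i, ∑ j, N i j •
        LinearMap.toContinuousLinearMap (Matrix.toLin b b (Matrix.single i j 1))) w =
        Matrix.toLin b b N w := fun N => by
      conv_rhs => rw [Matrix.matrix_eq_sum_single N]
      simp only [ContinuousLinearMap.sum_apply, ContinuousLinearMap.smul_apply, map_sum,
        LinearMap.sum_apply, LinearMap.coe_toContinuousLinearMap']
      refine Finset.sum_congr rfl fun i _ => Finset.sum_congr rfl fun j _ => ?_
      rw [← LinearMap.smul_apply, ← map_smul, Matrix.smul_single, smul_eq_mul, mul_one]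
    simp only [h1]
    have h2 : (M z : W →ₗ[ℂ] W) = Matrix.toLin b b (LinearMap.toMatrix b b (M z : W →ₗ[ℂ] W)) :=
      (Matrix.toLin_toMatrix b b _).symm
    set A := LinearMap.toMatrix b b (M z : W →ₗ[ℂ] W) with hA
    have h3 : (Matrix.toLin b b A) (Matrix.toLin b b A.adjugate w) = A.det • w := by
      rw [← LinearMap.comp_apply, ← Matrix.toLin_mul, Matrix.mul_adjugate, map_smul,
        Matrix.toLin_one]
      rfl
    rw [← h2] at h3
    rw [← LinearMap.det_toMatrix b, ← hA]
    exact h3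

theorem exists_analytic_inverse {M : ℂ → W →L[ℂ] W} {z₀ : ℂ} (hM : AnalyticAt ℂ M z₀)
    (h0 : LinearMap.det (M z₀ : W →ₗ[ℂ] W) ≠ 0) :
    ∃ G : ℂ → W →L[ℂ] W, AnalyticAt ℂ G z₀ ∧
      ∀ᶠ z in 𝓝 z₀, ∀ w, M z (G z w) = w ∧ G z (M z w) = w := by
  obtain ⟨G, hG, h⟩ := exists_analytic_adjugate hM
  refine ⟨fun z => (LinearMap.det (M z : W →ₗ[ℂ] W))⁻¹ • G z, ((analyticAt_det hM).inv h0).smul hG,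
    ?_⟩
  filter_upwards [(analyticAt_det hM).continuousAt.eventually_ne h0] with z hz
  have h1 : ∀ w, M z (((LinearMap.det (M z : W →ₗ[ℂ] W))⁻¹ • G z) w) = w := fun w => by
    rw [ContinuousLinearMap.smul_apply, map_smul, h, smul_smul, inv_mul_cancel₀ hz, one_smul]
  refine fun w => ⟨h1 w, ?_⟩
  have hinj : Function.Injective (M z) :=
    (LinearMap.injective_iff_surjective (f := (M z : W →ₗ[ℂ] W))).2 fun w => ⟨_, h1 w⟩
  exact hinj (h1 _)

end Adjugate

variable {V : Type*} [NormedAddCommGroup V] [NormedSpace ℂ V] [FiniteDimensional ℂ V]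
  {W : Type*} [NormedAddCommGroup W] [NormedSpace ℂ W] [FiniteDimensional ℂ W]

/-- `𝒢` is near `z₀` the range of a holomorphic family of injective maps. -/
def LocFrame (W : Type*) [NormedAddCommGroup W] [NormedSpace ℂ W] (𝒢 : ℂ → Submodule ℂ V)
    (z₀ : ℂ) : Prop :=
  ∃ J : ℂ → W →L[ℂ] V, AnalyticAt ℂ J z₀ ∧
    ∀ᶠ z in 𝓝 z₀, Function.Injective (J z) ∧ LinearMap.range (J z : W →ₗ[ℂ] V) = 𝒢 z

theorem exists_leftInverse_of_injective {J : W →L[ℂ] V} (hJ : Function.Injective J) :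
    ∃ L : V →L[ℂ] W, ∀ w, L (J w) = w := by
  obtain ⟨L, hL⟩ := LinearMap.exists_leftInverse_of_injective (J : W →ₗ[ℂ] V)
    (LinearMap.ker_eq_bot.2 hJ)
  exact ⟨LinearMap.toContinuousLinearMap L, fun w => LinearMap.congr_fun hL w⟩

theorem det_ne_zero_of_injective {M : W →L[ℂ] W} (h : Function.Injective M) :
    LinearMap.det (M : W →ₗ[ℂ] W) ≠ 0 := by
  intro h0
  obtain ⟨w, hw, hw0⟩ := (Submodule.ne_bot_iff _).1 (LinearMap.bot_lt_ker_of_det_eq_zero h0).ne'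
  exact hw0 (h ((LinearMap.mem_ker.1 hw).trans (map_zero M).symm))

/-- A local analytic left inverse of a holomorphic family of injective maps. -/
theorem exists_analytic_leftInverse {J : ℂ → W →L[ℂ] V} {z₀ : ℂ} (hJ : AnalyticAt ℂ J z₀)
    (h0 : Function.Injective (J z₀)) :
    ∃ G : ℂ → V →L[ℂ] W, AnalyticAt ℂ G z₀ ∧ ∀ᶠ z in 𝓝 z₀, ∀ w, G z (J z w) = w := by
  obtain ⟨L, hL⟩ := exists_leftInverse_of_injective h0
  have h1 : AnalyticAt ℂ (fun z => L ∘L J z) z₀ := analyticAt_clm_comp analyticAt_const hJ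
  obtain ⟨G, hG, h⟩ := exists_analytic_inverse h1 (det_ne_zero_of_injective fun x y hxy => by
    simpa only [ContinuousLinearMap.comp_apply, hL] using hxy)
  refine ⟨fun z => G z ∘L L, analyticAt_clm_comp hG analyticAt_const, ?_⟩
  filter_upwards [h] with z hz w
  exact (hz w).2

theorem LocFrame.mem_of_eventually {𝒢 : ℂ → Submodule ℂ V} {z₀ : ℂ} (h : LocFrame W 𝒢 z₀)
    {l : Filter ℂ} [l.NeBot] (hl : l ≤ 𝓝 z₀)
    {g : ℂ → V} (hg : ContinuousAt g z₀) (hgm : ∀ᶠ z in l, g z ∈ 𝒢 z) : g z₀ ∈ 𝒢 z₀ := by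
  obtain ⟨J, hJ, hJ2⟩ := h
  obtain ⟨G, hG, hG2⟩ := exists_analytic_leftInverse hJ hJ2.self_of_nhds.1
  have h1 : ContinuousAt (fun z => J z (G z (g z))) z₀ :=
    hJ.continuousAt.clm_apply (hG.continuousAt.clm_apply hg)
  have h2 : ∀ᶠ z in l, J z (G z (g z)) = g z := by
    filter_upwards [hgm, hl hJ2, hl hG2] with z hz hz1 hz2
    rw [← hz1.2] at hz
    obtain ⟨w, hw⟩ := hz
    rw [← hw]
    exact congrArg (J z) (hz2 w)
  have h3 : J z₀ (G z₀ (g z₀)) = g z₀ :=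
    tendsto_nhds_unique ((h1.tendsto.mono_left hl).congr' h2)
      (hg.tendsto.mono_left hl)
  rw [← h3, ← hJ2.self_of_nhds.2]
  exact ⟨_, rfl⟩

end

section

variable {V : Type*} [NormedAddCommGroup V] [NormedSpace ℂ V] [FiniteDimensional ℂ V]
  {W : Type*} [NormedAddCommGroup W] [NormedSpace ℂ W] [FiniteDimensional ℂ W]

/-- `N` is a section over `z` of the projection `P` restricted to `𝒢 z`. -/
def IsSect (P : V →L[ℂ] W) (𝒢 : ℂ → Submodule ℂ V) (z : ℂ) (N : W →L[ℂ] V) : Prop :=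
  (∀ w, N w ∈ 𝒢 z) ∧ ∀ w, P (N w) = w

theorem isSect_iff {P : V →L[ℂ] W} {𝒢 : ℂ → Submodule ℂ V} {z : ℂ} {J : W →L[ℂ] V}
    (hJr : LinearMap.range (J : W →ₗ[ℂ] V) = 𝒢 z) {G : W →L[ℂ] W}
    (hG : ∀ w, P (J (G w)) = LinearMap.det ((P ∘L J : W →L[ℂ] W) : W →ₗ[ℂ] W) • w) :
    ((∃ N, IsSect P 𝒢 z N) ↔ LinearMap.det ((P ∘L J : W →L[ℂ] W) : W →ₗ[ℂ] W) ≠ 0) ∧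
    ∀ N, IsSect P 𝒢 z N →
      N = (LinearMap.det ((P ∘L J : W →L[ℂ] W) : W →ₗ[ℂ] W))⁻¹ • (J ∘L G) := by
  have hmem : ∀ w, J w ∈ 𝒢 z := fun w => hJr ▸ ⟨w, rfl⟩
  have hinj : ∀ N, IsSect P 𝒢 z N → Function.Injective (P ∘L J : W →L[ℂ] W) := fun N hN => by
    refine (LinearMap.injective_iff_surjective (f := ((P ∘L J : W →L[ℂ] W) : W →ₗ[ℂ] W))).2
      fun w => ?_
    have h1 := hN.1 w
    rw [← hJr] at h1
    obtain ⟨x, hx⟩ := h1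
    exact ⟨x, (congrArg P hx).trans (hN.2 w)⟩
  have hdet : ∀ N, IsSect P 𝒢 z N → LinearMap.det ((P ∘L J : W →L[ℂ] W) : W →ₗ[ℂ] W) ≠ 0 :=
    fun N hN => det_ne_zero_of_injective (hinj N hN)
  refine ⟨⟨fun ⟨N, hN⟩ => hdet N hN, fun h => ⟨(LinearMap.det
    ((P ∘L J : W →L[ℂ] W) : W →ₗ[ℂ] W))⁻¹ • (J ∘L G), fun w => (𝒢 z).smul_mem _ (hmem _),
    fun w => ?_⟩⟩, fun N hN => ?_⟩
  · rw [ContinuousLinearMap.smul_apply, map_smul, ContinuousLinearMap.comp_apply, hG, smul_smul,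
      inv_mul_cancel₀ h, one_smul]
  · ext w
    have h1 := hN.1 w
    rw [← hJr] at h1
    obtain ⟨x, hx⟩ := h1
    have hx' : J x = N w := hx
    rw [← hx', ContinuousLinearMap.smul_apply, ContinuousLinearMap.comp_apply, ← map_smul]
    congr 1
    refine hinj N hN ?_
    rw [map_smul, ContinuousLinearMap.comp_apply, ContinuousLinearMap.comp_apply, hx', hN.2, hG,
      smul_smul, inv_mul_cancel₀ (hdet N hN), one_smul]

theorem exists_meromorphic_sect {𝒢 : ℂ → Submodule ℂ V}
    (h : ∀ z ∈ closedBall (0:ℂ) 1, LocFrame W 𝒢 z) :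
    ∃ (P : V →L[ℂ] W) (N : ℂ → W →L[ℂ] V), ∀ z₀ ∈ closedBall (0:ℂ) 1,
      MeromorphicAt N z₀ ∧ ∀ᶠ z in 𝓝[≠] z₀, IsSect P 𝒢 z (N z) := by
  classical
  obtain ⟨J₀, -, hJ₀⟩ := h 0 (by simp)
  obtain ⟨hJ₀i, hJ₀r⟩ := hJ₀.self_of_nhds
  obtain ⟨P, hP⟩ := exists_leftInverse_of_injective hJ₀i
  have hp0 : ∃ N, IsSect P 𝒢 0 N := ⟨J₀ 0, fun w => hJ₀r ▸ ⟨w, rfl⟩, hP⟩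
  set N : ℂ → W →L[ℂ] V := fun z => if h : ∃ N, IsSect P 𝒢 z N then h.choose else 0 with hN
  have hNs : ∀ z, (∃ N, IsSect P 𝒢 z N) → IsSect P 𝒢 z (N z) := fun z hz => by
    simp only [hN, dif_pos hz]
    exact hz.choose_spec
  have hdich : ∀ z₀ ∈ closedBall (0:ℂ) 1, (∀ᶠ z in 𝓝 z₀, ¬ ∃ N, IsSect P 𝒢 z N) ∨
      (MeromorphicAt N z₀ ∧ ∀ᶠ z in 𝓝[≠] z₀, ∃ N, IsSect P 𝒢 z N) := by
    intro z₀ hz₀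
    obtain ⟨J, hJ, hJ2⟩ := h z₀ hz₀
    have hM : AnalyticAt ℂ (fun z => P ∘L J z) z₀ := analyticAt_clm_comp analyticAt_const hJ
    obtain ⟨G, hG, hG2⟩ := exists_analytic_adjugate hM
    have hD := analyticAt_det hM
    rcases hD.eventually_eq_zero_or_eventually_ne_zero with h0 | h0
    · left
      filter_upwards [h0, hJ2] with z hz hz2
      rw [(isSect_iff hz2.2 (hG2 z)).1, not_not]
      exact hz
    · right
      constructor
      · refine (hD.meromorphicAt.inv.smul (analyticAt_clm_comp hJ hG).meromorphicAt).congr ?_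
        filter_upwards [h0, nhdsWithin_le_nhds hJ2] with z hz hz2
        have h3 := isSect_iff hz2.2 (hG2 z)
        exact (h3.2 _ (hNs z (h3.1.2 hz))).symm
      · filter_upwards [h0, nhdsWithin_le_nhds hJ2] with z hz hz2
        exact (isSect_iff hz2.2 (hG2 z)).1.2 hz
  have hall : ∀ z₀ ∈ closedBall (0:ℂ) 1, ∀ᶠ z in 𝓝[≠] z₀, ∃ N, IsSect P 𝒢 z N := by
    have hc : IsPreconnected (closedBall (0:ℂ) 1) := (convex_closedBall _ _).isPreconnected
    refine hc.subset_left_of_subset_union (u := {x | ∀ᶠ z in 𝓝[≠] x, ∃ N, IsSect P 𝒢 z N})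
      (v := {x | ∀ᶠ z in 𝓝 x, ¬ ∃ N, IsSect P 𝒢 z N}) isOpen_setOf_eventually_nhdsWithin
      isOpen_setOf_eventually_nhds ?_ ?_ ?_
    · rw [Set.disjoint_left]
      intro x hx hx2
      rw [mem_setOf_eq] at hx hx2
      obtain ⟨z, hz1, hz2⟩ := (hx.and (nhdsWithin_le_nhds hx2)).exists
      exact hz2 hz1
    · intro z hz
      exact (hdich z hz).symm.imp (fun h => h.2) id
    · refine ⟨0, by simp, ?_⟩
      rcases hdich 0 (by simp) with h0 | h0
      · exact absurd hp0 h0.self_of_nhds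
      · exact h0.2
  refine ⟨P, N, fun z₀ hz₀ => ?_⟩
  have h1 := hall z₀ hz₀
  refine ⟨?_, h1.mono fun z hz => hNs z hz⟩
  rcases hdich z₀ hz₀ with h0 | h0
  · obtain ⟨z, hz1, hz2⟩ := (h1.and (nhdsWithin_le_nhds h0)).exists
    exact absurd hz1 hz2
  · exact h0.1

theorem exists_generic_frame {𝒢 : ℂ → Submodule ℂ V}
    (h : ∀ z ∈ closedBall (0:ℂ) 1, LocFrame W 𝒢 z) :
    ∃ (P : V →L[ℂ] W) (g : ℂ → W →L[ℂ] V) (q : Polynomial ℂ), q ≠ 0 ∧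
      AnalyticOnNhd ℂ g (closedBall 0 1) ∧ ∀ z ∈ closedBall (0:ℂ) 1, (∀ w, g z w ∈ 𝒢 z) ∧
      LinearMap.det ((P ∘L g z : W →L[ℂ] W) : W →ₗ[ℂ] W) = q.eval z := by
  obtain ⟨P, N, hN⟩ := exists_meromorphic_sect h
  have hmer : ∀ x, ∃ n : ℕ, x ∈ closedBall (0:ℂ) 1 → AnalyticAt ℂ (fun z => (z - x) ^ n • N z) x :=
    fun x => by
      by_cases hx : x ∈ closedBall (0:ℂ) 1
      · obtain ⟨n, hn⟩ := (hN x hx).1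
        exact ⟨n, fun _ => hn⟩
      · exact ⟨0, fun h => absurd h hx⟩
  choose n hn using hmer
  obtain ⟨t, ht, htc⟩ := (isCompact_closedBall (0:ℂ) 1).elim_nhds_subcover
    (fun x => {z | AnalyticAt ℂ (fun z => (z - x) ^ n x • N z) z})
    (fun x hx => (hn x hx).eventually_analyticAt)
  set Q : Polynomial ℂ := ∏ x ∈ t, (Polynomial.X - Polynomial.C x) ^ n x with hQ
  have hQ0 : Q ≠ 0 := Finset.prod_ne_zero_iff.2 fun x _ =>
    pow_ne_zero _ (Polynomial.X_sub_C_ne_zero x)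
  have hQe : ∀ z, Q.eval z = ∏ x ∈ t, (z - x) ^ n x := fun z => by
    simp only [hQ, Polynomial.eval_prod, Polynomial.eval_pow, Polynomial.eval_sub,
      Polynomial.eval_X, Polynomial.eval_C]
  have hQa : ∀ z₀, AnalyticAt ℂ (fun z => Q.eval z) z₀ := fun z₀ =>
    Q.differentiable.analyticAt z₀
  have hg : AnalyticOnNhd ℂ (fun z => Q.eval z • N z) (closedBall 0 1) := by
    intro z hz
    classical
    obtain ⟨x, hx, hxz⟩ := mem_iUnion₂.1 (htc hz)
    have h1 : AnalyticAt ℂ (fun z => ∏ y ∈ t.erase x, (z - y) ^ n y) z :=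
      Finset.analyticAt_fun_prod _ fun y _ => (analyticAt_id.sub analyticAt_const).pow _
    refine (h1.smul hxz).congr (Eventually.of_forall fun y => ?_)
    simp only [Pi.smul_apply', smul_smul, hQe]
    rw [Finset.prod_erase_mul _ _ hx]
  refine ⟨P, _, Q ^ Module.finrank ℂ W, pow_ne_zero _ hQ0, hg, fun z hz => ⟨fun w => ?_, ?_⟩⟩
  · refine (h z hz).mem_of_eventually (l := 𝓝[≠] z) nhdsWithin_le_nhds (g := fun z => (Q.eval z • N z) w)
      (analyticAt_clm_apply (hg z hz) analyticAt_const).continuousAt ?_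
    filter_upwards [(hN z hz).2] with y hy
    exact (𝒢 y).smul_mem _ (hy.1 w)
  · have h1 : (P ∘L (Q.eval z • N z) : W →L[ℂ] W) = Q.eval z • ContinuousLinearMap.id ℂ W := by
      refine tendsto_nhds_unique (l := 𝓝[≠] z) (f := fun z => P ∘L (Q.eval z • N z)) ?_ ?_
      · exact (analyticAt_clm_comp analyticAt_const (hg z hz)).continuousAt.tendsto.mono_left
          nhdsWithin_le_nhds
      · refine (((hQa z).smul (analyticAt_const (v := ContinuousLinearMap.id ℂ W))).continuousAt.tendsto.mono_left
          nhdsWithin_le_nhds).congr' ?_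
        filter_upwards [(hN z hz).2] with y hy
        ext w
        simp [hy.2 w]
    rw [h1, Polynomial.eval_pow]
    simp [LinearMap.det_smul]

theorem LocFrame.exists_frame_of_det {𝒢 : ℂ → Submodule ℂ V}
    (h : ∀ z ∈ closedBall (0:ℂ) 1, LocFrame W 𝒢 z) (P : V →L[ℂ] W) (d : ℕ) :
    ∀ (g : ℂ → W →L[ℂ] V) (q : Polynomial ℂ), q ≠ 0 → q.natDegree = d →
      AnalyticOnNhd ℂ g (closedBall 0 1) → (∀ z ∈ closedBall (0:ℂ) 1, (∀ w, g z w ∈ 𝒢 z) ∧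
      LinearMap.det ((P ∘L g z : W →L[ℂ] W) : W →ₗ[ℂ] W) = q.eval z) →
    ∃ B : ℂ → W →L[ℂ] V, AnalyticOnNhd ℂ B (closedBall 0 1) ∧
      ∀ z ∈ closedBall (0:ℂ) 1, Function.Injective (B z) ∧ ∀ w, B z w ∈ 𝒢 z := by
  induction d using Nat.strong_induction_on with
  | _ d ih =>
  intro g q hq hqd hg hgz
  by_cases hinj : ∀ z ∈ closedBall (0:ℂ) 1, Function.Injective (g z)
  · exact ⟨g, hg, fun z hz => ⟨hinj z hz, (hgz z hz).1⟩⟩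
  push Not at hinj
  obtain ⟨z₀, hz₀, hni⟩ := hinj
  obtain ⟨c, hgc, hc⟩ : ∃ c, g z₀ c = 0 ∧ c ≠ 0 := by
    by_contra! hcon
    exact hni ((injective_iff_map_eq_zero (g z₀)).2 hcon)
  have hq0 : q.eval z₀ = 0 := by
    rw [← (hgz z₀ hz₀).2]
    by_contra hne
    have hu := LinearMap.isUnit_iff_isUnit_det _ |>.2 (isUnit_iff_ne_zero.2 hne)
    have hk := (Module.End.isUnit_iff _).1 hu
    refine hc (hk.1 (a₂ := 0) ?_)
    simp [hgc]
  obtain ⟨ℓ, hℓ⟩ : ∃ ℓ : W →L[ℂ] ℂ, ℓ c = 1 := SeparatingDual.exists_eq_one hc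
  obtain ⟨q', hq'⟩ := Polynomial.dvd_iff_isRoot.2 hq0
  have hq'0 : q' ≠ 0 := by rintro rfl; exact hq (by rw [hq', mul_zero])
  have hdeg : q'.natDegree < d := by
    rw [← hqd, hq', Polynomial.natDegree_mul (Polynomial.X_sub_C_ne_zero _) hq'0,
      Polynomial.natDegree_X_sub_C]
    omega
  have hfc : ∀ z ∈ closedBall (0:ℂ) 1, AnalyticAt ℂ (fun z => g z c) z := fun z hz =>
    analyticAt_clm_apply (hg z hz) analyticAt_const
  have hds : ∀ z ∈ closedBall (0:ℂ) 1, AnalyticAt ℂ (dslope (fun z => g z c) z₀) z := by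
    intro z hz
    rcases eq_or_ne z z₀ with rfl | hne
    · obtain ⟨p, hp⟩ := hfc z hz
      exact ⟨_, hp.has_fpower_series_dslope_fslope⟩
    · refine AnalyticAt.congr (f := fun y => (y - z₀)⁻¹ • (g y c - g z₀ c)) ?_ ?_
      · exact ((analyticAt_id.sub analyticAt_const).inv (sub_ne_zero.2 hne)).smul
          ((hfc z hz).sub analyticAt_const)
      · filter_upwards [isOpen_ne.mem_nhds hne] with y hy
        rw [dslope_of_ne _ hy, slope_def_module]
  have hmul : ∀ z, g z c = (z - z₀) • dslope (fun z => g z c) z₀ z := fun z => by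
    rw [sub_smul_dslope, hgc, sub_zero]
  set g' : ℂ → W →L[ℂ] V := fun z => g z - ℓ.smulRight (g z c) +
    ℓ.smulRight (dslope (fun z => g z c) z₀ z) with hg'
  have hsr : ∀ {s : ℂ → V} {z : ℂ}, AnalyticAt ℂ s z → AnalyticAt ℂ (fun z => ℓ.smulRight (s z)) z :=
    fun hs => ((ContinuousLinearMap.smulRightL ℂ W V ℓ).analyticAt _).comp hs
  have hg'a : AnalyticOnNhd ℂ g' (closedBall 0 1) := fun z hz =>
    ((hg z hz).sub (hsr (hfc z hz))).add (hsr (hds z hz))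
  have hfac : ∀ z, g z = g' z ∘L LinearMap.toContinuousLinearMap
      (LinearMap.transvection (ℓ : W →ₗ[ℂ] ℂ) ((z - z₀ - 1) • c)) := fun z => by
    ext w
    have : ℓ w • g z c = (z - z₀) • ℓ w • dslope (fun z => g z c) z₀ z := by
      rw [smul_comm, ← hmul]
    simp only [hg', ContinuousLinearMap.comp_apply, LinearMap.coe_toContinuousLinearMap',
      LinearMap.transvection.apply, ContinuousLinearMap.add_apply, ContinuousLinearMap.sub_apply,
      ContinuousLinearMap.smulRight_apply, map_add, map_smul, ContinuousLinearMap.coe_coe, hℓ,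
      smul_eq_mul, mul_one]
    rw [hmul]
    module
  have hnb : (𝓝[≠] z₀ ⊓ 𝓟 (closedBall (0:ℂ) 1)).NeBot := by
    refine IsPreconnected.preperfect_of_nontrivial ?_ (convex_closedBall _ _).isPreconnected z₀ hz₀
    exact ⟨0, by simp, 1, by simp, zero_ne_one⟩
  have hle : 𝓝[≠] z₀ ⊓ 𝓟 (closedBall (0:ℂ) 1) ≤ 𝓝 z₀ := inf_le_left.trans nhdsWithin_le_nhds
  have hev : ∀ᶠ z in 𝓝[≠] z₀ ⊓ 𝓟 (closedBall (0:ℂ) 1), z ∈ closedBall (0:ℂ) 1 ∧ z ≠ z₀ := by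
    refine Filter.Eventually.and (mem_inf_of_right (mem_principal_self _)) (mem_inf_of_left ?_)
    exact self_mem_nhdsWithin
  have hne : ∀ z ∈ closedBall (0:ℂ) 1, z ≠ z₀ → (∀ w, g' z w ∈ 𝒢 z) := fun z hz hne w => by
    have h1 : dslope (fun z => g z c) z₀ z ∈ 𝒢 z := by
      rw [dslope_of_ne _ hne, slope_def_module, hgc, sub_zero]
      exact (𝒢 z).smul_mem _ ((hgz z hz).1 c)
    exact (𝒢 z).add_mem ((𝒢 z).sub_mem ((hgz z hz).1 w) ((𝒢 z).smul_mem _ ((hgz z hz).1 c)))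
      ((𝒢 z).smul_mem _ h1)
  have hdet : ∀ z ∈ closedBall (0:ℂ) 1, z ≠ z₀ →
      LinearMap.det ((P ∘L g' z : W →L[ℂ] W) : W →ₗ[ℂ] W) = q'.eval z := fun z hz hne => by
    have h1 := (hgz z hz).2
    have h2 : ((P ∘L g z : W →L[ℂ] W) : W →ₗ[ℂ] W) = ((P ∘L g' z : W →L[ℂ] W) : W →ₗ[ℂ] W) *
        LinearMap.transvection (ℓ : W →ₗ[ℂ] ℂ) ((z - z₀ - 1) • c) := by
      rw [hfac z]
      rfl
    rw [h2, map_mul, LinearMap.transvection.det, hq', Polynomial.eval_mul, Polynomial.eval_sub,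
      Polynomial.eval_X, Polynomial.eval_C, map_smul, ContinuousLinearMap.coe_coe, hℓ] at h1
    have h3 : z - z₀ ≠ 0 := sub_ne_zero.2 hne
    refine mul_right_cancel₀ h3 (Eq.trans ?_ (h1.trans (mul_comm _ _)))
    simp
  refine ih _ hdeg g' q' hq'0 rfl hg'a fun z hz => ?_
  rcases eq_or_ne z z₀ with rfl | hzne
  · refine ⟨fun w => (h z hz).mem_of_eventually hle (g := fun z => g' z w)
      (analyticAt_clm_apply (hg'a z hz) analyticAt_const).continuousAt
      (hev.mono fun y hy => hne y hy.1 hy.2 w), ?_⟩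
    refine tendsto_nhds_unique ((analyticAt_det (analyticAt_clm_comp analyticAt_const
      (hg'a z hz))).continuousAt.tendsto.mono_left hle)
      ((q'.continuous.continuousAt.tendsto.mono_left hle).congr' ?_)
    exact hev.mono fun y hy => (hdet y hy.1 hy.2).symm
  · exact ⟨hne z hz hzne, hdet z hz hzne⟩

/-- A holomorphic subbundle of a trivial bundle over the closed disc has a global frame. -/
theorem LocFrame.exists_frame {𝒢 : ℂ → Submodule ℂ V}
    (h : ∀ z ∈ closedBall (0:ℂ) 1, LocFrame W 𝒢 z) :
    ∃ B : ℂ → W →L[ℂ] V, AnalyticOnNhd ℂ B (closedBall 0 1) ∧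
      ∀ z ∈ closedBall (0:ℂ) 1, Function.Injective (B z) ∧
        LinearMap.range (B z : W →ₗ[ℂ] V) = 𝒢 z := by
  obtain ⟨P, g, q, hq, hg, hgz⟩ := exists_generic_frame h
  obtain ⟨B, hB, hBz⟩ := LocFrame.exists_frame_of_det h P _ g q hq rfl hg hgz
  refine ⟨B, hB, fun z hz => ⟨(hBz z hz).1, ?_⟩⟩
  obtain ⟨J, -, hJ⟩ := h z hz
  refine Submodule.eq_of_le_of_finrank_eq ?_ ?_
  · rintro _ ⟨w, rfl⟩
    exact (hBz z hz).2 w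
  · rw [← hJ.self_of_nhds.2, LinearMap.finrank_range_of_inj (hBz z hz).1,
      LinearMap.finrank_range_of_inj hJ.self_of_nhds.1]

end

theorem exists_lipschitz_closedBall {F : Type*} [NormedAddCommGroup F] [NormedSpace ℂ F]
    [CompleteSpace F] {g : ℂ → F} (hg : AnalyticOnNhd ℂ g (closedBall 0 1)) :
    ∃ K, 0 ≤ K ∧ ∀ x ∈ closedBall (0:ℂ) 1, ∀ y ∈ closedBall (0:ℂ) 1,
      ‖g x - g y‖ ≤ K * ‖x - y‖ := by
  obtain ⟨K, hK⟩ := (isCompact_closedBall (0:ℂ) 1).exists_bound_of_continuousOn hg.deriv.continuousOn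
  refine ⟨K, (norm_nonneg _).trans (hK 0 (by simp)), fun x hx y hy => ?_⟩
  exact (convex_closedBall _ _).norm_image_sub_le_of_norm_deriv_le
    (fun z hz => (hg z hz).differentiableAt) hK hy hx

theorem exists_bound_closedBall {F : Type*} [NormedAddCommGroup F]
    {g : ℂ → F} (hg : ContinuousOn g (closedBall 0 1)) :
    ∃ K, 0 ≤ K ∧ ∀ x ∈ closedBall (0:ℂ) 1, ‖g x‖ ≤ K := by
  obtain ⟨K, hK⟩ := (isCompact_closedBall (0:ℂ) 1).exists_bound_of_continuousOn hg
  exact ⟨K, (norm_nonneg _).trans (hK 0 (by simp)), hK⟩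

theorem exists_lower_bound {V W : Type*} [NormedAddCommGroup V] [NormedSpace ℂ V]
    [NormedAddCommGroup W] [NormedSpace ℂ W] [FiniteDimensional ℂ W] {B : ℂ → W →L[ℂ] V}
    (hB : ContinuousOn B (closedBall 0 1))
    (hinj : ∀ z ∈ closedBall (0:ℂ) 1, Function.Injective (B z)) :
    ∃ ν, 0 < ν ∧ ∀ x ∈ closedBall (0:ℂ) 1, ∀ a, ν * ‖a‖ ≤ ‖B x a‖ := by
  have : ProperSpace W := FiniteDimensional.proper ℂ W
  have hc : IsCompact (closedBall (0:ℂ) 1 ×ˢ sphere (0:W) 1) :=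
    (isCompact_closedBall _ _).prod (isCompact_sphere _ _)
  have hcont : ContinuousOn (fun p : ℂ × W => ‖B p.1 p.2‖) (closedBall (0:ℂ) 1 ×ˢ sphere (0:W) 1) :=
    ((hB.comp continuousOn_fst fun p hp => hp.1).clm_apply continuousOn_snd).norm
  obtain ⟨ν, hν, hν2⟩ : ∃ ν, 0 < ν ∧ ∀ p ∈ closedBall (0:ℂ) 1 ×ˢ sphere (0:W) 1,
      ν ≤ ‖B p.1 p.2‖ := by
    rcases (closedBall (0:ℂ) 1 ×ˢ sphere (0:W) 1).eq_empty_or_nonempty with he | hne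
    · exact ⟨1, one_pos, by simp [he]⟩
    · obtain ⟨p, hp, hmin⟩ := hc.exists_isMinOn hne hcont
      refine ⟨_, norm_pos_iff.2 fun h0 => ?_, fun q hq => hmin hq⟩
      have h1 : p.2 = 0 := hinj p.1 hp.1 (h0.trans (map_zero _).symm)
      have h2 := hp.2
      simp [h1] at h2
  refine ⟨ν, hν, fun x hx a => ?_⟩
  rcases eq_or_ne a 0 with rfl | ha
  · simp
  have ha' : ‖a‖ ≠ 0 := norm_ne_zero_iff.2 ha
  have h1 := hν2 (x, (‖a‖⁻¹ : ℂ) • a) ⟨hx, by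
    rw [mem_sphere_zero_iff_norm, norm_smul, norm_inv, Complex.norm_real, norm_norm,
      inv_mul_cancel₀ ha']⟩
  rw [map_smul, norm_smul, norm_inv, Complex.norm_real, norm_norm, ← div_eq_inv_mul,
    le_div_iff₀ (by positivity)] at h1
  exact h1

theorem LocFrame.of_transport {V : Type*} [NormedAddCommGroup V] [NormedSpace ℂ V]
    [FiniteDimensional ℂ V] {𝒢 : ℂ → Submodule ℂ V} {s : Set ℂ} (hs : IsPreconnected s)
    (h : ∀ z₀ ∈ s, ∃ X : ℂ → V →L[ℂ] V, AnalyticAt ℂ X z₀ ∧ X z₀ = 0 ∧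
      ∀ᶠ z in 𝓝 z₀, 𝒢 z = (𝒢 z₀).map (1 + X z : V →L[ℂ] V).toLinearMap) {a : ℂ} (ha : a ∈ s) :
    ∀ z₀ ∈ s, LocFrame (𝒢 a) 𝒢 z₀ := by
  have hinj : ∀ z₀ (X : ℂ → V →L[ℂ] V), AnalyticAt ℂ X z₀ → X z₀ = 0 →
      ∀ᶠ z in 𝓝 z₀, Function.Injective (1 + X z : V →L[ℂ] V) := fun z₀ X hX hX0 => by
    have h1 : ∀ᶠ z in 𝓝 z₀, ‖X z‖ < 1 := by
      refine hX.continuousAt.norm.eventually_lt continuousAt_const ?_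
      simp [hX0]
    filter_upwards [h1] with z hz
    refine (injective_iff_map_eq_zero _).2 fun v hv => ?_
    by_contra hv0
    have h2 : ‖v‖ = ‖X z v‖ :=
      (congrArg norm (eq_neg_of_add_eq_zero_left (show v + X z v = 0 from hv))).trans (norm_neg _)
    have h3 := (X z).le_opNorm v
    have h4 : 0 < ‖v‖ := norm_pos_iff.2 hv0
    nlinarith
  have hdim : ∀ z₀ ∈ s, Module.finrank ℂ (𝒢 a) = Module.finrank ℂ (𝒢 z₀) := by
    intro z₀ hz₀
    refine hs.constant (f := fun z => Module.finrank ℂ (𝒢 z)) (fun z hz => ?_) ha hz₀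
    obtain ⟨X, hX, hX0, hX2⟩ := h z hz
    refine (continuousAt_const.congr (f := fun _ => Module.finrank ℂ (𝒢 z)) ?_).continuousWithinAt
    filter_upwards [hX2, hinj z X hX hX0] with y hy hy2
    rw [hy]
    exact (Submodule.equivMapOfInjective (1 + X y : V →L[ℂ] V).toLinearMap hy2 (𝒢 z)).finrank_eq
  intro z₀ hz₀
  obtain ⟨X, hX, hX0, hX2⟩ := h z₀ hz₀
  set e := LinearEquiv.ofFinrankEq _ _ (hdim z₀ hz₀)
  refine ⟨fun z => (1 + X z) ∘L LinearMap.toContinuousLinearMap ((𝒢 z₀).subtype ∘ₗ e.toLinearMap),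
    analyticAt_clm_comp (analyticAt_const.add hX) analyticAt_const, ?_⟩
  filter_upwards [hX2, hinj z₀ X hX hX0] with z hz hz2
  refine ⟨fun x y hxy => e.injective (Subtype.ext (hz2 hxy)), ?_⟩
  rw [hz]
  ext y
  constructor
  · rintro ⟨x, rfl⟩
    exact ⟨e x, (e x).2, rfl⟩
  · rintro ⟨x, hx, rfl⟩
    exact ⟨e.symm ⟨x, hx⟩, by simp⟩

/-- The local estimate behind the choice of a plurisubharmonic weight. -/
theorem exp_mul_norm_transport_le {V Y : Type*} [NormedAddCommGroup V] [InnerProductSpace ℂ V]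
    [NormedAddCommGroup Y] [InnerProductSpace ℂ Y] {v x : V} (hv : v ≠ 0) {p q : Y} {C : ℝ}
    (hx : ‖x‖ ≤ C * ‖q - p‖ * ‖v‖) :
    Real.exp (-(C ^ 2 * ‖q‖ ^ 2 / 2)) * ‖Complex.exp (-(inner ℂ v x / (‖v‖ : ℂ) ^ 2) +
      (C ^ 2 : ℝ) * inner ℂ p (q - p)) • (v + x)‖ ≤ Real.exp (-(C ^ 2 * ‖p‖ ^ 2 / 2)) * ‖v‖ := by
  have hv0 : 0 < ‖v‖ := norm_pos_iff.2 hv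
  set ρ : ℝ := (inner ℂ v x : ℂ).re / ‖v‖ ^ 2 with hρ
  set R : ℝ := (inner ℂ p (q - p) : ℂ).re with hR
  set δ := ‖q - p‖
  have h1 : (-(inner ℂ v x / (‖v‖ : ℂ) ^ 2) + (C ^ 2 : ℝ) * inner ℂ p (q - p) : ℂ).re =
      -ρ + C ^ 2 * R := by
    rw [Complex.add_re, Complex.neg_re, Complex.re_ofReal_mul, ← Complex.ofReal_pow,
      Complex.div_ofReal_re]
  have h2 : ‖q‖ ^ 2 = ‖p‖ ^ 2 + 2 * R + δ ^ 2 := by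
    have := norm_add_sq (𝕜 := ℂ) p (q - p)
    rwa [add_sub_cancel] at this
  have h3 : ‖v + x‖ ≤ ‖v‖ * Real.exp (ρ + C ^ 2 * δ ^ 2 / 2) := by
    have h4 : ‖v + x‖ ^ 2 = ‖v‖ ^ 2 + 2 * (ρ * ‖v‖ ^ 2) + ‖x‖ ^ 2 := by
      rw [hρ, div_mul_cancel₀ _ (by positivity)]
      exact norm_add_sq (𝕜 := ℂ) v x
    have h5 : ‖x‖ ^ 2 ≤ (C * δ * ‖v‖) ^ 2 := pow_le_pow_left₀ (norm_nonneg _) hx 2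
    refine le_of_sq_le_sq ?_ (by positivity)
    rw [mul_pow, ← Real.exp_nat_mul]
    have h6 := Real.add_one_le_exp ((2:ℕ) * (ρ + C ^ 2 * δ ^ 2 / 2))
    calc ‖v + x‖ ^ 2 ≤ ‖v‖ ^ 2 * ((2:ℕ) * (ρ + C ^ 2 * δ ^ 2 / 2) + 1) := by
          push_cast; nlinarith
      _ ≤ _ := by gcongr
  rw [norm_smul, Complex.norm_exp, h1, h2]
  calc _ ≤ Real.exp (-(C ^ 2 * (‖p‖ ^ 2 + 2 * R + δ ^ 2) / 2)) * (Real.exp (-ρ + C ^ 2 * R) *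
        (‖v‖ * Real.exp (ρ + C ^ 2 * δ ^ 2 / 2))) := by gcongr
    _ = (Real.exp (-(C ^ 2 * (‖p‖ ^ 2 + 2 * R + δ ^ 2) / 2)) * Real.exp (-ρ + C ^ 2 * R) *
        Real.exp (ρ + C ^ 2 * δ ^ 2 / 2)) * ‖v‖ := by ring
    _ = _ := by
      rw [← Real.exp_add, ← Real.exp_add]
      congr 2
      ring

/-- A holomorphic subbundle over the disc whose local triviality is controlled by a bounded
holomorphic map `f` has bounded sections through every vector of the central fibre. -/
theorem exists_bounded_section_of_transport {V Y : Type*} [NormedAddCommGroup V]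
    [InnerProductSpace ℂ V] [FiniteDimensional ℂ V] [NormedAddCommGroup Y] [InnerProductSpace ℂ Y]
    [CompleteSpace Y] {f : ℂ → Y} (hf : AnalyticOnNhd ℂ f (closedBall 0 1)) {R₀ : ℝ}
    (hR₀ : ∀ z ∈ closedBall (0:ℂ) 1, ‖f z‖ ≤ R₀) {𝒢 : ℂ → Submodule ℂ V} {C : ℝ}
    (h : ∀ z₀ ∈ closedBall (0:ℂ) 1, ∃ X : ℂ → V →L[ℂ] V, AnalyticAt ℂ X z₀ ∧
      ∀ᶠ z in 𝓝 z₀, 𝒢 z = (𝒢 z₀).map (1 + X z : V →L[ℂ] V).toLinearMap ∧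
        ‖X z‖ ≤ C * ‖f z - f z₀‖) {v : V} (hv : v ∈ 𝒢 0) :
    ∃ S : ℂ → V, DifferentiableOn ℂ S (ball 0 1) ∧ S 0 = v ∧
      ∀ z ∈ ball (0:ℂ) 1, S z ∈ 𝒢 z ∧ ‖S z‖ ≤ Real.exp (C ^ 2 * R₀ ^ 2 / 2) * ‖v‖ := by
  have h0c : (0:ℂ) ∈ closedBall (0:ℂ) 1 := by simp
  have hX0 : ∀ z₀ (X : ℂ → V →L[ℂ] V), (∀ᶠ z in 𝓝 z₀, 𝒢 z = (𝒢 z₀).map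
      (1 + X z : V →L[ℂ] V).toLinearMap ∧ ‖X z‖ ≤ C * ‖f z - f z₀‖) → X z₀ = 0 :=
    fun z₀ X hX => by simpa using hX.self_of_nhds.2
  have hLF := LocFrame.of_transport (𝒢 := 𝒢) (convex_closedBall (0:ℂ) 1).isPreconnected
    (fun z₀ hz₀ => by
      obtain ⟨X, hX, hX2⟩ := h z₀ hz₀
      exact ⟨X, hX, hX0 z₀ X hX2, hX2.mono fun z hz => hz.1⟩) h0c
  obtain ⟨B, hB, hBz⟩ := LocFrame.exists_frame hLF
  set w : ℂ → ℝ := fun z => Real.exp (-(C ^ 2 * ‖f z‖ ^ 2 / 2)) with hw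
  have hwc : ContinuousOn w (closedBall 0 1) :=
    Real.continuous_exp.comp_continuousOn
      (((hf.continuousOn.norm.pow 2).const_smul (C ^ 2)).div_const 2).neg
  have hww : ∀ z ∈ closedBall (0:ℂ) 1, Real.exp (-(C ^ 2 * R₀ ^ 2 / 2)) ≤ w z := fun z hz => by
    have := hR₀ z hz
    simp only [hw]
    gcongr
  have hw1 : ∀ z, w z ≤ 1 := fun z => Real.exp_le_one_iff.2 (by
    have : 0 ≤ C ^ 2 * ‖f z‖ ^ 2 / 2 := by positivity
    linarith)
  obtain ⟨ν, hν, hν2⟩ := exists_lower_bound hB.continuousOn fun z hz => (hBz z hz).1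
  obtain ⟨κ, hκ⟩ : ∃ κ, ∀ x ∈ closedBall (0:ℂ) 1, ∀ y ∈ closedBall (0:ℂ) 1,
      ‖(w x : ℂ) • B x - (w y : ℂ) • B y‖ ≤ κ * ‖x - y‖ := by
    obtain ⟨K, hK0, hK⟩ := exists_lipschitz_closedBall hB
    obtain ⟨K', hK'0, hK'⟩ := exists_lipschitz_closedBall hf
    obtain ⟨D, hD0, hD⟩ := exists_bound_closedBall hB.continuousOn
    have hR : 0 ≤ R₀ := (norm_nonneg _).trans (hR₀ 0 h0c)
    have hwl : ∀ x ∈ closedBall (0:ℂ) 1, ∀ y ∈ closedBall (0:ℂ) 1,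
        |w x - w y| ≤ C ^ 2 * R₀ * K' * ‖x - y‖ := by
      have key : ∀ x ∈ closedBall (0:ℂ) 1, ∀ y ∈ closedBall (0:ℂ) 1,
          w x - w y ≤ C ^ 2 * R₀ * K' * ‖x - y‖ := by
        intro x hx y hy
        have h1 : ‖f y‖ - ‖f x‖ ≤ K' * ‖x - y‖ := by
          refine (norm_sub_norm_le _ _).trans ?_
          rw [norm_sub_rev]
          exact hK' x hx y hy
        have h2 := Real.add_one_le_exp (C ^ 2 * ‖f x‖ ^ 2 / 2 - C ^ 2 * ‖f y‖ ^ 2 / 2)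
        have h3 : w y = w x * Real.exp (C ^ 2 * ‖f x‖ ^ 2 / 2 - C ^ 2 * ‖f y‖ ^ 2 / 2) := by
          simp only [hw]
          rw [← Real.exp_add]
          congr 1
          ring
        have h4 : 0 < w x := Real.exp_pos _
        have h5 : ‖f y‖ ^ 2 - ‖f x‖ ^ 2 ≤ 2 * R₀ * (K' * ‖x - y‖) := by
          have h6 := hR₀ x hx
          have h7 := hR₀ y hy
          have h8 : 0 ≤ K' * ‖x - y‖ := by positivity
          nlinarith [norm_nonneg (f x), norm_nonneg (f y)]
        have h9 : w x - w y ≤ w x * (C ^ 2 * ‖f y‖ ^ 2 / 2 - C ^ 2 * ‖f x‖ ^ 2 / 2) := by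
          rw [h3]; nlinarith
        have h10 : C ^ 2 * ‖f y‖ ^ 2 / 2 - C ^ 2 * ‖f x‖ ^ 2 / 2 ≤ C ^ 2 * R₀ * K' * ‖x - y‖ := by
          nlinarith [sq_nonneg C]
        have h11 : 0 ≤ C ^ 2 * R₀ * K' * ‖x - y‖ := by positivity
        nlinarith [hw1 x]
      intro x hx y hy
      refine abs_sub_le_iff.2 ⟨key x hx y hy, ?_⟩
      rw [norm_sub_rev]
      exact key y hy x hx
    refine ⟨K + C ^ 2 * R₀ * K' * D, fun x hx y hy => ?_⟩
    have h1 : (w x : ℂ) • B x - (w y : ℂ) • B y =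
        (w x : ℂ) • (B x - B y) + ((w x - w y : ℝ) : ℂ) • B y := by
      push_cast
      module
    rw [h1]
    refine (norm_add_le _ _).trans ?_
    rw [norm_smul, norm_smul, Complex.norm_real, Complex.norm_real, Real.norm_eq_abs,
      Real.norm_eq_abs, abs_of_pos (Real.exp_pos _ : 0 < w x)]
    have h2 : w x * ‖B x - B y‖ ≤ 1 * (K * ‖x - y‖) := by
      gcongr
      exacts [hw1 x, hK x hx y hy]
    have h3 : |w x - w y| * ‖B y‖ ≤ (C ^ 2 * R₀ * K' * ‖x - y‖) * D :=
      mul_le_mul (hwl x hx y hy) (hD y hy) (norm_nonneg _) (by positivity)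
    linarith
  have hloc : ∀ z₀ ∈ ball (0:ℂ) 1, ∀ a, ∃ σ : ℂ → 𝒢 0, AnalyticAt ℂ σ z₀ ∧ σ z₀ = a ∧
      ∀ᶠ z in 𝓝 z₀, w z * ‖B z (σ z)‖ ≤ w z₀ * ‖B z₀ a‖ := by
    intro z₀ hz₀ a
    have hz₀c := ball_subset_closedBall hz₀
    rcases eq_or_ne (B z₀ a) 0 with hv0 | hv0
    · have ha : a = 0 := (hBz z₀ hz₀c).1 (hv0.trans (map_zero _).symm)
      exact ⟨fun _ => 0, analyticAt_const, ha.symm, by simp [ha]⟩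
    obtain ⟨X, hX, hX2⟩ := h z₀ hz₀c
    obtain ⟨G, hG, hG2⟩ := exists_analytic_leftInverse (hB z₀ hz₀c) (hBz z₀ hz₀c).1
    have hXz := hX0 z₀ X hX2
    set v₀ := B z₀ a with hv₀
    set s : ℂ → V := fun z => Complex.exp (-(inner ℂ v₀ (X z v₀) / (‖v₀‖ : ℂ) ^ 2) +
      (C ^ 2 : ℝ) * inner ℂ (f z₀) (f z - f z₀)) • (v₀ + X z v₀) with hs
    have hXv : AnalyticAt ℂ (fun z => X z v₀) z₀ := analyticAt_clm_apply hX analyticAt_const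
    have hsa : AnalyticAt ℂ s z₀ := by
      refine AnalyticAt.smul (AnalyticAt.cexp ?_) (analyticAt_const.add hXv)
      refine AnalyticAt.add (AnalyticAt.neg ?_) (analyticAt_const.mul ?_)
      · exact (((innerSL ℂ v₀).analyticAt _).comp hXv).div_const
      · exact ((innerSL ℂ (f z₀)).analyticAt _).comp ((hf z₀ hz₀c).sub analyticAt_const)
    have hs0 : s z₀ = v₀ := by simp [hs, hXz]
    refine ⟨fun z => G z (s z), analyticAt_clm_apply hG hsa, ?_, ?_⟩
    · exact (congrArg (G z₀) hs0).trans (hG2.self_of_nhds a)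
    · filter_upwards [hX2, hG2, isOpen_ball.mem_nhds hz₀] with z hz hz2 hzb
      have hmem : s z ∈ 𝒢 z := by
        refine (𝒢 z).smul_mem _ ?_
        rw [hz.1]
        refine ⟨v₀, ?_, rfl⟩
        rw [← (hBz z₀ hz₀c).2]
        exact ⟨a, rfl⟩
      rw [← (hBz z (ball_subset_closedBall hzb)).2] at hmem
      obtain ⟨b, hb⟩ := hmem
      have hb' : B z b = s z := hb
      rw [← hb', hz2 b, hb']
      exact exp_mul_norm_transport_le hv0 ((X z).le_of_opNorm_le hz.2 v₀)
  have hv' := hv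
  rw [← (hBz 0 h0c).2] at hv'
  obtain ⟨a, ha⟩ := hv'
  have ha' : B 0 a = v := ha
  obtain ⟨S, hS, hS0, hSz⟩ := exists_bounded_section hB hwc (Real.exp_pos _) hww
    (mul_pos (Real.exp_pos (-(C ^ 2 * R₀ ^ 2 / 2))) hν) hκ (fun x hx a => by
      rw [mul_assoc]
      exact mul_le_mul (hww x hx) (hν2 x hx a) (by positivity) (Real.exp_pos _).le) hloc a
  refine ⟨S, hS, hS0.trans ha', fun z hz => ⟨?_, (hSz z hz).2.trans ?_⟩⟩
  · rw [← (hBz z (ball_subset_closedBall hz)).2]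
    exact (hSz z hz).1
  · rw [ha', div_eq_mul_inv, ← Real.exp_neg, neg_neg]
    have : w 0 * ‖v‖ ≤ 1 * ‖v‖ := by gcongr; exact hw1 0
    nlinarith [Real.exp_pos (C ^ 2 * R₀ ^ 2 / 2)]

section

variable {E Y : Type*} [NormedAddCommGroup E] [NormedSpace ℂ E] [NormedAddCommGroup Y]
  [NormedSpace ℂ Y]

/-- A graph chart of `M` around `p` with quantitative bounds. -/
structure UChart (M : Set Y) (r C : ℝ) (p : Y) (π : Y →L[ℂ] E) (g : E → Y) : Prop where
  norm_le : ‖π‖ ≤ C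
  diff : DifferentiableOn ℂ g (ball (π p) r)
  mem : ∀ x ∈ ball (π p) r, g x ∈ M
  proj : ∀ x ∈ ball (π p) r, π (g x) = x
  fderiv_le : ∀ x ∈ ball (π p) r, ‖fderiv ℂ g x‖ ≤ C
  lip : ∀ x ∈ ball (π p) r, ∀ y ∈ ball (π p) r, ‖fderiv ℂ g x - fderiv ℂ g y‖ ≤ C * ‖x - y‖
  apply_proj : ∀ q ∈ M, q ∈ ball p r → g (π q) = q

variable {M : Set Y} {r C : ℝ} {p : Y} {π : Y →L[ℂ] E} {g : E → Y}

theorem UChart.mono (h : UChart M r C p π g) {r' C' : ℝ} (hr : r' ≤ r) (hC : C ≤ C') :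
    UChart M r' C' p π g where
  norm_le := h.norm_le.trans hC
  diff := h.diff.mono (ball_subset_ball hr)
  mem x hx := h.mem x (ball_subset_ball hr hx)
  proj x hx := h.proj x (ball_subset_ball hr hx)
  fderiv_le x hx := (h.fderiv_le x (ball_subset_ball hr hx)).trans hC
  lip x hx y hy := (h.lip x (ball_subset_ball hr hx) y (ball_subset_ball hr hy)).trans (by gcongr)
  apply_proj q hq hqr := h.apply_proj q hq (ball_subset_ball hr hqr)

theorem Good.exists_uChart (h : Good E M p) (hp : p ∈ M) :
    ∃ (π : Y →L[ℂ] E) (g : E → Y), ∃ ρ > 0, ∃ r > 0, ∃ C, ∀ q ∈ ball p ρ, UChart M r C q π g := by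
  obtain ⟨π, W, g, β, hpW, hG⟩ := h
  have hpM : π p ∈ β := hG.proj_mem hp hpW
  obtain ⟨r, hr, C, hC, hsub, hlip⟩ := exists_lipschitz_fderiv hG.isOpen_β hG.diff hpM
  obtain ⟨s, hs, hsW⟩ := Metric.isOpen_iff.1 hG.isOpen_W p hpW
  set ρ := min (s / 2) (r / (2 * (‖π‖ + 1))) with hρ
  have hρ0 : 0 < ρ := by positivity
  have hball : ∀ q ∈ ball p ρ, ball (π q) (min (s / 2) (r / 2)) ⊆ ball (π p) r := by
    intro q hq
    refine ball_subset_ball' ?_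
    have h1 : dist (π q) (π p) ≤ r / 2 := by
      rw [dist_eq_norm, ← map_sub]
      refine (π.le_opNorm _).trans ?_
      have h2 : ‖q - p‖ ≤ r / (2 * (‖π‖ + 1)) := by
        rw [← dist_eq_norm]
        exact hq.le.trans (min_le_right _ _)
      calc ‖π‖ * ‖q - p‖ ≤ (‖π‖ + 1) * (r / (2 * (‖π‖ + 1))) := by gcongr; linarith
        _ = r / 2 := by field_simp
    linarith [min_le_right (s / 2) (r / 2)]
  refine ⟨π, g, ρ, hρ0, min (s / 2) (r / 2), by positivity,
    max ‖π‖ (max C (‖fderiv ℂ g (π p)‖ + C * r)), fun q hq => ?_⟩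
  have hb := hball q hq
  refine ⟨le_max_left _ _, hG.diff.mono (hb.trans hsub), fun x hx => (hG.mem (hsub (hb hx))).1,
    fun x hx => hG.proj x (hsub (hb hx)), fun x hx => ?_, fun x hx y hy => ?_, fun y hy hyq => ?_⟩
  · refine le_trans ?_ ((le_max_right _ _).trans (le_max_right _ _))
    have h1 := hlip x (hb hx) (π p) (mem_ball_self hr)
    have h2 : ‖x - π p‖ ≤ r := by
      rw [← dist_eq_norm]
      exact (hb hx).le
    have h3 := norm_le_norm_add_norm_sub' (fderiv ℂ g x) (fderiv ℂ g (π p))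
    have h4 : C * ‖x - π p‖ ≤ C * r := by gcongr
    linarith
  · refine (hlip x (hb hx) y (hb hy)).trans ?_
    gcongr
    exact (le_max_left _ _).trans (le_max_right _ _)
  · refine hG.apply_proj hy (hsW ?_)
    rw [mem_ball] at hyq hq ⊢
    have h1 := dist_triangle y q p
    have h2 := min_le_left (s / 2) (r / 2)
    have h3 := min_le_left (s / 2) (r / (2 * (‖π‖ + 1)))
    linarith

theorem exists_uniform_uChart {K : Set Y} (hK : IsCompact K) (hKM : K ⊆ M)
    (h : ∀ p ∈ K, Good E M p) :
    ∃ r > 0, ∃ C ≥ 1, ∀ p ∈ K, ∃ (π : Y →L[ℂ] E) (g : E → Y), UChart M r C p π g := by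
  refine hK.induction_on (p := fun s => ∃ r > 0, ∃ C ≥ 1, ∀ p ∈ s,
    ∃ (π : Y →L[ℂ] E) (g : E → Y), UChart M r C p π g) ?_ ?_ ?_ ?_
  · exact ⟨1, one_pos, 1, le_rfl, by simp⟩
  · rintro s t hst ⟨r, hr, C, hC, h⟩
    exact ⟨r, hr, C, hC, fun p hp => h p (hst hp)⟩
  · rintro s t ⟨r, hr, C, hC, h⟩ ⟨r', hr', C', hC', h'⟩
    refine ⟨min r r', lt_min hr hr', max C C', le_max_of_le_left hC, ?_⟩
    rintro p (hp | hp)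
    · obtain ⟨π, g, hg⟩ := h p hp
      exact ⟨π, g, hg.mono (min_le_left _ _) (le_max_left _ _)⟩
    · obtain ⟨π, g, hg⟩ := h' p hp
      exact ⟨π, g, hg.mono (min_le_right _ _) (le_max_right _ _)⟩
  · intro p hp
    obtain ⟨π, g, ρ, hρ, r, hr, C, hC⟩ := (h p hp).exists_uChart (hKM hp)
    exact ⟨ball p ρ, mem_nhdsWithin_of_mem_nhds (ball_mem_nhds p hρ), r, hr, max C 1,
      le_max_right _ _, fun q hq => ⟨π, g, (hC q hq).mono le_rfl (le_max_left _ _)⟩⟩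

/-- The projection onto the tangent space of the graph of `g` at `q`. -/
noncomputable def tproj (π : Y →L[ℂ] E) (g : E → Y) (q : Y) : Y →L[ℂ] Y :=
  fderiv ℂ g (π q) ∘L π

theorem UChart.differentiableAt (h : UChart M r C p π g) {x : E} (hx : x ∈ ball (π p) r) :
    DifferentiableAt ℂ g x :=
  (h.diff x hx).differentiableAt (isOpen_ball.mem_nhds hx)

theorem UChart.proj_fderiv (h : UChart M r C p π g) {x : E} (hx : x ∈ ball (π p) r) (v : E) :
    π (fderiv ℂ g x v) = v := by
  have h1 : HasFDerivAt (fun x => π (g x)) (π.comp (fderiv ℂ g x)) x :=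
    π.hasFDerivAt.comp x (h.differentiableAt hx).hasFDerivAt
  have h2 : HasFDerivAt (fun x => π (g x)) (ContinuousLinearMap.id ℂ E) x :=
    (hasFDerivAt_id x).congr_of_eventuallyEq (by
      filter_upwards [isOpen_ball.mem_nhds hx] with y hy using h.proj y hy)
  exact DFunLike.congr_fun (h1.unique h2) v

/-- Velocities of curves in `M` are fixed by the tangent projection. -/
theorem UChart.tproj_velocity (h : UChart M r C p π g) {q : Y} (hq : q ∈ ball p r)
    (hπq : π q ∈ ball (π p) r) {c : ℂ → Y} {v : Y} {t : ℂ} (hc : HasDerivAt c v t) (h0 : c t = q)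
    (hM : ∀ᶠ s in 𝓝 t, c s ∈ M) : tproj π g q v = v := by
  have h1 : HasDerivAt (fun s => g (π (c s))) (fderiv ℂ g (π q) (π v)) t := by
    have h2 : HasDerivAt (fun s => π (c s)) (π v) t := π.hasFDerivAt.comp_hasDerivAt t hc
    refine HasFDerivAt.comp_hasDerivAt t ?_ h2
    rw [h0]
    exact (h.differentiableAt hπq).hasFDerivAt
  refine h1.unique (hc.congr_of_eventuallyEq ?_)
  have h3 : ∀ᶠ s in 𝓝 t, c s ∈ ball p r :=
    hc.continuousAt.eventually_mem (isOpen_ball.mem_nhds (h0 ▸ hq))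
  filter_upwards [hM, h3] with s hs hs2 using h.apply_proj _ hs hs2

/-- Tangent vectors of `M`, in the sense of a chart, are velocities of curves in `M`. -/
theorem UChart.exists_curve (h : UChart M r C p π g) {q : Y} (hqM : q ∈ M) (hq : q ∈ ball p r)
    (hπq : π q ∈ ball (π p) r) (v : Y) :
    ∃ c : ℂ → Y, HasDerivAt c (tproj π g q v) 0 ∧ c 0 = q ∧ ∀ᶠ s in 𝓝 0, c s ∈ M := by
  have h2 : HasDerivAt (fun s : ℂ => π q + s • π v) (π v) 0 := by
    simpa using ((hasDerivAt_id (0:ℂ)).smul_const (π v)).const_add (π q)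
  refine ⟨fun s => g (π q + s • π v), ?_, ?_, ?_⟩
  · refine HasFDerivAt.comp_hasDerivAt 0 ?_ h2
    simp only [zero_smul, add_zero]
    exact (h.differentiableAt hπq).hasFDerivAt
  · simp only [zero_smul, add_zero]
    exact h.apply_proj q hqM hq
  · have h3 : ∀ᶠ s in 𝓝 (0:ℂ), π q + s • π v ∈ ball (π p) r :=
      h2.continuousAt.eventually_mem (isOpen_ball.mem_nhds (by simpa using hπq))
    filter_upwards [h3] with s hs using h.mem _ hs

theorem UChart.tproj_comp_tproj (h : UChart M r C p π g) {r' C' : ℝ} {p' : Y} {π' : Y →L[ℂ] E}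
    {g' : E → Y} (h' : UChart M r' C' p' π' g') {q : Y} (hqM : q ∈ M) (hq : q ∈ ball p r)
    (hπq : π q ∈ ball (π p) r) (hq' : q ∈ ball p' r') (hπq' : π' q ∈ ball (π' p') r') :
    tproj π g q ∘L tproj π' g' q = tproj π' g' q := by
  ext v
  obtain ⟨c, hc, hc0, hcM⟩ := h'.exists_curve hqM hq' hπq' v
  exact h.tproj_velocity hq hπq hc hc0 hcM

theorem UChart.tproj_comp_tproj_of_proj (h : UChart M r C p π g) {q' : Y} (q : Y)
    (hπq : π q' ∈ ball (π p) r) :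
    tproj π g q ∘L tproj π g q' = tproj π g q := by
  ext v
  simp only [tproj, ContinuousLinearMap.comp_apply, h.proj_fderiv hπq]

theorem UChart.norm_tproj_sub_le (h : UChart M r C p π g) {q q' : Y}
    (hq : π q ∈ ball (π p) r) (hq' : π q' ∈ ball (π p) r) :
    ‖tproj π g q - tproj π g q'‖ ≤ C ^ 3 * ‖q - q'‖ := by
  have hC : 0 ≤ C := (norm_nonneg _).trans h.norm_le
  have h1 : tproj π g q - tproj π g q' = (fderiv ℂ g (π q) - fderiv ℂ g (π q')) ∘L π := by
    ext v
    simp [tproj]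
  rw [h1]
  have h2 : ‖π q - π q'‖ ≤ C * ‖q - q'‖ := by
    rw [← map_sub]
    exact π.le_of_opNorm_le h.norm_le _
  calc _ ≤ ‖fderiv ℂ g (π q) - fderiv ℂ g (π q')‖ * ‖π‖ := ContinuousLinearMap.opNorm_comp_le _ _
    _ ≤ (C * (C * ‖q - q'‖)) * C := by
      gcongr
      · exact (h.lip _ hq _ hq').trans (by gcongr)
      · exact h.norm_le
    _ = _ := by ring

theorem UChart.norm_sub_sub_le (h : UChart M r C p π g) {x y y' : E} (hx : x ∈ ball (π p) r)
    (hy : y ∈ ball (π p) r) (hy' : y' ∈ ball (π p) r) {δ : ℝ} (hyx : ‖y - x‖ ≤ δ)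
    (hyx' : ‖y' - x‖ ≤ δ) : ‖g y - g y' - fderiv ℂ g x (y - y')‖ ≤ C * δ * ‖y - y'‖ :=
  norm_sub_sub_fderiv_le ((norm_nonneg _).trans h.norm_le) (fun x hx => h.differentiableAt hx)
    h.lip hx hy hy' hyx hyx'

/-- The derivative of the chart is holomorphic along holomorphic discs. -/
theorem UChart.differentiableOn_fderiv [FiniteDimensional ℂ E] [CompleteSpace Y]
    (h : UChart M r C p π g) {U : Set ℂ} (hU : IsOpen U) {x : ℂ → E}
    (hx : DifferentiableOn ℂ x U) (hxr : ∀ z ∈ U, x z ∈ ball (π p) r) :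
    DifferentiableOn ℂ (fun z => fderiv ℂ g (x z)) U := by
  have hC : 0 ≤ C := (norm_nonneg _).trans h.norm_le
  refine ((contDiffOn_clm_apply (n := 1)).2 fun e => ?_).differentiableOn one_ne_zero
  refine DifferentiableOn.contDiffOn ?_ hU
  intro z₀ hz₀
  -- on a smaller neighbourhood there is room for difference quotients
  obtain ⟨s, hs, hsr⟩ := exists_between (mem_ball.1 (hxr z₀ hz₀))
  set U' := U ∩ x ⁻¹' ball (π p) s with hU'
  have hU'o : IsOpen U' := hx.continuousOn.isOpen_inter_preimage hU isOpen_ball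
  have hz₀' : z₀ ∈ U' := ⟨hz₀, hs⟩
  have hmem : ∀ t : ℂ, ‖t‖ * ‖e‖ ≤ r - s → ∀ z ∈ U', x z + t • e ∈ ball (π p) r := by
    intro t ht z hz
    rw [mem_ball, dist_eq_norm]
    have h1 : ‖x z - π p‖ < s := by
      rw [← dist_eq_norm]
      exact hz.2
    have h2 := norm_add_le (x z - π p) (t • e)
    rw [norm_smul] at h2
    rw [add_sub_right_comm]
    linarith
  have hev : ∀ᶠ n : ℕ in atTop, ‖((n:ℂ) + 1)⁻¹‖ * ‖e‖ ≤ r - s := by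
    have h1 : Tendsto (fun n : ℕ => ‖((n:ℂ) + 1)⁻¹‖ * ‖e‖) atTop (𝓝 (‖(0:ℂ)‖ * ‖e‖)) := by
      refine (Tendsto.norm ?_).mul_const _
      simpa using tendsto_one_div_add_atTop_nhds_zero_nat (𝕜 := ℂ)
    rw [norm_zero, zero_mul] at h1
    exact h1.eventually_le_const (by linarith)
  have hlim : TendstoUniformlyOn (fun (n : ℕ) z => ((n:ℂ) + 1) • (g (x z + ((n:ℂ) + 1)⁻¹ • e) - g (x z)))
      (fun z => fderiv ℂ g (x z) e) atTop U' := by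
    rw [Metric.tendstoUniformlyOn_iff]
    intro ε hε
    have h1 : Tendsto (fun n : ℕ => C * ‖((n:ℂ) + 1)⁻¹‖ * ‖e‖ ^ 2) atTop (𝓝 (C * ‖(0:ℂ)‖ * ‖e‖ ^ 2)) := by
      refine ((Tendsto.norm ?_).const_mul _).mul_const _
      simpa using tendsto_one_div_add_atTop_nhds_zero_nat (𝕜 := ℂ)
    rw [norm_zero, mul_zero, zero_mul] at h1
    filter_upwards [hev, h1.eventually_lt_const hε] with n hn hn2 z hz
    refine lt_of_le_of_lt ?_ hn2
    have hn0 : (n:ℂ) + 1 ≠ 0 := Nat.cast_add_one_ne_zero n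
    set t := ((n:ℂ) + 1)⁻¹ with ht
    have ht0 : t ≠ 0 := inv_ne_zero hn0
    have h2 := h.norm_sub_sub_le (hxr z hz.1) (hmem t hn z hz) (hxr z hz.1)
      (δ := ‖t‖ * ‖e‖) (by rw [add_sub_cancel_left, norm_smul])
      (by rw [sub_self, norm_zero]; positivity)
    rw [add_sub_cancel_left, norm_smul, map_smul] at h2
    have h3 : fderiv ℂ g (x z) e - ((n:ℂ) + 1) • (g (x z + t • e) - g (x z)) =
        -(t⁻¹ • (g (x z + t • e) - g (x z) - t • fderiv ℂ g (x z) e)) := by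
      have e1 : (n:ℂ) + 1 = t⁻¹ := by rw [ht, inv_inv]
      rw [e1, smul_sub t⁻¹ (g _ - g _) (t • _), smul_smul, inv_mul_cancel₀ ht0]
      module
    rw [dist_eq_norm, h3, norm_neg, norm_smul, norm_inv]
    have ht1 : 0 < ‖t‖ := norm_pos_iff.2 ht0
    rw [inv_mul_le_iff₀ ht1]
    nlinarith
  have hd : DifferentiableOn ℂ (fun z => fderiv ℂ g (x z) e) U' := by
    refine hlim.tendstoLocallyUniformlyOn.differentiableOn ?_ hU'o
    filter_upwards [hev] with n hn
    have hx' := hx.mono (inter_subset_left : U' ⊆ U)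
    refine DifferentiableOn.const_smul (DifferentiableOn.sub ?_ ?_) _
    · exact h.diff.comp (hx'.add_const _) fun z hz => hmem _ hn z hz
    · exact h.diff.comp hx' fun z hz => hxr z hz.1
  exact ((hd z₀ hz₀').differentiableAt (hU'o.mem_nhds hz₀')).differentiableWithinAt

end

/-- The bounded section theorem for an arbitrary finite-dimensional normed space. -/
theorem exists_bounded_section_of_transport_normed (V : Type*) {Y : Type*} [NormedAddCommGroup V]
    [NormedSpace ℂ V] [FiniteDimensional ℂ V] [NormedAddCommGroup Y] [InnerProductSpace ℂ Y]
    [CompleteSpace Y] (R₀ C : ℝ) :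
    ∃ D, 0 ≤ D ∧ ∀ (f : ℂ → Y), AnalyticOnNhd ℂ f (closedBall 0 1) →
      (∀ z ∈ closedBall (0:ℂ) 1, ‖f z‖ ≤ R₀) → ∀ 𝒢 : ℂ → Submodule ℂ V,
      (∀ z₀ ∈ closedBall (0:ℂ) 1, ∃ X : ℂ → V →L[ℂ] V, AnalyticAt ℂ X z₀ ∧
        ∀ᶠ z in 𝓝 z₀, 𝒢 z = (𝒢 z₀).map (1 + X z : V →L[ℂ] V).toLinearMap ∧
          ‖X z‖ ≤ C * ‖f z - f z₀‖) → ∀ v ∈ 𝒢 0,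
      ∃ S : ℂ → V, DifferentiableOn ℂ S (ball 0 1) ∧ S 0 = v ∧
        ∀ z ∈ ball (0:ℂ) 1, S z ∈ 𝒢 z ∧ ‖S z‖ ≤ D * ‖v‖ := by
  let T : V ≃L[ℂ] EuclideanSpace ℂ (Fin (Module.finrank ℂ V)) :=
    ContinuousLinearEquiv.ofFinrankEq (by simp)
  set a := ‖(T : V →L[ℂ] EuclideanSpace ℂ (Fin (Module.finrank ℂ V)))‖ with ha
  set b := ‖(T.symm : EuclideanSpace ℂ (Fin (Module.finrank ℂ V)) →L[ℂ] V)‖ with hb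
  refine ⟨b * (Real.exp ((a * b * C) ^ 2 * R₀ ^ 2 / 2) * a), by positivity,
    fun f hf hR₀ 𝒢 h v hv => ?_⟩
  have key := exists_bounded_section_of_transport (V := EuclideanSpace ℂ (Fin (Module.finrank ℂ V)))
    hf hR₀ (𝒢 := fun z => (𝒢 z).map (T : V →L[ℂ] EuclideanSpace ℂ (Fin (Module.finrank ℂ V))).toLinearMap)
    (C := a * b * C) ?_ (v := T v) ⟨v, hv, rfl⟩
  · obtain ⟨S, hS, hS0, hSb⟩ := key
    refine ⟨fun z => T.symm (S z), ?_, by simp [hS0], fun z hz => ⟨?_, ?_⟩⟩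
    · exact (T.symm : EuclideanSpace ℂ (Fin (Module.finrank ℂ V)) →L[ℂ] V).differentiable.comp_differentiableOn hS
    · obtain ⟨w, hw, hwz⟩ := (hSb z hz).1
      have : T.symm (S z) = w := by simp [← hwz]
      change T.symm (S z) ∈ 𝒢 z
      rwa [this]
    · calc ‖T.symm (S z)‖ ≤ b * ‖S z‖ :=
            (T.symm : EuclideanSpace ℂ (Fin (Module.finrank ℂ V)) →L[ℂ] V).le_opNorm _
        _ ≤ b * (Real.exp ((a * b * C) ^ 2 * R₀ ^ 2 / 2) * (a * ‖v‖)) := by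
            gcongr
            refine (hSb z hz).2.trans ?_
            gcongr
            exact (T : V →L[ℂ] EuclideanSpace ℂ (Fin (Module.finrank ℂ V))).le_opNorm _
        _ = _ := by ring
  · intro z₀ hz₀
    obtain ⟨X, hX, hXz⟩ := h z₀ hz₀
    refine ⟨fun z => (T : V →L[ℂ] EuclideanSpace ℂ (Fin (Module.finrank ℂ V))) ∘L X z ∘L
      (T.symm : EuclideanSpace ℂ (Fin (Module.finrank ℂ V)) →L[ℂ] V), ?_, ?_⟩
    · exact analyticAt_clm_comp analyticAt_const (analyticAt_clm_comp hX analyticAt_const)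
    · filter_upwards [hXz] with z hz
      refine ⟨?_, ?_⟩
      · rw [hz.1]
        ext w
        simp only [Submodule.mem_map]
        constructor
        · rintro ⟨_, ⟨u, hu, rfl⟩, rfl⟩
          refine ⟨T u, ⟨u, hu, rfl⟩, ?_⟩
          simp
        · rintro ⟨_, ⟨u, hu, rfl⟩, rfl⟩
          refine ⟨u + X z u, ⟨u, hu, rfl⟩, ?_⟩
          simp
      · calc _ ≤ a * (‖X z‖ * b) :=
              (ContinuousLinearMap.opNorm_comp_le _ _).trans (by
                gcongr
                exact ContinuousLinearMap.opNorm_comp_le _ _)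
          _ ≤ a * ((C * ‖f z - f z₀‖) * b) := by gcongr; exact hz.2
          _ = _ := by ring

section Stabilizer

variable {Y : Type*} [NormedAddCommGroup Y] [NormedSpace ℂ Y]

/-- Pairs of an endomorphism with values in the image of `Q`, and the scalar by which it acts
there. -/
noncomputable def stab (Q : Y →L[ℂ] Y) : Submodule ℂ ((Y →L[ℂ] Y) × ℂ) where
  carrier := {x | Q * x.1 = x.1 ∧ x.1 * Q = x.2 • Q}
  zero_mem' := by simp
  add_mem' := by
    rintro x y ⟨hx, hx'⟩ ⟨hy, hy'⟩
    exact ⟨by simp [mul_add, hx, hy], by simp [add_mul, add_smul, hx', hy']⟩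
  smul_mem' := by
    rintro c x ⟨hx, hx'⟩
    exact ⟨by simp [hx], by simp [hx', smul_smul]⟩

variable {Q Q₀ : Y →L[ℂ] Y}

theorem stab_le_of_mul_eq (h : Q * Q₀ = Q₀) (h' : Q₀ * Q = Q) : stab Q ≤ stab Q₀ := by
  rintro x ⟨hx, hx'⟩
  refine ⟨?_, ?_⟩
  · rw [← hx, ← mul_assoc, h']
  · rw [← h, ← mul_assoc, hx', smul_mul_assoc]

theorem stab_eq_of_mul_eq (h : Q * Q₀ = Q₀) (hq : Q₀ * Q = Q) : stab Q = stab Q₀ :=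
  (stab_le_of_mul_eq h hq).antisymm (stab_le_of_mul_eq hq h)

/-- Conjugation by `1 + Δ`, minus the identity, when `Δ ^ 2 = 0`. -/
noncomputable def conjSub (Δ : Y →L[ℂ] Y) : ((Y →L[ℂ] Y) × ℂ) →L[ℂ] ((Y →L[ℂ] Y) × ℂ) :=
  ContinuousLinearMap.inl ℂ (Y →L[ℂ] Y) ℂ ∘L
    ((ContinuousLinearMap.compL ℂ Y Y Y Δ - (ContinuousLinearMap.compL ℂ Y Y Y).flip Δ -
      ContinuousLinearMap.compL ℂ Y Y Y Δ ∘L (ContinuousLinearMap.compL ℂ Y Y Y).flip Δ) ∘L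
    ContinuousLinearMap.fst ℂ (Y →L[ℂ] Y) ℂ)

theorem conjSub_apply (Δ : Y →L[ℂ] Y) (x : (Y →L[ℂ] Y) × ℂ) :
    conjSub Δ x = (Δ * x.1 - x.1 * Δ - Δ * (x.1 * Δ), 0) := rfl

theorem one_add_conjSub_apply (Δ : Y →L[ℂ] Y) (x : (Y →L[ℂ] Y) × ℂ) :
    (1 + conjSub Δ : ((Y →L[ℂ] Y) × ℂ) →L[ℂ] ((Y →L[ℂ] Y) × ℂ)) x =
      ((1 + Δ) * x.1 * (1 - Δ), x.2) := by
  rw [ContinuousLinearMap.add_apply, conjSub_apply]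
  refine Prod.ext ?_ ?_
  · simp only [ContinuousLinearMap.one_apply, Prod.fst_add]
    noncomm_ring
  · simp

theorem norm_conjSub_le {Δ : Y →L[ℂ] Y} (hΔ : ‖Δ‖ ≤ 1) : ‖conjSub Δ‖ ≤ 3 * ‖Δ‖ := by
  refine ContinuousLinearMap.opNorm_le_bound _ (by positivity) fun x => ?_
  rw [conjSub_apply, Prod.norm_def, norm_zero, max_eq_left (norm_nonneg _)]
  have h0 : ‖x.1‖ ≤ ‖x‖ := norm_fst_le x
  have h1 : ‖Δ * x.1‖ ≤ ‖Δ‖ * ‖x‖ := (norm_mul_le _ _).trans (by gcongr)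
  have h2 : ‖x.1 * Δ‖ ≤ ‖Δ‖ * ‖x‖ := (norm_mul_le _ _).trans (by rw [mul_comm]; gcongr)
  have h3 : ‖Δ * (x.1 * Δ)‖ ≤ ‖Δ‖ * ‖x‖ :=
    (norm_mul_le _ _).trans <| (mul_le_mul hΔ h2 (norm_nonneg _) zero_le_one).trans (one_mul _).le
  have h4 := norm_sub_le (Δ * x.1 - x.1 * Δ) (Δ * (x.1 * Δ))
  have h5 := norm_sub_le (Δ * x.1) (x.1 * Δ)
  linarith

theorem analyticAt_conjSub {Δ : ℂ → Y →L[ℂ] Y} {z : ℂ} (h : AnalyticAt ℂ Δ z) :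
    AnalyticAt ℂ (fun z => conjSub (Δ z)) z := by
  have h1 : AnalyticAt ℂ (fun z => ContinuousLinearMap.compL ℂ Y Y Y (Δ z)) z :=
    ((ContinuousLinearMap.compL ℂ Y Y Y).analyticAt _).comp h
  have h2 : AnalyticAt ℂ (fun z => (ContinuousLinearMap.compL ℂ Y Y Y).flip (Δ z)) z :=
    ((ContinuousLinearMap.compL ℂ Y Y Y).flip.analyticAt _).comp h
  exact analyticAt_clm_comp analyticAt_const
    (analyticAt_clm_comp ((h1.sub h2).sub (analyticAt_clm_comp h1 h2)) analyticAt_const)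

theorem conj_mem_stab (h : Q * Q₀ = Q) (h' : Q₀ * Q = Q₀) {x : (Y →L[ℂ] Y) × ℂ}
    (hx : x ∈ stab Q₀) : ((1 + (Q - Q₀)) * x.1 * (1 - (Q - Q₀)), x.2) ∈ stab Q := by
  have hQ : Q * Q = Q := by
    calc Q * Q = (Q * Q₀) * Q := by rw [h]
      _ = Q := by rw [mul_assoc, h', h]
  have hQ₀ : Q₀ * Q₀ = Q₀ := by
    calc Q₀ * Q₀ = (Q₀ * Q) * Q₀ := by rw [h']
      _ = Q₀ := by rw [mul_assoc, h, h']
  obtain ⟨hx1, hx2⟩ := hx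
  have e1 : (1 + (Q - Q₀)) * x.1 = Q * x.1 := by
    have : (1 + (Q - Q₀)) * (Q₀ * x.1) = Q * (Q₀ * x.1) := by
      rw [← mul_assoc, ← mul_assoc, add_mul, sub_mul, hQ₀, one_mul]
      congr 1
      abel
    rwa [hx1] at this
  have e2 : (1 - (Q - Q₀)) * Q = Q₀ := by
    rw [sub_mul, sub_mul, hQ, h', one_mul]
    abel
  refine ⟨?_, ?_⟩
  · simp only
    rw [e1, ← mul_assoc, ← mul_assoc, hQ]
  · simp only
    rw [e1, mul_assoc, e2, mul_assoc, hx2, mul_smul_comm, h]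

theorem stab_eq_map_conjSub (h : Q * Q₀ = Q) (h' : Q₀ * Q = Q₀) :
    stab Q = (stab Q₀).map (1 + conjSub (Q - Q₀) :
      ((Y →L[ℂ] Y) × ℂ) →L[ℂ] ((Y →L[ℂ] Y) × ℂ)).toLinearMap := by
  have hQ : Q * Q = Q := by
    calc Q * Q = (Q * Q₀) * Q := by rw [h]
      _ = Q := by rw [mul_assoc, h', h]
  have hQ₀ : Q₀ * Q₀ = Q₀ := by
    calc Q₀ * Q₀ = (Q₀ * Q) * Q₀ := by rw [h']
      _ = Q₀ := by rw [mul_assoc, h, h']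
  have hΔ : (Q - Q₀) * (Q - Q₀) = 0 := by
    rw [sub_mul, mul_sub, mul_sub, hQ, h, h', hQ₀]
    abel
  refine le_antisymm (fun x hx => ?_) ?_
  · refine ⟨_, conj_mem_stab h' h hx, ?_⟩
    change (1 + conjSub (Q - Q₀) : ((Y →L[ℂ] Y) × ℂ) →L[ℂ] ((Y →L[ℂ] Y) × ℂ)) _ = x
    rw [one_add_conjSub_apply]
    refine Prod.ext ?_ rfl
    simp only
    set Δ := Q - Q₀ with hΔd
    have e : Q₀ - Q = -Δ := by rw [hΔd]; abel
    rw [e]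
    have e1 : (1 + Δ) * (1 + -Δ) = 1 := by
      rw [mul_add, add_mul, add_mul, mul_neg, mul_neg, hΔ]
      simp
    have e2 : (1 - -Δ) * (1 - Δ) = 1 := by
      rw [mul_sub, sub_mul, sub_mul, neg_mul, neg_mul, hΔ]
      simp
    calc _ = ((1 + Δ) * (1 + -Δ)) * x.1 * ((1 - -Δ) * (1 - Δ)) := by noncomm_ring
      _ = x.1 := by rw [e1, e2, one_mul, mul_one]
  · rintro _ ⟨x, hx, rfl⟩
    have := conj_mem_stab h h' hx
    rw [← one_add_conjSub_apply] at this
    exact this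

end Stabilizer

/-- Along a holomorphic disc in a compact part of `M` there are uniformly bounded holomorphic
endomorphisms of the ambient space which map into the tangent spaces of `M` and are scalar
there. -/
theorem exists_bounded_stabilizer {E Y : Type*} [NormedAddCommGroup E] [NormedSpace ℂ E]
    [FiniteDimensional ℂ E] [NormedAddCommGroup Y] [InnerProductSpace ℂ Y] [FiniteDimensional ℂ Y]
    {M K : Set Y} (hK : IsCompact K) (hKM : K ⊆ M) {r C : ℝ} (hr : 0 < r)
    {π : Y → Y →L[ℂ] E} {g : Y → E → Y} (h : ∀ p ∈ K, UChart M r C p (π p) (g p)) :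
    ∃ D, 0 ≤ D ∧ ∀ (R : ℝ) (f : ℂ → Y), 1 < R → DifferentiableOn ℂ f (ball 0 R) →
      MapsTo f (ball 0 R) K →
      ∃ (S : ℂ → Y →L[ℂ] Y) (l : ℂ → ℂ), DifferentiableOn ℂ S (ball 0 1) ∧
        DifferentiableOn ℂ l (ball 0 1) ∧ l 0 = 1 ∧ S 0 = tproj (π (f 0)) (g (f 0)) (f 0) ∧
        ∀ z ∈ ball (0:ℂ) 1, ‖S z‖ ≤ D ∧ ‖l z‖ ≤ D ∧
          tproj (π (f z)) (g (f z)) (f z) * S z = S z ∧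
          S z * tproj (π (f z)) (g (f z)) (f z) = l z • tproj (π (f z)) (g (f z)) (f z) := by
  have : CompleteSpace Y := FiniteDimensional.complete ℂ Y
  have : CompleteSpace E := FiniteDimensional.complete ℂ E
  obtain ⟨R₀, hR₀⟩ := hK.isBounded.exists_norm_le
  obtain ⟨D, hD, H⟩ := exists_bounded_section_of_transport_normed ((Y →L[ℂ] Y) × ℂ) (Y := Y)
    R₀ (3 * C ^ 3)
  refine ⟨D * max (C * C) 1, by positivity, fun R f hR hf hfK => ?_⟩
  have hsub : closedBall (0:ℂ) 1 ⊆ ball 0 R := closedBall_subset_ball hR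
  have hfa : AnalyticOnNhd ℂ f (ball 0 R) := hf.analyticOnNhd isOpen_ball
  have hself : ∀ p ∈ K, tproj (π p) (g p) p * tproj (π p) (g p) p = tproj (π p) (g p) p :=
    fun p hp => (h p hp).tproj_comp_tproj (h p hp) (hKM hp) (mem_ball_self hr) (mem_ball_self hr)
      (mem_ball_self hr) (mem_ball_self hr)
  have h0 : (0:ℂ) ∈ ball (0:ℂ) R := mem_ball_self (by linarith)
  have htr : ∀ z₀ ∈ closedBall (0:ℂ) 1, ∃ X : ℂ → ((Y →L[ℂ] Y) × ℂ) →L[ℂ] ((Y →L[ℂ] Y) × ℂ),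
      AnalyticAt ℂ X z₀ ∧ ∀ᶠ z in 𝓝 z₀, stab (tproj (π (f z)) (g (f z)) (f z)) =
        (stab (tproj (π (f z₀)) (g (f z₀)) (f z₀))).map
          (1 + X z : ((Y →L[ℂ] Y) × ℂ) →L[ℂ] ((Y →L[ℂ] Y) × ℂ)).toLinearMap ∧
        ‖X z‖ ≤ 3 * C ^ 3 * ‖f z - f z₀‖ := by
    intro z₀ hz₀
    have hz₀R := hsub hz₀
    set p := f z₀ with hp
    have hpK : p ∈ K := hfK hz₀R
    have hh := h p hpK
    have hc : ContinuousAt f z₀ := (hfa z₀ hz₀R).continuousAt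
    have hcπ : ∀ L : Y →L[ℂ] E, ContinuousAt (fun z => L (f z)) z₀ := fun L =>
      L.continuous.continuousAt.comp hc
    have hev : ∀ᶠ z in 𝓝 z₀, z ∈ ball (0:ℂ) R ∧ f z ∈ ball p r ∧ π p (f z) ∈ ball (π p p) r :=
      (isOpen_ball.eventually_mem hz₀R).and ((hc.eventually_mem (ball_mem_nhds _ hr)).and
        ((hcπ _).eventually_mem (ball_mem_nhds _ hr)))
    obtain ⟨U, hU, hUo, hzU⟩ := _root_.mem_nhds_iff.1 hev
    have hxd : DifferentiableOn ℂ (fun z => π p (f z)) U :=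
      (π p).differentiable.comp_differentiableOn (hf.mono fun z hz => (hU hz).1)
    have hT : AnalyticAt ℂ (fun z => tproj (π p) (g p) (f z)) z₀ := by
      refine analyticAt_clm_comp ?_ analyticAt_const
      exact (hh.differentiableOn_fderiv hUo hxd fun z hz => (hU hz).2.2).analyticAt (hUo.mem_nhds hzU)
    have hΔa : AnalyticAt ℂ (fun z => tproj (π p) (g p) (f z) - tproj (π p) (g p) p) z₀ :=
      hT.sub analyticAt_const
    refine ⟨_, analyticAt_conjSub hΔa, ?_⟩
    have hsmall : ∀ᶠ z in 𝓝 z₀, ‖tproj (π p) (g p) (f z) - tproj (π p) (g p) p‖ < 1 := by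
      refine hΔa.continuousAt.norm.eventually_lt_const ?_
      simp [hp]
    filter_upwards [hev, hsmall] with z hz hzs
    have hzK : f z ∈ K := hfK hz.1
    have hpp : π p p ∈ ball (π p p) r := mem_ball_self hr
    refine ⟨?_, ?_⟩
    · have e1 : stab (tproj (π (f z)) (g (f z)) (f z)) = stab (tproj (π p) (g p) (f z)) :=
        stab_eq_of_mul_eq
          ((h _ hzK).tproj_comp_tproj hh (hKM hzK) (mem_ball_self hr) (mem_ball_self hr) hz.2.1 hz.2.2)
          (hh.tproj_comp_tproj (h _ hzK) (hKM hzK) hz.2.1 hz.2.2 (mem_ball_self hr) (mem_ball_self hr))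
      refine e1.trans ?_
      exact stab_eq_map_conjSub (hh.tproj_comp_tproj_of_proj _ hpp)
        (hh.tproj_comp_tproj_of_proj _ hz.2.2)
    · refine (norm_conjSub_le hzs.le).trans ?_
      have := hh.norm_tproj_sub_le hz.2.2 hpp
      linarith
  obtain ⟨S, hS, hS0, hSb⟩ := H f (hfa.mono hsub) (fun z hz => hR₀ _ (hfK (hsub hz)))
    (fun z => stab (tproj (π (f z)) (g (f z)) (f z))) htr (tproj (π (f 0)) (g (f 0)) (f 0), 1)
    ⟨hself _ (hfK h0), by simpa using hself _ (hfK h0)⟩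
  have hv : ‖((tproj (π (f 0)) (g (f 0)) (f 0), 1) : (Y →L[ℂ] Y) × ℂ)‖ ≤ max (C * C) 1 := by
    rw [Prod.norm_def, norm_one]
    refine max_le_max ((ContinuousLinearMap.opNorm_comp_le _ _).trans ?_) le_rfl
    have hh := h _ (hfK h0)
    have hC : 0 ≤ C := (norm_nonneg _).trans hh.norm_le
    gcongr
    · exact hh.fderiv_le _ (mem_ball_self hr)
    · exact hh.norm_le
  refine ⟨fun z => (S z).1, fun z => (S z).2, hS.fst, hS.snd, congrArg Prod.snd hS0, congrArg Prod.fst hS0,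
    fun z hz => ?_⟩
  have hb : ‖S z‖ ≤ D * max (C * C) 1 := (hSb z hz).2.trans (by gcongr)
  exact ⟨(norm_fst_le _).trans hb, (norm_snd_le _).trans hb, (hSb z hz).1⟩

/-- Fixed points of a holomorphic family of contractions depend holomorphically on the
parameter. -/
theorem exists_differentiableOn_fixedPoint {E : Type*} [NormedAddCommGroup E] [NormedSpace ℂ E]
    [CompleteSpace E] {V : Set ℂ} (hV : IsOpen V) {ρ : ℝ} (hρ : 0 ≤ ρ) {Ψ : ℂ → E → E}
    (hmaps : ∀ z ∈ V, ∀ σ ∈ closedBall (0:E) ρ, Ψ z σ ∈ closedBall (0:E) ρ)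
    (hcontr : ∀ z ∈ V, ∀ σ ∈ closedBall (0:E) ρ, ∀ σ' ∈ closedBall (0:E) ρ,
      ‖Ψ z σ - Ψ z σ'‖ ≤ 1 / 2 * ‖σ - σ'‖)
    (hhol : ∀ σ : ℂ → E, DifferentiableOn ℂ σ V → (∀ z ∈ V, σ z ∈ closedBall (0:E) ρ) →
      DifferentiableOn ℂ (fun z => Ψ z (σ z)) V) :
    ∃ σ : ℂ → E, DifferentiableOn ℂ σ V ∧
      ∀ z ∈ V, σ z ∈ closedBall (0:E) ρ ∧ Ψ z (σ z) = σ z := by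
  let u : ℕ → ℂ → E := fun n => Nat.rec (fun _ => 0) (fun _ s z => Ψ z (s z)) n
  have hu : ∀ n z, u (n + 1) z = Ψ z (u n z) := fun n z => rfl
  have hmem : ∀ n, ∀ z ∈ V, u n z ∈ closedBall (0:E) ρ := by
    intro n
    induction n with
    | zero => exact fun z _ => mem_closedBall_self hρ
    | succ n ih => exact fun z hz => hmaps z hz _ (ih z hz)
  have hdiff : ∀ n, DifferentiableOn ℂ (u n) V := by
    intro n
    induction n with
    | zero => exact differentiableOn_const (0:E)
    | succ n ih => exact hhol _ ih (hmem n)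
  have hgeo : ∀ z ∈ V, ∀ n, dist (u n z) (u (n + 1) z) ≤ ρ * (1 / 2) ^ n := by
    intro z hz n
    induction n with
    | zero =>
      have := hmem 1 z hz
      rw [mem_closedBall, dist_comm] at this
      rw [pow_zero, mul_one]
      exact this
    | succ n ih =>
      rw [hu n, hu (n + 1), dist_eq_norm]
      refine (hcontr z hz _ (hmem n z hz) _ (hmem (n + 1) z hz)).trans ?_
      rw [← dist_eq_norm]
      calc 1 / 2 * dist (u n z) (u (n + 1) z) ≤ 1 / 2 * (ρ * (1 / 2) ^ n) := by gcongr
        _ = _ := by ring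
  have hlim : ∀ z, ∃ s, z ∈ V → Tendsto (fun n => u n z) atTop (𝓝 s) := by
    intro z
    by_cases hz : z ∈ V
    · obtain ⟨s, hs⟩ := cauchySeq_tendsto_of_complete
        (cauchySeq_of_le_geometric (1 / 2) ρ (by norm_num) (hgeo z hz))
      exact ⟨s, fun _ => hs⟩
    · exact ⟨0, fun h => absurd h hz⟩
  choose σ hσ using hlim
  have hσmem : ∀ z ∈ V, σ z ∈ closedBall (0:E) ρ := fun z hz =>
    isClosed_closedBall.mem_of_tendsto (hσ z hz) (Eventually.of_forall fun n => hmem n z hz)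
  refine ⟨σ, ?_, fun z hz => ⟨hσmem z hz, ?_⟩⟩
  · refine TendstoLocallyUniformlyOn.differentiableOn (φ := atTop) (F := u) ?_
      (Eventually.of_forall hdiff) hV
    refine TendstoUniformlyOn.tendstoLocallyUniformlyOn ?_
    rw [Metric.tendstoUniformlyOn_iff]
    intro ε hε
    have h1 : Tendsto (fun n : ℕ => ρ * (1 / 2 : ℝ) ^ n / (1 - 1 / 2)) atTop
        (𝓝 (ρ * 0 / (1 - 1 / 2))) :=
      ((tendsto_pow_atTop_nhds_zero_of_lt_one (by norm_num) (by norm_num)).const_mul _).div_const _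
    rw [mul_zero, zero_div] at h1
    filter_upwards [h1.eventually_lt_const hε] with n hn z hz
    rw [dist_comm]
    exact (dist_le_of_le_geometric_of_tendsto (1 / 2) ρ (by norm_num) (hgeo z hz) (hσ z hz) n).trans_lt hn
  · refine tendsto_nhds_unique ?_ ((tendsto_add_atTop_iff_nat 1).2 (hσ z hz))
    have h1 : Tendsto (fun n => 1 / 2 * ‖u n z - σ z‖) atTop (𝓝 (1 / 2 * ‖σ z - σ z‖)) :=
      (((hσ z hz).sub_const _).norm).const_mul _
    rw [sub_self, norm_zero, mul_zero] at h1
    exact tendsto_iff_norm_sub_tendsto_zero.2 (squeeze_zero (fun _ => norm_nonneg _)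
      (fun n => hcontr z hz _ (hmem n z hz) _ (hσmem z hz)) h1)

section FixMap

variable {E Y : Type*} [NormedAddCommGroup E] [NormedSpace ℂ E] [NormedAddCommGroup Y]
  [NormedSpace ℂ Y]

/-- The map whose fixed points solve the perturbation equation in a chart. -/
noncomputable def fixMap (π : Y →L[ℂ] E) (g : E → Y) (S : Y →L[ℂ] Y) (l : ℂ) (x : E) (a : Y)
    (σ : E) : E :=
  π (S a) - (l ^ 2)⁻¹ • π (S (g (x + l • σ) - g x - fderiv ℂ g x (l • σ)))

variable {M : Set Y} {r C D ρ : ℝ} {p : Y} {π : Y →L[ℂ] E} {g : E → Y} {S : Y →L[ℂ] Y} {l : ℂ}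
  {x : E} {a : Y}

theorem fixMap_zero : fixMap π g S l x a 0 = π (S a) := by
  simp [fixMap]

theorem add_smul_mem_ball (hx : x ∈ ball (π p) (r / 2)) (hl : ‖l‖ ≤ D) (hρr : D * ρ ≤ r / 2)
    {σ : E} (hσ : σ ∈ closedBall (0:E) ρ) : x + l • σ ∈ ball (π p) r := by
  rw [mem_ball, dist_eq_norm] at hx ⊢
  rw [mem_closedBall_zero_iff] at hσ
  have h1 : ‖l • σ‖ ≤ r / 2 := by
    rw [norm_smul]
    refine le_trans ?_ hρr
    gcongr
    exact (norm_nonneg l).trans hl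
  rw [add_sub_right_comm]
  linarith [norm_add_le (x - π p) (l • σ)]

theorem UChart.fixMap_sub_le (h : UChart M r C p π g) (hx : x ∈ ball (π p) (r / 2))
    (hS : ‖S‖ ≤ D) (hl : ‖l‖ ≤ D) (hl0 : l ≠ 0) (hρ : C ^ 2 * D * ρ ≤ 1 / 2)
    (hρr : D * ρ ≤ r / 2) {σ σ' : E} (hσ : σ ∈ closedBall (0:E) ρ) (hσ' : σ' ∈ closedBall (0:E) ρ) :
    ‖fixMap π g S l x a σ - fixMap π g S l x a σ'‖ ≤ 1 / 2 * ‖σ - σ'‖ := by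
  have hC : 0 ≤ C := (norm_nonneg _).trans h.norm_le
  have hD : 0 ≤ D := (norm_nonneg _).trans hS
  have hr : 0 < r := by linarith [pos_of_mem_ball hx]
  have e : fixMap π g S l x a σ - fixMap π g S l x a σ' = -((l ^ 2)⁻¹ • π (S (g (x + l • σ) -
      g (x + l • σ') - fderiv ℂ g x ((x + l • σ) - (x + l • σ'))))) := by
    simp only [fixMap, map_sub, smul_sub, add_sub_add_left_eq_sub]
    abel
  have hlp : 0 < ‖l‖ := norm_pos_iff.2 hl0
  have hd : ∀ τ ∈ closedBall (0:E) ρ, ‖x + l • τ - x‖ ≤ ‖l‖ * ρ := by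
    intro τ hτ
    rw [add_sub_cancel_left, norm_smul]
    gcongr
    exact mem_closedBall_zero_iff.1 hτ
  have h1 := h.norm_sub_sub_le (ball_subset_ball (by linarith) hx) (add_smul_mem_ball hx hl hρr hσ)
    (add_smul_mem_ball hx hl hρr hσ') (hd σ hσ) (hd σ' hσ')
  rw [e, norm_neg, norm_smul, norm_inv, norm_pow]
  have e2 : x + l • σ - (x + l • σ') = l • (σ - σ') := by rw [smul_sub]; abel
  have e3 : ‖x + l • σ - (x + l • σ')‖ = ‖l‖ * ‖σ - σ'‖ := by rw [e2, norm_smul]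
  rw [e3] at h1
  calc _ ≤ (‖l‖ ^ 2)⁻¹ * (C * (D * (C * (‖l‖ * ρ) * (‖l‖ * ‖σ - σ'‖)))) := by
        gcongr
        refine (π.le_of_opNorm_le h.norm_le _).trans ?_
        gcongr
        refine (S.le_of_opNorm_le hS _).trans ?_
        gcongr
    _ = C ^ 2 * D * ρ * ‖σ - σ'‖ := by field_simp
    _ ≤ _ := by gcongr

theorem fixMap_eq_iff (hl0 : l ≠ 0) (hπ : ∀ v, π (fderiv ℂ g x v) = v)
    (hS : ∀ u, fderiv ℂ g x (π (S u)) = S u)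
    (hSl : ∀ v, S (fderiv ℂ g x v) = l • fderiv ℂ g x v) {σ : E} :
    fixMap π g S l x a σ = σ ↔ S (g (x + l • σ) - g x) = l ^ 2 • S a := by
  have hl2 : l ^ 2 ≠ 0 := pow_ne_zero 2 hl0
  have hinj : ∀ v w, fderiv ℂ g x v = fderiv ℂ g x w → v = w := fun v w hvw => by
    rw [← hπ v, hvw, hπ]
  have e1 : fderiv ℂ g x (fixMap π g S l x a σ) =
      S a - (l ^ 2)⁻¹ • S (g (x + l • σ) - g x) + fderiv ℂ g x σ := by
    rw [fixMap, map_sub, map_smul, hS, hS, map_sub S (g (x + l • σ) - g x), map_smul (fderiv ℂ g x),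
      map_smul S, hSl, smul_smul, ← pow_two, smul_sub, smul_smul, inv_mul_cancel₀ hl2, one_smul]
    abel
  constructor
  · intro hσ
    rw [hσ, eq_comm, add_eq_right, sub_eq_zero] at e1
    rw [e1, smul_smul, mul_inv_cancel₀ hl2, one_smul]
  · intro hσ
    refine hinj _ _ ?_
    rw [e1, hσ, smul_smul, inv_mul_cancel₀ hl2, one_smul, sub_self, zero_add]

end FixMap

section

variable {E Y : Type*} [NormedAddCommGroup E] [NormedSpace ℂ E] [NormedAddCommGroup Y]
  [NormedSpace ℂ Y]

/-- `y` is a point of `M` near `q` whose displacement from `q` is seen by `S` as `l ^ 2 • a`. -/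
structure IsSol (M : Set Y) (c : ℝ) (q : Y) (S : Y →L[ℂ] Y) (l : ℂ) (a y : Y) : Prop where
  mem : y ∈ M
  norm_le : ‖y - q‖ ≤ c * ‖l‖
  eq : S (y - q) = l ^ 2 • S a

theorem isSol_self {M : Set Y} {c : ℝ} {q a : Y} {S : Y →L[ℂ] Y} (hq : q ∈ M) :
    IsSol M c q S 0 a q :=
  ⟨hq, by simp, by simp⟩

theorem IsSol.eq_of_zero {M : Set Y} {c : ℝ} {q a y : Y} {S : Y →L[ℂ] Y}
    (h : IsSol M c q S 0 a y) : y = q := by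
  have := h.norm_le
  rw [norm_zero, mul_zero] at this
  exact sub_eq_zero.1 (norm_le_zero_iff.1 this)

variable {M : Set Y} {r C D ρ ρ₁ c : ℝ} {p q : Y} {π : Y →L[ℂ] E} {g : E → Y} {S : Y →L[ℂ] Y}
  {l : ℂ} {a : Y}

theorem UChart.fixMap_iff_of_stab (h : UChart M r C p π g) (hqM : q ∈ M) (hq : q ∈ ball p r)
    (hπq : π q ∈ ball (π p) r) (hl0 : l ≠ 0) (hst : (S, l) ∈ stab (tproj π g q)) {σ : E} :
    fixMap π g S l (π q) a σ = σ ↔ S (g (π q + l • σ) - q) = l ^ 2 • S a := by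
  have hπ := h.proj_fderiv hπq
  rw [fixMap_eq_iff hl0 hπ (fun u => DFunLike.congr_fun hst.1 u) (fun v => ?_),
    h.apply_proj q hqM hq]
  have := DFunLike.congr_fun hst.2 (fderiv ℂ g (π q) v)
  simpa [tproj, hπ] using this

theorem UChart.exists_of_isSol (h : UChart M r C p π g) (hqM : q ∈ M) (hq : q ∈ ball p (r / 2))
    (hπq : π q ∈ ball (π p) (r / 2)) (hl : ‖l‖ ≤ D) (hl0 : l ≠ 0)
    (hst : (S, l) ∈ stab (tproj π g q)) (hcρ : C * c ≤ ρ) (hcr : c * D ≤ r / 2) (hc : 0 ≤ c)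
    {y : Y} (hy : IsSol M c q S l a y) :
    ∃ σ ∈ closedBall (0:E) ρ, fixMap π g S l (π q) a σ = σ ∧ y = g (π q + l • σ) := by
  have hr : 0 < r := by linarith [pos_of_mem_ball hq]
  have hC : 0 ≤ C := (norm_nonneg _).trans h.norm_le
  have hlp : 0 < ‖l‖ := norm_pos_iff.2 hl0
  have e : π q + l • (l⁻¹ • (π y - π q)) = π y := by
    rw [smul_smul, mul_inv_cancel₀ hl0, one_smul]
    abel
  have hyr : y ∈ ball p r := by
    have h1 : dist y q ≤ r / 2 := by
      rw [dist_eq_norm]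
      exact hy.norm_le.trans (le_trans (by gcongr) hcr)
    have h2 := dist_triangle y q p
    rw [mem_ball] at hq ⊢
    linarith
  have hgy : g (π y) = y := h.apply_proj y hy.mem hyr
  refine ⟨l⁻¹ • (π y - π q), ?_, ?_, ?_⟩
  · rw [mem_closedBall_zero_iff, norm_smul, norm_inv, inv_mul_le_iff₀ hlp, ← map_sub]
    calc ‖π (y - q)‖ ≤ C * (c * ‖l‖) :=
          (π.le_of_opNorm_le h.norm_le _).trans (by gcongr; exact hy.norm_le)
      _ = ‖l‖ * (C * c) := by ring
      _ ≤ ‖l‖ * ρ := by gcongr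
  · rw [h.fixMap_iff_of_stab hqM (ball_subset_ball (by linarith) hq)
      (ball_subset_ball (by linarith) hπq) hl0 hst, e, hgy]
    exact hy.eq
  · rw [e, hgy]

theorem UChart.isSol_unique (h : UChart M r C p π g) (hqM : q ∈ M) (hq : q ∈ ball p (r / 2))
    (hπq : π q ∈ ball (π p) (r / 2)) (hS : ‖S‖ ≤ D) (hl : ‖l‖ ≤ D) (hl0 : l ≠ 0)
    (hst : (S, l) ∈ stab (tproj π g q)) (hρ : C ^ 2 * D * ρ ≤ 1 / 2) (hρr : D * ρ ≤ r / 2)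
    (hcρ : C * c ≤ ρ) (hcr : c * D ≤ r / 2) (hc : 0 ≤ c)
    {y y' : Y} (hy : IsSol M c q S l a y) (hy' : IsSol M c q S l a y') : y = y' := by
  obtain ⟨σ, hσ, hσf, rfl⟩ := h.exists_of_isSol hqM hq hπq hl hl0 hst hcρ hcr hc hy
  obtain ⟨σ', hσ', hσf', rfl⟩ := h.exists_of_isSol hqM hq hπq hl hl0 hst hcρ hcr hc hy'
  have h1 := h.fixMap_sub_le (a := a) hπq hS hl hl0 hρ hρr hσ hσ'
  rw [hσf, hσf'] at h1
  have h2 : σ = σ' := sub_eq_zero.1 (norm_le_zero_iff.1 (by linarith [norm_nonneg (σ - σ')]))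
  rw [h2]

theorem UChart.isSol_of_fixMap (h : UChart M r C p π g) (hqM : q ∈ M) (hq : q ∈ ball p r)
    (hπq : π q ∈ ball (π p) (r / 2)) (hl : ‖l‖ ≤ D) (hl0 : l ≠ 0)
    (hst : (S, l) ∈ stab (tproj π g q)) (hρr : D * ρ ≤ r / 2) (hρc : C * ρ ≤ c) {σ : E}
    (hσ : σ ∈ closedBall (0:E) ρ) (hfix : fixMap π g S l (π q) a σ = σ) :
    IsSol M c q S l a (g (π q + l • σ)) := by
  have hr : 0 < r := by linarith [pos_of_mem_ball hπq]
  have hC : 0 ≤ C := (norm_nonneg _).trans h.norm_le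
  have hπq' : π q ∈ ball (π p) r := ball_subset_ball (by linarith) hπq
  have hm := add_smul_mem_ball hπq hl hρr hσ
  refine ⟨h.mem _ hm, ?_, (h.fixMap_iff_of_stab hqM hq hπq' hl0 hst).1 hfix⟩
  have h1 := (convex_ball (π p) r).norm_image_sub_le_of_norm_fderiv_le (𝕜 := ℂ)
    (fun x hx => h.differentiableAt hx) h.fderiv_le hπq' hm
  rw [h.apply_proj q hqM hq, add_sub_cancel_left, norm_smul] at h1
  rw [mem_closedBall_zero_iff] at hσ
  calc _ ≤ C * (‖l‖ * ‖σ‖) := h1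
    _ ≤ C * (‖l‖ * ρ) := by gcongr
    _ = (C * ρ) * ‖l‖ := by ring
    _ ≤ _ := by gcongr

theorem UChart.fixMap_mem (h : UChart M r C p π g) {x : E} (hx : x ∈ ball (π p) (r / 2))
    (hS : ‖S‖ ≤ D) (hl : ‖l‖ ≤ D) (hl0 : l ≠ 0) (hρ : C ^ 2 * D * ρ ≤ 1 / 2)
    (hρr : D * ρ ≤ r / 2) (hρ0 : 0 ≤ ρ) (ha : C * D * ‖a‖ ≤ ρ / 2) {σ : E}
    (hσ : σ ∈ closedBall (0:E) ρ) : fixMap π g S l x a σ ∈ closedBall (0:E) ρ := by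
  have hC : 0 ≤ C := (norm_nonneg _).trans h.norm_le
  have h1 := h.fixMap_sub_le (a := a) hx hS hl hl0 hρ hρr hσ (mem_closedBall_self hρ0)
  rw [fixMap_zero, sub_zero] at h1
  have h2 : ‖π (S a)‖ ≤ ρ / 2 := by
    refine le_trans ((π.le_of_opNorm_le h.norm_le _).trans ?_) ha
    rw [mul_assoc]
    gcongr
    exact S.le_of_opNorm_le hS _
  rw [mem_closedBall_zero_iff] at hσ ⊢
  have h3 := norm_le_norm_add_norm_sub' (fixMap π g S l x a σ) (π (S a))
  linarith

/-- Solutions of the perturbation equation exist locally and depend holomorphically on the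
parameter. -/
theorem UChart.exists_differentiableOn_isSol [FiniteDimensional ℂ E] [CompleteSpace Y]
    (h : UChart M r C p π g) {V : Set ℂ} (hV : IsOpen V) {f a : ℂ → Y} {S : ℂ → Y →L[ℂ] Y}
    {l : ℂ → ℂ} (hf : DifferentiableOn ℂ f V) (ha : DifferentiableOn ℂ a V)
    (hS : DifferentiableOn ℂ S V) (hl : DifferentiableOn ℂ l V) (hfM : ∀ z ∈ V, f z ∈ M)
    (hfp : ∀ z ∈ V, f z ∈ ball p r) (hπf : ∀ z ∈ V, π (f z) ∈ ball (π p) (r / 2))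
    (hSD : ∀ z ∈ V, ‖S z‖ ≤ D) (hlD : ∀ z ∈ V, ‖l z‖ ≤ D) (hl0 : ∀ z ∈ V, l z ≠ 0)
    (hst : ∀ z ∈ V, (S z, l z) ∈ stab (tproj π g (f z))) (hρ : C ^ 2 * D * ρ ≤ 1 / 2)
    (hρr : D * ρ ≤ r / 2) (hρ0 : 0 ≤ ρ) (haρ : ∀ z ∈ V, C * D * ‖a z‖ ≤ ρ / 2)
    (hρc : C * ρ ≤ c) :
    ∃ y : ℂ → Y, DifferentiableOn ℂ y V ∧ ∀ z ∈ V, IsSol M c (f z) (S z) (l z) (a z) (y z) := by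
  have : CompleteSpace E := FiniteDimensional.complete ℂ E
  have hx : DifferentiableOn ℂ (fun z => π (f z)) V := π.differentiable.comp_differentiableOn hf
  have hxr : ∀ z ∈ V, π (f z) ∈ ball (π p) r := fun z hz => by
    have := hπf z hz
    exact ball_subset_ball (by linarith [pos_of_mem_ball this]) this
  have hg : ∀ σ : ℂ → E, DifferentiableOn ℂ σ V → (∀ z ∈ V, σ z ∈ closedBall (0:E) ρ) →
      DifferentiableOn ℂ (fun z => g (π (f z) + l z • σ z)) V := fun σ hσ hσρ =>
    h.diff.comp (hx.add (hl.smul hσ)) fun z hz => add_smul_mem_ball (hπf z hz) (hlD z hz) hρr (hσρ z hz)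
  obtain ⟨σ, hσ, hσf⟩ := exists_differentiableOn_fixedPoint hV hρ0
    (Ψ := fun z σ => fixMap π g (S z) (l z) (π (f z)) (a z) σ)
    (fun z hz σ hσ => h.fixMap_mem (hπf z hz) (hSD z hz) (hlD z hz) (hl0 z hz) hρ hρr hρ0
      (haρ z hz) hσ)
    (fun z hz σ hσ σ' hσ' => h.fixMap_sub_le (hπf z hz) (hSD z hz) (hlD z hz) (hl0 z hz) hρ hρr
      hσ hσ')
    (fun σ hσ hσρ => by
      have h1 := hg σ hσ hσρ
      have h2 : DifferentiableOn ℂ (fun z => g (π (f z))) V := h.diff.comp hx hxr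
      have h3 := h.differentiableOn_fderiv hV hx hxr
      refine DifferentiableOn.sub ?_ (DifferentiableOn.smul ((hl.pow 2).inv fun z hz => pow_ne_zero 2 (hl0 z hz)) ?_)
      · exact π.differentiable.comp_differentiableOn (hS.clm_apply ha)
      · exact π.differentiable.comp_differentiableOn (hS.clm_apply
          ((h1.sub h2).sub (h3.clm_apply (hl.smul hσ)))))
  exact ⟨_, hg σ hσ fun z hz => (hσf z hz).1, fun z hz => h.isSol_of_fixMap (hfM z hz) (hfp z hz)
    (hπf z hz) (hlD z hz) (hl0 z hz) (hst z hz) hρr hρc (hσf z hz).1 (hσf z hz).2⟩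

end

/-- A map which is close to a holomorphic one to the order of a holomorphic function `l`, and
holomorphic off the zeros of `l`, is holomorphic. -/
theorem differentiableOn_of_norm_sub_le {Y : Type*} [NormedAddCommGroup Y] [NormedSpace ℂ Y]
    [CompleteSpace Y] {f ψ : ℂ → Y} {l : ℂ → ℂ} {c : ℝ} {R : ℝ}
    (hf : ContinuousOn f (ball 0 R)) (hl : DifferentiableOn ℂ l (ball 0 R)) (hR : 0 < R)
    (hl0 : l 0 ≠ 0) (h : ∀ z ∈ ball (0:ℂ) R, ‖ψ z - f z‖ ≤ c * ‖l z‖)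
    (hψ : ∀ z ∈ ball (0:ℂ) R, l z ≠ 0 → DifferentiableAt ℂ ψ z) :
    DifferentiableOn ℂ ψ (ball 0 R) := by
  intro z₀ hz₀
  have hmem : ∀ᶠ z in 𝓝 z₀, z ∈ ball (0:ℂ) R := isOpen_ball.eventually_mem hz₀
  refine DifferentiableAt.differentiableWithinAt ?_
  by_cases hz : l z₀ = 0
  swap
  · exact hψ z₀ hz₀ hz
  refine (Complex.analyticAt_of_differentiable_on_punctured_nhds_of_continuousAt ?_ ?_).differentiableAt
  · have hla := hl.analyticOnNhd isOpen_ball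
    rcases (hla z₀ hz₀).eventually_eq_zero_or_eventually_ne_zero with h0 | h0
    · exact absurd (hla.eqOn_zero_of_preconnected_of_eventuallyEq_zero
        (convex_ball (0:ℂ) R).isPreconnected hz₀ h0 (mem_ball_self hR)) hl0
    · filter_upwards [h0, hmem.filter_mono nhdsWithin_le_nhds] with z hz hzR using hψ z hzR hz
  · have hψz : ψ z₀ = f z₀ := by
      have := h z₀ hz₀
      rw [hz, norm_zero, mul_zero] at this
      exact sub_eq_zero.1 (norm_le_zero_iff.1 this)
    have hfc : ContinuousAt f z₀ := hf.continuousAt (isOpen_ball.mem_nhds hz₀)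
    have hlc : ContinuousAt l z₀ := hl.continuousOn.continuousAt (isOpen_ball.mem_nhds hz₀)
    have h1 : Tendsto (fun z => ψ z - f z) (𝓝 z₀) (𝓝 0) := by
      refine squeeze_zero_norm' (a := fun z => c * ‖l z‖) (hmem.mono h) ?_
      have : Tendsto (fun z => c * ‖l z‖) (𝓝 z₀) (𝓝 (c * ‖l z₀‖)) := hlc.norm.const_mul c
      rwa [hz, norm_zero, mul_zero] at this
    have h2 := h1.add hfc
    simp only [sub_add_cancel, zero_add] at h2
    rw [ContinuousAt, hψz]
    exact h2

/-- Holomorphic discs in a compact part of a submanifold can be perturbed, with the same centre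
and with values in a larger part, to discs with a uniformly larger derivative. -/
theorem exists_stretch {E Y : Type*} [NormedAddCommGroup E] [NormedSpace ℂ E]
    [FiniteDimensional ℂ E] [NormedAddCommGroup Y] [InnerProductSpace ℂ Y] [FiniteDimensional ℂ Y]
    {M K O : Set Y} (hK : IsCompact K) (hKM : K ⊆ M) (hgood : ∀ p ∈ K, Good E M p)
    (hO : IsOpen O) (hKO : K ⊆ O) :
    ∃ ε : ℝ, 0 < ε ∧ ∀ (R : ℝ) (f : ℂ → Y), 1 < R → DifferentiableOn ℂ f (ball 0 R) →
      MapsTo f (ball 0 R) K → ∃ ψ : ℂ → Y, DifferentiableOn ℂ ψ (ball 0 1) ∧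
        MapsTo ψ (ball 0 1) (M ∩ O) ∧ ψ 0 = f 0 ∧
        deriv ψ 0 = ((1 + ε : ℝ) : ℂ) • deriv f 0 := by
  have : CompleteSpace Y := FiniteDimensional.complete ℂ Y
  obtain ⟨r, hr, C, hC, hch⟩ := exists_uniform_uChart hK hKM hgood
  choose! π g hch using hch
  obtain ⟨D', hD', hstab⟩ := exists_bounded_stabilizer hK hKM hr hch
  obtain ⟨θ, hθ, hθO⟩ := hK.exists_thickening_subset_open hO hKO
  obtain ⟨R₀, hR₀⟩ := hK.isBounded.exists_norm_le
  set D := max D' 1 with hDdef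
  set W := max R₀ 1 with hWdef
  have hD : 1 ≤ D := le_max_right _ _
  have hW : 1 ≤ W := le_max_right _ _
  set ρ := min (1 / (2 * C ^ 2 * D)) (min (r / (2 * D)) (θ / (2 * D))) with hρdef
  have hρ0 : 0 < ρ := by positivity
  have hρ1 : C ^ 2 * D * ρ ≤ 1 / 2 := by
    calc C ^ 2 * D * ρ ≤ C ^ 2 * D * (1 / (2 * C ^ 2 * D)) := by gcongr; exact min_le_left _ _
      _ = 1 / 2 := by field_simp
  have hρr : D * ρ ≤ r / 2 := by
    calc D * ρ ≤ D * (r / (2 * D)) := by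
          gcongr
          exact (min_le_right _ _).trans (min_le_left _ _)
      _ = r / 2 := by field_simp
  have hρθ : D * ρ ≤ θ / 2 := by
    calc D * ρ ≤ D * (θ / (2 * D)) := by
          gcongr
          exact (min_le_right _ _).trans (min_le_right _ _)
      _ = θ / 2 := by field_simp
  set c := ρ / C with hcdef
  have hc0 : 0 < c := by positivity
  have hcρ : C * c ≤ ρ := by rw [hcdef]; field_simp; exact le_rfl
  have hcρ' : c ≤ ρ := div_le_self hρ0.le hC
  have hcr : c * D ≤ r / 2 := by rw [mul_comm]; exact le_trans (by gcongr) hρr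
  have hcθ : c * D < θ := by
    rw [mul_comm]
    exact (le_trans (by gcongr) hρθ).trans_lt (half_lt_self hθ)
  set ρ₁ := ρ / C ^ 2 with hρ₁def
  have hρ₁0 : 0 < ρ₁ := by positivity
  have hρ₁ρ : ρ₁ ≤ ρ := div_le_self hρ0.le (one_le_pow₀ hC)
  have hρ₁1 : C ^ 2 * D * ρ₁ ≤ 1 / 2 := le_trans (by gcongr) hρ1
  have hρ₁r : D * ρ₁ ≤ r / 2 := le_trans (by gcongr) hρr
  have hρ₁c : C * ρ₁ ≤ c := by
    rw [hρ₁def, hcdef]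
    exact le_of_eq (by field_simp)
  set ε := ρ₁ / (2 * C * D * W) with hεdef
  have hε0 : 0 < ε := by positivity
  refine ⟨ε, hε0, fun R f hR hf hfK => ?_⟩
  obtain ⟨S, l, hS, hl, hl0, hS0, hb⟩ := hstab R f hR hf hfK
  have hsub : ball (0:ℂ) 1 ⊆ ball 0 R := ball_subset_ball hR.le
  have hf1 : DifferentiableOn ℂ f (ball 0 1) := hf.mono hsub
  have hfK1 : MapsTo f (ball 0 1) K := hfK.mono_left hsub
  have hSD : ∀ z ∈ ball (0:ℂ) 1, ‖S z‖ ≤ D := fun z hz => (hb z hz).1.trans (le_max_left _ _)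
  have hlD : ∀ z ∈ ball (0:ℂ) 1, ‖l z‖ ≤ D := fun z hz => (hb z hz).2.1.trans (le_max_left _ _)
  have hst : ∀ z ∈ ball (0:ℂ) 1, (S z, l z) ∈ stab (tproj (π (f z)) (g (f z)) (f z)) :=
    fun z hz => (hb z hz).2.2
  set w := deriv f 0 with hwdef
  have hw : ‖w‖ ≤ W := by
    have hd : DiffContOnCl ℂ f (ball 0 1) := by
      refine DifferentiableOn.diffContOnCl (hf.mono ?_)
      rw [closure_ball _ one_ne_zero]
      exact closedBall_subset_ball hR
    have := Complex.norm_deriv_le_of_forall_mem_sphere_norm_le one_pos hd (C := R₀) fun z hz =>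
      hR₀ _ (hfK (closedBall_subset_ball hR (sphere_subset_closedBall hz)))
    rw [div_one] at this
    exact this.trans (le_max_left _ _)
  set a : ℂ → Y := fun z => ((ε:ℂ) * z) • w with hadef
  have haρ : ∀ z ∈ ball (0:ℂ) 1, C * D * ‖a z‖ ≤ ρ₁ / 2 := by
    intro z hz
    have hz1 : ‖z‖ ≤ 1 := by simpa using (mem_ball_zero_iff.1 hz).le
    calc C * D * ‖a z‖ ≤ C * D * (ε * 1 * W) := by
          rw [hadef]
          simp only [norm_smul, norm_mul, Complex.norm_real, Real.norm_of_nonneg hε0.le]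
          gcongr
      _ = ρ₁ / 2 := by rw [hεdef]; field_simp
  have hself : ∀ q : Y, q ∈ ball q (r / 2) := fun q => mem_ball_self (half_pos hr)
  have huniq : ∀ z ∈ ball (0:ℂ) 1, ∀ y y', IsSol M c (f z) (S z) (l z) (a z) y →
      IsSol M c (f z) (S z) (l z) (a z) y' → y = y' := by
    intro z hz y y' hy hy'
    by_cases h0 : l z = 0
    · rw [h0] at hy hy'
      exact hy.eq_of_zero.trans hy'.eq_of_zero.symm
    · exact (hch _ (hfK1 hz)).isSol_unique (hKM (hfK1 hz)) (hself _) (mem_ball_self (half_pos hr)) (hSD z hz) (hlD z hz)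
        h0 (hst z hz) hρ1 hρr hcρ hcr hc0.le hy hy'
  have hloc : ∀ z₀ ∈ ball (0:ℂ) 1, l z₀ ≠ 0 → ∃ V, IsOpen V ∧ z₀ ∈ V ∧ V ⊆ ball (0:ℂ) 1 ∧
      ∃ y : ℂ → Y, DifferentiableOn ℂ y V ∧
        ∀ z ∈ V, IsSol M c (f z) (S z) (l z) (a z) (y z) := by
    intro z₀ hz₀ hlz
    have hh := hch _ (hfK1 hz₀)
    have hfc : ContinuousAt f z₀ := hf1.continuousOn.continuousAt (isOpen_ball.mem_nhds hz₀)
    have hlc : ContinuousAt l z₀ := hl.continuousOn.continuousAt (isOpen_ball.mem_nhds hz₀)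
    have hπc : ContinuousAt (fun z => π (f z₀) (f z)) z₀ :=
      (π (f z₀)).continuous.continuousAt.comp hfc
    have hev : ∀ᶠ z in 𝓝 z₀, z ∈ ball (0:ℂ) 1 ∧ f z ∈ ball (f z₀) r ∧
        π (f z₀) (f z) ∈ ball (π (f z₀) (f z₀)) (r / 2) ∧ l z ≠ 0 :=
      (isOpen_ball.eventually_mem hz₀).and ((hfc.eventually_mem (ball_mem_nhds _ hr)).and
        ((hπc.eventually_mem (ball_mem_nhds _ (half_pos hr))).and (hlc.eventually_ne hlz)))
    obtain ⟨V, hV, hVo, hzV⟩ := _root_.mem_nhds_iff.1 hev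
    have hV1 : V ⊆ ball 0 1 := fun z hz => (hV hz).1
    have ha : DifferentiableOn ℂ a V :=
      (((differentiable_const _).mul differentiable_id).smul_const w).differentiableOn
    refine ⟨V, hVo, hzV, hV1, hh.exists_differentiableOn_isSol hVo (hf1.mono hV1) ha
      (hS.mono hV1) (hl.mono hV1) (fun z hz => hKM (hfK1 (hV1 hz))) (fun z hz => (hV hz).2.1)
      (fun z hz => (hV hz).2.2.1) (fun z hz => hSD z (hV1 hz)) (fun z hz => hlD z (hV1 hz))
      (fun z hz => (hV hz).2.2.2) (fun z hz => ?_) hρ₁1 hρ₁r hρ₁0.le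
      (fun z hz => haρ z (hV1 hz)) hρ₁c⟩
    have hzK := hfK1 (hV1 hz)
    have hπr : π (f z₀) (f z) ∈ ball (π (f z₀) (f z₀)) r :=
      ball_subset_ball (by linarith) (hV hz).2.2.1
    rw [← stab_eq_of_mul_eq
      ((hch _ hzK).tproj_comp_tproj hh (hKM hzK) (mem_ball_self hr) (mem_ball_self hr)
        (hV hz).2.1 hπr)
      (hh.tproj_comp_tproj (hch _ hzK) (hKM hzK) (hV hz).2.1 hπr (mem_ball_self hr)
        (mem_ball_self hr))]
    exact hst z (hV1 hz)
  have hex : ∀ z, ∃ y, z ∈ ball (0:ℂ) 1 → IsSol M c (f z) (S z) (l z) (a z) y := by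
    intro z
    by_cases hz : z ∈ ball (0:ℂ) 1
    · by_cases h0 : l z = 0
      · refine ⟨f z, fun _ => ?_⟩
        rw [h0]
        exact isSol_self (hKM (hfK1 hz))
      · obtain ⟨V, -, hzV, -, y, -, hy⟩ := hloc z hz h0
        exact ⟨y z, fun _ => hy z hzV⟩
    · exact ⟨0, fun h => absurd h hz⟩
  choose ψ hψ using hex
  have h01 : (0:ℂ) ∈ ball (0:ℂ) 1 := mem_ball_self one_pos
  have hψd : DifferentiableOn ℂ ψ (ball 0 1) := by
    refine differentiableOn_of_norm_sub_le hf1.continuousOn hl one_pos (by rw [hl0]; exact one_ne_zero)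
      (fun z hz => (hψ z hz).norm_le) fun z hz hlz => ?_
    obtain ⟨V, hVo, hzV, hV1, y, hy, hysol⟩ := hloc z hz hlz
    refine (hy.congr fun t ht => ?_).differentiableAt (hVo.mem_nhds hzV)
    exact huniq t (hV1 ht) _ _ (hψ t (hV1 ht)) (hysol t ht)
  have hψM : ∀ z ∈ ball (0:ℂ) 1, ψ z ∈ M := fun z hz => (hψ z hz).mem
  have hp0 : f 0 ∈ K := hfK1 h01
  have hψ0 : ψ 0 = f 0 := by
    refine huniq 0 h01 _ _ (hψ 0 h01) ⟨hKM hp0, ?_, ?_⟩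
    · rw [sub_self, norm_zero]
      positivity
    · simp [hadef]
  refine ⟨ψ, hψd, fun z hz => ⟨hψM z hz, hθO ?_⟩, hψ0, ?_⟩
  · rw [mem_thickening_iff]
    refine ⟨f z, hfK1 hz, ?_⟩
    rw [dist_eq_norm]
    refine ((hψ z hz).norm_le.trans ?_).trans_lt hcθ
    gcongr
    exact hlD z hz
  · have hψ' : HasDerivAt ψ (deriv ψ 0) 0 :=
      (hψd.differentiableAt (isOpen_ball.mem_nhds h01)).hasDerivAt
    have hf' : HasDerivAt f w 0 := (hf1.differentiableAt (isOpen_ball.mem_nhds h01)).hasDerivAt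
    have hS' : HasDerivAt S (deriv S 0) 0 :=
      (hS.differentiableAt (isOpen_ball.mem_nhds h01)).hasDerivAt
    have hl' : HasDerivAt l (deriv l 0) 0 :=
      (hl.differentiableAt (isOpen_ball.mem_nhds h01)).hasDerivAt
    have e1 := hS'.clm_apply (hψ'.sub hf')
    have e2 := (((hl'.pow 2).mul ((hasDerivAt_id (0:ℂ)).const_mul (ε:ℂ))).smul
      (hS'.clm_apply (hasDerivAt_const (0:ℂ) w)))
    have e3 := e1.unique (e2.congr_of_eventuallyEq (by
      filter_upwards [isOpen_ball.mem_nhds h01] with z hz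
      have := (hψ z hz).eq
      rw [hadef, map_smul, smul_smul] at this
      simpa using this))
    have hball : ∀ᶠ z in 𝓝 (0:ℂ), z ∈ ball (0:ℂ) 1 := isOpen_ball.eventually_mem h01
    have e4 := (hch _ hp0).tproj_velocity (mem_ball_self hr) (mem_ball_self hr) hψ' hψ0
      (hball.mono hψM)
    have e5 := (hch _ hp0).tproj_velocity (mem_ball_self hr) (mem_ball_self hr) hf' rfl
      (hball.mono fun z hz => hKM (hfK1 hz))
    simp [hψ0, hl0, hS0, e4, e5] at e3
    rw [sub_eq_iff_eq_add] at e3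
    rw [e3]
    push_cast
    rw [add_smul, one_smul, Complex.coe_smul, add_comm]

/-- A continuous lift of a differentiable curve through an immersion is differentiable. -/
theorem differentiableAt_of_comp {E Y : Type*} [NormedAddCommGroup E] [NormedSpace ℂ E]
    [FiniteDimensional ℂ E] [NormedAddCommGroup Y] [NormedSpace ℂ Y] [FiniteDimensional ℂ Y]
    {H : E → Y} {L : E →L[ℂ] Y} {u : ℂ → E} {f : ℂ → Y} {z : ℂ}
    (hH : HasFDerivAt H L (u z)) (hL : Function.Injective L) (hu : ContinuousAt u z)
    (hf : DifferentiableAt ℂ f z) (h : ∀ᶠ t in 𝓝 z, H (u t) = f t) : DifferentiableAt ℂ u z := by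
  obtain ⟨P₀, hP₀⟩ := L.toLinearMap.exists_leftInverse_of_injective (LinearMap.ker_eq_bot.2 hL)
  set P : Y →L[ℂ] E := P₀.toContinuousLinearMap with hP
  have hPL : P.comp L = ContinuousLinearMap.id ℂ E := by
    ext v
    exact LinearMap.congr_fun hP₀ v
  have hG : HasFDerivAt (fun x => P (H x)) (ContinuousLinearMap.id ℂ E) (u z) :=
    hPL ▸ P.hasFDerivAt.comp (u z) hH
  have hc : HasDerivAt (fun t => P (H (u t))) (P (deriv f z)) z :=
    (P.hasFDerivAt.comp_hasDerivAt z hf.hasDerivAt).congr_of_eventuallyEq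
      (h.mono fun t ht => congrArg P ht)
  have hO : (fun t => u t - u z) =O[𝓝 z] fun t => t - z :=
    ((hG.isTheta_sub Topology.IsInducing.id).symm.isBigO.comp_tendsto hu).trans
      hc.differentiableAt.isBigO_sub
  have ho : (fun t => P (H (u t)) - P (H (u z)) - (u t - u z)) =o[𝓝 z] fun t => t - z :=
    ((hasFDerivAt_iff_isLittleO.1 hG).comp_tendsto hu).trans_isBigO hO
  have h2 : HasDerivAt u (P (deriv f z)) z := by
    rw [hasDerivAt_iff_isLittleO] at hc ⊢
    refine (hc.sub ho).congr_left fun t => ?_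
    abel
  exact h2.differentiableAt

section Embedding

variable {n N : ℕ} {A : Type*} [TopologicalSpace A] [ChartedSpace (EuclideanSpace ℂ (Fin n)) A]
  {j : A → EuclideanSpace ℂ (Fin N)}

/-- The manifold derivative, with its source and target regarded as fixed vector spaces. -/
noncomputable def tderiv (j : A → EuclideanSpace ℂ (Fin N)) (a : A) :
    EuclideanSpace ℂ (Fin n) →L[ℂ] EuclideanSpace ℂ (Fin N) :=
  mfderiv 𝓘(ℂ, EuclideanSpace ℂ (Fin n)) 𝓘(ℂ, EuclideanSpace ℂ (Fin N)) j a

theorem hasFDerivAt_tderiv (hj : MDifferentiable 𝓘(ℂ, EuclideanSpace ℂ (Fin n))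
    𝓘(ℂ, EuclideanSpace ℂ (Fin N)) j) (a : A) :
    HasFDerivAt (fun x => j ((chartAt (EuclideanSpace ℂ (Fin n)) a).symm x)) (tderiv (n := n) j a)
      (chartAt (EuclideanSpace ℂ (Fin n)) a a) := by
  have h : HasFDerivWithinAt (fun x => j ((chartAt (EuclideanSpace ℂ (Fin n)) a).symm x))
      (tderiv (n := n) j a) (range 𝓘(ℂ, EuclideanSpace ℂ (Fin n)))
      (chartAt (EuclideanSpace ℂ (Fin n)) a a) := (hj a).hasMFDerivAt.2
  rwa [ModelWithCorners.range_eq_univ, hasFDerivWithinAt_univ] at h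

theorem hasParam_range (hj : MDifferentiable 𝓘(ℂ, EuclideanSpace ℂ (Fin n))
    𝓘(ℂ, EuclideanSpace ℂ (Fin N)) j) (hemb : IsEmbedding j)
    (hinj : ∀ a, Function.Injective (tderiv (n := n) j a)) {p : EuclideanSpace ℂ (Fin N)}
    (hp : p ∈ range j) : HasParam (EuclideanSpace ℂ (Fin n)) (range j) p := by
  obtain ⟨a, rfl⟩ := hp
  have : Nonempty A := ⟨a⟩
  set c := chartAt (EuclideanSpace ℂ (Fin n)) a with hc
  have hac : a ∈ c.source := mem_chart_source _ a
  obtain ⟨r, hr, hrc⟩ := Metric.nhds_basis_closedBall.mem_iff.1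
    (c.open_target.mem_nhds (c.map_source hac))
  have hmem : ∀ ζ ∈ closedBall (0 : EuclideanSpace ℂ (Fin n)) r, c a + ζ ∈ c.target := by
    intro ζ hζ
    refine hrc ?_
    rw [mem_closedBall, dist_eq_norm, add_sub_cancel_left]
    exact mem_closedBall_zero_iff.1 hζ
  have hinv : ∀ x, Function.invFun j (j x) = x := Function.leftInverse_invFun hemb.injective
  refine ⟨fun ζ => j (c.symm (c a + ζ)), fun q => c (Function.invFun j q) - c a, tderiv (n := n) j a, r, hr,
    ?_, ?_, ?_, ?_, ?_, ?_, ?_, hinj a⟩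
  · simp [c.left_inv hac]
  · exact hemb.continuous.comp_continuousOn
      (c.continuousOn_symm.comp (continuous_const.add continuous_id).continuousOn hmem)
  · exact fun ζ _ => mem_range_self _
  · intro ζ hζ
    simp only
    rw [hinv, c.right_inv (hmem ζ hζ), add_sub_cancel_left]
  · rw [ContinuousWithinAt, ← hemb.map_nhds_eq, tendsto_map'_iff]
    have h1 : (fun q => c (Function.invFun j q) - c a) ∘ j = fun x => c x - c a := by
      ext1 x
      simp only [Function.comp_apply, hinv]
    rw [h1, hinv]
    exact (c.continuousAt hac).sub_const _
  · rw [← hemb.map_nhds_eq, eventually_map]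
    filter_upwards [c.open_source.mem_nhds hac] with x hx
    rw [hinv, add_sub_cancel, c.left_inv hx]
  · have h1 := hasFDerivAt_tderiv hj a
    rw [← hc] at h1
    have h2 : HasFDerivAt (fun ζ : EuclideanSpace ℂ (Fin n) => c a + ζ)
        (ContinuousLinearMap.id ℂ _) 0 := (hasFDerivAt_id _).const_add _
    have h3 : HasFDerivAt (fun x => j (c.symm x)) (tderiv (n := n) j a) (c a + 0) := by rwa [add_zero]
    exact h3.comp 0 h2

theorem mdifferentiableAt_invFun [Nonempty A] (hj : MDifferentiable 𝓘(ℂ, EuclideanSpace ℂ (Fin n))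
    𝓘(ℂ, EuclideanSpace ℂ (Fin N)) j) (hemb : IsEmbedding j)
    (hinj : ∀ a, Function.Injective (tderiv (n := n) j a)) {f : ℂ → EuclideanSpace ℂ (Fin N)} {z : ℂ}
    (hf : DifferentiableAt ℂ f z) (hfj : ∀ᶠ t in 𝓝 z, f t ∈ range j) :
    MDifferentiableAt 𝓘(ℂ, ℂ) 𝓘(ℂ, EuclideanSpace ℂ (Fin n)) (fun t => Function.invFun j (f t)) z := by
  have hjf : ∀ᶠ t in 𝓝 z, j (Function.invFun j (f t)) = f t :=
    hfj.mono fun t ht => Function.invFun_eq ht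
  have hc : ContinuousAt (fun t => Function.invFun j (f t)) z := by
    rw [hemb.isInducing.continuousAt_iff]
    exact hf.continuousAt.congr (hjf.mono fun t ht => ht.symm)
  rw [mdifferentiableAt_iff]
  refine ⟨hc, ?_⟩
  rw [ModelWithCorners.range_eq_univ, differentiableWithinAt_univ]
  set a := Function.invFun j (f z) with ha
  have hcs : ContinuousAt (fun t => chartAt (EuclideanSpace ℂ (Fin n)) a (Function.invFun j (f t))) z :=
    ContinuousAt.comp (f := fun t => Function.invFun j (f t))
      ((chartAt (EuclideanSpace ℂ (Fin n)) a).continuousAt (mem_chart_source _ a)) hc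
  refine differentiableAt_of_comp (H := fun x => j ((chartAt (EuclideanSpace ℂ (Fin n)) a).symm x))
    (u := fun t => chartAt (EuclideanSpace ℂ (Fin n)) a (Function.invFun j (f t)))
    (hasFDerivAt_tderiv hj a) (hinj a) hcs hf ?_
  filter_upwards [hjf, hc.eventually_mem ((chartAt (EuclideanSpace ℂ (Fin n)) a).open_source.mem_nhds
    (mem_chart_source _ a))] with t ht hts
  rw [(chartAt (EuclideanSpace ℂ (Fin n)) a).left_inv hts, ht]

theorem hasDerivAt_comp_tderiv (hj : MDifferentiable 𝓘(ℂ, EuclideanSpace ℂ (Fin n))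
    𝓘(ℂ, EuclideanSpace ℂ (Fin N)) j) {φ : ℂ → A} {z : ℂ}
    (hφ : MDifferentiableAt 𝓘(ℂ, ℂ) 𝓘(ℂ, EuclideanSpace ℂ (Fin n)) φ z) :
    HasDerivAt (fun t => j (φ t)) (tderiv (n := n) j (φ z)
      (show EuclideanSpace ℂ (Fin n) from
        mfderiv 𝓘(ℂ, ℂ) 𝓘(ℂ, EuclideanSpace ℂ (Fin n)) φ z (show ℂ from 1))) z := by
  have h := (hj (φ z)).hasMFDerivAt.comp z hφ.hasMFDerivAt
  have h' : HasFDerivAt (fun t => j (φ t)) (tderiv (n := n) j (φ z) ∘L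
      (show ℂ →L[ℂ] EuclideanSpace ℂ (Fin n) from
        mfderiv 𝓘(ℂ, ℂ) 𝓘(ℂ, EuclideanSpace ℂ (Fin n)) φ z)) z :=
    hasMFDerivAt_iff_hasFDerivAt.1 h
  exact h'.hasDerivAt

end Embedding

section Candidates

variable {n N : ℕ} {A : Type*} [TopologicalSpace A] [ChartedSpace (EuclideanSpace ℂ (Fin n)) A]
  {j : A → EuclideanSpace ℂ (Fin N)}

/-- The set whose infimum is the Kobayashi metric. -/
def kobSet (Ω : Set A) (a : A) (v : EuclideanSpace ℂ (Fin n)) : Set ℝ :=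
  {r : ℝ | ∃ φ : ℂ → A, MDifferentiableOn 𝓘(ℂ, ℂ) 𝓘(ℂ, EuclideanSpace ℂ (Fin n)) φ (ball 0 1) ∧
    MapsTo φ (ball 0 1) Ω ∧ φ 0 = a ∧
    ∃ lam : ℂ, r = ‖lam‖ ∧
      lam • (show EuclideanSpace ℂ (Fin n) from
        mfderivWithin 𝓘(ℂ, ℂ) 𝓘(ℂ, EuclideanSpace ℂ (Fin n)) φ (ball 0 1) 0 (show ℂ from 1)) = v}

theorem mem_kobSet_iff (hj : MDifferentiable 𝓘(ℂ, EuclideanSpace ℂ (Fin n))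
    𝓘(ℂ, EuclideanSpace ℂ (Fin N)) j) (hemb : IsEmbedding j)
    (hinj : ∀ a, Function.Injective (tderiv (n := n) j a)) {Ω : Set A} {a : A}
    {v : EuclideanSpace ℂ (Fin n)} {r : ℝ} :
    r ∈ kobSet Ω a v ↔ ∃ f : ℂ → EuclideanSpace ℂ (Fin N), DifferentiableOn ℂ f (ball 0 1) ∧
      MapsTo f (ball 0 1) (j '' Ω) ∧ f 0 = j a ∧
      ∃ lam : ℂ, r = ‖lam‖ ∧ lam • deriv f 0 = tderiv (n := n) j a v := by
  have h0 : (0 : ℂ) ∈ ball (0 : ℂ) 1 := mem_ball_self one_pos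
  constructor
  · rintro ⟨φ, hφ, hφΩ, rfl, lam, hr, hlam⟩
    have hat : ∀ z ∈ ball (0 : ℂ) 1,
        MDifferentiableAt 𝓘(ℂ, ℂ) 𝓘(ℂ, EuclideanSpace ℂ (Fin n)) φ z :=
      fun z hz => (hφ z hz).mdifferentiableAt (isOpen_ball.mem_nhds hz)
    refine ⟨fun t => j (φ t), fun z hz =>
      (hasDerivAt_comp_tderiv hj (hat z hz)).differentiableAt.differentiableWithinAt,
      fun z hz => mem_image_of_mem j (hφΩ hz), rfl, lam, hr, ?_⟩
    rw [(hasDerivAt_comp_tderiv hj (hat 0 h0)).deriv, ← hlam, map_smul]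
    rw [mfderivWithin_of_mem_nhds (isOpen_ball.mem_nhds h0)]
  · rintro ⟨f, hf, hfΩ, hfa, lam, hr, hlam⟩
    have : Nonempty A := ⟨a⟩
    have hinv : ∀ x, Function.invFun j (j x) = x := Function.leftInverse_invFun hemb.injective
    have hat : ∀ z ∈ ball (0 : ℂ) 1, MDifferentiableAt 𝓘(ℂ, ℂ) 𝓘(ℂ, EuclideanSpace ℂ (Fin n))
        (fun t => Function.invFun j (f t)) z := fun z hz =>
      mdifferentiableAt_invFun hj hemb hinj (hf.differentiableAt (isOpen_ball.mem_nhds hz))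
        ((isOpen_ball.eventually_mem hz).mono fun t ht => image_subset_range j Ω (hfΩ ht))
    have hjf : (fun t => j (Function.invFun j (f t))) =ᶠ[𝓝 0] f :=
      (isOpen_ball.eventually_mem h0).mono fun t ht =>
        Function.invFun_eq (image_subset_range j Ω (hfΩ ht))
    have hφ0 : Function.invFun j (f 0) = a := by rw [hfa, hinv]
    refine ⟨fun t => Function.invFun j (f t), fun z hz => (hat z hz).mdifferentiableWithinAt,
      fun z hz => ?_, hφ0, lam, hr, ?_⟩
    · obtain ⟨x, hx, hxz⟩ := hfΩ hz
      change Function.invFun j (f z) ∈ Ω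
      rwa [← hxz, hinv]
    · rw [mfderivWithin_of_mem_nhds (isOpen_ball.mem_nhds h0)]
      have hd := ((hasDerivAt_comp_tderiv hj (hat 0 h0)).congr_of_eventuallyEq hjf.symm).deriv
      refine hinj a ?_
      rw [map_smul, ← hlam, hd]
      congr 2
      exact congrArg (tderiv (n := n) j) hφ0.symm

end Candidates

section Contraction

variable {n N : ℕ} {A : Type*} [TopologicalSpace A] [ChartedSpace (EuclideanSpace ℂ (Fin n)) A]
  {j : A → EuclideanSpace ℂ (Fin N)}

theorem kobSet_bddBelow (Ω : Set A) (a : A) (v : EuclideanSpace ℂ (Fin n)) :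
    BddBelow (kobSet Ω a v) := by
  refine ⟨0, ?_⟩
  rintro r ⟨φ, -, -, -, lam, rfl, -⟩
  exact norm_nonneg lam

/-- Discs in a relatively compact subset can be uniformly stretched inside the ambient domain. -/
theorem exists_div_mem_kobSet (hj : MDifferentiable 𝓘(ℂ, EuclideanSpace ℂ (Fin n))
    𝓘(ℂ, EuclideanSpace ℂ (Fin N)) j) (hemb : IsClosedEmbedding j)
    (hinj : ∀ a, Function.Injective (tderiv (n := n) j a)) {X U : Set A} (hX : IsOpen X)
    (hUX : closure U ⊆ X) (hU : IsCompact (closure U)) :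
    ∃ δ : ℝ, 0 < δ ∧ ∀ (a : A) (v : EuclideanSpace ℂ (Fin n)), ∀ r ∈ kobSet U a v,
      r / (1 + δ) ∈ kobSet X a v := by
  obtain ⟨O, hO, rfl⟩ := hemb.isInducing.isOpen_iff.1 hX
  have hgood : ∀ p ∈ j '' closure U, Good (EuclideanSpace ℂ (Fin n)) (range j) p := fun p hp =>
    good_of_hasParam hemb.isClosed_range
      (fun q hq => hasParam_range hj hemb.isEmbedding hinj hq) (image_subset_range _ _ hp)
  obtain ⟨ε, hε, hst⟩ := exists_stretch (hU.image hemb.continuous) (image_subset_range _ _) hgood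
    hO (image_subset_iff.2 hUX)
  refine ⟨ε / 2, half_pos hε, fun a v r hr => ?_⟩
  rw [mem_kobSet_iff hj hemb.isEmbedding hinj] at hr ⊢
  obtain ⟨f, hf, hfU, hfa, lam, rfl, hlam⟩ := hr
  set s : ℝ := (1 + ε / 2) / (1 + ε) with hs
  have hs0 : 0 < s := by positivity
  have hs1 : s < 1 := by rw [hs, div_lt_one (by positivity)]; linarith
  have hmap : MapsTo (fun z : ℂ => (s : ℂ) * z) (ball 0 s⁻¹) (ball 0 1) := by
    intro z hz
    rw [mem_ball_zero_iff] at hz ⊢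
    rw [norm_mul, Complex.norm_of_nonneg hs0.le, ← mul_inv_cancel₀ hs0.ne']
    exact mul_lt_mul_of_pos_left hz hs0
  obtain ⟨ψ, hψ, hψX, hψ0, hψd⟩ := hst s⁻¹ (fun z => f (s * z)) ((one_lt_inv₀ hs0).2 hs1)
    (hf.comp ((differentiable_id.const_mul (s : ℂ)).differentiableOn) hmap)
    (fun z hz => image_mono subset_closure (hfU (hmap hz)))
  refine ⟨ψ, hψ, fun z hz => ?_, ?_, lam / ((1 + ε / 2 : ℝ) : ℂ), ?_, ?_⟩
  · obtain ⟨⟨x, hx⟩, hxO⟩ := hψX hz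
    exact ⟨x, by rwa [mem_preimage, hx], hx⟩
  · rw [hψ0, mul_zero, hfa]
  · rw [norm_div, Complex.norm_of_nonneg (by positivity)]
  · rw [hψd, deriv_comp_mul_left, mul_zero, ← hlam, smul_smul, smul_smul]
    congr 1
    have h1 : (1 + ε) * s = 1 + ε / 2 := by rw [hs]; field_simp
    have h2 : ((1 + ε / 2 : ℝ) : ℂ) ≠ 0 := Complex.ofReal_ne_zero.2 (by positivity)
    rw [mul_assoc, ← Complex.ofReal_mul, h1, div_mul_cancel₀ _ h2]

theorem kobSet_nonempty_of_mem (hj : MDifferentiable 𝓘(ℂ, EuclideanSpace ℂ (Fin n))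
    𝓘(ℂ, EuclideanSpace ℂ (Fin N)) j) (hemb : IsEmbedding j)
    (hinj : ∀ a, Function.Injective (tderiv (n := n) j a)) {X U : Set A} (hU : IsOpen U) {a : A}
    (ha : a ∈ U) {v : EuclideanSpace ℂ (Fin n)} (h : (kobSet X a v).Nonempty) :
    (kobSet U a v).Nonempty := by
  obtain ⟨r, hr⟩ := h
  obtain ⟨f, hf, hfX, hfa, lam, -, hlam⟩ := (mem_kobSet_iff hj hemb hinj).1 hr
  obtain ⟨O, hO, rfl⟩ := hemb.isInducing.isOpen_iff.1 hU
  have hc : ContinuousAt f 0 :=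
    (hf.differentiableAt (isOpen_ball.mem_nhds (mem_ball_self one_pos))).continuousAt
  obtain ⟨d, hd, hdO⟩ := Metric.mem_nhds_iff.1
    (hc.preimage_mem_nhds (hO.mem_nhds (by rwa [hfa])))
  set s : ℝ := min d 1 with hs
  have hs0 : 0 < s := lt_min hd one_pos
  have hmap : MapsTo (fun z : ℂ => (s : ℂ) * z) (ball 0 1) (ball 0 s) := by
    intro z hz
    rw [mem_ball_zero_iff] at hz ⊢
    rw [norm_mul, Complex.norm_of_nonneg hs0.le]
    exact mul_lt_of_lt_one_right hs0 hz
  have hs1 : ball (0 : ℂ) s ⊆ ball 0 1 := ball_subset_ball (min_le_right _ _)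
  refine ⟨_, (mem_kobSet_iff hj hemb hinj).2 ⟨fun z => f (s * z),
    hf.comp ((differentiable_id.const_mul (s : ℂ)).differentiableOn) (hmap.mono_right hs1),
    fun z hz => ?_, ?_, lam / s, rfl, ?_⟩⟩
  · obtain ⟨x, -, hx⟩ := hfX (hs1 (hmap hz))
    refine ⟨x, ?_, hx⟩
    rw [mem_preimage, hx]
    exact hdO (ball_subset_ball (min_le_left _ _) (hmap hz))
  · simp only [mul_zero, hfa]
  · rw [deriv_comp_mul_left, mul_zero, smul_smul, ← hlam,
      div_mul_cancel₀ _ (Complex.ofReal_ne_zero.2 hs0.ne')]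

end Contraction

end KobAux

/-- Let `A` be a Stein manifold of dimension `n`, `X ⊂ A` a Kobayashi-hyperbolic domain, and
`U ⊂ X` open and relatively compact in `X`. Then there exists `k < 1` such that
`F_X(a,v) ≤ k · F_U(a,v)` for all `a ∈ U` and tangent vectors `v`. -/
theorem kobayashi_metric_contraction {n : ℕ}
    {A : Type*} [TopologicalSpace A] [ChartedSpace (EuclideanSpace ℂ (Fin n)) A]
    (hStein : IsSteinManifold (EuclideanSpace ℂ (Fin n)) A)
    (X : Set A) (hXo : IsOpen X) (hXconn : IsPreconnected X)
    (hXhyp : ∀ a ∈ X, ∀ b ∈ X, a ≠ b → 0 < kobDistOn (EuclideanSpace ℂ (Fin n)) X a b)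
    (U : Set A) (hUo : IsOpen U) (hUX : closure U ⊆ X) (hUc : IsCompact (closure U)) :
    ∃ k : ℝ, k < 1 ∧ ∀ a ∈ U, ∀ v : TangentSpace 𝓘(ℂ, EuclideanSpace ℂ (Fin n)) a,
      kobMetricOn (EuclideanSpace ℂ (Fin n)) X a v ≤
        k * kobMetricOn (EuclideanSpace ℂ (Fin n)) U a v := by
  obtain ⟨N, ι, hι, hιc, hιi⟩ := hStein
  set T : (Fin N → ℂ) ≃L[ℂ] EuclideanSpace ℂ (Fin N) := (EuclideanSpace.equiv (Fin N) ℂ).symm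
  have hT : ∀ y, HasMFDerivAt 𝓘(ℂ, Fin N → ℂ) 𝓘(ℂ, EuclideanSpace ℂ (Fin N)) T y
      (T : (Fin N → ℂ) →L[ℂ] EuclideanSpace ℂ (Fin N)) := fun y => T.hasFDerivAt.hasMFDerivAt
  have hd := fun a => (hT (ι a)).comp a (hι a).hasMFDerivAt
  have hj : MDifferentiable 𝓘(ℂ, EuclideanSpace ℂ (Fin n)) 𝓘(ℂ, EuclideanSpace ℂ (Fin N))
      (T ∘ ι) := fun a => (hd a).mdifferentiableAt
  have hemb : IsClosedEmbedding (T ∘ ι) := T.toHomeomorph.isClosedEmbedding.comp hιc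
  have hinj : ∀ a, Function.Injective (KobAux.tderiv (n := n) (T ∘ ι) a) := by
    intro a
    have h := (hd a).mfderiv
    have h' : KobAux.tderiv (n := n) (T ∘ ι) a = (T : (Fin N → ℂ) →L[ℂ] EuclideanSpace ℂ (Fin N)) ∘L
      (show EuclideanSpace ℂ (Fin n) →L[ℂ] (Fin N → ℂ) from
        mfderiv 𝓘(ℂ, EuclideanSpace ℂ (Fin n)) 𝓘(ℂ, Fin N → ℂ) ι a) := h
    rw [h']
    exact T.injective.comp (hιi a)
  obtain ⟨δ, hδ, hdiv⟩ := KobAux.exists_div_mem_kobSet hj hemb hinj hXo hUX hUc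
  refine ⟨1 / (1 + δ), by rw [div_lt_one (by positivity)]; linarith, fun a ha v => ?_⟩
  change sInf (KobAux.kobSet X a v) ≤ 1 / (1 + δ) * sInf (KobAux.kobSet U a v)
  rcases (KobAux.kobSet U a v).eq_empty_or_nonempty with hU | hU
  · have hX : KobAux.kobSet X a v = ∅ := by
      by_contra hne
      have h := KobAux.kobSet_nonempty_of_mem hj hemb.isEmbedding hinj hUo ha
        (nonempty_iff_ne_empty.2 hne)
      exact h.ne_empty hU
    rw [hU, hX, Real.sInf_empty, mul_zero]
  · rw [one_div_mul_eq_div, le_div_iff₀ (by positivity)]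
    refine le_csInf hU fun r hr => ?_
    rw [← le_div_iff₀ (by positivity)]
    exact csInf_le (KobAux.kobSet_bddBelow X a v) (hdiv a v r hr)
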